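/- Let d, n ≥ 1, 1 < q < p < ∞, let Ω ∈ L^∞(S^{d−1}) with ∫_{S^{d−1}} Ω = 0, and let W be a matrix A_q weight on ℝ^d. Then the maximal weighted rough singular integral T*_{Ω,W,p} is bounded from L^p(ℝ^d; ℂⁿ) to L^p(ℝ^d): ‖T*_{Ω,W,p} f‖_{L^p(ℝ^d)} ≤ c · [W]_{A_q}^{1/p} · [W]_{A_{q,∞}^{sc}}^{1+1/p'} · ‖f‖_{L^p(ℝ^d;ℂⁿ)} ≤ c · [W]_{A_q}² · ‖f‖_{L^p(ℝ^d;ℂⁿ)}, where p' = p/(p−1) and c depends only on n, d, p, q and ‖Ω‖_{L^∞}. -/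

import Mathlib

open MeasureTheory ENNReal
open scoped ComplexOrder

noncomputable section

abbrev Rd (d : ℕ) := EuclideanSpace ℝ (Fin d)
abbrev Mat (n : ℕ) := Matrix (Fin n) (Fin n) ℂ
abbrev Vec (n : ℕ) := EuclideanSpace ℂ (Fin n)

/-- A cube in `ℝ^d` with sides parallel to the coordinate axes, given by its
lower-left corner and (positive) side length. -/
structure Cube (d : ℕ) where
  corner : Rd d
  side : ℝ
  side_pos : 0 < side

namespace Cube

/-- The underlying set of the cube. -/
def set {d : ℕ} (Q : Cube d) : Set (Rd d) :=
  {x | ∀ i, Q.corner i ≤ x i ∧ x i ≤ Q.corner i + Q.side}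

/-- The concentric triple `3Q` of a cube. -/
def triple {d : ℕ} (Q : Cube d) : Set (Rd d) :=
  {x | ∀ i, Q.corner i - Q.side ≤ x i ∧ x i ≤ Q.corner i + 2 * Q.side}

end Cube

/-- Operator norm of an `n × n` complex matrix acting on `ℂⁿ` with the Euclidean norm. -/
def opNorm {n : ℕ} (A : Mat n) : ℝ := ‖Matrix.toEuclideanCLM (𝕜 := ℂ) (n := Fin n) A‖

/-- A matrix acting on a Euclidean vector. -/
def mvec {n : ℕ} (A : Mat n) (v : Vec n) : Vec n := Matrix.toEuclideanLin A v

/-- Fractional power of a Hermitian matrix via the spectral calculus (junk value `1`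
for non-Hermitian matrices). -/
def matPow {n : ℕ} (A : Mat n) (s : ℝ) : Mat n :=
  if h : A.IsHermitian then
    (h.eigenvectorUnitary : Mat n) *
      Matrix.diagonal (fun i => ((h.eigenvalues i ^ s : ℝ) : ℂ)) *
      star (h.eigenvectorUnitary : Mat n)
  else 1

/-- A matrix weight: measurable, positive definite (hence Hermitian) a.e. -/
def IsMatrixWeight {d n : ℕ} (W : Rd d → Mat n) : Prop :=
  (∀ i j, Measurable fun x => W x i j) ∧ ∀ᵐ x : Rd d, (W x).PosDef


/-- Componentwise measurability of a `ℂⁿ`-valued function. -/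
def MeasurableV {d n : ℕ} (f : Rd d → Vec n) : Prop := ∀ i, Measurable fun x => f x i
/-- The matrix `A₁` characteristic of `W`. -/
def A1Const {d n : ℕ} (W : Rd d → Mat n) : ℝ≥0∞ :=
  ⨆ Q : Cube d,
    essSup (fun y => (volume Q.set)⁻¹ *
      ∫⁻ x in Q.set, ENNReal.ofReal (opNorm (W x * (W y)⁻¹))) (volume.restrict Q.set)

/-- The matrix `A_q` characteristic of `W`, `1 < q < ∞`. -/
def AqConst {d n : ℕ} (W : Rd d → Mat n) (q : ℝ) : ℝ≥0∞ :=
  ⨆ Q : Cube d, (volume Q.set)⁻¹ * ∫⁻ x in Q.set,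
    ((volume Q.set)⁻¹ * ∫⁻ y in Q.set,
        ENNReal.ofReal (opNorm (matPow (W x) (1/q) * matPow (W y) (-(1/q)))) ^ (q/(q-1))) ^ (q-1)

/-- Hardy–Littlewood maximal operator (over cubes) of an `ℝ≥0∞`-valued function. -/
def HLM {d : ℕ} (g : Rd d → ℝ≥0∞) (x : Rd d) : ℝ≥0∞ :=
  ⨆ (Q : Cube d) (_ : x ∈ Q.set), (volume Q.set)⁻¹ * ∫⁻ y in Q.set, g y

/-- The Fujii–Wilson `A∞` characteristic of a scalar weight `w`. -/
def AInftyConst {d : ℕ} (w : Rd d → ℝ≥0∞) : ℝ≥0∞ :=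
  ⨆ Q : Cube d, (∫⁻ x in Q.set, w x)⁻¹ * ∫⁻ x in Q.set, HLM (Q.set.indicator w) x

/-- The scalar `A_{q,∞}` characteristic of a matrix weight `W`. -/
def AqScConst {d n : ℕ} (W : Rd d → Mat n) (q : ℝ) : ℝ≥0∞ :=
  ⨆ e : Vec n, AInftyConst (fun x => (‖mvec (matPow (W x) (1/q)) e‖₊ : ℝ≥0∞) ^ q)

/-- `L^p` norm of an `ℝ≥0∞`-valued function. -/
def lpNormE {d : ℕ} (p : ℝ) (g : Rd d → ℝ≥0∞) : ℝ≥0∞ := (∫⁻ x, g x ^ p) ^ (1/p)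

/-- `L^p` norm of a `ℂⁿ`-valued function. -/
def lpNormV {d n : ℕ} (p : ℝ) (f : Rd d → Vec n) : ℝ≥0∞ :=
  (∫⁻ x, (‖f x‖₊ : ℝ≥0∞) ^ p) ^ (1/p)

/-- The weighted norm `‖f‖_{L^p(W)}`. -/
def lpWNorm {d n : ℕ} (p : ℝ) (W : Rd d → Mat n) (f : Rd d → Vec n) : ℝ≥0∞ :=
  (∫⁻ x, (‖mvec (matPow (W x) (1/p)) (f x)‖₊ : ℝ≥0∞) ^ p) ^ (1/p)


/-- The truncated rough singular integral `T_{Ω,δ}`, acting componentwise on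
`ℂⁿ`-valued functions. -/
def truncRough {d n : ℕ} (Ω : Rd d → ℂ) (δ : ℝ) (f : Rd d → Vec n) (x : Rd d) : Vec n :=
  ∫ y in {y : Rd d | δ < ‖x - y‖}, (Ω (x - y) * ((‖x - y‖ ^ (d : ℝ) : ℝ) : ℂ)⁻¹) • f y

/-- `Ω` is (the degree-zero homogeneous extension of) a bounded measurable function on the
unit sphere with vanishing mean, with `‖Ω‖_{L^∞(S^{d-1})} ≤ CΩ`.  The vanishing mean over
the sphere is expressed, equivalently, as vanishing integral over the annulus `1 < |x| < 2`. -/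
def IsRoughKernel {d : ℕ} (Ω : Rd d → ℂ) (CΩ : ℝ) : Prop :=
  Measurable Ω ∧ (∀ (r : ℝ) (x : Rd d), 0 < r → x ≠ 0 → Ω (r • x) = Ω x) ∧
  (∀ x : Rd d, x ≠ 0 → ‖Ω x‖ ≤ CΩ) ∧
  (∫ x in {x : Rd d | 1 < ‖x‖ ∧ ‖x‖ < 2}, Ω x) = 0

/-- The maximal weighted rough singular integral `T^*_{Ω,W,p}`. -/
def TstarRough {d n : ℕ} (Ω : Rd d → ℂ) (W : Rd d → Mat n) (p : ℝ)
    (f : Rd d → Vec n) (x : Rd d) : ℝ≥0∞ :=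
  ⨆ (δ : ℝ) (_ : 0 < δ),
    (‖mvec (matPow (W x) (1/p))
        (truncRough Ω δ (fun y => mvec (matPow (W y) (-(1/p))) (f y)) x)‖₊ : ℝ≥0∞)

namespace RoughWeight
open Set Filter Topology Metric FourierTransform

variable {d : ℕ}

/-- Half-open version of a cube. -/
def hset (Q : Cube d) : Set (Rd d) :=
  {x | ∀ i, Q.corner i ≤ x i ∧ x i < Q.corner i + Q.side}

/-- The volume of a cube, as an extended nonnegative real. -/
def qvol (Q : Cube d) : ℝ≥0∞ := ENNReal.ofReal Q.side ^ d

lemma qvol_ne_zero (Q : Cube d) : qvol Q ≠ 0 :=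
  pow_ne_zero _ (by simpa using Q.side_pos)

lemma qvol_ne_top (Q : Cube d) : qvol Q ≠ ⊤ := pow_ne_top ofReal_ne_top

lemma qvol_pos (Q : Cube d) : 0 < qvol Q := pos_iff_ne_zero.2 (qvol_ne_zero Q)

lemma hset_eq_preimage (Q : Cube d) :
    hset Q = (MeasurableEquiv.toLp 2 (Fin d → ℝ)).symm ⁻¹'
      (Set.univ.pi fun i => Ico (Q.corner i) (Q.corner i + Q.side)) := by
  ext x; simp [hset, Set.mem_pi]

lemma set_eq_preimage (Q : Cube d) :
    Q.set = (MeasurableEquiv.toLp 2 (Fin d → ℝ)).symm ⁻¹'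
      (Set.univ.pi fun i => Icc (Q.corner i) (Q.corner i + Q.side)) := by
  ext x; simp [Cube.set, Pi.le_def, forall_and]

lemma measurableSet_hset (Q : Cube d) : MeasurableSet (hset Q) := by
  rw [hset_eq_preimage]
  exact (MeasurableEquiv.measurable _) (MeasurableSet.univ_pi fun i => measurableSet_Ico)

lemma measurableSet_set (Q : Cube d) : MeasurableSet Q.set := by
  rw [set_eq_preimage]
  exact (MeasurableEquiv.measurable _) (MeasurableSet.univ_pi fun i => measurableSet_Icc)

lemma isClosed_set (Q : Cube d) : IsClosed Q.set := by
  have : Q.set = ⋂ i, {x : Rd d | Q.corner i ≤ x i ∧ x i ≤ Q.corner i + Q.side} := by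
    ext x; simp [Cube.set]
  rw [this]
  refine isClosed_iInter fun i => ?_
  have hc : Continuous fun x : Rd d => x i := by fun_prop
  exact (isClosed_le continuous_const hc).inter (isClosed_le hc continuous_const)

lemma volume_hset (Q : Cube d) : volume (hset Q) = qvol Q := by
  rw [hset_eq_preimage,
    (EuclideanSpace.volume_preserving_symm_measurableEquiv_toLp (Fin d)).measure_preimage_equiv,
    Real.volume_pi_Ico]
  simp [qvol]

lemma volume_set (Q : Cube d) : volume Q.set = qvol Q := by
  rw [set_eq_preimage,
    (EuclideanSpace.volume_preserving_symm_measurableEquiv_toLp (Fin d)).measure_preimage_equiv,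
    Set.pi_univ_Icc, Real.volume_Icc_pi]
  simp [qvol]

lemma hset_subset_set (Q : Cube d) : hset Q ⊆ Q.set := fun _ hx i =>
  ⟨(hx i).1, (hx i).2.le⟩

lemma hset_ae_eq_set (Q : Cube d) : hset Q =ᵐ[volume] Q.set :=
  ae_eq_of_subset_of_measure_ge (hset_subset_set Q) (by rw [volume_hset, volume_set])
    (measurableSet_hset Q).nullMeasurableSet (by rw [volume_set]; exact qvol_ne_top Q)

lemma lintegral_hset (Q : Cube d) (f : Rd d → ℝ≥0∞) :
    ∫⁻ x in hset Q, f x = ∫⁻ x in Q.set, f x :=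
  setLIntegral_congr (hset_ae_eq_set Q)

/-- The dyadic children of a cube. -/
def child (Q : Cube d) (ε : Fin d → Bool) : Cube d where
  corner := WithLp.toLp 2 fun i => Q.corner i + if ε i then Q.side / 2 else 0
  side := Q.side / 2
  side_pos := half_pos Q.side_pos

@[simp] lemma child_corner (Q : Cube d) (ε : Fin d → Bool) (i : Fin d) :
    (child Q ε).corner i = Q.corner i + if ε i then Q.side / 2 else 0 := rfl

@[simp] lemma child_side (Q : Cube d) (ε : Fin d → Bool) : (child Q ε).side = Q.side / 2 := rfl

lemma hset_child_subset (Q : Cube d) (ε : Fin d → Bool) : hset (child Q ε) ⊆ hset Q := by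
  intro x hx i
  have h := hx i
  have := Q.side_pos
  simp only [child_corner, child_side] at h
  split_ifs at h <;> constructor <;> linarith [h.1, h.2]

lemma iUnion_child (Q : Cube d) : ⋃ ε, hset (child Q ε) = hset Q := by
  apply Subset.antisymm (iUnion_subset fun ε => hset_child_subset Q ε)
  intro x hx
  refine mem_iUnion.2 ⟨fun i => decide (Q.corner i + Q.side / 2 ≤ x i), fun i => ?_⟩
  have h := hx i
  simp only [child_corner, child_side, decide_eq_true_eq]
  split_ifs with h1 <;> constructor <;> linarith [h.1, h.2]

lemma disjoint_child (Q : Cube d) : Pairwise (Function.onFun Disjoint fun ε => hset (child Q ε)) := by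
  intro ε ε' hne
  obtain ⟨i, hi⟩ := Function.ne_iff.1 hne
  refine Set.disjoint_left.2 fun x hx hx' => hi ?_
  have h := hx i; have h' := hx' i
  simp only [child_corner, child_side] at h h'
  cases h1 : ε i <;> cases h2 : ε' i <;> simp [h1, h2] at h h' ⊢ <;> linarith [h.1, h.2, h'.1, h'.2]

lemma lintegral_child (Q : Cube d) (f : Rd d → ℝ≥0∞) :
    ∫⁻ x in hset Q, f x = ∑ ε, ∫⁻ x in hset (child Q ε), f x := by
  rw [← iUnion_child Q, lintegral_iUnion (fun ε => measurableSet_hset _) (disjoint_child Q),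
    tsum_fintype]

lemma volume_inter_child (Q : Cube d) (s : Set (Rd d)) :
    volume (s ∩ hset Q) = ∑ ε, volume (s ∩ hset (child Q ε)) := by
  rw [← Measure.restrict_apply' (measurableSet_hset Q), ← iUnion_child Q,
    Measure.restrict_iUnion (disjoint_child Q) (fun ε => measurableSet_hset _),
    Measure.sum_apply_of_countable, tsum_fintype]
  simp [Measure.restrict_apply' (measurableSet_hset _)]

lemma qvol_child (Q : Cube d) (ε : Fin d → Bool) : 2 ^ d * qvol (child Q ε) = qvol Q := by
  rw [qvol, qvol, ← mul_pow, child_side, show (2 : ℝ≥0∞) = ENNReal.ofReal 2 by simp,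
    ← ofReal_mul (by norm_num)]
  congr 2; ring

/-- The concentric triple as a cube. -/
def tri (Q : Cube d) : Cube d where
  corner := WithLp.toLp 2 fun i => Q.corner i - Q.side
  side := 3 * Q.side
  side_pos := by have := Q.side_pos; linarith

@[simp] lemma tri_corner (Q : Cube d) (i : Fin d) : (tri Q).corner i = Q.corner i - Q.side := rfl
@[simp] lemma tri_side (Q : Cube d) : (tri Q).side = 3 * Q.side := rfl

lemma qvol_tri (Q : Cube d) : qvol (tri Q) = 3 ^ d * qvol Q := by
  rw [qvol, qvol, ← mul_pow, tri_side, ofReal_mul (by norm_num)]; simp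

lemma set_subset_tri (Q : Cube d) : Q.set ⊆ (tri Q).set := by
  intro x hx i
  have h := hx i; have := Q.side_pos
  simp only [tri_corner, tri_side]; constructor <;> linarith [h.1, h.2]

lemma child_set_subset (Q : Cube d) (ε : Fin d → Bool) : (child Q ε).set ⊆ Q.set := by
  intro x hx i
  have h := hx i
  have := Q.side_pos
  simp only [child_corner, child_side] at h
  split_ifs at h <;> constructor <;> linarith [h.1, h.2]

lemma abs_le_norm (x : Rd d) (i : Fin d) : |x i| ≤ ‖x‖ := by
  simpa using PiLp.norm_apply_le x i

lemma norm_le_of_abs_le {x : Rd d} {a : ℝ} (h : ∀ i, |x i| ≤ a) : ‖x‖ ≤ d * a := by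
  have h1 : ‖x‖ ≤ ∑ i, |x i| := by
    rw [EuclideanSpace.norm_eq]
    refine Real.sqrt_le_iff.2 ⟨Finset.sum_nonneg fun _ _ => abs_nonneg _, ?_⟩
    simp only [Real.norm_eq_abs]
    exact Finset.sum_sq_le_sq_sum_of_nonneg (fun _ _ => abs_nonneg _)
  refine h1.trans ((Finset.sum_le_sum fun i _ => h i).trans ?_)
  simp

lemma dist_le_of_mem_set {Q : Cube d} {x y : Rd d} (hx : x ∈ Q.set) (hy : y ∈ Q.set) :
    ‖x - y‖ ≤ d * Q.side := by
  refine norm_le_of_abs_le (fun i => ?_)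
  have h := hx i; have h' := hy i
  rw [PiLp.sub_apply, abs_le]; constructor <;> linarith [h.1, h.2, h'.1, h'.2]

/-- Points outside the triple of a cube are far from the cube. -/
lemma side_le_of_notMem_tri {Q : Cube d} {x y : Rd d} (hx : x ∈ Q.set) (hy : y ∉ (tri Q).set) :
    Q.side ≤ ‖x - y‖ := by
  simp only [Cube.set, Set.mem_ofPred_eq, not_forall] at hy
  obtain ⟨i, hi⟩ := hy
  refine le_trans ?_ (abs_le_norm (x - y) i)
  have h := hx i
  simp only [tri_corner, tri_side] at hi
  rw [PiLp.sub_apply, le_abs]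
  by_contra! hc
  exact hi ⟨by linarith [h.1, h.2, hc.1, hc.2], by linarith [h.1, h.2, hc.1, hc.2]⟩

/-- The cube centred at `x` of sidelength `2 r`. -/
def cubeAt (x : Rd d) (r : ℝ) (hr : 0 < r) : Cube d where
  corner := WithLp.toLp 2 fun i => x i - r
  side := 2 * r
  side_pos := by linarith

@[simp] lemma cubeAt_corner (x : Rd d) (r : ℝ) (hr : 0 < r) (i : Fin d) :
    (cubeAt x r hr).corner i = x i - r := rfl
@[simp] lemma cubeAt_side (x : Rd d) (r : ℝ) (hr : 0 < r) : (cubeAt x r hr).side = 2 * r := rfl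

lemma closedBall_subset_cubeAt (x : Rd d) (r : ℝ) (hr : 0 < r) :
    closedBall x r ⊆ (cubeAt x r hr).set := by
  intro y hy i
  have h := (abs_le_norm (y - x) i).trans (mem_closedBall_iff_norm.1 hy)
  rw [PiLp.sub_apply, abs_le] at h
  simp only [cubeAt_corner, cubeAt_side]; constructor <;> linarith [h.1, h.2]

lemma mem_cubeAt (x : Rd d) (r : ℝ) (hr : 0 < r) : x ∈ (cubeAt x r hr).set :=
  closedBall_subset_cubeAt x r hr (mem_closedBall_self hr.le)

lemma qvol_cubeAt (x : Rd d) (r : ℝ) (hr : 0 < r) :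
    qvol (cubeAt x r hr) = ENNReal.ofReal (2 * r) ^ d := rfl

lemma hset_nonempty (Q : Cube d) : (hset Q).Nonempty :=
  ⟨Q.corner, fun i => ⟨le_rfl, by linarith [Q.side_pos]⟩⟩

lemma interior_set_nonempty (Q : Cube d) : (interior Q.set).Nonempty := by
  have hs := Q.side_pos
  refine ⟨WithLp.toLp 2 fun i => Q.corner i + Q.side / 2, ?_⟩
  rw [mem_interior_iff_mem_nhds]
  refine Filter.mem_of_superset (closedBall_mem_nhds _ (half_pos hs)) ?_
  intro y hy i
  have h := (abs_le_norm _ i).trans (mem_closedBall_iff_norm.1 hy)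
  rw [PiLp.sub_apply, abs_le] at h
  simp only at h
  constructor <;> linarith [h.1, h.2]

/-- The volume of a ball is comparable with the volume of cubes of comparable size. -/
lemma volume_closedBall_le (x : Rd d) (r : ℝ) (hr : 0 < r) :
    volume (closedBall x r) ≤ ENNReal.ofReal (2 * r) ^ d :=
  (measure_mono (closedBall_subset_cubeAt x r hr)).trans_eq (volume_set _)

lemma ball_contains_cube (x : Rd d) (r : ℝ) (hr : 0 < r) (hd : 1 ≤ d) :
    ENNReal.ofReal (2 * r / d) ^ d ≤ volume (closedBall x r) := by
  have hd' : (0 : ℝ) < d := by exact_mod_cast hd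
  have : (cubeAt x (r / d) (by positivity)).set ⊆ closedBall x r := by
    intro y hy
    rw [mem_closedBall_iff_norm]
    refine (norm_le_of_abs_le (a := r / d) (fun i => ?_)).trans_eq (by field_simp)
    have h := hy i
    simp only [cubeAt_corner, cubeAt_side] at h
    rw [PiLp.sub_apply, abs_le]; constructor <;> linarith [h.1, h.2]
  refine le_trans (le_of_eq ?_) (measure_mono this)
  rw [volume_set, qvol_cubeAt]; congr 2; ring

lemma vol_tripleBall_le (x : Rd d) (r : ℝ) (hr : 0 < r) (hd : 1 ≤ d) :
    volume (closedBall x (3 * r)) ≤ (3 * d : ℝ≥0∞) ^ d * volume (closedBall x r) := by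
  have hd' : (0 : ℝ) < d := by exact_mod_cast hd
  refine (volume_closedBall_le x (3 * r) (by positivity)).trans ?_
  refine le_trans (le_of_eq ?_) (mul_le_mul_right (ball_contains_cube x r hr hd) _)
  rw [← mul_pow, show (3 * d : ℝ≥0∞) = ENNReal.ofReal (3 * d) by
    rw [ofReal_mul (by norm_num)]; simp, ← ofReal_mul (by positivity)]
  congr 2; field_simp

/-- A Vitali family containing all small cubes around each point. -/
def cubeFamily (hd : 1 ≤ d) : VitaliFamily (volume : Measure (Rd d)) :=
  Vitali.vitaliFamily volume ((6 * d ^ 2 : ℕ) ^ d : NNReal) (fun x => by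
    refine Eventually.frequently ?_
    filter_upwards [self_mem_nhdsWithin] with r hr
    refine (vol_tripleBall_le x r hr hd).trans (mul_le_mul_left ?_ _)
    push_cast
    gcongr
    · norm_num
    · exact_mod_cast Nat.le_self_pow two_ne_zero d)

lemma cube_mem_family (hd : 1 ≤ d) {x : Rd d} {Q : Cube d} (hx : x ∈ Q.set) :
    Q.set ∈ (cubeFamily hd).setsAt x := by
  have hs := Q.side_pos
  have hd' : (0 : ℝ) < d := by exact_mod_cast hd
  refine ⟨isClosed_set Q, interior_set_nonempty Q, d * Q.side, fun y hy => ?_, ?_⟩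
  · rw [mem_closedBall_iff_norm]; exact dist_le_of_mem_set hy hx
  · refine (volume_closedBall_le x _ (by positivity)).trans ?_
    rw [volume_set, qvol]
    push_cast
    rw [← mul_pow]
    refine pow_le_pow_left' ?_ d
    rw [show (6 * (d : ℝ≥0∞) ^ 2) = ENNReal.ofReal (6 * d ^ 2) by
      rw [ofReal_mul (by norm_num), ofReal_pow (by positivity)]; simp,
      ← ofReal_mul (by positivity)]
    refine ofReal_le_ofReal ?_
    have : (1 : ℝ) ≤ d := by exact_mod_cast hd
    nlinarith [mul_pos hd' hs]

/-- Lebesgue differentiation along cubes. -/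
lemma ae_lebesgue_point (hd : 1 ≤ d) {h : Rd d → ℂ} (hh : LocallyIntegrable h) :
    ∀ᵐ x : Rd d, ∀ ε : ℝ≥0∞, 0 < ε → ∃ r : ℝ, 0 < r ∧ ∀ Q : Cube d, x ∈ Q.set → Q.side < r →
      (qvol Q)⁻¹ * ∫⁻ y in Q.set, ‖h y - h x‖ₑ ≤ ε := by
  filter_upwards [(cubeFamily hd).ae_tendsto_lintegral_enorm_sub_div hh] with x hx ε hε
  have hd' : (0 : ℝ) < d := by exact_mod_cast hd
  obtain ⟨r, hr, H⟩ := ((cubeFamily hd).eventually_filterAt_iff).1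
    (hx.eventually (Iic_mem_nhds hε))
  refine ⟨r / d, by positivity, fun Q hQ hs => ?_⟩
  have := H Q.set (cube_mem_family hd hQ) (fun y hy => by
    rw [mem_closedBall_iff_norm]
    refine (dist_le_of_mem_set hy hQ).trans ?_
    rw [lt_div_iff₀ hd'] at hs; linarith)
  rwa [volume_set, ENNReal.div_eq_inv_mul] at this

lemma lintegral_Ioo_rpow {y s : ℝ} (hy : 0 ≤ y) (hs : 0 < s) :
    ∫⁻ t in Ioo 0 y, ENNReal.ofReal (t ^ (s - 1)) = ENNReal.ofReal (y ^ s / s) := by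
  have hi := (intervalIntegral.intervalIntegrable_rpow' (a := 0) (b := y)
    (r := s - 1) (by linarith))
  rw [← ofReal_integral_eq_lintegral_ofReal]
  · rw [← integral_Ioc_eq_integral_Ioo, ← intervalIntegral.integral_of_le hy,
      integral_rpow (Or.inl (by linarith))]
    simp [Real.zero_rpow hs.ne']
  · exact (hi.1).mono_set Ioo_subset_Ioc_self
  · filter_upwards [ae_restrict_mem measurableSet_Ioo] with t ht
    exact Real.rpow_nonneg ht.1.le _

lemma lintegral_layer_rpow (y : ℝ≥0∞) {s : ℝ} (hs : 0 < s) :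
    ∫⁻ t in Ioi (0 : ℝ), {t : ℝ | ENNReal.ofReal t < y}.indicator
      (fun t => ENNReal.ofReal (t ^ (s - 1))) t = y ^ s / ENNReal.ofReal s := by
  have key : ∀ y : ℝ, 0 ≤ y → ∫⁻ t in Ioi (0 : ℝ), {t : ℝ | ENNReal.ofReal t < ENNReal.ofReal y}.indicator
      (fun t => ENNReal.ofReal (t ^ (s - 1))) t = ENNReal.ofReal (y ^ s / s) := by
    intro y hy
    rw [← lintegral_Ioo_rpow hy hs, lintegral_indicator, Measure.restrict_restrict]
    · congr 2
      ext t
      simp only [mem_inter_iff, mem_ofPred_eq, mem_Ioi, mem_Ioo]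
      constructor
      · rintro ⟨h1, h2⟩; exact ⟨h2, ((ofReal_lt_ofReal_iff').1 h1).1⟩
      · rintro ⟨h1, h2⟩; exact ⟨(ofReal_lt_ofReal_iff').2 ⟨h2, h1.trans h2⟩, h1⟩
    all_goals exact measurableSet_lt (by fun_prop) (by fun_prop)
  induction y using recTopCoe with
  | top =>
    rw [top_rpow_of_pos hs, top_div_of_ne_top ofReal_ne_top]
    have hle : ∀ n : ℕ, ENNReal.ofReal ((n : ℝ) ^ s / s) ≤ ∫⁻ t in Ioi (0 : ℝ),
        {t : ℝ | ENNReal.ofReal t < ⊤}.indicator (fun t => ENNReal.ofReal (t ^ (s - 1))) t := by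
      intro n
      rw [← key n (by positivity)]
      refine lintegral_mono fun t => indicator_le_indicator_of_subset ?_ (fun _ => zero_le) t
      intro t _; exact ofReal_lt_top
    refine eq_top_iff.2 (le_of_tendsto' (f := fun n : ℕ => ENNReal.ofReal ((n : ℝ) ^ s / s))
      (x := atTop) ?_ hle)
    refine tendsto_ofReal_nhds_top.2 ?_
    exact (((tendsto_rpow_atTop hs).comp tendsto_natCast_atTop_atTop).atTop_div_const hs)
  | coe y =>
    have := key y y.2
    rw [ofReal_coe_nnreal] at this
    rw [this, ofReal_div_of_pos hs]
    congr 1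
    rw [← ofReal_coe_nnreal (p := y), ofReal_rpow_of_nonneg y.coe_nonneg hs.le]

lemma lintegral_upper_rpow (y : ℝ≥0∞) {s : ℝ} (hs : 0 < s) :
    y ^ (2 : ℝ) * ∫⁻ t in Ioi (0 : ℝ), {t : ℝ | y ≤ ENNReal.ofReal t}.indicator
      (fun t => ENNReal.ofReal (t ^ (-s - 1))) t ≤ y ^ (2 - s) / ENNReal.ofReal s := by
  induction y using recTopCoe with
  | top => simp
  | coe y =>
    rcases eq_or_ne y 0 with rfl | hy
    · simp
    have hy' : (0 : ℝ) < y := NNReal.coe_pos.2 (pos_iff_ne_zero.2 hy)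
    have h1 : ∫⁻ t in Ioi (0 : ℝ), {t : ℝ | (y : ℝ≥0∞) ≤ ENNReal.ofReal t}.indicator
        (fun t => ENNReal.ofReal (t ^ (-s - 1))) t
        = ∫⁻ t in Ioi (y : ℝ), ENNReal.ofReal (t ^ (-s - 1)) := by
      rw [lintegral_indicator, Measure.restrict_restrict, Measure.restrict_congr_set Ioi_ae_eq_Ici]
      · congr 2
        ext t
        simp only [mem_inter_iff, mem_ofPred_eq, mem_Ioi, mem_Ici]
        rw [← ofReal_coe_nnreal]
        constructor
        · rintro ⟨h1, h2⟩; exact (ofReal_le_ofReal_iff h2.le).1 h1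
        · intro h; exact ⟨ofReal_le_ofReal h, hy'.trans_le h⟩
      all_goals exact measurableSet_le (by fun_prop) (by fun_prop)
    rw [h1, ← ofReal_integral_eq_lintegral_ofReal, integral_Ioi_rpow_of_lt (by linarith) hy']
    · rw [← ofReal_coe_nnreal, ofReal_rpow_of_pos hy', ofReal_rpow_of_pos hy',
        ← ofReal_mul (by positivity), ← ofReal_div_of_pos hs]
      refine ofReal_le_ofReal (le_of_eq ?_)
      rw [show -s - 1 + 1 = -s by ring, Real.rpow_sub hy', Real.rpow_neg hy'.le]
      field_simp
    · exact integrableOn_Ioi_rpow_of_lt (by linarith) hy'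
    · filter_upwards [ae_restrict_mem measurableSet_Ioi] with t ht
      exact Real.rpow_nonneg (hy'.trans ht).le _

section
variable {α : Type*} [MeasurableSpace α] {μ : Measure α}

lemma measurableSet_layer {h : α → ℝ≥0∞} (hh : Measurable h) :
    MeasurableSet {z : ℝ × α | ENNReal.ofReal z.1 < h z.2} :=
  measurableSet_lt (by fun_prop) (by fun_prop)

lemma measurableSet_layer' {h : α → ℝ≥0∞} (hh : Measurable h) :
    MeasurableSet {z : ℝ × α | h z.2 ≤ ENNReal.ofReal z.1} :=
  measurableSet_le (by fun_prop) (by fun_prop)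

/-- Cavalieri's principle with an additional weight. -/
lemma lintegral_layer [SFinite μ] {h w : α → ℝ≥0∞} (hh : Measurable h) (hw : Measurable w)
    {s : ℝ} (hs : 0 < s) :
    ∫⁻ t in Ioi (0 : ℝ), ENNReal.ofReal (t ^ (s - 1)) * ∫⁻ x in {x | ENNReal.ofReal t < h x}, w x ∂μ
      = (∫⁻ x, w x * h x ^ s ∂μ) / ENNReal.ofReal s := by
  have h1 : ∀ t : ℝ, ENNReal.ofReal (t ^ (s - 1)) * ∫⁻ x in {x | ENNReal.ofReal t < h x}, w x ∂μ
      = ∫⁻ x, {z : ℝ × α | ENNReal.ofReal z.1 < h z.2}.indicator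
        (fun z => ENNReal.ofReal (z.1 ^ (s - 1)) * w z.2) (t, x) ∂μ := by
    intro t
    rw [← lintegral_const_mul _ hw, ← lintegral_indicator (measurableSet_lt (by fun_prop) hh)]
    rfl
  simp_rw [h1]
  rw [lintegral_lintegral_swap]
  · rw [div_eq_mul_inv, ← lintegral_mul_const _ (by fun_prop)]
    refine lintegral_congr fun x => ?_
    rw [mul_assoc, ← div_eq_mul_inv, ← lintegral_layer_rpow (h x) hs, ← lintegral_const_mul]
    · refine lintegral_congr fun t => ?_
      by_cases ht : ENNReal.ofReal t < h x
      · rw [indicator_of_mem (by exact ht), indicator_of_mem (by exact ht), mul_comm]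
      · rw [indicator_of_notMem (by exact ht), indicator_of_notMem (by exact ht), mul_zero]
    · exact Measurable.indicator (by fun_prop) (measurableSet_lt (by fun_prop) (by fun_prop))
  · refine Measurable.aemeasurable ?_
    exact Measurable.indicator (by fun_prop) (measurableSet_layer hh)

lemma lintegral_upper [SFinite μ] {h : α → ℝ≥0∞} (hh : Measurable h)
    {s : ℝ} (hs : 0 < s) :
    ∫⁻ t in Ioi (0 : ℝ), ENNReal.ofReal (t ^ (-s - 1)) *
      ∫⁻ x in {x | h x ≤ ENNReal.ofReal t}, h x ^ (2 : ℝ) ∂μ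
      ≤ (∫⁻ x, h x ^ (2 - s) ∂μ) / ENNReal.ofReal s := by
  have h1 : ∀ t : ℝ, ENNReal.ofReal (t ^ (-s - 1)) *
      ∫⁻ x in {x | h x ≤ ENNReal.ofReal t}, h x ^ (2 : ℝ) ∂μ
      = ∫⁻ x, {z : ℝ × α | h z.2 ≤ ENNReal.ofReal z.1}.indicator
        (fun z => ENNReal.ofReal (z.1 ^ (-s - 1)) * h z.2 ^ (2 : ℝ)) (t, x) ∂μ := by
    intro t
    rw [← lintegral_const_mul _ (by fun_prop),
      ← lintegral_indicator (measurableSet_le hh (by fun_prop))]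
    rfl
  simp_rw [h1]
  rw [lintegral_lintegral_swap]
  · rw [div_eq_mul_inv, ← lintegral_mul_const _ (by fun_prop)]
    refine lintegral_mono fun x => ?_
    refine le_trans (le_of_eq ?_) (lintegral_upper_rpow (h x) hs)
    rw [← lintegral_const_mul]
    · refine lintegral_congr fun t => ?_
      by_cases ht : h x ≤ ENNReal.ofReal t
      · rw [indicator_of_mem (by exact ht), indicator_of_mem (by exact ht), mul_comm]
      · rw [indicator_of_notMem (by exact ht), indicator_of_notMem (by exact ht), mul_zero]
    · exact Measurable.indicator (by fun_prop) (measurableSet_le (by fun_prop) (by fun_prop))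
  · refine Measurable.aemeasurable ?_
    exact Measurable.indicator (by fun_prop) (measurableSet_layer' hh)

/-- Marcinkiewicz-type integration of a distributional inequality (endpoint `1` only). -/
lemma lintegral_rpow_le_of_weak [SFinite μ] {Y h : α → ℝ≥0∞} (hY : Measurable Y)
    (hh : Measurable h) {C : ℝ≥0∞} (hC : C ≠ ⊤)
    (H : ∀ t : ℝ, 0 < t → ENNReal.ofReal t * μ {x | ENNReal.ofReal t < Y x} ≤
      C * ∫⁻ x in {x | ENNReal.ofReal t < h x}, h x ∂μ) {a : ℝ} (ha : 1 < a) :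
    ∫⁻ x, Y x ^ a ∂μ ≤ ENNReal.ofReal (a / (a - 1)) * C * ∫⁻ x, h x ^ a ∂μ := by
  have ha0 : 0 < a := by linarith
  have e1 := lintegral_layer (μ := μ) hY (measurable_const (a := (1 : ℝ≥0∞))) ha0
  have e2 := lintegral_layer (μ := μ) hh hh (s := a - 1) (by linarith)
  simp only [lintegral_const, one_mul, Measure.restrict_apply_univ] at e1
  have e3 : ∫⁻ t in Ioi (0 : ℝ), ENNReal.ofReal (t ^ (a - 1)) * μ {x | ENNReal.ofReal t < Y x}
      ≤ C * ∫⁻ t in Ioi (0 : ℝ), ENNReal.ofReal (t ^ (a - 1 - 1)) *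
        ∫⁻ x in {x | ENNReal.ofReal t < h x}, h x ∂μ := by
    rw [← lintegral_const_mul' _ _ hC]
    refine setLIntegral_mono' measurableSet_Ioi fun t ht => ?_
    have ht : 0 < t := ht
    rw [show t ^ (a - 1) = t ^ (a - 1 - 1) * t by
      rw [Real.rpow_sub_one ht.ne' (a - 1)]; field_simp, ofReal_mul (by positivity),
      mul_assoc, mul_left_comm C]
    exact mul_le_mul_right (H t ht) _
  have e4 : ∀ x, h x * h x ^ (a - 1) = h x ^ a := fun x => by
    conv_lhs => rw [← rpow_one (h x), ← rpow_mul, one_mul]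
    rw [← rpow_add_of_nonneg _ _ zero_le_one (by linarith)]; congr 1; ring
  simp_rw [e4] at e2
  rw [e1, e2, ENNReal.div_le_iff (by simpa using ha0) ofReal_ne_top] at e3
  refine e3.trans (le_of_eq ?_)
  rw [ofReal_div_of_pos (by linarith)]
  simp only [div_eq_mul_inv]
  ring

/-- Marcinkiewicz interpolation between `1` and `2` in distributional form. -/
lemma lintegral_rpow_le_of_weak_strong [SFinite μ] {Y h : α → ℝ≥0∞} (hY : Measurable Y)
    (hh : Measurable h) {C D : ℝ≥0∞} (hC : C ≠ ⊤) (hD : D ≠ ⊤)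
    (H : ∀ t : ℝ, 0 < t → μ {x | ENNReal.ofReal t < Y x} ≤
      C * ENNReal.ofReal t⁻¹ * ∫⁻ x in {x | ENNReal.ofReal t < h x}, h x ∂μ +
      D * ENNReal.ofReal (t ^ (-2 : ℝ)) * ∫⁻ x in {x | h x ≤ ENNReal.ofReal t}, h x ^ (2 : ℝ) ∂μ)
    {a : ℝ} (ha : 1 < a) (ha2 : a < 2) :
    ∫⁻ x, Y x ^ a ∂μ ≤ ENNReal.ofReal a *
      (C * (ENNReal.ofReal (a - 1))⁻¹ + D * (ENNReal.ofReal (2 - a))⁻¹) * ∫⁻ x, h x ^ a ∂μ := by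
  have ha0 : 0 < a := by linarith
  have e1 := lintegral_layer (μ := μ) hY (measurable_const (a := (1 : ℝ≥0∞))) ha0
  have e2 := lintegral_layer (μ := μ) hh hh (s := a - 1) (by linarith)
  have e2' := lintegral_upper (μ := μ) hh (s := 2 - a) (by linarith)
  simp only [lintegral_const, one_mul, Measure.restrict_apply_univ] at e1
  have hm : Measurable fun t : ℝ => C * (ENNReal.ofReal (t ^ (a - 1 - 1)) *
        ∫⁻ x in {x | ENNReal.ofReal t < h x}, h x ∂μ) := by
    have : Antitone fun t : ℝ => ∫⁻ x in {x | ENNReal.ofReal t < h x}, h x ∂μ := fun s t hst =>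
      lintegral_mono_set fun x hx => lt_of_le_of_lt (ofReal_le_ofReal hst) hx
    have := this.measurable
    fun_prop
  have e3 : ∫⁻ t in Ioi (0 : ℝ), ENNReal.ofReal (t ^ (a - 1)) * μ {x | ENNReal.ofReal t < Y x}
      ≤ C * (∫⁻ t in Ioi (0 : ℝ), ENNReal.ofReal (t ^ (a - 1 - 1)) *
        ∫⁻ x in {x | ENNReal.ofReal t < h x}, h x ∂μ) +
       D * (∫⁻ t in Ioi (0 : ℝ), ENNReal.ofReal (t ^ (-(2 - a) - 1)) *
        ∫⁻ x in {x | h x ≤ ENNReal.ofReal t}, h x ^ (2 : ℝ) ∂μ) := by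
    rw [← lintegral_const_mul' _ _ hC, ← lintegral_const_mul' _ _ hD,
      ← lintegral_add_left hm]
    refine setLIntegral_mono' measurableSet_Ioi fun t ht => ?_
    have ht : 0 < t := ht
    refine (mul_le_mul_right (H t ht) _).trans (le_of_eq ?_)
    rw [show t ^ (a - 1 - 1) = t ^ (a - 1) * t⁻¹ by
        rw [Real.rpow_sub_one ht.ne' (a - 1)]; field_simp,
      show t ^ (-(2 - a) - 1) = t ^ (a - 1) * t ^ (-2 : ℝ) by
        rw [← Real.rpow_add ht]; congr 1; ring,
      ofReal_mul (by positivity), ofReal_mul (by positivity)]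
    ring
  have e4 : ∀ x, h x * h x ^ (a - 1) = h x ^ a := fun x => by
    conv_lhs => rw [← rpow_one (h x), ← rpow_mul, one_mul]
    rw [← rpow_add_of_nonneg _ _ zero_le_one (by linarith)]; congr 1; ring
  simp_rw [e4] at e2
  simp_rw [show 2 - (2 - a) = a by ring] at e2'
  rw [e1, e2] at e3
  replace e3 := e3.trans (add_le_add_right (mul_le_mul_right e2' D) _)
  rw [ENNReal.div_le_iff (by simpa using ha0) ofReal_ne_top] at e3
  refine e3.trans (le_of_eq ?_)
  simp only [div_eq_mul_inv]
  ring

end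

/-- The cube `Q` enlarged by `a` in every direction. -/
def enl (Q : Cube d) (a : ℝ) (ha : 0 ≤ a) : Cube d where
  corner := WithLp.toLp 2 fun i => Q.corner i - a
  side := Q.side + 2 * a
  side_pos := by have := Q.side_pos; linarith

@[simp] lemma enl_corner (Q : Cube d) (a : ℝ) (ha : 0 ≤ a) (i : Fin d) :
    (enl Q a ha).corner i = Q.corner i - a := rfl
@[simp] lemma enl_side (Q : Cube d) (a : ℝ) (ha : 0 ≤ a) :
    (enl Q a ha).side = Q.side + 2 * a := rfl

lemma mem_enl {Q : Cube d} {a : ℝ} (ha : 0 ≤ a) {x y : Rd d} (hx : x ∈ Q.set)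
    (hxy : ‖y - x‖ ≤ a) : y ∈ (enl Q a ha).set := by
  intro i
  have h := (abs_le_norm (y - x) i).trans hxy
  have h' := hx i
  rw [PiLp.sub_apply, abs_le] at h
  simp only [enl_corner, enl_side]
  constructor <;> linarith [h.1, h.2, h'.1, h'.2]

lemma set_subset_enl (Q : Cube d) {a : ℝ} (ha : 0 ≤ a) : Q.set ⊆ (enl Q a ha).set :=
  fun x hx => mem_enl ha hx (by simpa using ha)

lemma avg_le_HLM (g : Rd d → ℝ≥0∞) {Q : Cube d} {x : Rd d} (hx : x ∈ Q.set) :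
    (qvol Q)⁻¹ * ∫⁻ y in Q.set, g y ≤ HLM g x := by
  rw [← volume_set]
  exact le_iSup₂ (f := fun (Q : Cube d) (_ : x ∈ Q.set) =>
    (volume Q.set)⁻¹ * ∫⁻ y in Q.set, g y) Q hx

lemma lt_HLM_iff {g : Rd d → ℝ≥0∞} {x : Rd d} {l : ℝ≥0∞} :
    l < HLM g x ↔ ∃ Q : Cube d, x ∈ Q.set ∧ l < (qvol Q)⁻¹ * ∫⁻ y in Q.set, g y := by
  simp only [HLM, lt_iSup_iff, volume_set, exists_prop]

lemma HLM_le_iff {g : Rd d → ℝ≥0∞} {x : Rd d} {l : ℝ≥0∞} :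
    HLM g x ≤ l ↔ ∀ Q : Cube d, x ∈ Q.set → (qvol Q)⁻¹ * ∫⁻ y in Q.set, g y ≤ l := by
  simp only [HLM, iSup_le_iff, volume_set]

lemma isOpen_lt_HLM (g : Rd d → ℝ≥0∞) (l : ℝ≥0∞) : IsOpen {x | l < HLM g x} := by
  rw [isOpen_iff_mem_nhds]
  intro x hx
  obtain ⟨Q, hQ, hl⟩ := lt_HLM_iff.1 hx
  have hs := Q.side_pos
  have hcont : Tendsto (fun a : ℝ => (ENNReal.ofReal (Q.side + 2 * a) ^ d)⁻¹ * ∫⁻ y in Q.set, g y)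
      (𝓝[>] 0) (𝓝 ((qvol Q)⁻¹ * ∫⁻ y in Q.set, g y)) := by
    refine ENNReal.Tendsto.mul_const ?_ (Or.inl (ENNReal.inv_ne_zero.2 (qvol_ne_top Q)))
    refine tendsto_inv_iff.2 ?_
    refine ((ENNReal.continuous_pow d).tendsto _).comp ?_
    refine (continuous_ofReal.tendsto _).comp ?_
    refine tendsto_nhdsWithin_of_tendsto_nhds ?_
    have : Continuous fun a : ℝ => Q.side + 2 * a := by fun_prop
    simpa using this.tendsto 0
  obtain ⟨a, hal, ha⟩ := ((hcont.eventually (lt_mem_nhds hl)).and self_mem_nhdsWithin).exists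
  have ha : 0 < a := ha
  refine Filter.mem_of_superset (closedBall_mem_nhds x ha) fun y hy => ?_
  refine lt_HLM_iff.2 ⟨enl Q a ha.le, mem_enl ha.le hQ (mem_closedBall_iff_norm.1 hy), ?_⟩
  exact hal.trans_le (mul_le_mul_right (lintegral_mono_set (set_subset_enl Q ha.le)) _)

lemma measurable_HLM (g : Rd d → ℝ≥0∞) : Measurable (HLM g) :=
  measurable_of_Ioi fun l => (isOpen_lt_HLM g l).measurableSet

lemma HLM_mono {g h : Rd d → ℝ≥0∞} (H : ∀ x, g x ≤ h x) (x : Rd d) : HLM g x ≤ HLM h x :=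
  HLM_le_iff.2 fun _ hQ => (mul_le_mul_right (lintegral_mono H) _).trans (avg_le_HLM h hQ)

lemma HLM_congr_ae {g h : Rd d → ℝ≥0∞} (H : g =ᵐ[volume] h) : HLM g = HLM h := by
  funext x
  simp only [HLM]
  refine iSup_congr fun Q => iSup_congr fun _ => ?_
  rw [lintegral_congr_ae (ae_restrict_of_ae H)]

/-- Weak type `(1,1)` of the Hardy–Littlewood maximal operator. -/
lemma HLM_weak (hd : 1 ≤ d) (g : Rd d → ℝ≥0∞) (l : ℝ≥0∞) :
    l * volume {x | l < HLM g x} ≤ 5 ^ d * ∫⁻ x, g x := by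
  rcases eq_or_ne (∫⁻ x, g x) ⊤ with htop | htop
  · simp [htop]
  rcases eq_or_ne l 0 with rfl | hl0
  · simp
  rcases eq_or_ne l ⊤ with rfl | hlt
  · simp
  set t : Set (Cube d) := {Q | l < (qvol Q)⁻¹ * ∫⁻ y in Q.set, g y} with ht
  have hbd : ∀ Q ∈ t, l * qvol Q ≤ ∫⁻ y in Q.set, g y := fun Q hQ => by
    have h1 : l ≤ (qvol Q)⁻¹ * ∫⁻ y in Q.set, g y := le_of_lt hQ
    rwa [← ENNReal.div_eq_inv_mul, ENNReal.le_div_iff_mul_le (Or.inl (qvol_ne_zero Q))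
      (Or.inl (qvol_ne_top Q))] at h1
  obtain ⟨R, hR⟩ : ∃ R : ℝ, ∀ Q ∈ t, Q.side ≤ R := by
    refine ⟨max 1 ((∫⁻ x, g x) / l).toReal, fun Q hQ => ?_⟩
    rcases le_total Q.side 1 with h1 | h1
    · exact h1.trans (le_max_left _ _)
    · refine le_trans ?_ (le_max_right _ _)
      have h2 : ENNReal.ofReal Q.side ≤ (∫⁻ x, g x) / l := by
        rw [ENNReal.le_div_iff_mul_le (Or.inl hl0) (Or.inl hlt), mul_comm]
        refine le_trans (mul_le_mul_right ?_ _) ((hbd Q hQ).trans (setLIntegral_le_lintegral _ _))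
        exact le_self_pow₀ (by simpa using h1) (by omega)
      exact (ofReal_le_iff_le_toReal (div_ne_top htop hl0)).1 h2
  obtain ⟨u, hut, hdisj, hcov⟩ := Vitali.exists_disjoint_subfamily_covering_enlargement
    (fun Q : Cube d => Q.set) t (fun Q => Q.side) 2 one_lt_two (fun Q _ => Q.side_pos.le) R hR
    (fun Q _ => (hset_nonempty Q).mono (hset_subset_set Q))
  have hcount : u.Countable := hdisj.countable_of_nonempty_interior
    fun Q _ => interior_set_nonempty Q
  have hsub : {x | l < HLM g x} ⊆ ⋃ P ∈ u, (enl P (2 * P.side) (by linarith [P.side_pos])).set := by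
    intro x hx
    obtain ⟨Q, hQ, hl⟩ := lt_HLM_iff.1 hx
    obtain ⟨P, hP, ⟨z, hzQ, hzP⟩, hside⟩ := hcov Q hl
    refine mem_iUnion₂.2 ⟨P, hP, fun i => ?_⟩
    have h1 := hQ i; have h2 := hzQ i; have h3 := hzP i
    simp only [enl_corner, enl_side]
    constructor <;> linarith [h1.1, h1.2, h2.1, h2.2, h3.1, h3.2]
  calc l * volume {x | l < HLM g x}
      ≤ l * ∑' P : u, volume (enl P.1 (2 * P.1.side) (by linarith [P.1.side_pos])).set := by
        refine mul_le_mul_right ((measure_mono hsub).trans ?_) _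
        exact measure_biUnion_le volume hcount _
    _ = ∑' P : u, 5 ^ d * (l * qvol P.1) := by
        rw [← ENNReal.tsum_mul_left]
        refine tsum_congr fun P => ?_
        rw [volume_set, qvol, enl_side, show P.1.side + 2 * (2 * P.1.side) = 5 * P.1.side by ring,
          ofReal_mul (by norm_num), mul_pow, qvol]
        simp; ring
    _ ≤ ∑' P : u, 5 ^ d * ∫⁻ y in P.1.set, g y :=
        ENNReal.tsum_le_tsum fun P => mul_le_mul_right (hbd _ (hut P.2)) _
    _ = 5 ^ d * ∫⁻ y in ⋃ P ∈ u, P.set, g y := by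
        rw [ENNReal.tsum_mul_left, lintegral_biUnion hcount (fun P _ => measurableSet_set P) hdisj]
    _ ≤ 5 ^ d * ∫⁻ x, g x := mul_le_mul_right (setLIntegral_le_lintegral _ _) _

/-- Strong type of the Hardy–Littlewood maximal operator. -/
lemma HLM_strong (hd : 1 ≤ d) {h : Rd d → ℝ≥0∞} (hh : Measurable h) {a : ℝ} (ha : 1 < a) :
    ∫⁻ x, HLM h x ^ a ≤ ENNReal.ofReal (a / (a - 1)) * (5 ^ d * 2 ^ a) * ∫⁻ x, h x ^ a := by
  have h2 : ∫⁻ x, (2 * h x) ^ a = 2 ^ a * ∫⁻ x, h x ^ a := by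
    rw [← lintegral_const_mul _ (by fun_prop)]
    exact lintegral_congr fun x => mul_rpow_of_nonneg _ _ (by linarith)
  rw [← mul_assoc, mul_assoc _ _ (∫⁻ x, h x ^ a), ← h2]
  refine lintegral_rpow_le_of_weak (measurable_HLM h) (by fun_prop) (by finiteness) ?_ ha
  intro t ht
  set s : Set (Rd d) := {x | ENNReal.ofReal t < 2 * h x} with hs
  have hsm : MeasurableSet s := measurableSet_lt (by fun_prop) (by fun_prop)
  have hsub : {x | ENNReal.ofReal t < HLM h x} ⊆
      {x | ENNReal.ofReal (t / 2) < HLM (s.indicator h) x} := by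
    intro x hx
    obtain ⟨Q, hQ, hl⟩ := lt_HLM_iff.1 hx
    refine lt_HLM_iff.2 ⟨Q, hQ, ?_⟩
    by_contra! hcon
    refine hl.not_ge ?_
    have : ∀ y, h y ≤ s.indicator h y + ENNReal.ofReal (t / 2) := by
      intro y
      by_cases hy : y ∈ s
      · simp [hy]
      · have hy' : 2 * h y ≤ ENNReal.ofReal t := not_lt.1 hy
        rw [indicator_of_notMem hy, zero_add, ofReal_div_of_pos two_pos,
          ENNReal.le_div_iff_mul_le (by simp) (by simp), mul_comm]
        simpa using hy'
    calc (qvol Q)⁻¹ * ∫⁻ y in Q.set, h y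
        ≤ (qvol Q)⁻¹ * ∫⁻ y in Q.set, (s.indicator h y + ENNReal.ofReal (t / 2)) :=
          mul_le_mul_right (lintegral_mono this) _
      _ = ((qvol Q)⁻¹ * ∫⁻ y in Q.set, s.indicator h y) + ENNReal.ofReal (t / 2) := by
          rw [lintegral_add_right _ measurable_const, mul_add, setLIntegral_const, volume_set,
            mul_comm (ENNReal.ofReal _), ← mul_assoc,
            ENNReal.inv_mul_cancel (qvol_ne_zero Q) (qvol_ne_top Q), one_mul]
      _ ≤ ENNReal.ofReal (t / 2) + ENNReal.ofReal (t / 2) := add_le_add_left hcon _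
      _ = ENNReal.ofReal t := by
          rw [← ofReal_add (by positivity) (by positivity), add_halves]
  calc ENNReal.ofReal t * volume {x | ENNReal.ofReal t < HLM h x}
      ≤ ENNReal.ofReal t * volume {x | ENNReal.ofReal (t / 2) < HLM (s.indicator h) x} :=
        mul_le_mul_right (measure_mono hsub) _
    _ = 2 * (ENNReal.ofReal (t / 2) * volume {x | ENNReal.ofReal (t / 2) < HLM (s.indicator h) x}) := by
        rw [← mul_assoc]; congr 1
        rw [show (2 : ℝ≥0∞) = ENNReal.ofReal 2 by simp, ← ofReal_mul two_pos.le]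
        congr 1; ring
    _ ≤ 2 * (5 ^ d * ∫⁻ x, s.indicator h x) := mul_le_mul_right (HLM_weak hd _ _) _
    _ = 5 ^ d * ∫⁻ x in s, 2 * h x := by
        rw [lintegral_indicator hsm, lintegral_const_mul _ hh]; ring

/-- Measurable bounded functions with bounded support. -/
def Nice (h : Rd d → ℂ) : Prop :=
  Measurable h ∧ (∃ M : ℝ, ∀ x, ‖h x‖ ≤ M) ∧ ∃ R : ℝ, ∀ x, R < ‖x‖ → h x = 0

/-- Convolution of two complex functions. -/
def cv (κ h : Rd d → ℂ) (x : Rd d) : ℂ := ∫ y, h y * κ (x - y)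

lemma cv_eq (κ h : Rd d → ℂ) : cv κ h = convolution h κ (ContinuousLinearMap.mul ℂ ℂ) volume := rfl

namespace Nice

lemma bdd {h : Rd d → ℂ} (hh : Nice h) : ∃ M : ℝ, 0 < M ∧ ∀ x, ‖h x‖ ≤ M := by
  obtain ⟨-, ⟨M, hM⟩, -⟩ := hh
  exact ⟨max M 1, by positivity, fun x => (hM x).trans (le_max_left _ _)⟩

lemma supp {h : Rd d → ℂ} (hh : Nice h) : ∃ R : ℝ, 0 < R ∧ ∀ x, R < ‖x‖ → h x = 0 := by
  obtain ⟨-, -, R, hR⟩ := hh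
  exact ⟨max R 1, by positivity, fun x hx => hR x ((le_max_left _ _).trans_lt hx)⟩

lemma lintegral_rpow_lt_top {h : Rd d → ℂ} (hh : Nice h) {a : ℝ} (ha : 0 < a) :
    ∫⁻ x, ‖h x‖ₑ ^ a < ⊤ := by
  obtain ⟨M, hM0, hM⟩ := hh.bdd
  obtain ⟨R, hR0, hR⟩ := hh.supp
  have : ∀ x, ‖h x‖ₑ ^ a ≤ (closedBall (0 : Rd d) R).indicator
      (fun _ => ENNReal.ofReal M ^ a) x := by
    intro x
    by_cases hx : x ∈ closedBall (0 : Rd d) R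
    · rw [indicator_of_mem hx]
      refine rpow_le_rpow ?_ ha.le
      rw [← ofReal_norm]; exact ofReal_le_ofReal (hM x)
    · rw [hR x (by simpa using hx)]; simp [ha]
  refine (lintegral_mono this).trans_lt ?_
  rw [lintegral_indicator isClosed_closedBall.measurableSet, setLIntegral_const]
  exact mul_lt_top (by finiteness) measure_closedBall_lt_top

lemma lintegral_lt_top {h : Rd d → ℂ} (hh : Nice h) : ∫⁻ x, ‖h x‖ₑ < ⊤ := by
  simpa using hh.lintegral_rpow_lt_top one_pos

lemma integrable {h : Rd d → ℂ} (hh : Nice h) : Integrable h :=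
  ⟨hh.1.aestronglyMeasurable, hh.lintegral_lt_top⟩

lemma memLp_two {h : Rd d → ℂ} (hh : Nice h) : MemLp h 2 := by
  refine ⟨hh.1.aestronglyMeasurable, ?_⟩
  rw [eLpNorm_lt_top_iff_lintegral_rpow_enorm_lt_top (by simp) (by simp)]
  simpa using hh.lintegral_rpow_lt_top two_pos

lemma add {f g : Rd d → ℂ} (hf : Nice f) (hg : Nice g) : Nice (fun x => f x + g x) := by
  obtain ⟨M, hM0, hM⟩ := hf.bdd
  obtain ⟨R, hR0, hR⟩ := hf.supp
  obtain ⟨M', hM0', hM'⟩ := hg.bdd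
  obtain ⟨R', hR0', hR'⟩ := hg.supp
  refine ⟨hf.1.add hg.1, ⟨M + M', fun x => (norm_add_le _ _).trans (add_le_add (hM x) (hM' x))⟩,
    max R R', fun x hx => ?_⟩
  show f x + g x = 0
  rw [hR x ((le_max_left _ _).trans_lt hx), hR' x ((le_max_right _ _).trans_lt hx), add_zero]

lemma const_mul {f : Rd d → ℂ} (hf : Nice f) (c : ℂ) : Nice (fun x => c * f x) := by
  obtain ⟨M, hM0, hM⟩ := hf.bdd
  obtain ⟨R, hR0, hR⟩ := hf.supp
  refine ⟨hf.1.const_mul c, ⟨‖c‖ * M, fun x => ?_⟩, R, fun x hx => by simp [hR x hx]⟩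
  rw [norm_mul]; exact mul_le_mul_of_nonneg_left (hM x) (norm_nonneg _)

lemma neg {f : Rd d → ℂ} (hf : Nice f) : Nice (fun x => - f x) := by
  simpa using hf.const_mul (-1)

lemma sub {f g : Rd d → ℂ} (hf : Nice f) (hg : Nice g) : Nice (fun x => f x - g x) := by
  simpa [sub_eq_add_neg] using hf.add hg.neg

lemma zero : Nice (fun _ : Rd d => (0 : ℂ)) :=
  ⟨measurable_const, ⟨0, by simp⟩, 0, fun _ _ => rfl⟩

lemma sum {ι : Type*} (s : Finset ι) {f : ι → Rd d → ℂ} (hf : ∀ i ∈ s, Nice (f i)) :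
    Nice (fun x => ∑ i ∈ s, f i x) := by
  classical
  induction s using Finset.induction_on with
  | empty => simpa using Nice.zero
  | insert i s hi ih =>
    simp_rw [Finset.sum_insert hi]
    exact (hf i (Finset.mem_insert_self _ _)).add
      (ih fun j hj => hf j (Finset.mem_insert_of_mem hj))

lemma indicator {f : Rd d → ℂ} (hf : Nice f) {s : Set (Rd d)} (hs : MeasurableSet s) :
    Nice (s.indicator f) := by
  obtain ⟨M, hM0, hM⟩ := hf.bdd
  obtain ⟨R, hR0, hR⟩ := hf.supp
  refine ⟨hf.1.indicator hs, ⟨M, fun x => (norm_indicator_le_norm_self f x).trans (hM x)⟩, R,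
    fun x hx => ?_⟩
  by_cases h : x ∈ s <;> simp [h, hR x hx]

lemma integrable_cv {κ h : Rd d → ℂ} (hκ : Nice κ) (hh : Nice h) (x : Rd d) :
    Integrable fun y => h y * κ (x - y) := by
  obtain ⟨M, hM0, hM⟩ := hκ.bdd
  exact hh.integrable.mul_bdd (c := M)
    ((hκ.1.comp (measurable_const.sub measurable_id)).aestronglyMeasurable)
    (Eventually.of_forall fun y => hM _)

lemma measurable_cv {κ h : Rd d → ℂ} (hκ : Measurable κ) (hh : Measurable h) :
    Measurable (cv κ h) := by
  have : StronglyMeasurable (cv κ h) := by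
    refine StronglyMeasurable.integral_prod_right (f := fun x y => h y * κ (x - y)) ?_
    refine Measurable.stronglyMeasurable ?_
    exact (hh.comp measurable_snd).mul (hκ.comp (measurable_fst.sub measurable_snd))
  exact this.measurable

lemma cv_nice {κ h : Rd d → ℂ} (hκ : Nice κ) (hh : Nice h) : Nice (cv κ h) := by
  obtain ⟨M, hM0, hM⟩ := hκ.bdd
  obtain ⟨R, hR0, hR⟩ := hκ.supp
  obtain ⟨R', hR0', hR'⟩ := hh.supp
  refine ⟨measurable_cv hκ.1 hh.1, ⟨∫ y, ‖h y‖ * M, fun x => ?_⟩, R + R', fun x hx => ?_⟩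
  · refine norm_integral_le_of_norm_le (hh.integrable.norm.mul_const M)
      (Eventually.of_forall fun y => ?_)
    rw [norm_mul]; exact mul_le_mul_of_nonneg_left (hM _) (norm_nonneg _)
  · rw [cv, integral_eq_zero_of_ae]
    refine Eventually.of_forall fun y => ?_
    by_cases hy : R' < ‖y‖
    · simp [hR' y hy]
    · have : R < ‖x - y‖ := by
        have := norm_sub_norm_le x y
        push Not at hy; linarith
      simp [hR _ this]

lemma fourier_cv {κ h : Rd d → ℂ} (hκ : Nice κ) (hh : Nice h) (ξ : Rd d) :
    𝓕 (cv κ h) ξ = 𝓕 κ ξ * 𝓕 h ξ := by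
  rw [cv_eq, mul_comm]
  exact Real.fourier_mul_convolution_eq hh.integrable hκ.integrable ξ

end Nice

/-- Plancherel's theorem on `L¹ ∩ L²`. -/
lemma plancherel {h : Rd d → ℂ} (hi : Integrable h) (h2 : MemLp h 2) :
    ∫⁻ ξ, ‖𝓕 h ξ‖ₑ ^ (2 : ℝ) = ∫⁻ x, ‖h x‖ₑ ^ (2 : ℝ) := by
  set H : Lp (α := Rd d) ℂ 2 := h2.toLp h with hH
  have hcont : Continuous (𝓕 h) :=
    VectorFourier.fourierIntegral_continuous Real.continuous_fourierChar
      (by exact continuous_inner) hi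
  have hae : ∀ᵐ ξ : Rd d, 𝓕 h ξ = (𝓕 H : Lp (α := Rd d) ℂ 2 volume) ξ := by
    refine ae_eq_of_integral_contDiff_smul_eq hcont.locallyIntegrable
      ((Lp.memLp _).locallyIntegrable (by norm_num)) fun g hg hgs => ?_
    have hgs' : HasCompactSupport (fun x => (g x : ℂ)) := hgs.comp_left (g := fun t : ℝ => (t : ℂ)) (by simp)
    have hg' : ContDiff ℝ (⊤ : ℕ∞) (fun x => (g x : ℂ)) := Complex.ofRealCLM.contDiff.comp hg
    set ψ : SchwartzMap (Rd d) ℂ := hgs'.toSchwartzMap hg' with hψ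
    have e1 := congrArg (fun T => T ψ) (Lp.fourier_toTemperedDistribution_eq (E := Rd d) (F := ℂ) H)
    simp only [TemperedDistribution.fourier_apply, Lp.toTemperedDistribution_apply] at e1
    have e2 : ∫ x, (𝓕 ψ) x • H x = ∫ x, (𝓕 ψ) x • h x := by
      refine integral_congr_ae ?_
      filter_upwards [h2.coeFn_toLp] with x hx
      rw [hH, hx]
    have e3 : ∫ x, (𝓕 ψ) x • h x = ∫ x, ψ x • 𝓕 h x := by
      simpa using! (VectorFourier.integral_fourierIntegral_smul_eq_flip (L := innerₗ (Rd d))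
        Real.continuous_fourierChar continuous_inner ψ.integrable hi)
    rw [e2, e3] at e1
    exact e1
  rw [lintegral_congr_ae (hae.mono fun x hx => by
    show ‖𝓕 h x‖ₑ ^ (2 : ℝ) = ‖(𝓕 H : Lp (α := Rd d) ℂ 2 volume) x‖ₑ ^ (2 : ℝ); rw [hx])]
  have e := congrArg ENNReal.ofReal (Lp.norm_fourier_eq (E := Rd d) (F := ℂ) H)
  rw [ofReal_norm, ofReal_norm, Lp.enorm_def, Lp.enorm_def,
    eLpNorm_congr_ae h2.coeFn_toLp,
    eLpNorm_eq_lintegral_rpow_enorm_toReal (by simp) (by simp),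
    eLpNorm_eq_lintegral_rpow_enorm_toReal (by simp) (by simp)] at e
  have := rpow_left_injective (x := 1 / (2 : ℝ≥0∞).toReal) (by simp) e
  simpa using this

lemma Nice.plancherel {h : Rd d → ℂ} (hh : Nice h) :
    ∫⁻ ξ, ‖𝓕 h ξ‖ₑ ^ (2 : ℝ) = ∫⁻ x, ‖h x‖ₑ ^ (2 : ℝ) :=
  RoughWeight.plancherel hh.integrable hh.memLp_two

lemma Nice.continuous_fourier {h : Rd d → ℂ} (hh : Nice h) : Continuous (𝓕 h) :=
  VectorFourier.fourierIntegral_continuous Real.continuous_fourierChar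
      (by exact continuous_inner) hh.integrable

lemma cv_add_right {κ f g : Rd d → ℂ} (hκ : Nice κ) (hf : Nice f) (hg : Nice g) (x : Rd d) :
    cv κ (fun y => f y + g y) x = cv κ f x + cv κ g x := by
  rw [cv, cv, cv, ← integral_add (hκ.integrable_cv hf x) (hκ.integrable_cv hg x)]
  exact integral_congr_ae (Eventually.of_forall fun y => by simp [add_mul])

lemma cv_sum_right {ι : Type*} (s : Finset ι) {κ : Rd d → ℂ} {f : ι → Rd d → ℂ} (hκ : Nice κ)
    (hf : ∀ i ∈ s, Nice (f i)) (x : Rd d) :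
    cv κ (fun y => ∑ i ∈ s, f i y) x = ∑ i ∈ s, cv κ (f i) x := by
  simp only [cv]
  rw [← integral_finsetSum _ fun i hi => hκ.integrable_cv (hf i hi) x]
  exact integral_congr_ae (Eventually.of_forall fun y => by simp [Finset.sum_mul])

lemma cv_sub_left {κ κ' f : Rd d → ℂ} (hκ : Nice κ) (hκ' : Nice κ') (hf : Nice f) (x : Rd d) :
    cv (fun y => κ y - κ' y) f x = cv κ f x - cv κ' f x := by
  rw [cv, cv, cv, ← integral_sub (hκ.integrable_cv hf x) (hκ'.integrable_cv hf x)]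
  exact integral_congr_ae (Eventually.of_forall fun y => by simp [mul_sub])

lemma sum_zpow_Ico {q : ℝ} (hq : 0 < q) (hq1 : q ≠ 1) {b k : ℤ} (hbk : b ≤ k) :
    ∑ i ∈ Finset.Ico b k, q ^ i = (q ^ k - q ^ b) / (q - 1) := by
  have hq1' : q - 1 ≠ 0 := sub_ne_zero.2 hq1
  induction k, hbk using Int.leInduction with
  | base => simp
  | succ k hk ih =>
    have : Finset.Ico b (k + 1) = insert k (Finset.Ico b k) := by
      ext i; simp only [Finset.mem_Ico, Finset.mem_insert]; omega
    rw [this, Finset.sum_insert (by simp), ih, zpow_add_one₀ hq.ne']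
    field_simp; ring

/-- The ratio `2^{1/4}` of the geometric decay. -/
def qq : ℝ := (2 : ℝ) ^ (1 / 4 : ℝ)

lemma one_lt_qq : 1 < qq := Real.one_lt_rpow (by norm_num) (by norm_num)
lemma qq_pos : 0 < qq := zero_lt_one.trans one_lt_qq

/-- The decay profile `min(s^{1/4}, s^{-1/4})`. -/
def dec (s : ℝ) : ℝ := min (s ^ (1 / 4 : ℝ)) (s ^ (-(1 / 4) : ℝ))

lemma dec_nonneg {s : ℝ} (hs : 0 ≤ s) : 0 ≤ dec s :=
  le_min (Real.rpow_nonneg hs _) (Real.rpow_nonneg hs _)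

lemma dec_le_one {s : ℝ} (hs : 0 < s) : dec s ≤ 1 := by
  rcases le_total s 1 with h | h
  · exact (min_le_left _ _).trans (Real.rpow_le_one hs.le h (by norm_num))
  · exact (min_le_right _ _).trans (Real.rpow_le_one_of_one_le_of_nonpos h (by norm_num))

lemma two_zpow_mul_rpow {s : ℝ} (hs : 0 < s) (i : ℤ) :
    ((2 : ℝ) ^ i * s) ^ (1 / 4 : ℝ) = qq ^ i * s ^ (1 / 4 : ℝ) := by
  rw [Real.mul_rpow (by positivity) hs.le, qq, ← Real.rpow_intCast, ← Real.rpow_intCast,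
    ← Real.rpow_mul (by norm_num), ← Real.rpow_mul (by norm_num), mul_comm (i : ℝ)]

lemma two_zpow_mul_rpow_neg {s : ℝ} (hs : 0 < s) (i : ℤ) :
    ((2 : ℝ) ^ i * s) ^ (-(1 / 4) : ℝ) = qq⁻¹ ^ i * s ^ (-(1 / 4) : ℝ) := by
  rw [Real.rpow_neg (by positivity), two_zpow_mul_rpow hs, mul_inv, Real.rpow_neg hs.le, inv_zpow]

/-- The constant in the geometric series estimates. -/
def gC : ℝ := qq / (qq - 1)

lemma gC_pos : 0 < gC := div_pos qq_pos (sub_pos.2 one_lt_qq)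

lemma sum_dec_low {s : ℝ} (hs : 0 < s) (b k : ℤ) :
    ∑ i ∈ Finset.Ico b k, dec ((2 : ℝ) ^ i * s) ≤ gC * ((2 : ℝ) ^ k * s) ^ (1 / 4 : ℝ) := by
  rcases lt_or_ge k b with h | hbk
  · rw [Finset.Ico_eq_empty (by omega), Finset.sum_empty]
    exact mul_nonneg gC_pos.le (by positivity)
  have hq := one_lt_qq
  have hq0 := qq_pos
  calc ∑ i ∈ Finset.Ico b k, dec ((2 : ℝ) ^ i * s)
      ≤ ∑ i ∈ Finset.Ico b k, qq ^ i * s ^ (1 / 4 : ℝ) :=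
        Finset.sum_le_sum fun i _ => (min_le_left _ _).trans_eq (two_zpow_mul_rpow hs i)
    _ = (qq ^ k - qq ^ b) / (qq - 1) * s ^ (1 / 4 : ℝ) := by
        rw [← Finset.sum_mul, sum_zpow_Ico hq0 hq.ne' hbk]
    _ ≤ gC * ((2 : ℝ) ^ k * s) ^ (1 / 4 : ℝ) := by
        rw [two_zpow_mul_rpow hs, gC, ← mul_assoc]
        refine mul_le_mul_of_nonneg_right ?_ (by positivity)
        rw [div_mul_eq_mul_div]
        refine div_le_div_of_nonneg_right ?_ (by linarith)
        have := zpow_pos hq0 k; have := zpow_pos hq0 b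
        nlinarith

lemma sum_dec_high {s : ℝ} (hs : 0 < s) (k l : ℤ) :
    ∑ i ∈ Finset.Ico k l, dec ((2 : ℝ) ^ i * s) ≤ gC * ((2 : ℝ) ^ k * s) ^ (-(1 / 4) : ℝ) := by
  rcases lt_or_ge l k with h | hkl
  · rw [Finset.Ico_eq_empty (by omega), Finset.sum_empty]
    exact mul_nonneg gC_pos.le (by positivity)
  have hq := one_lt_qq
  have hq0 := qq_pos
  have hq' : qq⁻¹ ≠ 1 := by
    intro h; rw [inv_eq_one] at h; linarith
  calc ∑ i ∈ Finset.Ico k l, dec ((2 : ℝ) ^ i * s)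
      ≤ ∑ i ∈ Finset.Ico k l, qq⁻¹ ^ i * s ^ (-(1 / 4) : ℝ) :=
        Finset.sum_le_sum fun i _ => (min_le_right _ _).trans_eq (two_zpow_mul_rpow_neg hs i)
    _ = (qq⁻¹ ^ l - qq⁻¹ ^ k) / (qq⁻¹ - 1) * s ^ (-(1 / 4) : ℝ) := by
        rw [← Finset.sum_mul, sum_zpow_Ico (inv_pos.2 hq0) hq' hkl]
    _ ≤ gC * ((2 : ℝ) ^ k * s) ^ (-(1 / 4) : ℝ) := by
        rw [two_zpow_mul_rpow_neg hs, gC, ← mul_assoc]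
        refine mul_le_mul_of_nonneg_right ?_ (by positivity)
        have h1 : (qq⁻¹ ^ l - qq⁻¹ ^ k) / (qq⁻¹ - 1) = (qq⁻¹ ^ k - qq⁻¹ ^ l) * (qq / (qq - 1)) := by
          have : qq - 1 ≠ 0 := by linarith
          have h2 : qq⁻¹ - 1 ≠ 0 := sub_ne_zero.2 hq'
          rw [div_eq_iff h2]
          have : qq / (qq - 1) * (qq⁻¹ - 1) = -1 := by field_simp; ring
          linear_combination (qq⁻¹ ^ l - qq⁻¹ ^ k) * this
        rw [h1, mul_comm]
        refine mul_le_mul_of_nonneg_left ?_ gC_pos.le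
        have := zpow_pos (inv_pos.2 hq0) l
        linarith

lemma exists_zpow_near {s : ℝ} (hs : 0 < s) : ∃ k : ℤ, 1 ≤ (2 : ℝ) ^ k * s ∧ (2 : ℝ) ^ k * s ≤ 2 := by
  obtain ⟨n, h1, h2⟩ := exists_mem_Ico_zpow (x := s) (y := 2) hs one_lt_two
  refine ⟨-n, ?_, ?_⟩
  · rw [zpow_neg, le_inv_mul_iff₀ (by positivity)]; simpa using h1
  · rw [zpow_neg, inv_mul_le_iff₀ (by positivity), ← zpow_add_one₀ two_ne_zero]; exact h2.le

lemma sum_dec_le {s : ℝ} (hs : 0 < s) (b l : ℤ) :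
    ∑ i ∈ Finset.Ico b l, dec ((2 : ℝ) ^ i * s) ≤ 3 * gC := by
  obtain ⟨k, h1, h2⟩ := exists_zpow_near hs
  have hsub : Finset.Ico b l ⊆ Finset.Ico b k ∪ Finset.Ico k l := by
    intro i; simp only [Finset.mem_Ico, Finset.mem_union]; omega
  have hnn : ∀ i : ℤ, 0 ≤ dec ((2 : ℝ) ^ i * s) := fun i => dec_nonneg (by positivity)
  calc ∑ i ∈ Finset.Ico b l, dec ((2 : ℝ) ^ i * s)
      ≤ ∑ i ∈ Finset.Ico b k ∪ Finset.Ico k l, dec ((2 : ℝ) ^ i * s) :=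
        Finset.sum_le_sum_of_subset_of_nonneg hsub fun i _ _ => hnn i
    _ = ∑ i ∈ Finset.Ico b k, dec ((2 : ℝ) ^ i * s) + ∑ i ∈ Finset.Ico k l, dec ((2 : ℝ) ^ i * s) :=
        Finset.sum_union (Finset.disjoint_left.2 fun i => by simp only [Finset.mem_Ico]; omega)
    _ ≤ gC * ((2 : ℝ) ^ k * s) ^ (1 / 4 : ℝ) + gC * ((2 : ℝ) ^ k * s) ^ (-(1 / 4) : ℝ) :=
        add_le_add (sum_dec_low hs b k) (sum_dec_high hs k l)
    _ ≤ gC * 2 + gC * 1 := by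
        have hg := gC_pos.le
        gcongr
        · calc ((2 : ℝ) ^ k * s) ^ (1 / 4 : ℝ) ≤ ((2 : ℝ) ^ k * s) ^ (1 : ℝ) :=
              Real.rpow_le_rpow_of_exponent_le h1 (by norm_num)
            _ ≤ 2 := by simpa using h2
        · exact Real.rpow_le_one_of_one_le_of_nonpos h1 (by norm_num)
    _ = 3 * gC := by ring

/-- The `L¹`-normalised dilation of a function by `2^i`. -/
def dil (i : ℤ) (κ : Rd d → ℂ) (x : Rd d) : ℂ := (((2 : ℝ) ^ (-i)) ^ d : ℝ) * κ ((2 : ℝ) ^ (-i) • x)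

lemma norm_zpow_smul (i : ℤ) (x : Rd d) : ‖(2 : ℝ) ^ i • x‖ = (2 : ℝ) ^ i * ‖x‖ := by
  rw [norm_smul, Real.norm_of_nonneg (by positivity)]

lemma lt_norm_dil {R : ℝ} (i : ℤ) {x : Rd d} (hx : R * (2 : ℝ) ^ i < ‖x‖) :
    R < ‖(2 : ℝ) ^ (-i) • x‖ := by
  rw [norm_zpow_smul, zpow_neg, lt_inv_mul_iff₀ (by positivity)]; linarith

lemma dil_eq_zero {κ : Rd d → ℂ} {R : ℝ} (hR : ∀ x, R < ‖x‖ → κ x = 0) (i : ℤ) {x : Rd d}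
    (hx : R * (2 : ℝ) ^ i < ‖x‖) : dil i κ x = 0 := by
  rw [dil, hR _ (lt_norm_dil i hx), mul_zero]

lemma norm_dil_le {κ : Rd d → ℂ} {A : ℝ} (hA : ∀ x, ‖κ x‖ ≤ A) (i : ℤ) (x : Rd d) :
    ‖dil i κ x‖ ≤ ((2 : ℝ) ^ (-i)) ^ d * A := by
  rw [dil, norm_mul, Complex.norm_real, Real.norm_of_nonneg (by positivity)]
  exact mul_le_mul_of_nonneg_left (hA _) (by positivity)

lemma Nice.dil {κ : Rd d → ℂ} (hκ : Nice κ) (i : ℤ) : Nice (dil i κ) := by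
  obtain ⟨M, hM0, hM⟩ := hκ.bdd
  obtain ⟨R, hR0, hR⟩ := hκ.supp
  refine ⟨?_, ⟨_, norm_dil_le hM i⟩, R * (2 : ℝ) ^ i, fun x hx => dil_eq_zero hR i hx⟩
  exact (hκ.1.comp (measurable_const_smul _)).const_mul _

lemma fourier_dil (κ : Rd d → ℂ) (i : ℤ) (ξ : Rd d) :
    𝓕 (dil i κ) ξ = 𝓕 κ ((2 : ℝ) ^ i • ξ) := by
  rw [Real.fourier_eq, Real.fourier_eq]
  have h := Measure.integral_comp_smul (volume : Measure (Rd d))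
    (fun v => Real.fourierChar (-(inner ℝ v ((2 : ℝ) ^ i • ξ))) • κ v) ((2 : ℝ) ^ (-i))
  rw [finrank_euclideanSpace_fin] at h
  have h2 : ∀ v : Rd d, Real.fourierChar (-(inner ℝ v ξ)) • dil i κ v =
      (((2 : ℝ) ^ (-i)) ^ d : ℝ) • (Real.fourierChar (-(inner ℝ ((2 : ℝ) ^ (-i) • v) ((2 : ℝ) ^ i • ξ))) •
        κ ((2 : ℝ) ^ (-i) • v)) := by
    intro v
    rw [inner_smul_left, inner_smul_right]
    simp only [conj_trivial]
    rw [← mul_assoc, ← zpow_add₀ two_ne_zero, neg_add_cancel, zpow_zero, one_mul, dil,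
      smul_comm, Complex.real_smul]
  simp_rw [h2]
  rw [integral_smul, h, smul_smul, abs_of_nonneg (by positivity), mul_inv_cancel₀ (by positivity),
    one_smul]

/-- Pointwise domination of dilated convolutions by the maximal operator. -/
lemma cv_dil_le_HLM {κ : Rd d → ℂ} {A R : ℝ} (hR0 : 0 < R) (hA : ∀ x, ‖κ x‖ ≤ A)
    (hR : ∀ x, R < ‖x‖ → κ x = 0) (g : Rd d → ℂ) (i : ℤ) {x z : Rd d}
    (hxz : ‖z - x‖ ≤ R * (2 : ℝ) ^ i) :
    ‖cv (dil i κ) g x‖ₑ ≤ ENNReal.ofReal (A * (2 * R) ^ d) * HLM (fun y => ‖g y‖ₑ) z := by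
  set Q := cubeAt x (R * (2 : ℝ) ^ i) (by positivity) with hQ
  have hz : z ∈ Q.set := closedBall_subset_cubeAt _ _ _ (mem_closedBall_iff_norm.2 hxz)
  have hA0 : 0 ≤ A := (norm_nonneg _).trans (hA 0)
  calc ‖cv (dil i κ) g x‖ₑ ≤ ∫⁻ y, ‖g y * dil i κ (x - y)‖ₑ := enorm_integral_le_lintegral_enorm _
    _ ≤ ∫⁻ y, Q.set.indicator (fun y => ENNReal.ofReal (((2 : ℝ) ^ (-i)) ^ d * A) * ‖g y‖ₑ) y := by
        refine lintegral_mono fun y => ?_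
        by_cases hy : y ∈ Q.set
        · rw [indicator_of_mem hy, enorm_mul, mul_comm]
          refine mul_le_mul_left ?_ _
          rw [← ofReal_norm]; exact ofReal_le_ofReal (norm_dil_le hA i _)
        · have : R * (2 : ℝ) ^ i < ‖x - y‖ := by
            by_contra! hc
            exact hy (closedBall_subset_cubeAt _ _ _ (by
              rw [mem_closedBall_iff_norm, norm_sub_rev]; exact hc))
          simp [dil_eq_zero hR i this]
    _ = ENNReal.ofReal (((2 : ℝ) ^ (-i)) ^ d * A) * ∫⁻ y in Q.set, ‖g y‖ₑ := by
        rw [lintegral_indicator (measurableSet_set Q), lintegral_const_mul' _ _ ofReal_ne_top]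
    _ = ENNReal.ofReal (A * (2 * R) ^ d) * ((qvol Q)⁻¹ * ∫⁻ y in Q.set, ‖g y‖ₑ) := by
        rw [← mul_assoc]; congr 1
        rw [hQ, qvol_cubeAt, ← ofReal_pow (by positivity),
          ← ofReal_inv_of_pos (by positivity), ← ofReal_mul (by positivity)]
        congr 1
        have h1 : ((2 : ℝ) ^ i)⁻¹ ^ d * (2 ^ i) ^ d = 1 := by
          rw [← mul_pow, inv_mul_cancel₀ (by positivity), one_pow]
        have h2 : (2 * (R * (2 : ℝ) ^ i)) ^ d = (2 * R) ^ d * (2 ^ i) ^ d := by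
          rw [← mul_pow, mul_assoc]
        rw [zpow_neg, h2]
        field_simp
        rw [one_div]
        linear_combination A * h1
    _ ≤ _ := mul_le_mul_right (avg_le_HLM _ hz) _

/-- A smooth bump function of integral one, supported in the unit ball. -/
def phiR (d : ℕ) : Rd d → ℝ :=
  (⟨1 / 2, 1, by norm_num, by norm_num⟩ : ContDiffBump (0 : Rd d)).normed volume

/-- The complex-valued version of `phiR`. -/
def phi (d : ℕ) (x : Rd d) : ℂ := (phiR d x : ℂ)

lemma phiR_nonneg (x : Rd d) : 0 ≤ phiR d x := ContDiffBump.nonneg_normed _ _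

lemma continuous_phiR : Continuous (phiR d) := ContDiffBump.continuous_normed _

lemma integral_phiR : ∫ x, phiR d x = 1 := ContDiffBump.integral_normed _

lemma integrable_phiR : Integrable (phiR d) := ContDiffBump.integrable_normed _

lemma phiR_eq_zero {x : Rd d} (hx : 1 ≤ ‖x‖) : phiR d x = 0 := by
  by_contra h
  have h1 : x ∈ Function.support (phiR d) := h
  rw [phiR, ContDiffBump.support_normed_eq] at h1
  simp only [mem_ball, dist_zero_right] at h1
  linarith

lemma phi_eq_zero {x : Rd d} (hx : 1 < ‖x‖) : phi d x = 0 := by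
  rw [phi, phiR_eq_zero hx.le, Complex.ofReal_zero]

lemma norm_phi (x : Rd d) : ‖phi d x‖ = phiR d x := by
  rw [phi, Complex.norm_real, Real.norm_of_nonneg (phiR_nonneg x)]

lemma lintegral_phi : ∫⁻ x, ‖phi d x‖ₑ = 1 := by
  simp_rw [← ofReal_norm, norm_phi]
  rw [← ofReal_integral_eq_lintegral_ofReal integrable_phiR
    (Eventually.of_forall phiR_nonneg), integral_phiR, ofReal_one]

lemma exists_phi_const (d : ℕ) : ∃ A : ℝ, 1 ≤ A ∧ (∀ x, ‖phi d x‖ ≤ A) ∧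
    ∀ v, ∫⁻ x, ‖phi d (x + v) - phi d x‖ₑ ≤ ENNReal.ofReal (A * ‖v‖) := by
  have hcs : HasCompactSupport (phiR d) := ContDiffBump.hasCompactSupport_normed _
  have hcd : ContDiff ℝ 1 (phiR d) := ContDiffBump.contDiff_normed _
  obtain ⟨C, hC⟩ := hcd.lipschitzWith_of_hasCompactSupport hcs one_ne_zero
  obtain ⟨B, hB⟩ := hcs.exists_bound_of_continuous continuous_phiR
  have hL : ∀ x y, ‖phi d x - phi d y‖ ≤ C * ‖x - y‖ := fun x y => by
    rw [phi, phi, ← Complex.ofReal_sub, Complex.norm_real]; exact hC.norm_sub_le x y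
  have hB0 : ∀ x, ‖phi d x‖ ≤ B := fun x => by
    rw [phi, Complex.norm_real]; exact hB x
  set V := (volume (closedBall (0 : Rd d) 1)).toReal with hV
  have hV0 : 0 ≤ V := toReal_nonneg
  have hfin : volume (closedBall (0 : Rd d) 1) ≠ ⊤ := measure_closedBall_lt_top.ne
  have hC0 : (0 : ℝ) ≤ C := C.2
  refine ⟨max 1 (max B (2 * V * C)), le_max_left _ _, fun x => (hB0 x).trans (by simp),
    fun v => ?_⟩
  have hpt : ∀ x, ‖phi d (x + v) - phi d x‖ₑ ≤
      (closedBall (0 : Rd d) 1).indicator (fun _ => ENNReal.ofReal (C * ‖v‖)) (x + v) +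
      (closedBall (0 : Rd d) 1).indicator (fun _ => ENNReal.ofReal (C * ‖v‖)) x := by
    intro x
    have hle : ‖phi d (x + v) - phi d x‖ₑ ≤ ENNReal.ofReal (C * ‖v‖) := by
      rw [← ofReal_norm]; exact ofReal_le_ofReal (by simpa using hL (x + v) x)
    by_cases h1 : x + v ∈ closedBall (0 : Rd d) 1
    · rw [indicator_of_mem h1]; exact hle.trans le_self_add
    by_cases h2 : x ∈ closedBall (0 : Rd d) 1
    · rw [indicator_of_mem h2]; exact hle.trans le_add_self
    · rw [phi_eq_zero (by simpa using h1), phi_eq_zero (by simpa using h2)]; simp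
  have hm : Measurable ((closedBall (0 : Rd d) 1).indicator
      (fun _ => ENNReal.ofReal (C * ‖v‖))) :=
    measurable_const.indicator isClosed_closedBall.measurableSet
  calc ∫⁻ x, ‖phi d (x + v) - phi d x‖ₑ ≤ _ := lintegral_mono hpt
    _ = ENNReal.ofReal (C * ‖v‖) * volume (closedBall (0 : Rd d) 1) +
        ENNReal.ofReal (C * ‖v‖) * volume (closedBall (0 : Rd d) 1) := by
      rw [lintegral_add_right _ hm, lintegral_add_right_eq_self (μ := volume) (fun x =>
        (closedBall (0 : Rd d) 1).indicator (fun _ => ENNReal.ofReal (C * ‖v‖)) x) v,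
        lintegral_indicator isClosed_closedBall.measurableSet, setLIntegral_const]
    _ = ENNReal.ofReal (2 * V * C * ‖v‖) := by
      rw [← ofReal_toReal hfin, ← hV, ← ofReal_mul (by positivity),
        ← ofReal_add (by positivity) (by positivity)]
      congr 1; ring
    _ ≤ _ := ofReal_le_ofReal (mul_le_mul_of_nonneg_right (by simp) (norm_nonneg _))

/-- A constant controlling `phi`. -/
def cphi (d : ℕ) : ℝ := (exists_phi_const d).choose

lemma one_le_cphi : 1 ≤ cphi d := (exists_phi_const d).choose_spec.1
lemma norm_phi_le (x : Rd d) : ‖phi d x‖ ≤ cphi d := (exists_phi_const d).choose_spec.2.1 x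
lemma lintegral_phi_sub_le (v : Rd d) :
    ∫⁻ x, ‖phi d (x + v) - phi d x‖ₑ ≤ ENNReal.ofReal (cphi d * ‖v‖) :=
  (exists_phi_const d).choose_spec.2.2 v

lemma continuous_phi : Continuous (phi d) := Complex.continuous_ofReal.comp continuous_phiR

lemma nice_phi : Nice (phi d) :=
  ⟨continuous_phi.measurable, ⟨_, norm_phi_le⟩, 1, fun _ hx => phi_eq_zero hx⟩

lemma norm_integral_le_of_lintegral {f : Rd d → ℂ} {a : ℝ} (ha : 0 ≤ a)
    (h : ∫⁻ x, ‖f x‖ₑ ≤ ENNReal.ofReal a) : ‖∫ x, f x‖ ≤ a := by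
  have := (enorm_integral_le_lintegral_enorm f).trans h
  rwa [← ofReal_norm, ofReal_le_ofReal_iff ha] at this

lemma enorm_char_smul (t : ℝ) (z : ℂ) : ‖Real.fourierChar t • z‖ₑ = ‖z‖ₑ := by
  rw [← ofReal_norm, ← ofReal_norm, Circle.norm_smul]

lemma norm_fourier_phi_le_one (ξ : Rd d) : ‖𝓕 (phi d) ξ‖ ≤ 1 := by
  rw [Real.fourier_eq]
  refine norm_integral_le_of_lintegral zero_le_one ?_
  simp_rw [enorm_char_smul, lintegral_phi, ofReal_one, le_refl]

lemma norm_fourier_phi_le {ξ : Rd d} (hξ : ξ ≠ 0) : ‖𝓕 (phi d) ξ‖ ≤ cphi d / ‖ξ‖ := by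
  rw [Real.fourier_eq, fourierIntegral_eq_half_sub_half_period_translate hξ nice_phi.integrable,
    norm_smul]
  have hn : 0 < ‖ξ‖ := norm_pos_iff.2 hξ
  have h1 := one_le_cphi (d := d)
  have hv : ‖(1 / (2 * ‖ξ‖ ^ 2) : ℝ) • ξ‖ = 1 / (2 * ‖ξ‖) := by
    rw [norm_smul, Real.norm_of_nonneg (by positivity)]; field_simp
  have := norm_integral_le_of_lintegral (f := fun v => Real.fourierChar (-(inner ℝ v ξ)) •
      (phi d v - phi d (v + (1 / (2 * ‖ξ‖ ^ 2) : ℝ) • ξ)))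
      (a := cphi d * ‖(1 / (2 * ‖ξ‖ ^ 2) : ℝ) • ξ‖) (by positivity) (by
    simp_rw [enorm_char_smul]
    exact (lintegral_congr fun x => enorm_sub_rev _ _).trans_le (lintegral_phi_sub_le _))
  rw [hv] at this
  refine (mul_le_mul (b := 1) (by norm_num) this (norm_nonneg _) zero_le_one).trans ?_
  rw [one_mul, mul_one_div]
  gcongr; linarith

lemma integral_phi : ∫ x, phi d x = 1 := by
  simp only [phi]; rw [integral_complex_ofReal, integral_phiR, Complex.ofReal_one]

lemma norm_fourier_phi_sub_one_le (ξ : Rd d) : ‖𝓕 (phi d) ξ - 1‖ ≤ 2 * Real.pi * ‖ξ‖ := by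
  rw [Real.fourier_eq, ← integral_phi (d := d), ← integral_sub
    ((Real.fourierIntegral_convergent_iff ξ).2 nice_phi.integrable) nice_phi.integrable]
  refine norm_integral_le_of_lintegral (by positivity) ?_
  calc ∫⁻ v, ‖Real.fourierChar (-(inner ℝ v ξ)) • phi d v - phi d v‖ₑ
      ≤ ∫⁻ v, ENNReal.ofReal (2 * Real.pi * ‖ξ‖) * ‖phi d v‖ₑ := by
        refine lintegral_mono fun v => ?_
        rcases lt_or_ge 1 ‖v‖ with hv | hv
        · simp [phi_eq_zero hv]
        rw [Circle.smul_def, smul_eq_mul, ← sub_one_mul, enorm_mul]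
        refine mul_le_mul_left ?_ _
        rw [← ofReal_norm]
        refine ofReal_le_ofReal ?_
        rw [Real.fourierChar_apply, mul_comm (_ : ℂ) Complex.I]
        refine (Real.norm_exp_I_mul_ofReal_sub_one_le).trans ?_
        rw [norm_mul, norm_neg, norm_mul, Real.norm_of_nonneg Real.pi_pos.le, Real.norm_two]
        refine mul_le_mul_of_nonneg_left ?_ (by positivity)
        refine (norm_inner_le_norm _ _).trans ?_
        nlinarith [norm_nonneg ξ]
    _ = _ := by
        rw [lintegral_const_mul' _ _ ofReal_ne_top, lintegral_phi, mul_one]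

lemma Nice.fourier_integrable {h : Rd d → ℂ} (hh : Nice h) (ξ : Rd d) :
    Integrable fun v => Real.fourierChar (-(inner ℝ v ξ)) • h v :=
  (Real.fourierIntegral_convergent_iff ξ).2 hh.integrable

lemma fourier_sub {f g : Rd d → ℂ} (hf : Nice f) (hg : Nice g) (ξ : Rd d) :
    𝓕 (fun x => f x - g x) ξ = 𝓕 f ξ - 𝓕 g ξ := by
  rw [Real.fourier_eq, Real.fourier_eq, Real.fourier_eq,
    ← integral_sub (hf.fourier_integrable ξ) (hg.fourier_integrable ξ)]
  simp_rw [smul_sub]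

lemma fourier_sum {ι : Type*} (s : Finset ι) {f : ι → Rd d → ℂ} (hf : ∀ i ∈ s, Nice (f i))
    (ξ : Rd d) : 𝓕 (fun x => ∑ i ∈ s, f i x) ξ = ∑ i ∈ s, 𝓕 (f i) ξ := by
  simp_rw [Real.fourier_eq]
  rw [← integral_finsetSum _ fun i hi => (hf i hi).fourier_integrable ξ]
  simp_rw [Finset.smul_sum]

/-- Partial sums `∑_{k ≤ i < l} κ_i * h`. -/
def tl (κ h : Rd d → ℂ) (k l : ℤ) (x : Rd d) : ℂ := ∑ i ∈ Finset.Ico k l, cv (dil i κ) h x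

/-- The maximal operator associated with the dilates of `κ`. -/
def mx (κ : Rd d → ℂ) (b l : ℤ) (h : Rd d → ℂ) (x : Rd d) : ℝ≥0∞ :=
  ⨆ (k : ℤ) (_ : b ≤ k), ‖tl κ h k l x‖ₑ

lemma tl_add (κ h : Rd d → ℂ) {b k l : ℤ} (hbk : b ≤ k) (hkl : k ≤ l) (x : Rd d) :
    tl κ h b k x + tl κ h k l x = tl κ h b l x := by
  rw [tl, tl, tl, ← Finset.sum_union (Finset.disjoint_left.2 fun i => by
    simp only [Finset.mem_Ico]; omega)]
  congr 1
  ext i; simp only [Finset.mem_union, Finset.mem_Ico]; omega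

lemma tl_nice {κ h : Rd d → ℂ} (hκ : Nice κ) (hh : Nice h) (k l : ℤ) : Nice (tl κ h k l) :=
  Nice.sum _ fun i _ => (hκ.dil i).cv_nice hh

lemma fourier_tl {κ h : Rd d → ℂ} (hκ : Nice κ) (hh : Nice h) (k l : ℤ) (ξ : Rd d) :
    𝓕 (tl κ h k l) ξ = (∑ i ∈ Finset.Ico k l, 𝓕 κ ((2 : ℝ) ^ i • ξ)) * 𝓕 h ξ := by
  have := fourier_sum (Finset.Ico k l) (f := fun i => cv (dil i κ) h)
    (fun i _ => (hκ.dil i).cv_nice hh) ξ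
  rw [Finset.sum_mul]
  refine this.trans (Finset.sum_congr rfl fun i _ => ?_)
  rw [(hκ.dil i).fourier_cv hh, fourier_dil]

lemma measurable_mx {κ h : Rd d → ℂ} (hκ : Nice κ) (hh : Nice h) (b l : ℤ) :
    Measurable (mx κ b l h) :=
  Measurable.iSup fun _ => Measurable.iSup fun _ => (tl_nice hκ hh _ _).1.enorm

lemma ae_ne_zero (hd : 1 ≤ d) : ∀ᵐ ξ : Rd d, ξ ≠ 0 := by
  have : Nonempty (Fin d) := ⟨⟨0, hd⟩⟩
  exact Measure.ae_ne volume 0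

lemma dec_sq_le {s : ℝ} (hs : 0 < s) : dec s ^ 2 ≤ dec s := by
  have h1 := dec_nonneg hs.le
  have h2 := dec_le_one hs
  nlinarith

lemma enorm_rpow_two (z : ℂ) : ‖z‖ₑ ^ (2 : ℝ) = ENNReal.ofReal (‖z‖ ^ 2) := by
  rw [← ofReal_norm, ofReal_rpow_of_nonneg (norm_nonneg _) (by norm_num), Real.rpow_two]

/-- Square-function estimate from geometric decay of the multipliers. -/
lemma sum_sq_le (hd : 1 ≤ d) {F : ℤ → Rd d → ℂ} {h : Rd d → ℂ} {b l : ℤ} {E : ℝ}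
    (hF : ∀ k, Nice (F k)) (hh : Nice h)
    (hm : ∀ k ∈ Finset.Ico b l, ∀ ξ, ξ ≠ 0 →
      ‖𝓕 (F k) ξ‖ ≤ E * dec ((2 : ℝ) ^ k * ‖ξ‖) * ‖𝓕 h ξ‖) :
    ∑ k ∈ Finset.Ico b l, ∫⁻ x, ‖F k x‖ₑ ^ (2 : ℝ) ≤
      ENNReal.ofReal (E ^ 2 * (3 * gC)) * ∫⁻ x, ‖h x‖ₑ ^ (2 : ℝ) := by
  rw [← hh.plancherel, ← lintegral_const_mul' _ _ ofReal_ne_top]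
  simp_rw [← fun k => (hF k).plancherel]
  rw [← lintegral_finsetSum _ fun k _ => ((hF k).continuous_fourier.measurable.enorm.pow_const _)]
  refine lintegral_mono_ae ((ae_ne_zero hd).mono fun ξ hξ => ?_)
  have hn : 0 < ‖ξ‖ := norm_pos_iff.2 hξ
  simp_rw [enorm_rpow_two]
  rw [← ofReal_sum_of_nonneg fun _ _ => by positivity, ← ofReal_mul (by
    have := gC_pos; positivity)]
  refine ofReal_le_ofReal ?_
  calc ∑ k ∈ Finset.Ico b l, ‖𝓕 (F k) ξ‖ ^ 2
      ≤ ∑ k ∈ Finset.Ico b l, E ^ 2 * ‖𝓕 h ξ‖ ^ 2 * dec ((2 : ℝ) ^ k * ‖ξ‖) := by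
        refine Finset.sum_le_sum fun k hk => ?_
        have h1 := pow_le_pow_left₀ (norm_nonneg _) (hm k hk ξ hξ) 2
        have h2 := dec_sq_le (s := (2 : ℝ) ^ k * ‖ξ‖) (by positivity)
        refine h1.trans ?_
        rw [mul_pow, mul_pow]
        have := mul_le_mul_of_nonneg_left h2 (a := E ^ 2 * ‖𝓕 h ξ‖ ^ 2) (by positivity)
        linarith
    _ = E ^ 2 * ‖𝓕 h ξ‖ ^ 2 * ∑ k ∈ Finset.Ico b l, dec ((2 : ℝ) ^ k * ‖ξ‖) :=
        (Finset.mul_sum _ _ _).symm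
    _ ≤ E ^ 2 * ‖𝓕 h ξ‖ ^ 2 * (3 * gC) :=
        mul_le_mul_of_nonneg_left (sum_dec_le hn b l) (by positivity)
    _ = _ := by ring

lemma norm_fourier_tl_le {κ h : Rd d → ℂ} {D : ℝ} (hκ : Nice κ) (hh : Nice h)
    (hD : ∀ ξ, ξ ≠ 0 → ‖𝓕 κ ξ‖ ≤ D * dec ‖ξ‖) (k l : ℤ) {ξ : Rd d} (hξ : ξ ≠ 0) :
    ‖𝓕 (tl κ h k l) ξ‖ ≤ D * (∑ i ∈ Finset.Ico k l, dec ((2 : ℝ) ^ i * ‖ξ‖)) * ‖𝓕 h ξ‖ := by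
  rw [fourier_tl hκ hh, norm_mul]
  refine mul_le_mul_of_nonneg_right ?_ (norm_nonneg _)
  rw [Finset.mul_sum]
  refine (norm_sum_le _ _).trans (Finset.sum_le_sum fun i _ => ?_)
  have := hD ((2 : ℝ) ^ i • ξ) (smul_ne_zero (by positivity) hξ)
  rwa [norm_zpow_smul] at this

lemma low_mult {s φ : ℝ} (hs : 0 < s) (h1 : φ ≤ 1) (h2 : φ ≤ cphi d / s) {x : ℝ}
    (hφ : 0 ≤ φ) (hx : x ≤ gC * s ^ (1 / 4 : ℝ)) (hx' : x ≤ 3 * gC) :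
    φ * x ≤ 3 * gC * (7 * cphi d) * dec s := by
  have hg := gC_pos
  have hc := one_le_cphi (d := d)
  rw [dec, mul_min_of_nonneg _ _ (by positivity)]
  have hs4 : 0 ≤ s ^ (1 / 4 : ℝ) := by positivity
  have hs4' : 0 ≤ s ^ (-(1 / 4) : ℝ) := by positivity
  refine le_min ?_ ?_
  · calc φ * x ≤ φ * (gC * s ^ (1 / 4 : ℝ)) := mul_le_mul_of_nonneg_left hx hφ
      _ ≤ 1 * (gC * s ^ (1 / 4 : ℝ)) := mul_le_mul_of_nonneg_right h1 (by positivity)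
      _ ≤ 3 * gC * (7 * cphi d) * s ^ (1 / 4 : ℝ) := by
        rw [one_mul]; refine mul_le_mul_of_nonneg_right ?_ hs4; nlinarith
  · have h3 : φ ≤ cphi d * s ^ (-(1 / 4) : ℝ) := by
      rcases le_total s 1 with h | h
      · have := Real.one_le_rpow_of_pos_of_le_one_of_nonpos hs h (z := -(1 / 4)) (by norm_num)
        nlinarith
      · refine h2.trans ?_
        rw [div_eq_mul_inv, ← Real.rpow_neg_one]
        exact mul_le_mul_of_nonneg_left (Real.rpow_le_rpow_of_exponent_le h (by norm_num))
          (by positivity)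
    calc φ * x ≤ φ * (3 * gC) := mul_le_mul_of_nonneg_left hx' hφ
      _ ≤ (cphi d * s ^ (-(1 / 4) : ℝ)) * (3 * gC) := mul_le_mul_of_nonneg_right h3 (by positivity)
      _ ≤ _ := by
        have : 0 ≤ cphi d * s ^ (-(1 / 4) : ℝ) * gC := by positivity
        nlinarith

lemma high_mult {s φ : ℝ} (hs : 0 < s) (h1 : φ ≤ 2) (h2 : φ ≤ 2 * Real.pi * s) {x : ℝ}
    (hφ : 0 ≤ φ) (hx : x ≤ gC * s ^ (-(1 / 4) : ℝ)) (hx' : x ≤ 3 * gC) :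
    φ * x ≤ 3 * gC * (7 * cphi d) * dec s := by
  have hg := gC_pos
  have hc := one_le_cphi (d := d)
  have hpi := Real.pi_lt_d2
  rw [dec, mul_min_of_nonneg _ _ (by positivity)]
  have hs4 : 0 ≤ s ^ (1 / 4 : ℝ) := by positivity
  have hs4' : 0 ≤ s ^ (-(1 / 4) : ℝ) := by positivity
  refine le_min ?_ ?_
  · have h3 : φ ≤ 7 * s ^ (1 / 4 : ℝ) := by
      rcases le_total s 1 with h | h
      · have h4 : s ^ (1 : ℝ) ≤ s ^ (1 / 4 : ℝ) :=
          Real.rpow_le_rpow_of_exponent_ge hs h (by norm_num)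
        rw [Real.rpow_one] at h4
        nlinarith
      · have := Real.one_le_rpow h (z := 1 / 4) (by norm_num)
        linarith
    calc φ * x ≤ φ * (3 * gC) := mul_le_mul_of_nonneg_left hx' hφ
      _ ≤ (7 * s ^ (1 / 4 : ℝ)) * (3 * gC) := mul_le_mul_of_nonneg_right h3 (by positivity)
      _ ≤ _ := by
        have : 0 ≤ s ^ (1 / 4 : ℝ) * gC := by positivity
        nlinarith
  · calc φ * x ≤ φ * (gC * s ^ (-(1 / 4) : ℝ)) := mul_le_mul_of_nonneg_left hx hφ
      _ ≤ 2 * (gC * s ^ (-(1 / 4) : ℝ)) := mul_le_mul_of_nonneg_right h1 (by positivity)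
      _ ≤ 3 * gC * (7 * cphi d) * s ^ (-(1 / 4) : ℝ) := by
        rw [← mul_assoc]; refine mul_le_mul_of_nonneg_right ?_ hs4'; nlinarith

lemma add_sq_le_three (a b c : ℝ≥0∞) :
    (a + b + c) ^ (2 : ℝ) ≤ 4 * a ^ (2 : ℝ) + 4 * b ^ (2 : ℝ) + 4 * c ^ (2 : ℝ) := by
  have key : ∀ x y : ℝ≥0∞, (x + y) ^ (2 : ℝ) ≤ 2 * x ^ (2 : ℝ) + 2 * y ^ (2 : ℝ) := by
    intro x y
    have := rpow_add_le_mul_rpow_add_rpow x y (p := 2) (by norm_num)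
    norm_num at this ⊢
    rw [← mul_add]; exact this
  calc (a + b + c) ^ (2 : ℝ) ≤ 2 * (a + b) ^ (2 : ℝ) + 2 * c ^ (2 : ℝ) := key _ _
    _ ≤ 2 * (2 * a ^ (2 : ℝ) + 2 * b ^ (2 : ℝ)) + 4 * c ^ (2 : ℝ) := by
      gcongr
      · exact key _ _
      · norm_num
    _ = _ := by ring

/-- `L²` bound of the maximal operator. -/
theorem mx_L2 (hd : 1 ≤ d) : ∃ C : ℝ, 1 ≤ C ∧ ∀ (κ : Rd d → ℂ) (D : ℝ), Nice κ → 0 ≤ D →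
    (∀ ξ, ξ ≠ 0 → ‖𝓕 κ ξ‖ ≤ D * dec ‖ξ‖) → ∀ (b l : ℤ) (h : Rd d → ℂ), Nice h →
    ∫⁻ x, mx κ b l h x ^ (2 : ℝ) ≤ ENNReal.ofReal (C * D ^ 2) * ∫⁻ x, ‖h x‖ₑ ^ (2 : ℝ) := by
  have hg := gC_pos
  have hc := one_le_cphi (d := d)
  set c1 : ℝ := cphi d * (2 * 1) ^ d with hc1
  set c2 : ℝ := 3 * gC * (7 * cphi d) with hc2
  set C : ℝ := 4 * (c1 ^ 2 * (2 * (5 ^ d * 2 ^ (2 : ℝ)) * (3 * gC) ^ 2) + c2 ^ 2 * (3 * gC) +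
    c2 ^ 2 * (3 * gC)) with hC
  refine ⟨max C 1, le_max_right _ _, fun κ D hκ hD0 hD b l h hh => ?_⟩
  set T := tl κ h b l with hT
  have hTn : Nice T := tl_nice hκ hh b l
  set X : ℤ → Rd d → ℂ := fun k => cv (dil k (phi d)) (tl κ h b k) with hX
  set Y : ℤ → Rd d → ℂ := fun k x => tl κ h k l x - cv (dil k (phi d)) (tl κ h k l) x with hY
  have hXn : ∀ k, Nice (X k) := fun k => (nice_phi.dil k).cv_nice (tl_nice hκ hh b k)
  have hYn : ∀ k, Nice (Y k) := fun k =>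
    (tl_nice hκ hh k l).sub ((nice_phi.dil k).cv_nice (tl_nice hκ hh k l))
  -- pointwise decomposition
  have hpt : ∀ x, mx κ b l h x ^ (2 : ℝ) ≤
      4 * (ENNReal.ofReal c1 * HLM (fun y => ‖T y‖ₑ) x) ^ (2 : ℝ) +
      4 * ∑ k ∈ Finset.Ico b l, ‖X k x‖ₑ ^ (2 : ℝ) + 4 * ∑ k ∈ Finset.Ico b l, ‖Y k x‖ₑ ^ (2 : ℝ) := by
    intro x
    have hone : ∀ k, b ≤ k → ‖tl κ h k l x‖ₑ ≤ (4 * (ENNReal.ofReal c1 * HLM (fun y => ‖T y‖ₑ) x) ^ (2 : ℝ) +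
      4 * ∑ k ∈ Finset.Ico b l, ‖X k x‖ₑ ^ (2 : ℝ) +
      4 * ∑ k ∈ Finset.Ico b l, ‖Y k x‖ₑ ^ (2 : ℝ)) ^ (1 / 2 : ℝ) := by
      intro k hk
      rcases le_or_gt l k with hlk | hkl
      · rw [tl, Finset.Ico_eq_empty (by omega), Finset.sum_empty]; simp
      have hkm : k ∈ Finset.Ico b l := Finset.mem_Ico.2 ⟨hk, hkl⟩
      rw [← rpow_le_rpow_iff (z := 2) (by norm_num), ← rpow_mul]
      norm_num only [rpow_one]
      have hdec : tl κ h k l x = cv (dil k (phi d)) T x - X k x + Y k x := by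
        have h1 : T = fun y => tl κ h b k y + tl κ h k l y := by
          funext y
          exact (tl_add κ h hk hkl.le y).symm
        rw [h1, cv_add_right (nice_phi.dil k) (tl_nice hκ hh b k) (tl_nice hκ hh k l)]
        simp only [hX, hY]; ring
      have h2 : ‖tl κ h k l x‖ₑ ≤ ENNReal.ofReal c1 * HLM (fun y => ‖T y‖ₑ) x + ‖X k x‖ₑ + ‖Y k x‖ₑ := by
        rw [hdec]
        refine (enorm_add_le _ _).trans (add_le_add_left ?_ _)
        refine (enorm_sub_le).trans (add_le_add_left ?_ _)
        exact cv_dil_le_HLM one_pos norm_phi_le (fun _ => phi_eq_zero) T k (by simp; positivity)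
      refine (rpow_le_rpow h2 (by norm_num)).trans ((add_sq_le_three _ _ _).trans ?_)
      gcongr
      · exact Finset.single_le_sum (f := fun k => ‖X k x‖ₑ ^ (2 : ℝ)) (fun _ _ => zero_le) hkm
      · exact Finset.single_le_sum (f := fun k => ‖Y k x‖ₑ ^ (2 : ℝ)) (fun _ _ => zero_le) hkm
    have : mx κ b l h x ≤ _ := iSup₂_le hone
    refine (rpow_le_rpow this (z := 2) (by norm_num)).trans_eq ?_
    rw [← rpow_mul]; norm_num
  have hsD : ∀ (k k' : ℤ) (ξ : Rd d), ξ ≠ 0 → ∑ i ∈ Finset.Ico k k', dec ((2 : ℝ) ^ i * ‖ξ‖) ≤ 3 * gC :=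
    fun k k' ξ hξ => sum_dec_le (norm_pos_iff.2 hξ) k k'
  have hIT : ∫⁻ x, ‖T x‖ₑ ^ (2 : ℝ) ≤ ENNReal.ofReal ((D * (3 * gC)) ^ 2) * ∫⁻ x, ‖h x‖ₑ ^ (2 : ℝ) := by
    rw [← hh.plancherel, ← hTn.plancherel, ← lintegral_const_mul' _ _ ofReal_ne_top]
    refine lintegral_mono_ae ((ae_ne_zero hd).mono fun ξ hξ => ?_)
    simp only [enorm_rpow_two]
    rw [← ofReal_mul (by positivity), ← mul_pow]
    refine ofReal_le_ofReal (pow_le_pow_left₀ (norm_nonneg _) ?_ 2)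
    refine (norm_fourier_tl_le hκ hh hD b l hξ).trans ?_
    gcongr
    exact hsD b l ξ hξ
  have hIX : ∑ k ∈ Finset.Ico b l, ∫⁻ x, ‖X k x‖ₑ ^ (2 : ℝ) ≤
      ENNReal.ofReal ((c2 * D) ^ 2 * (3 * gC)) * ∫⁻ x, ‖h x‖ₑ ^ (2 : ℝ) := by
    refine sum_sq_le hd hXn hh fun k hk ξ hξ => ?_
    have hn := norm_pos_iff.2 hξ
    rw [(nice_phi.dil k).fourier_cv (tl_nice hκ hh b k), fourier_dil, norm_mul]
    have h3 := low_mult (d := d) (s := (2 : ℝ) ^ k * ‖ξ‖) (by positivity)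
      (norm_fourier_phi_le_one ((2 : ℝ) ^ k • ξ))
      (by have := norm_fourier_phi_le (d := d) (ξ := (2 : ℝ) ^ k • ξ) (smul_ne_zero (by positivity) hξ)
          rwa [norm_zpow_smul] at this) (norm_nonneg _) (sum_dec_low hn b k) (hsD b k ξ hξ)
    calc _ ≤ ‖𝓕 (phi d) ((2 : ℝ) ^ k • ξ)‖ *
          (D * (∑ i ∈ Finset.Ico b k, dec ((2 : ℝ) ^ i * ‖ξ‖)) * ‖𝓕 h ξ‖) :=
          mul_le_mul_of_nonneg_left (norm_fourier_tl_le hκ hh hD b k hξ) (norm_nonneg _)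
      _ = D * (‖𝓕 (phi d) ((2 : ℝ) ^ k • ξ)‖ *
          (∑ i ∈ Finset.Ico b k, dec ((2 : ℝ) ^ i * ‖ξ‖))) * ‖𝓕 h ξ‖ := by ring
      _ ≤ D * (c2 * dec ((2 : ℝ) ^ k * ‖ξ‖)) * ‖𝓕 h ξ‖ := by gcongr
      _ = _ := by ring
  have hIY : ∑ k ∈ Finset.Ico b l, ∫⁻ x, ‖Y k x‖ₑ ^ (2 : ℝ) ≤
      ENNReal.ofReal ((c2 * D) ^ 2 * (3 * gC)) * ∫⁻ x, ‖h x‖ₑ ^ (2 : ℝ) := by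
    refine sum_sq_le hd hYn hh fun k hk ξ hξ => ?_
    have hn := norm_pos_iff.2 hξ
    have h0 : 𝓕 (Y k) ξ = (1 - 𝓕 (phi d) ((2 : ℝ) ^ k • ξ)) * 𝓕 (tl κ h k l) ξ := by
      rw [hY, fourier_sub (tl_nice hκ hh k l) ((nice_phi.dil k).cv_nice (tl_nice hκ hh k l)),
        (nice_phi.dil k).fourier_cv (tl_nice hκ hh k l), fourier_dil]; ring
    rw [h0, norm_mul]
    have h3 := high_mult (d := d) (s := (2 : ℝ) ^ k * ‖ξ‖)
      (φ := ‖1 - 𝓕 (phi d) ((2 : ℝ) ^ k • ξ)‖) (by positivity)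
      (by
        refine (norm_sub_le _ _).trans ?_
        have := norm_fourier_phi_le_one (d := d) ((2 : ℝ) ^ k • ξ)
        rw [norm_one]; linarith)
      (by have := norm_fourier_phi_sub_one_le (d := d) ((2 : ℝ) ^ k • ξ)
          rwa [norm_zpow_smul, norm_sub_rev] at this) (norm_nonneg _)
      (sum_dec_high hn k l) (hsD k l ξ hξ)
    calc _ ≤ ‖1 - 𝓕 (phi d) ((2 : ℝ) ^ k • ξ)‖ *
          (D * (∑ i ∈ Finset.Ico k l, dec ((2 : ℝ) ^ i * ‖ξ‖)) * ‖𝓕 h ξ‖) :=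
          mul_le_mul_of_nonneg_left (norm_fourier_tl_le hκ hh hD k l hξ) (norm_nonneg _)
      _ = D * (‖1 - 𝓕 (phi d) ((2 : ℝ) ^ k • ξ)‖ *
          (∑ i ∈ Finset.Ico k l, dec ((2 : ℝ) ^ i * ‖ξ‖))) * ‖𝓕 h ξ‖ := by ring
      _ ≤ D * (c2 * dec ((2 : ℝ) ^ k * ‖ξ‖)) * ‖𝓕 h ξ‖ := by gcongr
      _ = _ := by ring
  have hIH : ∫⁻ x, (ENNReal.ofReal c1 * HLM (fun y => ‖T y‖ₑ) x) ^ (2 : ℝ) ≤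
      ENNReal.ofReal (c1 ^ 2 * (2 * (5 ^ d * 2 ^ (2 : ℝ)) * (3 * gC) ^ 2) * D ^ 2) *
        ∫⁻ x, ‖h x‖ₑ ^ (2 : ℝ) := by
    have := HLM_strong hd (hTn.1.enorm) (a := 2) (by norm_num)
    calc _ = ENNReal.ofReal (c1 ^ 2) * ∫⁻ x, HLM (fun y => ‖T y‖ₑ) x ^ (2 : ℝ) := by
          rw [← lintegral_const_mul' _ _ ofReal_ne_top]
          refine lintegral_congr fun x => ?_
          rw [mul_rpow_of_nonneg _ _ (by norm_num), ofReal_rpow_of_nonneg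
            (by positivity) (by norm_num), Real.rpow_two]
      _ ≤ ENNReal.ofReal (c1 ^ 2) * (ENNReal.ofReal (2 * (5 ^ d * 2 ^ (2 : ℝ))) *
          (ENNReal.ofReal ((D * (3 * gC)) ^ 2) * ∫⁻ x, ‖h x‖ₑ ^ (2 : ℝ))) := by
          refine mul_le_mul_right (this.trans ?_) _
          refine mul_le_mul' (le_of_eq ?_) hIT
          rw [ofReal_mul (by norm_num), ofReal_mul (by positivity),
            ofReal_pow (by norm_num), ← ofReal_rpow_of_pos (by norm_num)]
          norm_num
      _ = _ := by
          rw [← mul_assoc, ← mul_assoc, ← ofReal_mul (by positivity),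
            ← ofReal_mul (by positivity)]
          congr 2; ring
  have hmX : ∀ k ∈ Finset.Ico b l, Measurable fun x => ‖X k x‖ₑ ^ (2 : ℝ) :=
    fun k _ => (hXn k).1.enorm.pow_const _
  have hmY : ∀ k ∈ Finset.Ico b l, Measurable fun x => ‖Y k x‖ₑ ^ (2 : ℝ) :=
    fun k _ => (hYn k).1.enorm.pow_const _
  calc _ ≤ _ := lintegral_mono hpt
    _ = 4 * (∫⁻ x, (ENNReal.ofReal c1 * HLM (fun y => ‖T y‖ₑ) x) ^ (2 : ℝ)) +
        4 * (∑ k ∈ Finset.Ico b l, ∫⁻ x, ‖X k x‖ₑ ^ (2 : ℝ)) +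
        4 * (∑ k ∈ Finset.Ico b l, ∫⁻ x, ‖Y k x‖ₑ ^ (2 : ℝ)) := by
      rw [lintegral_add_right _ ((Finset.measurable_sum _ hmY).const_mul _),
        lintegral_add_right _ ((Finset.measurable_sum _ hmX).const_mul _),
        lintegral_const_mul' _ _ (by norm_num), lintegral_const_mul' _ _ (by norm_num),
        lintegral_const_mul' _ _ (by norm_num), lintegral_finsetSum _ hmX,
        lintegral_finsetSum _ hmY]
    _ ≤ 4 * (ENNReal.ofReal (c1 ^ 2 * (2 * (5 ^ d * 2 ^ (2 : ℝ)) * (3 * gC) ^ 2) * D ^ 2) *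
        (∫⁻ x, ‖h x‖ₑ ^ (2 : ℝ))) +
        4 * (ENNReal.ofReal ((c2 * D) ^ 2 * (3 * gC)) * ∫⁻ x, ‖h x‖ₑ ^ (2 : ℝ)) +
        4 * (ENNReal.ofReal ((c2 * D) ^ 2 * (3 * gC)) * ∫⁻ x, ‖h x‖ₑ ^ (2 : ℝ)) := by
      gcongr
    _ = ENNReal.ofReal (C * D ^ 2) * ∫⁻ x, ‖h x‖ₑ ^ (2 : ℝ) := by
      rw [← mul_assoc, ← mul_assoc 4 (ENNReal.ofReal ((c2 * D) ^ 2 * (3 * gC))), ← add_mul, ← add_mul,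
        show (4 : ℝ≥0∞) = ENNReal.ofReal 4 by norm_num, ← ofReal_mul (by norm_num),
        ← ofReal_mul (by norm_num), ← ofReal_add (by positivity) (by positivity),
        ← ofReal_add (by positivity) (by positivity)]
      congr 2; rw [hC]; ring
    _ ≤ _ := mul_le_mul_left (ofReal_le_ofReal
        (mul_le_mul_of_nonneg_right (le_max_left _ _) (by positivity))) _

/-- Kernels supported in a fixed ball, with size bound `A` and Lipschitz constant `A 2^N`. -/
structure Ker (κ : Rd d → ℂ) (A : ℝ) (N : ℕ) : Prop where
  meas : Measurable κ
  supp : ∀ x, 4 < ‖x‖ → κ x = 0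
  bdd : ∀ x, ‖κ x‖ ≤ A
  lip : ∀ x y, ‖κ x - κ y‖ ≤ A * 2 ^ N * ‖x - y‖

lemma Ker.nice {κ : Rd d → ℂ} {A : ℝ} {N : ℕ} (hκ : Ker κ A N) : Nice κ :=
  ⟨hκ.meas, ⟨A, hκ.bdd⟩, 4, hκ.supp⟩

lemma Ker.nonneg {κ : Rd d → ℂ} {A : ℝ} {N : ℕ} (hκ : Ker κ A N) : 0 ≤ A :=
  (norm_nonneg _).trans (hκ.bdd 0)

/-- The weights appearing in the regularity estimate at scale `s`. -/
def hw (N : ℕ) (s : ℝ) (i : ℤ) : ℝ :=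
  if s ≤ 4 * (2 : ℝ) ^ i then min 1 (2 ^ N * s * (2 : ℝ) ^ (-i)) else 0

lemma hw_nonneg {N : ℕ} {s : ℝ} (hs : 0 < s) (i : ℤ) : 0 ≤ hw N s i := by
  rw [hw]; split_ifs <;> positivity

lemma sum_hw_le (N : ℕ) {s : ℝ} (hs : 0 < s) (b l : ℤ) :
    ∑ i ∈ Finset.Ico b l, hw N s i ≤ N + 5 := by
  obtain ⟨m, h1, h2⟩ := exists_mem_Ico_zpow (x := s) (y := 2) hs one_lt_two
  have hz : ∀ i : ℤ, i < m - 2 → hw N s i = 0 := by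
    intro i hi
    rw [hw, if_neg]
    push Not
    refine lt_of_lt_of_le ?_ h1
    rw [show (4 : ℝ) = 2 ^ (2 : ℤ) by norm_num, ← zpow_add₀ two_ne_zero]
    exact zpow_lt_zpow_right₀ one_lt_two (by omega)
  set l' := max l (m + N + 1) with hl'
  have hsub : ∑ i ∈ Finset.Ico b l, hw N s i ≤
      ∑ i ∈ Finset.Ico (m - 2) (m + N + 1) ∪ Finset.Ico (m + N + 1) l', hw N s i := by
    rw [← Finset.sum_filter_add_sum_filter_not (Finset.Ico b l) (fun i => i < m - 2),
      Finset.sum_eq_zero (s := (Finset.Ico b l).filter (fun i => i < m - 2))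
      (fun i hi => hz i (Finset.mem_filter.1 hi).2), zero_add]
    refine Finset.sum_le_sum_of_subset_of_nonneg (fun i hi => ?_) fun i _ _ => hw_nonneg hs i
    simp only [Finset.mem_filter, Finset.mem_Ico, Finset.mem_union] at hi ⊢
    omega
  rw [Finset.sum_union (Finset.disjoint_left.2 fun i hi hi' => by
    simp only [Finset.mem_Ico] at hi hi'; omega)] at hsub
  refine hsub.trans ?_
  have hA : ∑ i ∈ Finset.Ico (m - 2) (m + N + 1), hw N s i ≤ N + 3 := by
    refine (Finset.sum_le_card_nsmul _ _ 1 fun i _ => ?_).trans ?_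
    · rw [hw]; split_ifs
      · exact min_le_left _ _
      · exact zero_le_one
    · rw [Int.card_Ico, nsmul_eq_mul, mul_one]
      have : (m + N + 1 - (m - 2)).toNat = N + 3 := by omega
      rw [this]; push_cast; rfl
  have hB : ∑ i ∈ Finset.Ico (m + N + 1) l', hw N s i ≤ 2 := by
    calc ∑ i ∈ Finset.Ico (m + N + 1) l', hw N s i
        ≤ ∑ i ∈ Finset.Ico (m + N + 1) l', (2 : ℝ) ^ (m + N + 1) * (1 / 2 : ℝ) ^ i := by
          refine Finset.sum_le_sum fun i _ => ?_
          have h3 : 2 ^ N * s * (2 : ℝ) ^ (-i) ≤ (2 : ℝ) ^ (m + N + 1) * (1 / 2 : ℝ) ^ i := by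
            rw [one_div, inv_zpow, ← zpow_neg, show m + N + 1 = (N : ℤ) + (m + 1) by ring,
              zpow_add₀ two_ne_zero, zpow_natCast]
            gcongr
          rw [hw]; split_ifs
          · exact (min_le_right _ _).trans h3
          · positivity
      _ = (2 : ℝ) ^ (m + N + 1) * (((1 / 2 : ℝ) ^ l' - (1 / 2) ^ (m + N + 1)) / (1 / 2 - 1)) := by
          rw [← Finset.mul_sum, sum_zpow_Ico (by norm_num) (by norm_num) (le_max_right _ _)]
      _ ≤ 2 := by
          have h4 : (2 : ℝ) ^ (m + N + 1) * (1 / 2) ^ (m + N + 1) = 1 := by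
            rw [← mul_zpow]; norm_num
          have h5 : 0 ≤ (2 : ℝ) ^ (m + N + 1) * (1 / 2) ^ l' := by positivity
          have : (2 : ℝ) ^ (m + N + 1) * (((1 / 2 : ℝ) ^ l' - (1 / 2) ^ (m + N + 1)) / (1 / 2 - 1)) =
            2 * ((2 : ℝ) ^ (m + N + 1) * (1 / 2) ^ (m + N + 1)) -
            2 * ((2 : ℝ) ^ (m + N + 1) * (1 / 2) ^ l') := by ring
          rw [this, h4]; linarith
  linarith

/-- Pointwise regularity of the dilated kernels away from the origin. -/
lemma Ker.dil_sub_le {κ : Rd d → ℂ} {A : ℝ} {N : ℕ} (hκ : Ker κ A N) (hd : 1 ≤ d) {s : ℝ}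
    (hs : 0 < s) {u u' : Rd d} (hu : s ≤ ‖u‖) (hu' : s ≤ ‖u'‖) (huu : ‖u - u'‖ ≤ d * s) (i : ℤ) :
    ‖dil i κ u - dil i κ u'‖ ≤ (closedBall (0 : Rd d) ((4 + 4 * d) * (2 : ℝ) ^ i)).indicator
      (fun _ => 2 * d * A * ((2 : ℝ) ^ (-i)) ^ d * hw N s i) u := by
  have hd' : (1 : ℝ) ≤ d := by exact_mod_cast hd
  have hA := hκ.nonneg
  have h2 : (0 : ℝ) < 2 ^ i := by positivity
  have h2' : (0 : ℝ) < 2 ^ (-i) := by positivity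
  by_cases hsi : s ≤ 4 * (2 : ℝ) ^ i
  · by_cases hub : u ∈ closedBall (0 : Rd d) ((4 + 4 * d) * (2 : ℝ) ^ i)
    · rw [indicator_of_mem hub, hw, if_pos hsi, mul_min_of_nonneg _ _ (by positivity)]
      refine le_min ?_ ?_
      · refine (norm_sub_le _ _).trans ((add_le_add (norm_dil_le hκ.bdd i u)
          (norm_dil_le hκ.bdd i u')).trans ?_)
        have : 0 ≤ ((2 : ℝ) ^ (-i)) ^ d * A := by positivity
        nlinarith
      · have h3 : ‖dil i κ u - dil i κ u'‖ ≤ ((2 : ℝ) ^ (-i)) ^ d * (A * 2 ^ N * ((2 : ℝ) ^ (-i) * (d * s))) := by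
          rw [dil, dil, ← mul_sub, norm_mul, Complex.norm_real, Real.norm_of_nonneg (by positivity)]
          refine mul_le_mul_of_nonneg_left ((hκ.lip _ _).trans ?_) (by positivity)
          rw [← smul_sub, norm_zpow_smul]
          gcongr
        refine h3.trans ?_
        have h0 : 0 ≤ ((2 : ℝ) ^ (-i)) ^ d * (A * 2 ^ N * ((2 : ℝ) ^ (-i) * (d * s))) := by positivity
        nlinarith
    · rw [indicator_of_notMem hub]
      have h4 : (4 + 4 * d) * (2 : ℝ) ^ i < ‖u‖ := by simpa using hub
      have h5 : 4 * (2 : ℝ) ^ i < ‖u'‖ := by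
        have h6 := norm_sub_norm_le u u'
        have h7 : d * s ≤ d * (4 * (2 : ℝ) ^ i) := mul_le_mul_of_nonneg_left hsi (by positivity)
        nlinarith
      have h8 : 4 * (2 : ℝ) ^ i < ‖u‖ := by nlinarith
      rw [dil_eq_zero hκ.supp i h5, dil_eq_zero hκ.supp i h8]; simp
  · push Not at hsi
    rw [dil_eq_zero hκ.supp i (hsi.trans_le hu), dil_eq_zero hκ.supp i (hsi.trans_le hu')]
    simp only [sub_zero, norm_zero]
    refine indicator_nonneg (fun _ _ => ?_) _
    have := hw_nonneg (N := N) hs i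
    positivity

/-- The constant in the regularity estimates. -/
def cH (d : ℕ) (A : ℝ) : ℝ := 2 * d * A * (2 * (4 + 4 * d)) ^ d

lemma scale_const (A : ℝ) (i : ℤ) (w : ℝ) :
    2 * d * A * ((2 : ℝ) ^ (-i)) ^ d * w * (2 * ((4 + 4 * d) * (2 : ℝ) ^ i)) ^ d = cH d A * w := by
  have h1 : ((2 : ℝ) ^ (-i)) ^ d * (2 ^ i) ^ d = 1 := by
    rw [← mul_pow, zpow_neg, inv_mul_cancel₀ (by positivity), one_pow]
  rw [cH, ← mul_assoc 2, mul_pow _ ((2 : ℝ) ^ i)]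
  linear_combination (2 * d * A * w * (2 * (4 + 4 * (d : ℝ))) ^ d) * h1

/-- Hörmander's condition for the family of dilates, uniformly in the window. -/
lemma Ker.hormander {κ : Rd d → ℂ} {A : ℝ} {N : ℕ} (hκ : Ker κ A N) (hd : 1 ≤ d) {P : Cube d}
    {y y' : Rd d} (hy : y ∈ P.set) (hy' : y' ∈ P.set) (b l : ℤ) :
    ∫⁻ x in (tri P).setᶜ, ∑ i ∈ Finset.Ico b l, ‖dil i κ (x - y) - dil i κ (x - y')‖ₑ ≤
      ENNReal.ofReal (cH d A * (N + 5)) := by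
  have hs := P.side_pos
  have hA := hκ.nonneg
  have hm : ∀ i, Measurable fun x => ‖dil i κ (x - y) - dil i κ (x - y')‖ₑ := fun i =>
    (((hκ.nice.dil i).1.comp (measurable_id.sub_const y)).sub
      ((hκ.nice.dil i).1.comp (measurable_id.sub_const y'))).enorm
  rw [lintegral_finsetSum _ fun i _ => hm i]
  calc ∑ i ∈ Finset.Ico b l, ∫⁻ x in (tri P).setᶜ, ‖dil i κ (x - y) - dil i κ (x - y')‖ₑ
      ≤ ∑ i ∈ Finset.Ico b l, ENNReal.ofReal (cH d A * hw N P.side i) := by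
        refine Finset.sum_le_sum fun i _ => ?_
        have hr : (0 : ℝ) < (4 + 4 * d) * (2 : ℝ) ^ i := by positivity
        have hw0 := hw_nonneg (N := N) hs i
        calc ∫⁻ x in (tri P).setᶜ, ‖dil i κ (x - y) - dil i κ (x - y')‖ₑ
            ≤ ∫⁻ x in (tri P).setᶜ, (closedBall y ((4 + 4 * d) * (2 : ℝ) ^ i)).indicator
              (fun _ => ENNReal.ofReal (2 * d * A * ((2 : ℝ) ^ (-i)) ^ d * hw N P.side i)) x := by
              refine setLIntegral_mono' (measurableSet_set _).compl fun x hx => ?_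
              have h := hκ.dil_sub_le hd hs (u := x - y) (u' := x - y')
                (by rw [norm_sub_rev]; exact side_le_of_notMem_tri hy hx)
                (by rw [norm_sub_rev]; exact side_le_of_notMem_tri hy' hx)
                (by
                  rw [show x - y - (x - y') = y' - y by abel]; exact dist_le_of_mem_set hy' hy) i
              rw [← ofReal_norm]
              by_cases hxb : x ∈ closedBall y ((4 + 4 * d) * (2 : ℝ) ^ i)
              · rw [indicator_of_mem (by simpa [dist_eq_norm] using hxb)] at h
                rw [indicator_of_mem hxb]
                exact ofReal_le_ofReal h
              · rw [indicator_of_notMem (by simpa [dist_eq_norm] using hxb)] at h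
                rw [indicator_of_notMem hxb, ofReal_of_nonpos h]
          _ ≤ ∫⁻ x, (closedBall y ((4 + 4 * d) * (2 : ℝ) ^ i)).indicator
              (fun _ => ENNReal.ofReal (2 * d * A * ((2 : ℝ) ^ (-i)) ^ d * hw N P.side i)) x :=
              setLIntegral_le_lintegral _ _
          _ ≤ ENNReal.ofReal (2 * d * A * ((2 : ℝ) ^ (-i)) ^ d * hw N P.side i) *
              ENNReal.ofReal (2 * ((4 + 4 * d) * (2 : ℝ) ^ i)) ^ d := by
              rw [lintegral_indicator isClosed_closedBall.measurableSet, setLIntegral_const]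
              exact mul_le_mul_right (volume_closedBall_le _ _ hr) _
          _ = _ := by
              rw [← ofReal_pow (by positivity), ← ofReal_mul (by positivity),
                scale_const]
    _ = ENNReal.ofReal (cH d A * ∑ i ∈ Finset.Ico b l, hw N P.side i) := by
        have hc : 0 ≤ cH d A := by unfold cH; positivity
        rw [Finset.mul_sum, ofReal_sum_of_nonneg fun i _ =>
          mul_nonneg hc (hw_nonneg hs i)]
    _ ≤ _ := by
        have hc : 0 ≤ cH d A := by unfold cH; positivity
        exact ofReal_le_ofReal (mul_le_mul_of_nonneg_left (sum_hw_le N hs b l) hc)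

/-- Oscillation on a cube of the part of `∑ κ_i * f` coming from away from the cube. -/
lemma Ker.oscillation {κ : Rd d → ℂ} {A : ℝ} {N : ℕ} (hκ : Ker κ A N) (hd : 1 ≤ d) {P : Cube d}
    {x x' z : Rd d} (hx : x ∈ P.set) (hx' : x' ∈ P.set) (hz : z ∈ P.set) {f : Rd d → ℂ}
    (hf : Nice f) (hfP : ∀ y ∈ (tri P).set, f y = 0) (k l : ℤ) :
    ‖tl κ f k l x - tl κ f k l x'‖ₑ ≤
      ENNReal.ofReal (cH d A * (N + 5)) * HLM (fun y => ‖f y‖ₑ) z := by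
  have hs := P.side_pos
  have hA := hκ.nonneg
  have hc : 0 ≤ cH d A := by unfold cH; positivity
  have hone : ∀ i : ℤ, ‖cv (dil i κ) f x - cv (dil i κ) f x'‖ₑ ≤
      ENNReal.ofReal (cH d A * hw N P.side i) * HLM (fun y => ‖f y‖ₑ) z := by
    intro i
    have hr : (0 : ℝ) < (4 + 4 * d) * (2 : ℝ) ^ i := by positivity
    have hw0 := hw_nonneg (N := N) hs i
    set Q := cubeAt x ((4 + 4 * d) * (2 : ℝ) ^ i) hr with hQ
    rw [cv, cv, ← integral_sub ((hκ.nice.dil i).integrable_cv hf x)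
      ((hκ.nice.dil i).integrable_cv hf x')]
    refine (enorm_integral_le_lintegral_enorm _).trans ?_
    calc ∫⁻ y, ‖f y * dil i κ (x - y) - f y * dil i κ (x' - y)‖ₑ
        ≤ ∫⁻ y, Q.set.indicator (fun y => ENNReal.ofReal
            (2 * d * A * ((2 : ℝ) ^ (-i)) ^ d * hw N P.side i) * ‖f y‖ₑ) y := by
          refine lintegral_mono fun y => ?_
          by_cases hyP : y ∈ (tri P).set
          · simp [hfP y hyP]
          rw [← mul_sub, enorm_mul]
          have h := hκ.dil_sub_le hd hs (u := x - y) (u' := x' - y)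
            (side_le_of_notMem_tri hx hyP) (side_le_of_notMem_tri hx' hyP)
            (by rw [sub_sub_sub_cancel_right]; exact dist_le_of_mem_set hx hx') i
          by_cases hyb : x - y ∈ closedBall (0 : Rd d) ((4 + 4 * d) * (2 : ℝ) ^ i)
          · rw [indicator_of_mem hyb] at h
            rw [indicator_of_mem (closedBall_subset_cubeAt _ _ _ (by
              rw [mem_closedBall_iff_norm, norm_sub_rev]; simpa using hyb)), mul_comm]
            refine mul_le_mul_left ?_ _
            rw [← ofReal_norm]; exact ofReal_le_ofReal h
          · rw [indicator_of_notMem hyb] at h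
            rw [norm_le_zero_iff.1 h]; simp
      _ = ENNReal.ofReal (2 * d * A * ((2 : ℝ) ^ (-i)) ^ d * hw N P.side i) *
            ∫⁻ y in Q.set, ‖f y‖ₑ := by
          rw [lintegral_indicator (measurableSet_set Q), lintegral_const_mul' _ _ ofReal_ne_top]
      _ = ENNReal.ofReal (cH d A * hw N P.side i) * ((qvol Q)⁻¹ * ∫⁻ y in Q.set, ‖f y‖ₑ) := by
          rw [← scale_const, ofReal_mul (by positivity) (q := (2 * ((4 + 4 * d) * (2 : ℝ) ^ i)) ^ d),
            ofReal_pow (by positivity), ← qvol_cubeAt x _ hr, ← hQ,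
            mul_assoc (ENNReal.ofReal _) (qvol Q), ← mul_assoc (qvol Q), ENNReal.mul_inv_cancel (qvol_ne_zero Q) (qvol_ne_top Q), one_mul]
      _ ≤ ENNReal.ofReal (cH d A * hw N P.side i) * HLM (fun y => ‖f y‖ₑ) z := by
          by_cases hsi : P.side ≤ 4 * (2 : ℝ) ^ i
          · refine mul_le_mul_right (avg_le_HLM _ (closedBall_subset_cubeAt _ _ _ ?_)) _
            rw [mem_closedBall_iff_norm]
            refine (dist_le_of_mem_set hz hx).trans ?_
            have : d * P.side ≤ d * (4 * (2 : ℝ) ^ i) := mul_le_mul_of_nonneg_left hsi (by positivity)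
            have : (0 : ℝ) < 2 ^ i := by positivity
            nlinarith
          · simp [hw, hsi]
  rw [tl, tl, ← Finset.sum_sub_distrib]
  calc _ ≤ ∑ i ∈ Finset.Ico k l, ‖cv (dil i κ) f x - cv (dil i κ) f x'‖ₑ := enorm_sum_le _ _
    _ ≤ ∑ i ∈ Finset.Ico k l, ENNReal.ofReal (cH d A * hw N P.side i) * HLM (fun y => ‖f y‖ₑ) z :=
        Finset.sum_le_sum fun i _ => hone i
    _ = ENNReal.ofReal (cH d A * ∑ i ∈ Finset.Ico k l, hw N P.side i) * HLM (fun y => ‖f y‖ₑ) z := by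
        rw [← Finset.sum_mul, Finset.mul_sum, ofReal_sum_of_nonneg fun i _ =>
          mul_nonneg hc (hw_nonneg hs i)]
    _ ≤ _ := mul_le_mul_left (ofReal_le_ofReal
        (mul_le_mul_of_nonneg_left (sum_hw_le N hs k l) hc)) _

lemma tl_sum {ι : Type*} (s : Finset ι) {κ : Rd d → ℂ} {f : ι → Rd d → ℂ} (hκ : Nice κ)
    (hf : ∀ j ∈ s, Nice (f j)) (k l : ℤ) (x : Rd d) :
    tl κ (fun y => ∑ j ∈ s, f j y) k l x = ∑ j ∈ s, tl κ (f j) k l x := by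
  simp only [tl]
  rw [Finset.sum_comm]
  exact Finset.sum_congr rfl fun i _ => cv_sum_right s (hκ.dil i) hf x

lemma mx_sum_le {ι : Type*} (s : Finset ι) {κ : Rd d → ℂ} {f : ι → Rd d → ℂ} (hκ : Nice κ)
    (hf : ∀ j ∈ s, Nice (f j)) (b l : ℤ) (x : Rd d) :
    mx κ b l (fun y => ∑ j ∈ s, f j y) x ≤ ∑ j ∈ s, mx κ b l (f j) x := by
  refine iSup₂_le fun k hk => ?_
  rw [tl_sum s hκ hf]
  refine (enorm_sum_le _ _).trans (Finset.sum_le_sum fun j _ => ?_)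
  exact le_iSup₂_of_le k hk le_rfl

lemma mx_add_le {κ f g : Rd d → ℂ} (hκ : Nice κ) (hf : Nice f) (hg : Nice g) (b l : ℤ) (x : Rd d) :
    mx κ b l (fun y => f y + g y) x ≤ mx κ b l f x + mx κ b l g x := by
  refine iSup₂_le fun k hk => ?_
  have : tl κ (fun y => f y + g y) k l x = tl κ f k l x + tl κ g k l x := by
    simp only [tl]
    rw [← Finset.sum_add_distrib]
    exact Finset.sum_congr rfl fun i _ => cv_add_right (hκ.dil i) hf hg x
  rw [this]
  exact (enorm_add_le _ _).trans (add_le_add (le_iSup₂_of_le k hk le_rfl)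
    (le_iSup₂_of_le k hk le_rfl))

lemma mx_le_sum {κ : Rd d → ℂ} (f : Rd d → ℂ) (b l : ℤ) (x : Rd d) :
    mx κ b l f x ≤ ∑ i ∈ Finset.Ico b l, ‖cv (dil i κ) f x‖ₑ := by
  refine iSup₂_le fun k hk => (enorm_sum_le _ _).trans ?_
  exact Finset.sum_le_sum_of_subset (Finset.Ico_subset_Ico_left hk)

lemma mx_zero {κ f : Rd d → ℂ} (hf : ∀ x, f x = 0) (b l : ℤ) (x : Rd d) :
    mx κ b l f x = 0 := by
  simp [mx, tl, cv, hf]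

/-- Away from the triple of a cube, the maximal operator is controlled on mean zero functions. -/
lemma Ker.lintegral_mx_atom_le {κ : Rd d → ℂ} {A : ℝ} {N : ℕ} (hκ : Ker κ A N) (hd : 1 ≤ d)
    {P : Cube d} {f : Rd d → ℂ} (hf : Nice f) (hfP : ∀ x ∉ P.set, f x = 0) (h0 : ∫ x, f x = 0)
    (b l : ℤ) :
    ∫⁻ x in (tri P).setᶜ, mx κ b l f x ≤
      ENNReal.ofReal (cH d A * (N + 5)) * ∫⁻ x, ‖f x‖ₑ := by
  have hcP : P.corner ∈ P.set := fun i => ⟨le_rfl, by linarith [P.side_pos]⟩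
  have hm : ∀ i, Measurable fun z : Rd d × Rd d =>
      ‖f z.2‖ₑ * ‖dil i κ (z.1 - z.2) - dil i κ (z.1 - P.corner)‖ₑ := fun i =>
    (hf.1.comp measurable_snd).enorm.mul
      (((hκ.nice.dil i).1.comp (measurable_fst.sub measurable_snd)).sub
      ((hκ.nice.dil i).1.comp (measurable_fst.sub_const _))).enorm
  have hone : ∀ i x, ‖cv (dil i κ) f x‖ₑ ≤
      ∫⁻ y, ‖f y‖ₑ * ‖dil i κ (x - y) - dil i κ (x - P.corner)‖ₑ := by
    intro i x
    have : cv (dil i κ) f x = ∫ y, f y * (dil i κ (x - y) - dil i κ (x - P.corner)) := by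
      simp only [mul_sub]
      rw [integral_sub ((hκ.nice.dil i).integrable_cv hf x) (hf.integrable.mul_const _),
        integral_mul_const, h0, zero_mul, sub_zero, cv]
    rw [this]
    refine (enorm_integral_le_lintegral_enorm _).trans (le_of_eq ?_)
    exact lintegral_congr fun y => enorm_mul _ _
  calc ∫⁻ x in (tri P).setᶜ, mx κ b l f x
      ≤ ∫⁻ x in (tri P).setᶜ, ∑ i ∈ Finset.Ico b l,
          ∫⁻ y, ‖f y‖ₑ * ‖dil i κ (x - y) - dil i κ (x - P.corner)‖ₑ :=
        lintegral_mono fun x => (mx_le_sum f b l x).trans (Finset.sum_le_sum fun i _ => hone i x)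
    _ = ∫⁻ x in (tri P).setᶜ, ∫⁻ y, ∑ i ∈ Finset.Ico b l,
          ‖f y‖ₑ * ‖dil i κ (x - y) - dil i κ (x - P.corner)‖ₑ := by
        refine lintegral_congr fun x => (lintegral_finsetSum _ fun i _ => ?_).symm
        exact (hm i).comp measurable_prodMk_left
    _ = ∫⁻ y, ∫⁻ x in (tri P).setᶜ, ∑ i ∈ Finset.Ico b l,
          ‖f y‖ₑ * ‖dil i κ (x - y) - dil i κ (x - P.corner)‖ₑ := by
        refine lintegral_lintegral_swap (Measurable.aemeasurable ?_)
        exact Finset.measurable_fun_sum _ fun i _ => hm i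
    _ ≤ ∫⁻ y, ENNReal.ofReal (cH d A * (N + 5)) * ‖f y‖ₑ := by
        refine lintegral_mono fun y => ?_
        by_cases hy : y ∈ P.set
        · simp only [← Finset.mul_sum]
          rw [lintegral_const_mul' _ _ enorm_ne_top, mul_comm]
          exact mul_le_mul_left (hκ.hormander hd hy hcP b l) _
        · simp [hfP y hy]
    _ = _ := lintegral_const_mul' _ _ ofReal_ne_top

/-- The average of `h` over the cube `c`, as a function supported on the cube. -/
def avgOn (h : Rd d → ℂ) (c : Cube d) : Rd d → ℂ :=
  (hset c).indicator fun _ => ((c.side ^ d)⁻¹ : ℝ) * ∫ y in hset c, h y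

lemma nice_indicator_hset (c : Cube d) (a : ℂ) : Nice ((hset c).indicator fun _ => a) := by
  refine ⟨measurable_const.indicator (measurableSet_hset c), ⟨‖a‖, fun x => ?_⟩, ?_⟩
  · by_cases hx : x ∈ hset c <;> simp [hx]
  · refine ⟨‖c.corner‖ + d * c.side, fun x hx => indicator_of_notMem (fun hxc => ?_) _⟩
    have h1 : c.corner ∈ c.set := fun i => ⟨le_rfl, by linarith [c.side_pos]⟩
    have h2 := dist_le_of_mem_set (hset_subset_set c hxc) h1
    have h3 := norm_sub_norm_le x c.corner
    linarith

lemma enorm_avg_le (h : Rd d → ℂ) (c : Cube d) :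
    ‖((c.side ^ d)⁻¹ : ℝ) * ∫ y in hset c, h y‖ₑ ≤ (qvol c)⁻¹ * ∫⁻ y in hset c, ‖h y‖ₑ := by
  have hs := c.side_pos
  rw [enorm_mul]
  refine mul_le_mul' (le_of_eq ?_) (enorm_integral_le_lintegral_enorm _)
  rw [← ofReal_norm, Complex.norm_real, Real.norm_of_nonneg (by positivity),
    ofReal_inv_of_pos (by positivity), ofReal_pow hs.le, qvol]

lemma lintegral_avgOn_le (h : Rd d → ℂ) (c : Cube d) :
    ∫⁻ x, ‖avgOn h c x‖ₑ ≤ ∫⁻ y in hset c, ‖h y‖ₑ := by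
  calc ∫⁻ x, ‖avgOn h c x‖ₑ
      = ∫⁻ x, (hset c).indicator (fun _ => ‖((c.side ^ d)⁻¹ : ℝ) * ∫ y in hset c, h y‖ₑ) x := by
        refine lintegral_congr fun x => ?_
        rw [avgOn, enorm_indicator_eq_indicator_enorm]
    _ ≤ ((qvol c)⁻¹ * ∫⁻ y in hset c, ‖h y‖ₑ) * qvol c := by
        rw [lintegral_indicator (measurableSet_hset c), setLIntegral_const, volume_hset]
        exact mul_le_mul_left (enorm_avg_le h c) _
    _ = _ := by
        rw [mul_comm, ← mul_assoc, ENNReal.mul_inv_cancel (qvol_ne_zero c) (qvol_ne_top c), one_mul]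

lemma lintegral_sq_avgOn_le (h : Rd d → ℂ) (c : Cube d) {L : ℝ≥0∞}
    (hL : ∫⁻ y in hset c, ‖h y‖ₑ ≤ L * qvol c) :
    ∫⁻ x in hset c, ‖avgOn h c x‖ₑ ^ (2 : ℝ) ≤ L * ∫⁻ y in hset c, ‖h y‖ₑ := by
  have h1 : ∀ x, ‖avgOn h c x‖ₑ ≤ L := by
    intro x
    by_cases hx : x ∈ hset c
    · rw [avgOn, indicator_of_mem hx]
      refine (enorm_avg_le h c).trans ?_
      rw [mul_comm, ← div_eq_mul_inv]
      exact div_le_of_le_mul hL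
    · simp [avgOn, hx]
  calc ∫⁻ x in hset c, ‖avgOn h c x‖ₑ ^ (2 : ℝ) ≤ ∫⁻ x, ‖avgOn h c x‖ₑ ^ (2 : ℝ) :=
        setLIntegral_le_lintegral _ _
    _ ≤ ∫⁻ x, L * ‖avgOn h c x‖ₑ := by
        refine lintegral_mono fun x => ?_
        rw [rpow_two, sq]
        exact mul_le_mul_left (h1 x) _
    _ = L * ∫⁻ x, ‖avgOn h c x‖ₑ := lintegral_const_mul _
        (measurable_const.indicator (measurableSet_hset c)).enorm
    _ ≤ _ := mul_le_mul_right (lintegral_avgOn_le h c) _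

lemma integral_indicator_sub_avgOn {h : Rd d → ℂ} (hh : Nice h) (c : Cube d) :
    ∫ x, ((hset c).indicator h x - avgOn h c x) = 0 := by
  have hs := c.side_pos
  unfold avgOn
  rw [integral_sub (hh.indicator (measurableSet_hset c)).integrable
    (nice_indicator_hset c _).integrable, integral_indicator (measurableSet_hset c)]
  rw [integral_indicator (measurableSet_hset c), setIntegral_const, measureReal_def,
    volume_hset, qvol, toReal_pow, toReal_ofReal hs.le, Complex.real_smul,
    ← mul_assoc, ← Complex.ofReal_mul, mul_inv_cancel₀ (by positivity)]
  simp

/-- The Calderón–Zygmund decomposition run for `k` generations inside a cube. -/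
lemma Ker.calderonZygmund {κ : Rd d → ℂ} {A : ℝ} {N : ℕ} (hκ : Ker κ A N) (hd : 1 ≤ d)
    (b l : ℤ) {h : Rd d → ℂ} (hh : Nice h) (L : ℝ≥0∞) (k : ℕ) :
    ∀ R : Cube d, ∫⁻ x in hset R, ‖h x‖ₑ ≤ L * qvol R →
    ∃ (g : Rd d → ℂ) (E U : Set (Rd d)), Nice g ∧ MeasurableSet E ∧ MeasurableSet U ∧
      (∀ x ∉ hset R, g x = 0) ∧ U ⊆ hset R ∧
      L * volume E ≤ 3 ^ d * ∫⁻ x in hset R, ‖h x‖ₑ ∧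
      ∫⁻ x in Eᶜ, mx κ b l (fun y => (hset R).indicator h y - g y) x ≤
        ENNReal.ofReal (cH d A * (N + 5)) * (2 * ∫⁻ x in hset R, ‖h x‖ₑ) ∧
      ∫⁻ x in hset R, ‖g x‖ₑ ^ (2 : ℝ) ≤ 2 ^ d * L * (∫⁻ x in hset R, ‖h x‖ₑ) +
        ∫⁻ x in U, ‖h x‖ₑ ^ (2 : ℝ) ∧
      ∀ x ∈ U, ∃ Q : Cube d, x ∈ Q.set ∧ Q.side = R.side * (1 / 2) ^ k ∧
        ∫⁻ y in Q.set, ‖h y‖ₑ ≤ L * qvol Q := by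
  induction k with
  | zero =>
    intro R hR
    refine ⟨(hset R).indicator h, ∅, hset R, hh.indicator (measurableSet_hset R),
      MeasurableSet.empty, measurableSet_hset R, fun x hx => indicator_of_notMem hx _,
      subset_rfl, by simp, ?_, ?_, fun x hx => ⟨R, hset_subset_set R hx, by simp, ?_⟩⟩
    · rw [lintegral_congr fun x => mx_zero (κ := κ) (fun y => sub_self _) b l x]
      simp
    · refine le_add_left (le_of_eq ?_)
      refine setLIntegral_congr_fun (measurableSet_hset R) fun x hx => ?_
      simp only [indicator_of_mem hx]
    · rwa [← lintegral_hset]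
  | succ k ih =>
    intro R hR
    have hchild : ∀ ε : Fin d → Bool, ∃ (g : Rd d → ℂ) (E U : Set (Rd d)), Nice g ∧
        MeasurableSet E ∧ MeasurableSet U ∧
        (∀ x ∉ hset (child R ε), g x = 0) ∧ U ⊆ hset (child R ε) ∧
        L * volume E ≤ 3 ^ d * ∫⁻ x in hset (child R ε), ‖h x‖ₑ ∧
        ∫⁻ x in Eᶜ, mx κ b l (fun y => (hset (child R ε)).indicator h y - g y) x ≤
          ENNReal.ofReal (cH d A * (N + 5)) * (2 * ∫⁻ x in hset (child R ε), ‖h x‖ₑ) ∧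
        ∫⁻ x in hset (child R ε), ‖g x‖ₑ ^ (2 : ℝ) ≤
          2 ^ d * L * (∫⁻ x in hset (child R ε), ‖h x‖ₑ) + ∫⁻ x in U, ‖h x‖ₑ ^ (2 : ℝ) ∧
        ∀ x ∈ U, ∃ Q : Cube d, x ∈ Q.set ∧ Q.side = R.side * (1 / 2) ^ (k + 1) ∧
          ∫⁻ y in Q.set, ‖h y‖ₑ ≤ L * qvol Q := by
      intro ε
      set c := child R ε with hc
      by_cases hgood : ∫⁻ x in hset c, ‖h x‖ₑ ≤ L * qvol c
      · obtain ⟨g, E, U, h1, h2, h3, h4, h5, h6, h7, h8, h9⟩ := ih c hgood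
        refine ⟨g, E, U, h1, h2, h3, h4, h5, h6, h7, h8, fun x hx => ?_⟩
        obtain ⟨Q, hQ1, hQ2, hQ3⟩ := h9 x hx
        refine ⟨Q, hQ1, ?_, hQ3⟩
        rw [hQ2, hc, child_side, pow_succ]; ring
      · push Not at hgood
        refine ⟨avgOn h c, (tri c).set, ∅, nice_indicator_hset c _, measurableSet_set _,
          MeasurableSet.empty, fun x hx => indicator_of_notMem hx _, empty_subset _, ?_, ?_, ?_,
          fun x hx => hx.elim⟩
        · rw [volume_set, qvol_tri, mul_left_comm]
          exact mul_le_mul_right hgood.le _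
        · refine (hκ.lintegral_mx_atom_le hd
            ((hh.indicator (measurableSet_hset c)).sub (nice_indicator_hset c _)) (fun x hx => ?_)
            (integral_indicator_sub_avgOn hh c) b l).trans (mul_le_mul_right ?_ _)
          · have hx' : x ∉ hset c := fun h' => hx (hset_subset_set c h')
            simp [hx']
          · calc ∫⁻ x, ‖(hset c).indicator h x - avgOn h c x‖ₑ
                ≤ ∫⁻ x, (‖(hset c).indicator h x‖ₑ + ‖avgOn h c x‖ₑ) :=
                  lintegral_mono fun x => enorm_sub_le
              _ = (∫⁻ x in hset c, ‖h x‖ₑ) + ∫⁻ x, ‖avgOn h c x‖ₑ := by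
                  rw [lintegral_add_left (hh.indicator (measurableSet_hset c)).1.enorm]
                  simp only [enorm_indicator_eq_indicator_enorm]
                  rw [lintegral_indicator (measurableSet_hset c)]
              _ ≤ _ := by
                  rw [two_mul]
                  exact add_le_add_right (lintegral_avgOn_le h c) _
        · refine le_add_right (lintegral_sq_avgOn_le h c ?_)
          calc ∫⁻ y in hset c, ‖h y‖ₑ ≤ ∫⁻ y in hset R, ‖h y‖ₑ :=
                lintegral_mono_set (hset_child_subset R ε)
            _ ≤ L * qvol R := hR
            _ = 2 ^ d * L * qvol c := by rw [← qvol_child R ε]; ring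
    choose g E U h1 h2 h3 h4 h5 h6 h7 h8 h9 using hchild
    have hgc : ∀ ε, ∀ x ∈ hset (child R ε), ∑ ε', g ε' x = g ε x := by
      intro ε x hx
      refine Finset.sum_eq_single ε (fun ε' _ hne => h4 ε' x fun hx' => ?_) (by simp)
      exact (disjoint_left.1 (disjoint_child R hne)) hx' hx
    have hind : ∀ x, (hset R).indicator h x = ∑ ε, (hset (child R ε)).indicator h x := by
      intro x
      by_cases hx : x ∈ hset R
      · obtain ⟨ε, hε⟩ := mem_iUnion.1 ((iUnion_child R).symm ▸ hx)
        rw [indicator_of_mem hx, Finset.sum_eq_single ε, indicator_of_mem hε]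
        · exact fun ε' _ hne => indicator_of_notMem (fun hx' =>
            (disjoint_left.1 (disjoint_child R hne)) hx' hε) _
        · simp
      · rw [indicator_of_notMem hx]
        exact (Finset.sum_eq_zero fun ε _ => indicator_of_notMem
          (fun hx' => hx (hset_child_subset R ε hx')) _).symm
    have hUdisj : Pairwise (Function.onFun Disjoint U) := fun ε ε' hne =>
      (disjoint_child R hne).mono (h5 ε) (h5 ε')
    refine ⟨fun x => ∑ ε, g ε x, ⋃ ε, E ε, ⋃ ε, U ε, Nice.sum _ fun ε _ => h1 ε,
      MeasurableSet.iUnion h2, MeasurableSet.iUnion h3, fun x hx => ?_, ?_, ?_, ?_, ?_, ?_⟩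
    · exact Finset.sum_eq_zero fun ε _ => h4 ε x fun hx' => hx (hset_child_subset R ε hx')
    · exact iUnion_subset fun ε => (h5 ε).trans (hset_child_subset R ε)
    · calc L * volume (⋃ ε, E ε) ≤ L * ∑ ε, volume (E ε) :=
            mul_le_mul_right (measure_iUnion_fintype_le _ _) _
        _ = ∑ ε, L * volume (E ε) := Finset.mul_sum _ _ _
        _ ≤ ∑ ε, 3 ^ d * ∫⁻ x in hset (child R ε), ‖h x‖ₑ := Finset.sum_le_sum fun ε _ => h6 ε
        _ = _ := by rw [lintegral_child R, Finset.mul_sum]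
    · have hn : ∀ ε, Nice fun y => (hset (child R ε)).indicator h y - g ε y := fun ε =>
        (hh.indicator (measurableSet_hset _)).sub (h1 ε)
      calc ∫⁻ x in (⋃ ε, E ε)ᶜ, mx κ b l (fun y => (hset R).indicator h y - ∑ ε, g ε y) x
          ≤ ∫⁻ x in (⋃ ε, E ε)ᶜ, ∑ ε,
              mx κ b l (fun y => (hset (child R ε)).indicator h y - g ε y) x := by
            refine lintegral_mono fun x => ?_
            refine le_trans (le_of_eq ?_) (mx_sum_le Finset.univ hκ.nice (fun ε _ => hn ε) b l x)
            congr 1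
            funext y
            rw [hind, Finset.sum_sub_distrib]
        _ = ∑ ε, ∫⁻ x in (⋃ ε, E ε)ᶜ,
              mx κ b l (fun y => (hset (child R ε)).indicator h y - g ε y) x :=
            lintegral_finsetSum _ fun ε _ => measurable_mx hκ.nice (hn ε) b l
        _ ≤ ∑ ε, ENNReal.ofReal (cH d A * (N + 5)) * (2 * ∫⁻ x in hset (child R ε), ‖h x‖ₑ) :=
            Finset.sum_le_sum fun ε _ => (lintegral_mono_set
              (compl_subset_compl.2 (subset_iUnion E ε))).trans (h7 ε)
        _ = _ := by rw [lintegral_child R, Finset.mul_sum, Finset.mul_sum]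
    · calc ∫⁻ x in hset R, ‖∑ ε, g ε x‖ₑ ^ (2 : ℝ)
          = ∑ ε, ∫⁻ x in hset (child R ε), ‖g ε x‖ₑ ^ (2 : ℝ) := by
            rw [lintegral_child R]
            refine Finset.sum_congr rfl fun ε _ => ?_
            refine setLIntegral_congr_fun (measurableSet_hset _) fun x hx => ?_
            simp only [hgc ε x hx]
        _ ≤ ∑ ε, (2 ^ d * L * (∫⁻ x in hset (child R ε), ‖h x‖ₑ) +
              ∫⁻ x in U ε, ‖h x‖ₑ ^ (2 : ℝ)) := Finset.sum_le_sum fun ε _ => h8 ε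
        _ = _ := by
            rw [Finset.sum_add_distrib, lintegral_child R, Finset.mul_sum,
              lintegral_iUnion h3 hUdisj, tsum_fintype]
    · intro x hx
      obtain ⟨ε, hε⟩ := mem_iUnion.1 hx
      exact h9 ε x hε

/-- A bounded support is contained in a cube of arbitrarily large measure. -/
lemma exists_cube_supp (hd : 1 ≤ d) (R0 : ℝ) {V : ℝ≥0∞} (hV : V ≠ ⊤) :
    ∃ R : Cube d, (∀ x, ‖x‖ ≤ R0 → x ∈ hset R) ∧ V ≤ qvol R := by
  set r : ℝ := |R0| + 1 + V.toReal with hr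
  have hr0 : 0 < r := by positivity
  refine ⟨cubeAt 0 r hr0, fun x hx i => ?_, ?_⟩
  · have h1 := (abs_le_norm x i).trans (hx.trans (le_abs_self R0))
    have h2 := abs_le.1 h1
    have h3 : 0 ≤ V.toReal := toReal_nonneg
    simp only [cubeAt, PiLp.zero_apply]
    constructor <;> linarith
  · rw [qvol_cubeAt]
    have h1 : V ≤ ENNReal.ofReal (2 * r) := by
      rw [← ofReal_toReal hV]
      refine ofReal_le_ofReal ?_
      have : 0 ≤ |R0| := abs_nonneg _
      have h3 : 0 ≤ V.toReal := toReal_nonneg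
      linarith
    refine h1.trans (le_self_pow₀ ?_ (by omega))
    rw [one_le_ofReal]
    have : 0 ≤ |R0| := abs_nonneg _
    have h3 : 0 ≤ V.toReal := toReal_nonneg
    linarith

lemma weak_type_of_strong_two {F : Rd d → ℝ≥0∞} {T : ℝ≥0∞} (hT : T ≠ 0) (hT' : T ≠ ⊤)
    (hF : Measurable F) :
    volume {x | T < F x} ≤ (T ^ 2)⁻¹ * ∫⁻ x, F x ^ (2 : ℝ) := by
  have h1 := mul_meas_ge_le_lintegral (hF.pow_const (2 : ℝ)) (T ^ 2) (μ := volume)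
  have h2 : volume {x | T < F x} ≤ volume {x | T ^ 2 ≤ F x ^ (2 : ℝ)} :=
    measure_mono fun x (hx : T < F x) => by
      change T ^ 2 ≤ F x ^ (2 : ℝ)
      rw [rpow_two]
      exact pow_le_pow_left₀ (zero_le) hx.le 2
  have h3 : T ^ 2 ≠ 0 := pow_ne_zero _ hT
  have h4 : T ^ 2 ≠ ⊤ := pow_ne_top hT'
  calc volume {x | T < F x} = (T ^ 2)⁻¹ * (T ^ 2 * volume {x | T < F x}) := by
        rw [← mul_assoc, ENNReal.inv_mul_cancel h3 h4, one_mul]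
    _ ≤ _ := mul_le_mul_right ((mul_le_mul_right h2 _).trans h1) _

/-- The Lebesgue points of `h` where `|h|` is large eventually leave the good sets. -/
lemma tendsto_good_part (hd : 1 ≤ d) {h : Rd d → ℂ} (hh : Nice h) {L : ℝ≥0∞}
    (hL : ∀ x, h x = 0 ∨ L < ‖h x‖ₑ) (s : ℝ) {U : ℕ → Set (Rd d)}
    (hUm : ∀ k, MeasurableSet (U k))
    (hU : ∀ k, ∀ x ∈ U k, ∃ Q : Cube d, x ∈ Q.set ∧ Q.side = s * (1 / 2) ^ k ∧
        ∫⁻ y in Q.set, ‖h y‖ₑ ≤ L * qvol Q) :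
    Tendsto (fun k => ∫⁻ x in U k, ‖h x‖ₑ ^ (2 : ℝ)) atTop (𝓝 0) := by
  have h0 : Tendsto (fun k => ∫⁻ x, (U k).indicator (fun x => ‖h x‖ₑ ^ (2 : ℝ)) x) atTop
      (𝓝 (∫⁻ _ : Rd d, 0)) := by
    refine tendsto_lintegral_of_dominated_convergence (fun x => ‖h x‖ₑ ^ (2 : ℝ))
      (fun k => (hh.1.enorm.pow_const _).indicator (hUm k))
      (fun k => ae_of_all _ fun x => indicator_le_self _ _ x)
      (hh.lintegral_rpow_lt_top two_pos).ne ?_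
    filter_upwards [ae_lebesgue_point hd hh.integrable.locallyIntegrable] with x hx
    rcases hL x with hx0 | hxL
    · refine tendsto_const_nhds.congr fun k => ?_
      by_cases hxk : x ∈ U k <;> simp [hxk, hx0]
    · obtain ⟨r, hr, hrQ⟩ := hx ((‖h x‖ₑ - L) / 2) (ENNReal.half_pos (tsub_pos_of_lt hxL).ne')
      have hlim : Tendsto (fun k : ℕ => s * (1 / 2) ^ k) atTop (𝓝 0) := by
        simpa using (tendsto_pow_atTop_nhds_zero_of_lt_one (by norm_num : (0 : ℝ) ≤ 1 / 2)
          (by norm_num)).const_mul s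
      refine tendsto_const_nhds.congr' ?_
      filter_upwards [hlim.eventually_lt_const hr] with k hk
      rw [indicator_of_notMem]
      intro hxk
      obtain ⟨Q, hxQ, hQs, hQ⟩ := hU k x hxk
      have h1 := hrQ Q hxQ (hQs ▸ hk)
      have hq0 := qvol_ne_zero Q
      have hqt := qvol_ne_top Q
      have h2 : ‖h x‖ₑ ≤ L + (‖h x‖ₑ - L) / 2 := by
        calc ‖h x‖ₑ = (qvol Q)⁻¹ * ∫⁻ _ in Q.set, ‖h x‖ₑ := by
              rw [setLIntegral_const, volume_set, mul_comm, mul_assoc,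
                ENNReal.mul_inv_cancel hq0 hqt, mul_one]
          _ ≤ (qvol Q)⁻¹ * ∫⁻ y in Q.set, (‖h y‖ₑ + ‖h y - h x‖ₑ) := by
              refine mul_le_mul_right (lintegral_mono fun y => ?_) _
              have := enorm_sub_le (a := h y) (b := h y - h x)
              simpa using this
          _ = (qvol Q)⁻¹ * (∫⁻ y in Q.set, ‖h y‖ₑ) + (qvol Q)⁻¹ * ∫⁻ y in Q.set, ‖h y - h x‖ₑ := by
              rw [lintegral_add_left hh.1.enorm, mul_add]
          _ ≤ _ := by
              refine add_le_add ?_ h1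
              calc (qvol Q)⁻¹ * (∫⁻ y in Q.set, ‖h y‖ₑ) ≤ (qvol Q)⁻¹ * (L * qvol Q) :=
                    mul_le_mul_right hQ _
                _ = L := by
                    rw [mul_left_comm, ENNReal.inv_mul_cancel hq0 hqt, mul_one]
      have hne : ‖h x‖ₑ - L ≠ 0 := (tsub_pos_of_lt hxL).ne'
      have hnt : ‖h x‖ₑ - L ≠ ⊤ := sub_ne_top enorm_ne_top
      have h3 : L + (‖h x‖ₑ - L) / 2 < ‖h x‖ₑ := by
        calc L + (‖h x‖ₑ - L) / 2 < L + (‖h x‖ₑ - L) :=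
              ENNReal.add_lt_add_left hxL.ne_top (ENNReal.half_lt_self hne hnt)
          _ = _ := add_tsub_cancel_of_le hxL.le
      exact absurd h2 (not_le.2 h3)
  simp only [lintegral_zero] at h0
  refine h0.congr fun k => lintegral_indicator (hUm k) _

/-- Weak type estimate for the maximal operator on functions which are large on their support. -/
lemma Ker.weak_high {κ : Rd d → ℂ} {A : ℝ} {N : ℕ} (hκ : Ker κ A N) (hd : 1 ≤ d)
    (b l : ℤ) {CB : ℝ≥0∞} (hCB : CB ≠ ⊤)
    (hB : ∀ g, Nice g → ∫⁻ x, mx κ b l g x ^ (2 : ℝ) ≤ CB * ∫⁻ x, ‖g x‖ₑ ^ (2 : ℝ))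
    {h : Rd d → ℂ} (hh : Nice h) {L T : ℝ≥0∞} (hL0 : L ≠ 0) (hLt : L ≠ ⊤) (hT0 : T ≠ 0)
    (hTt : T ≠ ⊤) (hL : ∀ x, h x = 0 ∨ L < ‖h x‖ₑ) :
    volume {x | 2 * T < mx κ b l h x} ≤
      (3 ^ d * L⁻¹ + ENNReal.ofReal (cH d A * (N + 5)) * 2 * T⁻¹ + CB * 2 ^ d * L * (T ^ 2)⁻¹) *
        ∫⁻ x, ‖h x‖ₑ := by
  obtain ⟨R0, hR0⟩ := hh.2.2
  set I := ∫⁻ x, ‖h x‖ₑ with hI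
  have hIt : I ≠ ⊤ := hh.lintegral_lt_top.ne
  obtain ⟨R, hR1, hR2⟩ := exists_cube_supp hd R0 (V := L⁻¹ * I)
    (mul_ne_top (inv_ne_top.2 hL0) hIt)
  have hhR : (hset R).indicator h = h := by
    refine indicator_eq_self.2 fun x hx => hR1 x ?_
    by_contra hc
    exact hx (hR0 x (not_le.1 hc))
  have hIR : ∫⁻ x in hset R, ‖h x‖ₑ = I := by
    rw [hI, ← lintegral_indicator (measurableSet_hset R)]
    refine lintegral_congr fun x => ?_
    rw [← enorm_indicator_eq_indicator_enorm, hhR]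
  have hIL : ∫⁻ x in hset R, ‖h x‖ₑ ≤ L * qvol R := by
    rw [hIR]
    calc I = L * (L⁻¹ * I) := by rw [← mul_assoc, ENNReal.mul_inv_cancel hL0 hLt, one_mul]
      _ ≤ _ := mul_le_mul_right hR2 _
  choose g E U h1 h2 h3 h4 h5 h6 h7 h8 h9 using
    fun k => hκ.calderonZygmund hd b l hh L k R hIL
  simp only [hIR, hhR] at h6 h7 h8
  have hlim := tendsto_good_part hd hh hL R.side h3 h9
  have hk : ∀ k, volume {x | 2 * T < mx κ b l h x} ≤
      (3 ^ d * L⁻¹ + ENNReal.ofReal (cH d A * (N + 5)) * 2 * T⁻¹ + CB * 2 ^ d * L * (T ^ 2)⁻¹) * I +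
        (T ^ 2)⁻¹ * CB * ∫⁻ x in U k, ‖h x‖ₑ ^ (2 : ℝ) := by
    intro k
    have hbn : Nice fun y => h y - g k y := hh.sub (h1 k)
    have hsub : {x | 2 * T < mx κ b l h x} ⊆
        E k ∪ ({x | T < mx κ b l (fun y => h y - g k y) x} ∩ (E k)ᶜ) ∪
          {x | T < mx κ b l (g k) x} := by
      intro x hx
      by_contra hc
      simp only [mem_union, mem_inter_iff, mem_compl_iff, not_or, not_and, not_not,
        Set.mem_ofPred_eq, not_lt] at hc
      obtain ⟨⟨hc1, hc2⟩, hc3⟩ := hc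
      have hc4 : mx κ b l (fun y => h y - g k y) x ≤ T := by
        by_contra h'
        exact hc1 (hc2 (not_le.1 h'))
      have := mx_add_le hκ.nice hbn (h1 k) b l x
      simp only [sub_add_cancel] at this
      refine absurd hx (not_lt.2 (this.trans ?_))
      rw [two_mul]
      exact add_le_add hc4 hc3
    have e1 : volume (E k) ≤ 3 ^ d * L⁻¹ * I := by
      calc volume (E k) = L⁻¹ * (L * volume (E k)) := by
            rw [← mul_assoc, ENNReal.inv_mul_cancel hL0 hLt, one_mul]
        _ ≤ L⁻¹ * (3 ^ d * I) := mul_le_mul_right (h6 k) _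
        _ = _ := by ring
    have e2 : volume ({x | T < mx κ b l (fun y => h y - g k y) x} ∩ (E k)ᶜ) ≤
        ENNReal.ofReal (cH d A * (N + 5)) * 2 * T⁻¹ * I := by
      have hm := measurable_mx hκ.nice hbn b l
      rw [← Measure.restrict_apply (measurableSet_lt measurable_const hm)]
      calc _ ≤ T⁻¹ * (T * (volume.restrict (E k)ᶜ) {x | T ≤ mx κ b l (fun y => h y - g k y) x}) := by
            rw [← mul_assoc, ENNReal.inv_mul_cancel hT0 hTt, one_mul]
            exact measure_mono fun x (hx : T < _) => (show T ≤ _ from hx.le)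
        _ ≤ T⁻¹ * (ENNReal.ofReal (cH d A * (N + 5)) * (2 * I)) :=
            mul_le_mul_right ((mul_meas_ge_le_lintegral hm T).trans (h7 k)) _
        _ = _ := by ring
    have e3 : volume {x | T < mx κ b l (g k) x} ≤ CB * 2 ^ d * L * (T ^ 2)⁻¹ * I +
        (T ^ 2)⁻¹ * CB * ∫⁻ x in U k, ‖h x‖ₑ ^ (2 : ℝ) := by
      have hgR : ∫⁻ x, ‖g k x‖ₑ ^ (2 : ℝ) = ∫⁻ x in hset R, ‖g k x‖ₑ ^ (2 : ℝ) := by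
        rw [← lintegral_indicator (measurableSet_hset R)]
        refine lintegral_congr fun x => ?_
        by_cases hx : x ∈ hset R
        · rw [indicator_of_mem hx]
        · rw [indicator_of_notMem hx, h4 k x hx]; simp
      calc _ ≤ (T ^ 2)⁻¹ * ∫⁻ x, mx κ b l (g k) x ^ (2 : ℝ) :=
            weak_type_of_strong_two hT0 hTt (measurable_mx hκ.nice (h1 k) b l)
        _ ≤ (T ^ 2)⁻¹ * (CB * (2 ^ d * L * I + ∫⁻ x in U k, ‖h x‖ₑ ^ (2 : ℝ))) := by
            refine mul_le_mul_right ((hB _ (h1 k)).trans (mul_le_mul_right ?_ _)) _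
            rw [hgR]; exact h8 k
        _ = _ := by ring
    calc _ ≤ volume (E k) + volume ({x | T < mx κ b l (fun y => h y - g k y) x} ∩ (E k)ᶜ) +
          volume {x | T < mx κ b l (g k) x} :=
          (measure_mono hsub).trans ((measure_union_le _ _).trans
            (add_le_add_left (measure_union_le _ _) _))
      _ ≤ _ := by
          refine (add_le_add (add_le_add e1 e2) e3).trans (le_of_eq ?_)
          ring
  refine ge_of_tendsto' (x := atTop) ?_ hk
  have hcne : (T ^ 2)⁻¹ * CB ≠ ⊤ :=
    mul_ne_top (inv_ne_top.2 (pow_ne_zero _ hT0)) hCB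
  have := (ENNReal.Tendsto.const_mul hlim (Or.inr hcne)).const_add
    ((3 ^ d * L⁻¹ + ENNReal.ofReal (cH d A * (N + 5)) * 2 * T⁻¹ + CB * 2 ^ d * L * (T ^ 2)⁻¹) * I)
  rwa [mul_zero, add_zero] at this

/-- The maximal operator is bounded on `L^a`, `1 < a < 2`, with a small constant when the Fourier
transform of the kernel is small. -/
theorem mx_Lp (hd : 1 ≤ d) {a A : ℝ} (ha : 1 < a) (ha2 : a < 2) (hA : 0 ≤ A) :
    ∃ C : ℝ, 0 ≤ C ∧ ∀ (κ : Rd d → ℂ) (D : ℝ) (N : ℕ), Ker κ A N → 0 < D → D ≤ A →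
      (∀ ξ ≠ 0, ‖𝓕 κ ξ‖ ≤ D * dec ‖ξ‖) → ∀ (b l : ℤ) (h : Rd d → ℂ), Nice h →
      ∫⁻ x, mx κ b l h x ^ a ≤
        ENNReal.ofReal (C * (N + 1) * D ^ (a - 1)) * ∫⁻ x, ‖h x‖ₑ ^ a := by
  obtain ⟨C2, hC2, hL2⟩ := mx_L2 hd
  have hc : 0 ≤ cH d A := by unfold cH; positivity
  set C1 : ℝ := (3 * 3 ^ d + 2 ^ d * C2 * 3) * A + 30 * cH d A with hC1
  have hC10 : 0 ≤ C1 := by positivity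
  refine ⟨a * (C1 / 3 / (a - 1) * 3 ^ a + C2 / (2 - a) * 3 ^ a * A), by
    have : 0 ≤ a - 1 := by linarith
    have : 0 ≤ 2 - a := by linarith
    positivity, fun κ D N hκ hD hDA hF b l h hh => ?_⟩
  have hL2' := fun g hg => hL2 κ D hκ.nice hD.le hF b l g hg
  have hY := measurable_mx hκ.nice hh b l
  have key : ∀ t : ℝ, 0 < t → volume {x | ENNReal.ofReal t < mx κ b l h x} ≤
      ENNReal.ofReal (C1 * (N + 1) / (3 * D)) * ENNReal.ofReal t⁻¹ *
        (∫⁻ x in {x | ENNReal.ofReal t < ENNReal.ofReal (3 * D) * ‖h x‖ₑ},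
          ENNReal.ofReal (3 * D) * ‖h x‖ₑ) +
      ENNReal.ofReal C2 * ENNReal.ofReal (t ^ (-2 : ℝ)) *
        ∫⁻ x in {x | ENNReal.ofReal (3 * D) * ‖h x‖ₑ ≤ ENNReal.ofReal t},
          (ENNReal.ofReal (3 * D) * ‖h x‖ₑ) ^ (2 : ℝ) := by
    intro t ht
    set H := {x | ENNReal.ofReal t < ENNReal.ofReal (3 * D) * ‖h x‖ₑ} with hH
    have hHm : MeasurableSet H := measurableSet_lt measurable_const (hh.1.enorm.const_mul _)
    have hHc : {x | ENNReal.ofReal (3 * D) * ‖h x‖ₑ ≤ ENNReal.ofReal t} = Hᶜ := by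
      ext x; simp [hH]
    rw [hHc]
    set L := ENNReal.ofReal (t / (3 * D)) with hLdef
    set T := ENNReal.ofReal (t / 3) with hTdef
    have hL0 : 0 < t / (3 * D) := by positivity
    have hT0 : 0 < t / 3 := by positivity
    have hhi : Nice (H.indicator h) := hh.indicator hHm
    have hlo : Nice (Hᶜ.indicator h) := hh.indicator hHm.compl
    have hLs : ∀ x, H.indicator h x = 0 ∨ L < ‖H.indicator h x‖ₑ := by
      intro x
      by_cases hx : x ∈ H
      · right
        rw [indicator_of_mem hx, hLdef, ofReal_div_of_pos (by positivity)]
        refine div_lt_of_lt_mul' hx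
      · left; exact indicator_of_notMem hx _
    have w1 := hκ.weak_high hd b l (CB := ENNReal.ofReal (C2 * D ^ 2)) ofReal_ne_top hL2' hhi
      (ofReal_pos.2 hL0).ne' ofReal_ne_top (ofReal_pos.2 hT0).ne' ofReal_ne_top hLs (T := T)
    have w2 := weak_type_of_strong_two (ofReal_pos.2 hT0).ne' (ofReal_ne_top (r := t / 3))
      (measurable_mx hκ.nice hlo b l)
    have hsub : {x | ENNReal.ofReal t < mx κ b l h x} ⊆
        {x | 2 * T < mx κ b l (H.indicator h) x} ∪ {x | T < mx κ b l (Hᶜ.indicator h) x} := by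
      intro x hx
      by_contra hcon
      simp only [mem_union, Set.mem_ofPred_eq, not_or, not_lt] at hcon
      have h1 := mx_add_le hκ.nice hhi hlo b l x
      simp only [indicator_self_add_compl_apply] at h1
      refine absurd hx (not_lt.2 (h1.trans ((add_le_add hcon.1 hcon.2).trans (le_of_eq ?_))))
      rw [hTdef, ← ofReal_ofNat, ← ofReal_mul (by norm_num),
        ← ofReal_add (by positivity) (by positivity)]
      congr 1; ring
    have i1 : ∫⁻ x, ‖H.indicator h x‖ₑ = ∫⁻ x in H, ‖h x‖ₑ := by
      simp only [enorm_indicator_eq_indicator_enorm]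
      exact lintegral_indicator hHm _
    have i2 : ∫⁻ x, ‖Hᶜ.indicator h x‖ₑ ^ (2 : ℝ) = ∫⁻ x in Hᶜ, ‖h x‖ₑ ^ (2 : ℝ) := by
      rw [← lintegral_indicator hHm.compl]
      refine lintegral_congr fun x => ?_
      by_cases hx : x ∈ H <;> simp [hx]
    refine (measure_mono hsub).trans ((measure_union_le _ _).trans (add_le_add ?_ ?_))
    · refine w1.trans ?_
      rw [i1, lintegral_const_mul' _ _ ofReal_ne_top, ← mul_assoc]
      refine mul_le_mul_left ?_ _
      rw [hTdef, ← ofReal_inv_of_pos hL0, ← ofReal_pow hT0.le,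
        ← ofReal_inv_of_pos hT0, ← ofReal_inv_of_pos (by positivity),
        ← ofReal_ofNat (n := 3), ← ofReal_ofNat (n := 2),
        ← ofReal_pow (by norm_num), ← ofReal_pow (by norm_num),
        ← ofReal_mul (by positivity), ← ofReal_mul (by positivity),
        ← ofReal_mul (by positivity), ← ofReal_mul (by positivity),
        ← ofReal_mul (by positivity), ← ofReal_mul (by positivity),
        ← ofReal_mul (by positivity), ← ofReal_mul (by positivity),
        ← ofReal_add (by positivity) (by positivity),
        ← ofReal_add (by positivity) (by positivity)]
      refine ofReal_le_ofReal ?_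
      have e : (3 : ℝ) ^ d * (t / (3 * D))⁻¹ + cH d A * (N + 5) * 2 * (t / 3)⁻¹ +
          C2 * D ^ 2 * 2 ^ d * (t / (3 * D)) * ((t / 3) ^ 2)⁻¹ =
          ((3 * 3 ^ d + 2 ^ d * C2 * 3) * D + 6 * cH d A * (N + 5)) * t⁻¹ := by
        field_simp; ring
      have e' : C1 * (N + 1) / (3 * D) * t⁻¹ * (3 * D) = C1 * (N + 1) * t⁻¹ := by
        field_simp
      rw [e, e']
      refine mul_le_mul_of_nonneg_right ?_ (by positivity)
      rw [hC1, add_mul (_ * A)]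
      have hN : (0 : ℝ) ≤ N := by positivity
      refine add_le_add ?_ ?_
      · have : (0 : ℝ) ≤ 3 * 3 ^ d + 2 ^ d * C2 * 3 := by positivity
        calc _ ≤ (3 * 3 ^ d + 2 ^ d * C2 * 3) * A := by gcongr
          _ ≤ _ := le_mul_of_one_le_right (by positivity) (by linarith)
      · nlinarith [mul_nonneg hc hN]
    · refine w2.trans (((mul_le_mul_right (hL2' _ hlo) _)).trans (le_of_eq ?_))
      rw [i2]
      have : ∀ x, (ENNReal.ofReal (3 * D) * ‖h x‖ₑ) ^ (2 : ℝ) =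
          ENNReal.ofReal (3 * D) ^ (2 : ℝ) * ‖h x‖ₑ ^ (2 : ℝ) := fun x =>
        mul_rpow_of_nonneg _ _ (by norm_num)
      simp only [this]
      rw [lintegral_const_mul' _ _ (rpow_ne_top_of_nonneg (by norm_num) ofReal_ne_top),
        ← mul_assoc, ← mul_assoc]
      congr 1
      rw [rpow_two, ← ofReal_pow hT0.le,
        ← ofReal_pow (by positivity : 0 ≤ 3 * D), ← ofReal_inv_of_pos (by positivity),
        ← ofReal_mul (by positivity), ← ofReal_mul (by positivity),
        ← ofReal_mul (by positivity)]
      congr 1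
      rw [Real.rpow_neg ht.le, Real.rpow_two]
      field_simp
  have fin := lintegral_rpow_le_of_weak_strong hY (hh.1.enorm.const_mul (ENNReal.ofReal (3 * D)))
    ofReal_ne_top ofReal_ne_top key ha ha2
  refine fin.trans ?_
  have hm : ∀ x, (ENNReal.ofReal (3 * D) * ‖h x‖ₑ) ^ a =
      ENNReal.ofReal ((3 * D) ^ a) * ‖h x‖ₑ ^ a := fun x => by
    rw [mul_rpow_of_nonneg _ _ (by linarith), ofReal_rpow_of_pos (by positivity)]
  simp only [hm]
  rw [lintegral_const_mul' _ _ ofReal_ne_top, ← mul_assoc]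
  refine mul_le_mul_left ?_ _
  have ha1 : 0 < a - 1 := by linarith
  have ha3 : 0 < 2 - a := by linarith
  rw [← ofReal_inv_of_pos ha1, ← ofReal_inv_of_pos ha3,
    ← ofReal_mul (by positivity), ← ofReal_mul (by positivity),
    ← ofReal_add (by positivity) (by positivity), ← ofReal_mul (by positivity),
    ← ofReal_mul (by positivity)]
  refine ofReal_le_ofReal ?_
  have hDa : D ^ a = D * D ^ (a - 1) := by
    rw [← Real.rpow_one_add' hD.le (by linarith)]; congr 1; ring
  have hDp : 0 < D ^ (a - 1) := by positivity
  rw [Real.mul_rpow (by norm_num) hD.le, hDa]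
  have hN : (0 : ℝ) ≤ N := by positivity
  have e : a * (C1 * (N + 1) / (3 * D) * (a - 1)⁻¹ + C2 * (2 - a)⁻¹) * (3 ^ a * (D * D ^ (a - 1))) =
      a * (C1 / 3 / (a - 1) * 3 ^ a * (N + 1) + C2 / (2 - a) * 3 ^ a * D) * D ^ (a - 1) := by
    field_simp
  rw [e]
  refine mul_le_mul_of_nonneg_right ?_ hDp.le
  rw [mul_assoc a, add_mul]
  refine mul_le_mul_of_nonneg_left (add_le_add le_rfl ?_) (by linarith)
  calc C2 / (2 - a) * 3 ^ a * D ≤ C2 / (2 - a) * 3 ^ a * A := by gcongr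
    _ ≤ _ := le_mul_of_one_le_right (by positivity) (by linarith)

lemma nat_add_one_le (c : ℝ) (hc : 0 < c) (N : ℕ) :
    (N + 1 : ℝ) ≤ (1 + (c * Real.log 2)⁻¹) * (2 : ℝ) ^ (c * N) := by
  have hl : 0 < c * Real.log 2 := mul_pos hc (Real.log_pos one_lt_two)
  have h1 : (1 : ℝ) ≤ (2 : ℝ) ^ (c * N) := Real.one_le_rpow one_le_two (by positivity)
  have h2 : c * Real.log 2 * N ≤ (2 : ℝ) ^ (c * N) := by
    rw [Real.rpow_def_of_pos two_pos]
    have := Real.add_one_le_exp (Real.log 2 * (c * N))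
    linarith
  have h3 : (N : ℝ) ≤ (c * Real.log 2)⁻¹ * (2 : ℝ) ^ (c * N) := by
    rw [← div_eq_inv_mul, le_div_iff₀ hl]; linarith
  linarith

/-- Exponential decay of the norm of the maximal operator in the smoothness parameter. -/
lemma mx_Lp_decay (hd : 1 ≤ d) {a A : ℝ} (ha : 1 < a) (ha2 : a < 2) (hA : 0 < A) :
    ∃ C : ℝ, 0 < C ∧ ∀ (κ : Rd d → ℂ) (N : ℕ), Ker κ A N →
      (∀ ξ ≠ 0, ‖𝓕 κ ξ‖ ≤ A * 2 ^ (-(N / 8 : ℝ)) * dec ‖ξ‖) → ∀ (b l : ℤ) (h : Rd d → ℂ), Nice h →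
      ∫⁻ x, mx κ b l h x ^ a ≤
        ENNReal.ofReal (C * 2 ^ (-((a - 1) / 16 * N))) * ∫⁻ x, ‖h x‖ₑ ^ a := by
  obtain ⟨C, hC, H⟩ := mx_Lp hd ha ha2 hA.le
  have ha1 : 0 < a - 1 := by linarith
  set K : ℝ := 1 + ((a - 1) / 16 * Real.log 2)⁻¹ with hK
  have hK0 : 0 < K := by
    have : 0 < Real.log 2 := Real.log_pos one_lt_two
    positivity
  refine ⟨C * K * A ^ (a - 1) + 1, by positivity, fun κ N hκ hF b l h hh => ?_⟩
  have hD : A * (2 : ℝ) ^ (-(N / 8 : ℝ)) ≤ A := by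
    refine mul_le_of_le_one_right hA.le (Real.rpow_le_one_of_one_le_of_nonpos one_le_two ?_)
    simp only [Left.neg_nonpos_iff]; positivity
  refine (H κ _ N hκ (by positivity) hD hF b l h hh).trans (mul_le_mul_left ?_ _)
  refine ofReal_le_ofReal ?_
  have e1 : (2 : ℝ) ^ ((a - 1) / 16 * N) * ((2 : ℝ) ^ (-(N / 8 : ℝ))) ^ (a - 1) =
      2 ^ (-((a - 1) / 16 * N)) := by
    rw [← Real.rpow_mul two_pos.le, ← Real.rpow_add two_pos]
    congr 1; ring
  rw [Real.mul_rpow hA.le (by positivity)]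
  calc C * (N + 1) * (A ^ (a - 1) * ((2 : ℝ) ^ (-(N / 8 : ℝ))) ^ (a - 1))
      ≤ C * (K * 2 ^ ((a - 1) / 16 * N)) * (A ^ (a - 1) * ((2 : ℝ) ^ (-(N / 8 : ℝ))) ^ (a - 1)) := by
        gcongr
        exact nat_add_one_le _ (by positivity) N
    _ = C * K * A ^ (a - 1) * (2 ^ ((a - 1) / 16 * N) * ((2 : ℝ) ^ (-(N / 8 : ℝ))) ^ (a - 1)) := by ring
    _ ≤ _ := by
        rw [e1]
        gcongr
        linarith

/-- The part of a function living outside of the triple of a cube. -/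
def outer (f : Rd d → ℂ) (P : Cube d) : Rd d → ℂ := (tri P).setᶜ.indicator f

lemma Nice.outer {f : Rd d → ℂ} (hf : Nice f) (P : Cube d) : Nice (outer f P) :=
  hf.indicator (measurableSet_set _).compl

lemma enorm_outer_le (f : Rd d → ℂ) (P : Cube d) (x : Rd d) : ‖outer f P x‖ₑ ≤ ‖f x‖ₑ := by
  rw [outer, enorm_indicator_eq_indicator_enorm]
  exact indicator_le_self _ _ x

lemma add_rpow_le_two_mul {ρ : ℝ} (h1 : 1 ≤ ρ) (h2 : ρ ≤ 2) (a b : ℝ≥0∞) :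
    (a + b) ^ ρ ≤ 2 * (a ^ ρ + b ^ ρ) := by
  refine (rpow_add_le_mul_rpow_add_rpow a b h1).trans (mul_le_mul_left ?_ _)
  calc (2 : ℝ≥0∞) ^ (ρ - 1) ≤ 2 ^ (1 : ℝ) :=
        rpow_le_rpow_of_exponent_le (by norm_num) (by linarith)
    _ = 2 := rpow_one _

/-- Averages of the outer part of the maximal function are dominated by maximal functions. -/
lemma avg_mx_outer_le {κ : Rd d → ℂ} (hκ : Nice κ) {ρ : ℝ} (h1 : 1 ≤ ρ) (h2 : ρ ≤ 2) {K : ℝ≥0∞}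
    {b l : ℤ}
    (hB : ∀ h, Nice h → ∫⁻ x, mx κ b l h x ^ ρ ≤ K * ∫⁻ x, ‖h x‖ₑ ^ ρ) {f : Rd d → ℂ}
    (hf : Nice f) (P : Cube d) {z : Rd d} (hz : z ∈ P.set) :
    (qvol P)⁻¹ * ∫⁻ x in P.set, mx κ b l (outer f P) x ^ ρ ≤
      2 * (HLM (fun x => mx κ b l f x ^ ρ) z + 3 ^ d * K * HLM (fun x => ‖f x‖ₑ ^ ρ) z) := by
  have hin : Nice fun x => -((tri P).set.indicator f x) := (hf.indicator (measurableSet_set _)).neg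
  have hpt : ∀ x, mx κ b l (outer f P) x ^ ρ ≤ 2 * (mx κ b l f x ^ ρ +
      mx κ b l (fun x => -((tri P).set.indicator f x)) x ^ ρ) := by
    intro x
    refine le_trans (rpow_le_rpow ?_ (by linarith)) (add_rpow_le_two_mul h1 h2 _ _)
    refine le_trans (le_of_eq ?_) (mx_add_le hκ hf hin b l x)
    congr 1
    funext y
    by_cases hy : y ∈ (tri P).set <;> simp [outer, hy]
  have hm1 := (measurable_mx hκ hf b l).pow_const ρ
  calc (qvol P)⁻¹ * ∫⁻ x in P.set, mx κ b l (outer f P) x ^ ρ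
      ≤ (qvol P)⁻¹ * ∫⁻ x in P.set, 2 * (mx κ b l f x ^ ρ +
          mx κ b l (fun x => -((tri P).set.indicator f x)) x ^ ρ) :=
        mul_le_mul_right (lintegral_mono hpt) _
    _ = 2 * ((qvol P)⁻¹ * (∫⁻ x in P.set, mx κ b l f x ^ ρ) + (qvol P)⁻¹ *
          ∫⁻ x in P.set, mx κ b l (fun x => -((tri P).set.indicator f x)) x ^ ρ) := by
        rw [lintegral_const_mul' _ _ (by norm_num), lintegral_add_left hm1]
        ring
    _ ≤ _ := by
        refine mul_le_mul_right (add_le_add (avg_le_HLM _ hz) ?_) _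
        calc (qvol P)⁻¹ * ∫⁻ x in P.set, mx κ b l (fun x => -((tri P).set.indicator f x)) x ^ ρ
            ≤ (qvol P)⁻¹ * (K * ∫⁻ x, ‖-((tri P).set.indicator f x)‖ₑ ^ ρ) :=
              mul_le_mul_right ((setLIntegral_le_lintegral _ _).trans (hB _ hin)) _
          _ = (qvol P)⁻¹ * (K * ∫⁻ x in (tri P).set, ‖f x‖ₑ ^ ρ) := by
              rw [← lintegral_indicator (measurableSet_set _)]
              congr 2
              refine lintegral_congr fun x => ?_
              by_cases hx : x ∈ (tri P).set
              · simp [hx]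
              · simp [hx, show 0 < ρ by linarith]
          _ = 3 ^ d * K * ((qvol (tri P))⁻¹ * ∫⁻ x in (tri P).set, ‖f x‖ₑ ^ ρ) := by
              have h3 : (3 : ℝ≥0∞) ^ d ≠ 0 := by positivity
              have h3' : (3 : ℝ≥0∞) ^ d ≠ ⊤ := pow_ne_top (by norm_num)
              rw [qvol_tri, ENNReal.mul_inv (Or.inl h3) (Or.inl h3')]
              calc _ = (3 ^ d * (3 ^ d)⁻¹) * ((qvol P)⁻¹ * (K * ∫⁻ x in (tri P).set, ‖f x‖ₑ ^ ρ)) := by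
                    rw [ENNReal.mul_inv_cancel h3 h3', one_mul]
                _ = _ := by ring
          _ ≤ _ := mul_le_mul_right (avg_le_HLM _ (set_subset_tri P hz)) _

/-- Pointwise bound for the outer part of the maximal function on a cube. -/
lemma Ker.mx_outer_le {κ : Rd d → ℂ} {A : ℝ} {N : ℕ} (hκ : Ker κ A N) (hd : 1 ≤ d)
    {P : Cube d} {x z : Rd d} (hx : x ∈ P.set) (hz : z ∈ P.set) {f : Rd d → ℂ} (hf : Nice f)
    (b l : ℤ) {ρ : ℝ} (hρ : 0 < ρ) {G : ℝ≥0∞}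
    (hG : (qvol P)⁻¹ * ∫⁻ x in P.set, mx κ b l (outer f P) x ^ ρ ≤ G ^ ρ) :
    mx κ b l (outer f P) x ≤ G + ENNReal.ofReal (cH d A * (N + 5)) * HLM (fun y => ‖f y‖ₑ) z := by
  set E := ENNReal.ofReal (cH d A * (N + 5)) * HLM (fun y => ‖f y‖ₑ) z with hE
  have hosc : ∀ x' ∈ P.set, mx κ b l (outer f P) x - E ≤ mx κ b l (outer f P) x' := by
    intro x' hx'
    rw [tsub_le_iff_right]
    refine iSup₂_le fun k hk => ?_
    have h1 := hκ.oscillation hd hx hx' hz (hf.outer P)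
      (fun y hy => indicator_of_notMem (by simpa using hy) _) k l
    have h2 : HLM (fun y => ‖outer f P y‖ₑ) z ≤ HLM (fun y => ‖f y‖ₑ) z :=
      HLM_mono (fun y => enorm_outer_le f P y) z
    calc ‖tl κ (outer f P) k l x‖ₑ
        = ‖tl κ (outer f P) k l x' + (tl κ (outer f P) k l x - tl κ (outer f P) k l x')‖ₑ := by
          congr 1; ring
      _ ≤ ‖tl κ (outer f P) k l x'‖ₑ + ‖tl κ (outer f P) k l x - tl κ (outer f P) k l x'‖ₑ :=
          enorm_add_le _ _
      _ ≤ _ := add_le_add (le_iSup₂_of_le k hk le_rfl) (h1.trans (mul_le_mul_right h2 _))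
  have h3 : (mx κ b l (outer f P) x - E) ^ ρ ≤ G ^ ρ := by
    calc _ = (qvol P)⁻¹ * ∫⁻ _ in P.set, (mx κ b l (outer f P) x - E) ^ ρ := by
          rw [setLIntegral_const, volume_set, mul_comm, mul_assoc,
            ENNReal.mul_inv_cancel (qvol_ne_zero P) (qvol_ne_top P), mul_one]
      _ ≤ (qvol P)⁻¹ * ∫⁻ x in P.set, mx κ b l (outer f P) x ^ ρ := by
          refine mul_le_mul_right (setLIntegral_mono' (measurableSet_set P) fun x' hx' => ?_) _
          exact rpow_le_rpow (hosc x' hx') hρ.le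
      _ ≤ _ := hG
  exact tsub_le_iff_right.1 ((rpow_le_rpow_iff hρ).1 h3)

/-- Grand maximal function estimate with exponents up to `v`, for one smooth kernel. -/
theorem Ker.grand (hd : 1 ≤ d) {r A : ℝ} (hr : 1 < r) (hr2 : r < 2) (hA : 0 < A) :
    ∃ C c : ℝ, 0 < C ∧ 0 < c ∧ ∀ (κ : Rd d → ℂ) (N : ℕ), Ker κ A N →
      (∀ ξ ≠ 0, ‖𝓕 κ ξ‖ ≤ A * 2 ^ (-(N / 8 : ℝ)) * dec ‖ξ‖) → ∀ v : ℝ, 2 ≤ v →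
      ∀ (b l : ℤ) (f : Rd d → ℂ), Nice f → ∃ G : Rd d → ℝ≥0∞, Measurable G ∧
        ∫⁻ x, G x ^ r ≤ ENNReal.ofReal ((C * (N + 1) * 2 ^ (-(c * N / v))) ^ r) *
          ∫⁻ x, ‖f x‖ₑ ^ r ∧
        ∀ (P : Cube d) (z : Rd d), z ∈ P.set →
          (qvol P)⁻¹ * ∫⁻ x in P.set, mx κ b l (outer f P) x ^ v ≤ G z ^ v := by
  set ρ : ℝ := (1 + r) / 2 with hρdef
  have hρ1 : 1 < ρ := by rw [hρdef]; linarith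
  have hρr : ρ < r := by rw [hρdef]; linarith
  have hρ0 : 0 < ρ := by linarith
  have hr0 : 0 < r := by linarith
  obtain ⟨C1, hC1, H1⟩ := mx_Lp_decay (d := d) hd hρ1 (hρr.trans hr2) hA
  obtain ⟨C2, hC2, H2⟩ := mx_Lp_decay (d := d) hd hr hr2 hA
  set τ : ℝ := r / ρ with hτdef
  have hτ1 : 1 < τ := (one_lt_div hρ0).2 hρr
  have hτ2 : τ ≤ 2 := by rw [hτdef, div_le_iff₀ hρ0]; linarith
  have hρτ : ρ * τ = r := by rw [hτdef]; field_simp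
  set M : ℝ≥0∞ := ENNReal.ofReal (τ / (τ - 1)) * (5 ^ d * 2 ^ τ) with hM
  have hMt : M ≠ ⊤ := mul_ne_top ofReal_ne_top (mul_ne_top
    (pow_ne_top (by norm_num)) (rpow_ne_top_of_nonneg (by linarith) (by norm_num)))
  set M' : ℝ≥0∞ := ENNReal.ofReal (r / (r - 1)) * (5 ^ d * 2 ^ r) with hM'
  have hMt' : M' ≠ ⊤ := mul_ne_top ofReal_ne_top (mul_ne_top
    (pow_ne_top (by norm_num)) (rpow_ne_top_of_nonneg (by linarith) (by norm_num)))
  set K1 : ℝ≥0∞ := 8 * M * (ENNReal.ofReal C2 + (3 ^ d * ENNReal.ofReal C1) ^ τ) with hK1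
  have hK1t : K1 ≠ ⊤ := mul_ne_top (mul_ne_top (by norm_num) hMt)
    (add_ne_top.2 ⟨ofReal_ne_top, rpow_ne_top_of_nonneg (by linarith)
      (mul_ne_top (pow_ne_top (by norm_num)) ofReal_ne_top)⟩)
  set K2 : ℝ≥0∞ := 2 * (K1 + ENNReal.ofReal (5 * cH d A) ^ r * M') with hK2
  have hK2t : K2 ≠ ⊤ := mul_ne_top (by norm_num) (add_ne_top.2 ⟨hK1t,
    mul_ne_top (rpow_ne_top_of_nonneg (by linarith) ofReal_ne_top) hMt'⟩)
  have hK12 : K1 ≤ K2 := by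
    rw [hK2, two_mul]
    exact (le_self_add).trans le_self_add
  refine ⟨K2.toReal + 1, (ρ - 1) * ρ / (16 * r), by positivity, by
    have : 0 < ρ - 1 := by linarith
    positivity, fun κ N hκ hF v hv b l f hf => ?_⟩
  have hv0 : 0 < v := by linarith
  have hc : 0 ≤ cH d A := by unfold cH; positivity
  set I := ∫⁻ x, ‖f x‖ₑ ^ r with hI
  set q := ENNReal.ofReal ((2 : ℝ) ^ (-((ρ - 1) / 16 * N))) with hq
  have hq1 : q ≤ 1 := by
    rw [hq, ofReal_le_one]
    refine Real.rpow_le_one_of_one_le_of_nonpos one_le_two ?_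
    have : 0 < ρ - 1 := by linarith
    simp only [Left.neg_nonpos_iff]; positivity
  set kρ := ENNReal.ofReal (C1 * 2 ^ (-((ρ - 1) / 16 * N))) with hkρ
  have hkρq : kρ = ENNReal.ofReal C1 * q := by rw [hkρ, ofReal_mul hC1.le]
  have hkr : ENNReal.ofReal (C2 * 2 ^ (-((r - 1) / 16 * N))) ≤ ENNReal.ofReal C2 * q := by
    rw [hq, ← ofReal_mul hC2.le]
    gcongr
    exact one_le_two
  have hS := measurable_mx hκ.nice hf b l
  set G0 : Rd d → ℝ≥0∞ := fun z => (2 * (HLM (fun x => mx κ b l f x ^ ρ) z +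
    3 ^ d * kρ * HLM (fun x => ‖f x‖ₑ ^ ρ) z)) ^ ρ⁻¹ with hG0
  have hG0m : Measurable G0 := (((measurable_HLM _).add
    ((measurable_HLM _).const_mul _)).const_mul _).pow_const _
  have hG0I : ∫⁻ x, G0 x ^ r ≤ K1 * q * I := by
    have e : ∀ x, G0 x ^ r ≤ 8 * (HLM (fun x => mx κ b l f x ^ ρ) x ^ τ +
        (3 ^ d * kρ) ^ τ * HLM (fun x => ‖f x‖ₑ ^ ρ) x ^ τ) := by
      intro x
      simp only [hG0]
      rw [← rpow_mul, show ρ⁻¹ * r = τ by rw [hτdef]; ring,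
        mul_rpow_of_nonneg 2 _ (by linarith)]
      have h4 : (2 : ℝ≥0∞) ^ τ ≤ 4 := by
        calc (2 : ℝ≥0∞) ^ τ ≤ 2 ^ (2 : ℝ) := rpow_le_rpow_of_exponent_le (by norm_num) hτ2
          _ = 4 := by rw [rpow_two]; norm_num
      calc _ ≤ 4 * (2 * (HLM (fun x => mx κ b l f x ^ ρ) x ^ τ +
            (3 ^ d * kρ * HLM (fun x => ‖f x‖ₑ ^ ρ) x) ^ τ)) :=
            mul_le_mul' h4 (add_rpow_le_two_mul hτ1.le hτ2 _ _)
        _ = _ := by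
            rw [mul_rpow_of_nonneg _ (HLM _ x) (by linarith), ← mul_assoc]
            norm_num
    have i1 : ∫⁻ x, HLM (fun x => mx κ b l f x ^ ρ) x ^ τ ≤ M * (ENNReal.ofReal C2 * q * I) := by
      refine (HLM_strong hd (hS.pow_const ρ) hτ1).trans (mul_le_mul_right ?_ _)
      simp only [← rpow_mul, hρτ]
      exact (H2 κ N hκ (fun ξ hξ => hF ξ hξ) b l f hf).trans (mul_le_mul_left hkr _)
    have i2 : ∫⁻ x, HLM (fun x => ‖f x‖ₑ ^ ρ) x ^ τ ≤ M * I := by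
      refine (HLM_strong hd (hf.1.enorm.pow_const ρ) hτ1).trans (mul_le_mul_right ?_ _)
      simp only [← rpow_mul, hρτ]
      exact le_rfl
    have hqτ : (3 ^ d * kρ) ^ τ ≤ (3 ^ d * ENNReal.ofReal C1) ^ τ * q := by
      rw [hkρq, ← mul_assoc, mul_rpow_of_nonneg _ q (by linarith)]
      refine mul_le_mul_right ?_ _
      calc q ^ τ ≤ q ^ (1 : ℝ) := rpow_le_rpow_of_exponent_ge hq1 hτ1.le
        _ = q := rpow_one _
    calc ∫⁻ x, G0 x ^ r ≤ ∫⁻ x, 8 * (HLM (fun x => mx κ b l f x ^ ρ) x ^ τ +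
          (3 ^ d * kρ) ^ τ * HLM (fun x => ‖f x‖ₑ ^ ρ) x ^ τ) := lintegral_mono e
      _ = 8 * ((∫⁻ x, HLM (fun x => mx κ b l f x ^ ρ) x ^ τ) +
          (3 ^ d * kρ) ^ τ * ∫⁻ x, HLM (fun x => ‖f x‖ₑ ^ ρ) x ^ τ) := by
          rw [lintegral_const_mul' _ _ (by norm_num),
            lintegral_add_left ((measurable_HLM _).pow_const _),
            lintegral_const_mul _ ((measurable_HLM _).pow_const _)]
      _ ≤ 8 * (M * (ENNReal.ofReal C2 * q * I) +
          (3 ^ d * ENNReal.ofReal C1) ^ τ * q * (M * I)) :=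
          mul_le_mul_right (add_le_add i1 (mul_le_mul' hqτ i2)) _
      _ = _ := by rw [hK1]; ring
  set E := ENNReal.ofReal (cH d A * (N + 5)) with hE
  have hEN : E ≤ ENNReal.ofReal (5 * cH d A) * ENNReal.ofReal (N + 1) := by
    rw [hE, ← ofReal_mul (by positivity)]
    refine ofReal_le_ofReal ?_
    nlinarith [mul_nonneg hc (Nat.cast_nonneg (α := ℝ) N)]
  set n1 := ENNReal.ofReal ((N : ℝ) + 1) with hn1
  have hn1' : 1 ≤ n1 := by
    rw [hn1, one_le_ofReal]; linarith [Nat.cast_nonneg (α := ℝ) N]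
  have hn1r : 1 ≤ n1 ^ r := one_le_rpow hn1' hr0
  set Hf : Rd d → ℝ≥0∞ := fun z => G0 z + E * HLM (fun y => ‖f y‖ₑ) z with hHf
  have hHm : Measurable Hf := hG0m.add ((measurable_HLM _).const_mul _)
  have hHI : ∫⁻ x, Hf x ^ r ≤ K2 * n1 ^ r * I := by
    have i3 := HLM_strong hd hf.1.enorm hr
    calc ∫⁻ x, Hf x ^ r ≤ ∫⁻ x, 2 * (G0 x ^ r + E ^ r * HLM (fun y => ‖f y‖ₑ) x ^ r) := by
          refine lintegral_mono fun x => ?_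
          rw [← mul_rpow_of_nonneg _ _ hr0.le]
          exact add_rpow_le_two_mul hr.le hr2.le _ _
      _ = 2 * ((∫⁻ x, G0 x ^ r) + E ^ r * ∫⁻ x, HLM (fun y => ‖f y‖ₑ) x ^ r) := by
          rw [lintegral_const_mul' _ _ (by norm_num), lintegral_add_left (hG0m.pow_const _),
            lintegral_const_mul _ ((measurable_HLM _).pow_const _)]
      _ ≤ 2 * (K1 * n1 ^ r * I + (ENNReal.ofReal (5 * cH d A) * n1) ^ r * (M' * I)) := by
          refine mul_le_mul_right (add_le_add (hG0I.trans ?_) ?_) _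
          · exact mul_le_mul_left (mul_le_mul_right (hq1.trans hn1r) _) _
          · exact mul_le_mul' (rpow_le_rpow hEN hr0.le) i3
      _ = _ := by
          rw [hK2, mul_rpow_of_nonneg _ _ hr0.le]; ring
  set θ : ℝ := ρ / v with hθ
  have hθ0 : 0 ≤ θ := by positivity
  have hθ1 : 0 ≤ 1 - θ := by
    have : θ ≤ 1 := by rw [hθ, div_le_one hv0]; linarith
    linarith
  have hθv : θ * v = ρ := by rw [hθ]; field_simp
  refine ⟨fun z => Hf z ^ (1 - θ) * G0 z ^ θ, (hHm.pow_const _).mul (hG0m.pow_const _), ?_, ?_⟩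
  · have e1 : ∀ z, (Hf z ^ (1 - θ) * G0 z ^ θ) ^ r = (Hf z ^ r) ^ (1 - θ) * (G0 z ^ r) ^ θ := by
      intro z
      generalize Hf z = a
      generalize G0 z = b
      rw [mul_rpow_of_nonneg _ _ hr0.le, ← rpow_mul, ← rpow_mul,
        ← rpow_mul, ← rpow_mul, mul_comm r (1 - θ), mul_comm r θ]
    simp only [e1]
    calc ∫⁻ z, (Hf z ^ r) ^ (1 - θ) * (G0 z ^ r) ^ θ
        ≤ (∫⁻ z, Hf z ^ r) ^ (1 - θ) * (∫⁻ z, G0 z ^ r) ^ θ :=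
          lintegral_mul_norm_pow_le (hHm.pow_const _).aemeasurable
            (hG0m.pow_const _).aemeasurable hθ1 hθ0 (by ring)
      _ ≤ (K2 * n1 ^ r * I) ^ (1 - θ) * (K2 * n1 ^ r * I * q) ^ θ := by
          refine mul_le_mul' (rpow_le_rpow hHI hθ1) (rpow_le_rpow ?_ hθ0)
          calc ∫⁻ x, G0 x ^ r ≤ K1 * 1 * I * q := hG0I.trans (le_of_eq (by ring))
            _ ≤ _ := mul_le_mul_left (mul_le_mul_left (mul_le_mul' hK12 hn1r) _) _
      _ = K2 * n1 ^ r * q ^ θ * I := by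
          rw [mul_rpow_of_nonneg _ q hθ0, ← mul_assoc, ← rpow_add_of_nonneg _ _ hθ1 hθ0,
            sub_add_cancel, rpow_one]
          ring
      _ ≤ _ := by
          refine mul_le_mul_left ?_ _
          have hK : K2 ≤ ENNReal.ofReal ((K2.toReal + 1) ^ r) := by
            rw [← ofReal_toReal hK2t, toReal_ofReal toReal_nonneg]
            refine ofReal_le_ofReal ?_
            have h0 : 0 ≤ K2.toReal := toReal_nonneg
            calc K2.toReal ≤ (K2.toReal + 1) ^ (1 : ℝ) := by rw [Real.rpow_one]; linarith
              _ ≤ _ := Real.rpow_le_rpow_of_exponent_le (by linarith) hr.le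
          have hqθ : q ^ θ = ENNReal.ofReal (((2 : ℝ) ^ (-((ρ - 1) * ρ / (16 * r) * N / v))) ^ r) := by
            rw [hq, ofReal_rpow_of_pos (by positivity), ← Real.rpow_mul two_pos.le,
              ← Real.rpow_mul two_pos.le]
            congr 2
            rw [hθ]; field_simp
          have hn : n1 ^ r = ENNReal.ofReal (((N : ℝ) + 1) ^ r) := by
            rw [hn1, ofReal_rpow_of_pos (by positivity)]
          rw [Real.mul_rpow (by positivity) (by positivity), Real.mul_rpow (by positivity) (by positivity),
            ofReal_mul (by positivity), ofReal_mul (by positivity), ← hqθ, ← hn]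
          exact mul_le_mul_left (mul_le_mul_left hK _) _
  · intro P z hz
    have hGP : (qvol P)⁻¹ * ∫⁻ x in P.set, mx κ b l (outer f P) x ^ ρ ≤ G0 z ^ ρ := by
      simp only [hG0]
      rw [← rpow_mul, inv_mul_cancel₀ hρ0.ne', rpow_one]
      exact avg_mx_outer_le hκ.nice hρ1.le (hρr.trans hr2).le
        (fun h hh => H1 κ N hκ hF b l h hh) hf P hz
    have hm := measurable_mx hκ.nice (hf.outer P) b l
    calc (qvol P)⁻¹ * ∫⁻ x in P.set, mx κ b l (outer f P) x ^ v
        ≤ (qvol P)⁻¹ * ∫⁻ x in P.set, Hf z ^ (v - ρ) * mx κ b l (outer f P) x ^ ρ := by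
          refine mul_le_mul_right (setLIntegral_mono' (measurableSet_set P) fun x hx => ?_) _
          have h1 := hκ.mx_outer_le hd hx hz hf b l hρ0 hGP
          have h2 : v = (v - ρ) + ρ := by ring
          conv_lhs => rw [h2, rpow_add_of_nonneg _ _ (by linarith) hρ0.le]
          exact mul_le_mul_left (rpow_le_rpow h1 (by linarith)) _
      _ = Hf z ^ (v - ρ) * ((qvol P)⁻¹ * ∫⁻ x in P.set, mx κ b l (outer f P) x ^ ρ) := by
          rw [lintegral_const_mul _ (hm.pow_const _), mul_left_comm]
      _ ≤ Hf z ^ (v - ρ) * G0 z ^ ρ := mul_le_mul_right hGP _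
      _ = _ := by
          beta_reduce
          generalize Hf z = a
          generalize G0 z = b
          rw [mul_rpow_of_nonneg _ _ hv0.le, ← rpow_mul, ← rpow_mul, hθv,
            sub_mul, hθv, one_mul]

lemma IsRoughKernel.mono {Ω : Rd d → ℂ} {C C' : ℝ} (h : IsRoughKernel Ω C) (hC : C ≤ C') :
    IsRoughKernel Ω C' :=
  ⟨h.1, h.2.1, fun x hx => (h.2.2.1 x hx).trans hC, h.2.2.2⟩

/-- The homogeneous kernel `Ω(x) |x|^{-d}`. -/
def rk (Ω : Rd d → ℂ) (x : Rd d) : ℂ := Ω x * ((‖x‖ ^ d : ℝ) : ℂ)⁻¹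

/-- The part of the homogeneous kernel in the annulus `1 < |x| ≤ 2`. -/
def rk0 (Ω : Rd d → ℂ) : Rd d → ℂ := {x | 1 < ‖x‖ ∧ ‖x‖ ≤ 2}.indicator (rk Ω)

lemma measurable_rk {Ω : Rd d → ℂ} (h : Measurable Ω) : Measurable (rk Ω) := by
  unfold rk; fun_prop

lemma measurableSet_annulus (a b : ℝ) : MeasurableSet {x : Rd d | a < ‖x‖ ∧ ‖x‖ ≤ b} :=
  (measurableSet_lt measurable_const measurable_norm).inter
    (measurableSet_le measurable_norm measurable_const)

section
variable {Ω : Rd d → ℂ} {C : ℝ}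

lemma rk_smul (h : IsRoughKernel Ω C) {t : ℝ} (ht : 0 < t) {x : Rd d} (hx : x ≠ 0) :
    rk Ω (t • x) = ((t ^ d : ℝ) : ℂ)⁻¹ * rk Ω x := by
  rw [rk, rk, h.2.1 t x ht hx, norm_smul, Real.norm_of_nonneg ht.le, mul_pow]
  push_cast
  rw [mul_inv]; ring

lemma norm_rk_le (h : IsRoughKernel Ω C) {x : Rd d} (hx : x ≠ 0) : ‖rk Ω x‖ ≤ C * (‖x‖ ^ d)⁻¹ := by
  rw [rk, norm_mul, norm_inv, Complex.norm_real, Real.norm_of_nonneg (by positivity)]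
  exact mul_le_mul_of_nonneg_right (h.2.2.1 x hx) (by positivity)

lemma norm_rk0_le (h : IsRoughKernel Ω C) (hC : 0 ≤ C) (x : Rd d) : ‖rk0 Ω x‖ ≤ C := by
  rw [rk0, indicator_apply]
  split_ifs with hx
  · have hx0 : x ≠ 0 := norm_pos_iff.1 (zero_lt_one.trans hx.1)
    refine (norm_rk_le h hx0).trans (mul_le_of_le_one_right hC ?_)
    exact inv_le_one_of_one_le₀ (one_le_pow₀ hx.1.le)
  · simpa using hC

lemma rk0_eq_zero {x : Rd d} (hx : 2 < ‖x‖) : rk0 Ω x = 0 :=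
  indicator_of_notMem (fun h => absurd h.2 (not_le.2 hx)) _

lemma nice_rk0 (h : IsRoughKernel Ω C) (hC : 0 ≤ C) : Nice (rk0 Ω) :=
  ⟨(measurable_rk h.1).indicator (measurableSet_annulus _ _), ⟨C, norm_rk0_le h hC⟩, 2,
    fun _ => rk0_eq_zero⟩

lemma dil_rk0 (h : IsRoughKernel Ω C) (i : ℤ) :
    dil i (rk0 Ω) = {x | (2 : ℝ) ^ i < ‖x‖ ∧ ‖x‖ ≤ (2 : ℝ) ^ (i + 1)}.indicator (rk Ω) := by
  funext x
  have h2 : (0 : ℝ) < 2 ^ i := by positivity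
  have e : ((2 : ℝ) ^ (-i) • x ∈ {x : Rd d | 1 < ‖x‖ ∧ ‖x‖ ≤ 2}) ↔
      x ∈ {x : Rd d | (2 : ℝ) ^ i < ‖x‖ ∧ ‖x‖ ≤ (2 : ℝ) ^ (i + 1)} := by
    simp only [Set.mem_ofPred_eq, norm_zpow_smul]
    rw [zpow_neg, zpow_add_one₀ (two_ne_zero' ℝ), ← div_eq_inv_mul, one_lt_div h2, div_le_iff₀ h2, mul_comm 2]
  rw [dil, rk0]
  by_cases hx : x ∈ {x : Rd d | (2 : ℝ) ^ i < ‖x‖ ∧ ‖x‖ ≤ (2 : ℝ) ^ (i + 1)}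
  · have hx0 : x ≠ 0 := norm_pos_iff.1 (h2.trans hx.1)
    rw [indicator_of_mem (e.2 hx), indicator_of_mem hx, rk_smul h (by positivity) hx0, ← mul_assoc,
      mul_inv_cancel₀, one_mul]
    exact_mod_cast (by positivity : ((2 : ℝ) ^ (-i)) ^ d ≠ 0)
  · rw [indicator_of_notMem (mt e.1 hx), indicator_of_notMem hx, mul_zero]

lemma sum_dil_rk0 (h : IsRoughKernel Ω C) {k l : ℤ} (hkl : k ≤ l) (x : Rd d) :
    ∑ i ∈ Finset.Ico k l, dil i (rk0 Ω) x =
      {x | (2 : ℝ) ^ k < ‖x‖ ∧ ‖x‖ ≤ (2 : ℝ) ^ l}.indicator (rk Ω) x := by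
  induction l, hkl using Int.leInduction with
  | base => 
    rw [Finset.Ico_self, Finset.sum_empty, indicator_of_notMem]
    rintro ⟨h1, h2⟩; linarith
  | succ l hl ih =>
    have : Finset.Ico k (l + 1) = insert l (Finset.Ico k l) := by
      ext i; simp only [Finset.mem_Ico, Finset.mem_insert]; omega
    rw [this, Finset.sum_insert (by simp), ih, dil_rk0 h]
    have h1 : (2 : ℝ) ^ l ≤ 2 ^ (l + 1) := zpow_le_zpow_right₀ one_le_two (by omega)
    have h2 : (2 : ℝ) ^ k ≤ 2 ^ l := zpow_le_zpow_right₀ one_le_two hl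
    simp only [indicator_apply, Set.mem_ofPred_eq]
    rcases le_or_gt ‖x‖ (2 ^ l) with h3 | h3
    · rw [if_neg (by intro h; linarith [h.1]), zero_add]
      congr 1
      simp only [h3, h3.trans h1]
    · rw [if_neg (by intro h; linarith [h.2] : ¬ (2 ^ k < ‖x‖ ∧ ‖x‖ ≤ (2 : ℝ) ^ l)), add_zero]
      congr 1
      simp only [h3, h2.trans_lt h3]

lemma integrableOn_of_ball (h : IsRoughKernel Ω C) (hd : 1 ≤ d) {s : Set (Rd d)} 
    {R : ℝ} (hR : s ⊆ closedBall 0 R) : IntegrableOn Ω s := by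
  refine Measure.integrableOn_of_bounded (M := C) ?_ h.1.aestronglyMeasurable ?_
  · exact ((measure_mono hR).trans_lt measure_closedBall_lt_top).ne
  · exact ae_restrict_of_ae ((ae_ne_zero hd).mono fun x hx => h.2.2.1 x hx)

lemma integral_ball_scale (h : IsRoughKernel Ω C) (hd : 1 ≤ d) {s : ℝ} (hs : 0 < s) :
    ∫ x in closedBall (0 : Rd d) s, Ω x = (s : ℂ) ^ d *
      ∫ x in closedBall (0 : Rd d) 1, Ω x := by
  have e := Measure.integral_comp_smul (volume : Measure (Rd d))
    ((closedBall (0 : Rd d) s).indicator Ω) s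
  rw [integral_indicator isClosed_closedBall.measurableSet] at e
  have e2 : ∫ x : Rd d, (closedBall (0 : Rd d) s).indicator Ω (s • x) =
      ∫ x in closedBall (0 : Rd d) 1, Ω x := by
    rw [← integral_indicator isClosed_closedBall.measurableSet]
    refine integral_congr_ae ((ae_ne_zero hd).mono fun x hx => ?_)
    have : s • x ∈ closedBall (0 : Rd d) s ↔ x ∈ closedBall (0 : Rd d) 1 := by
      simp only [mem_closedBall_zero_iff, norm_smul, Real.norm_of_nonneg hs.le]
      exact mul_le_iff_le_one_right hs
    beta_reduce
    by_cases hx1 : x ∈ closedBall (0 : Rd d) 1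
    · rw [indicator_of_mem hx1, indicator_of_mem (this.2 hx1), h.2.1 s x hs hx]
    · rw [indicator_of_notMem hx1, indicator_of_notMem (mt this.1 hx1)]
  rw [e2, finrank_euclideanSpace, Fintype.card_fin, abs_of_nonneg (by positivity)] at e
  rw [e, Complex.real_smul, ← mul_assoc]
  push_cast
  rw [mul_inv_cancel₀, one_mul]
  exact pow_ne_zero _ (by exact_mod_cast hs.ne')

lemma integral_ball_eq_zero (h : IsRoughKernel Ω C) (hd : 1 ≤ d) {s : ℝ} (hs : 0 < s) :
    ∫ x in closedBall (0 : Rd d) s, Ω x = 0 := by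
  rw [integral_ball_scale h hd hs]
  have h2 := integral_ball_scale h hd two_pos
  have hn : Nonempty (Fin d) := ⟨⟨0, hd⟩⟩
  have e : ({x : Rd d | 1 < ‖x‖ ∧ ‖x‖ < 2} : Set (Rd d)) =ᵐ[volume]
      (closedBall 0 2 \ closedBall 0 1 : Set (Rd d)) := by
    have hs2 : ∀ᵐ x : Rd d, x ∉ sphere (0 : Rd d) 2 :=
      measure_eq_zero_iff_ae_notMem.1 (Measure.addHaar_sphere_of_ne_zero volume 0 two_ne_zero)
    filter_upwards [hs2] with x hx
    rw [mem_sphere_zero_iff_norm] at hx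
    refine propext (Iff.trans ?_ (Set.mem_sdiff x).symm)
    rw [mem_closedBall_zero_iff, mem_closedBall_zero_iff, not_le]
    exact ⟨fun h => ⟨h.2.le, h.1⟩, fun h => ⟨h.2, lt_of_le_of_ne h.1 hx⟩⟩
  have h4 := h.2.2.2
  rw [setIntegral_congr_set e, setIntegral_sdiff isClosed_closedBall.measurableSet
    (integrableOn_of_ball h hd Subset.rfl) (closedBall_subset_closedBall one_le_two), h2] at h4
  have h5 : ((2 : ℂ) ^ d - 1) * ∫ x in closedBall (0 : Rd d) 1, Ω x = 0 := by
    rw [← h4]; push_cast; ring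
  rcases mul_eq_zero.1 h5 with h6 | h6
  · exfalso
    have : (2 : ℂ) ^ d = 1 := sub_eq_zero.1 h6
    have h7 : (2 : ℝ) ^ d = 1 := by exact_mod_cast this
    exact absurd h7 (one_lt_pow₀ _root_.one_lt_two (Nat.one_le_iff_ne_zero.1 hd)).ne'
  · rw [h6, mul_zero]

lemma integral_rk0 (h : IsRoughKernel Ω C) (hd : 1 ≤ d) : ∫ x, rk0 Ω x = 0 := by
  have hd0 : d ≠ 0 := Nat.one_le_iff_ne_zero.1 hd
  set A : Set (Rd d) := {x | 1 < ‖x‖ ∧ ‖x‖ ≤ 2} with hA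
  have hAm : MeasurableSet A := measurableSet_annulus 1 2
  have hAi : IntegrableOn Ω A := integrableOn_of_ball h hd (R := 2) fun x hx => by
    rw [mem_closedBall_zero_iff]; exact hx.2
  set F : Rd d → ℝ → ℂ := fun x t => {y : Rd d × ℝ | y.2 * ‖y.1‖ ^ d ≤ 1}.indicator
    (fun y => Ω y.1) (x, t) with hF
  have hSm : MeasurableSet {y : Rd d × ℝ | y.2 * ‖y.1‖ ^ d ≤ 1} :=
    measurableSet_le (by fun_prop) measurable_const
  have e1 : ∀ x ∈ A, rk Ω x = ∫ t in Ioc (0 : ℝ) 1, F x t := by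
    intro x hx
    have hx1 : 1 ≤ ‖x‖ ^ d := one_le_pow₀ hx.1.le
    have hx0 : 0 < ‖x‖ ^ d := by linarith
    have : ∀ t, F x t = (Iic (‖x‖ ^ d)⁻¹).indicator (fun _ => Ω x) t := by
      intro t
      have : (x, t) ∈ {y : Rd d × ℝ | y.2 * ‖y.1‖ ^ d ≤ 1} ↔ t ∈ Iic (‖x‖ ^ d)⁻¹ := by
        simp only [Set.mem_ofPred_eq, mem_Iic]
        rw [← one_div, le_div_iff₀ hx0]
      by_cases ht : t ∈ Iic (‖x‖ ^ d)⁻¹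
      · rw [indicator_of_mem ht, hF]; exact indicator_of_mem (this.2 ht) _
      · rw [indicator_of_notMem ht, hF]; exact indicator_of_notMem (mt this.1 ht) _
    simp_rw [this]
    rw [setIntegral_indicator measurableSet_Iic, Ioc_inter_Iic, min_eq_right (inv_le_one_of_one_le₀ hx1),
      setIntegral_const, Measure.real, Real.volume_Ioc, sub_zero,
      toReal_ofReal (inv_nonneg.2 hx0.le), rk, Complex.real_smul, mul_comm]
    push_cast; rfl
  have e2 : ∀ t ∈ Ioc (0 : ℝ) 1, ∫ x in A, F x t = 0 := by
    intro t ht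
    set s : ℝ := (t⁻¹) ^ (d : ℝ)⁻¹ with hs
    have hsd : s ^ d = t⁻¹ := Real.rpow_inv_natCast_pow (inv_nonneg.2 ht.1.le) hd0
    have hs0 : 0 < s := Real.rpow_pos_of_pos (inv_pos.2 ht.1) _
    have hs1 : 1 ≤ s := by
      rw [← one_le_pow_iff_of_nonneg hs0.le hd0, hsd]
      exact (one_le_inv₀ ht.1).2 ht.2
    have hF' : ∀ x, F x t = (closedBall (0 : Rd d) s).indicator Ω x := by
      intro x
      have : (x, t) ∈ {y : Rd d × ℝ | y.2 * ‖y.1‖ ^ d ≤ 1} ↔ x ∈ closedBall (0 : Rd d) s := by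
        simp only [Set.mem_ofPred_eq, mem_closedBall_zero_iff]
        rw [← pow_le_pow_iff_left₀ (norm_nonneg x) hs0.le hd0, hsd, ← one_div, le_div_iff₀ ht.1, mul_comm]
      by_cases hx : x ∈ closedBall (0 : Rd d) s
      · rw [indicator_of_mem hx, hF]; exact indicator_of_mem (this.2 hx) _
      · rw [indicator_of_notMem hx, hF]; exact indicator_of_notMem (mt this.1 hx) _
    have hAs : A ∩ closedBall (0 : Rd d) s =
        closedBall 0 (min 2 s) \ closedBall 0 1 := by
      ext x
      simp only [hA, Set.mem_inter_iff, Set.mem_sdiff, mem_closedBall_zero_iff, not_le, le_min_iff,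
        Set.mem_ofPred_eq]
      tauto
    simp_rw [hF']
    rw [setIntegral_indicator isClosed_closedBall.measurableSet, hAs,
      setIntegral_sdiff isClosed_closedBall.measurableSet (integrableOn_of_ball h hd Subset.rfl)
        (closedBall_subset_closedBall (le_min one_le_two hs1)),
      integral_ball_eq_zero h hd (by positivity), integral_ball_eq_zero h hd one_pos, sub_zero]
  rw [rk0, integral_indicator hAm, setIntegral_congr_fun hAm e1, integral_integral_swap,
    setIntegral_congr_fun measurableSet_Ioc e2, integral_zero]
  have : Integrable (fun y : Rd d × ℝ => Ω y.1) ((volume.restrict A).prod (volume.restrict (Ioc 0 1))) :=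
    hAi.comp_fst _
  exact this.indicator hSm

end

lemma volume_slab_le (hd : 1 ≤ d) {ξ : Rd d} (hξ : ξ ≠ 0) {τ : ℝ} (hτ : 0 ≤ τ) :
    volume {y : Rd d | ‖y‖ ≤ 2 ∧ |inner ℝ y ξ| ≤ τ * ‖ξ‖} ≤ ENNReal.ofReal (2 * 4 ^ d * τ) := by
  have hn : 0 < ‖ξ‖ := norm_pos_iff.2 hξ
  set i0 : Fin d := ⟨0, hd⟩
  set w : Rd d := ‖ξ‖ • EuclideanSpace.single i0 (1 : ℝ) with hw
  have hwn : ‖ξ‖ = ‖w‖ := by simp [hw, norm_smul]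
  set L := (Submodule.span ℝ {ξ - w})ᗮ.reflection with hL
  have hLξ : L ξ = w := Submodule.reflection_sub hwn
  set a : Fin d → ℝ := fun i => if i = i0 then τ else 2 with ha
  have hsub : {y : Rd d | ‖y‖ ≤ 2 ∧ |inner ℝ y ξ| ≤ τ * ‖ξ‖} ⊆
      L ⁻¹' ((MeasurableEquiv.toLp 2 (Fin d → ℝ)).symm ⁻¹' (Set.pi univ fun i => Icc (-(a i)) (a i))) := by
    rintro y ⟨h1, h2⟩ i -
    show L y i ∈ Icc _ _
    rw [mem_Icc, ← abs_le, ha]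
    beta_reduce
    split_ifs with hi
    · rw [← L.inner_map_map, hLξ, hw, inner_smul_right, EuclideanSpace.inner_single_right] at h2
      simp only [one_mul, conj_trivial, abs_mul, abs_norm] at h2
      rw [hi]
      rw [mul_comm] at h2
      exact le_of_mul_le_mul_right h2 hn
    · refine (abs_le_norm _ i).trans ?_
      rwa [L.norm_map]
  refine (measure_mono hsub).trans ?_
  have hBm : MeasurableSet (Set.pi univ fun i => Icc (-(a i)) (a i)) :=
    MeasurableSet.univ_pi fun i => measurableSet_Icc
  rw [L.measurePreserving.measure_preimage
    ((MeasurableEquiv.toLp 2 (Fin d → ℝ)).symm.measurable hBm).nullMeasurableSet,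
    (EuclideanSpace.volume_preserving_symm_measurableEquiv_toLp (Fin d)).measure_preimage_equiv,
    Set.pi_univ_Icc, Real.volume_Icc_pi, ← Finset.mul_prod_erase Finset.univ _ (Finset.mem_univ i0)]
  have e : ∏ i ∈ Finset.univ.erase i0, ENNReal.ofReal (a i - -a i) ≤ 4 ^ d := by
    calc _ = ∏ i ∈ Finset.univ.erase i0, (4 : ℝ≥0∞) := by
          refine Finset.prod_congr rfl fun i hi => ?_
          simp only [ha, if_neg (Finset.ne_of_mem_erase hi)]
          norm_num
      _ ≤ _ := by
          rw [Finset.prod_const]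
          refine pow_le_pow_right₀ (by norm_num) ?_
          exact (Finset.card_erase_le).trans (by simp)
  refine (mul_le_mul_right e _).trans (le_of_eq ?_)
  simp only [ha, if_true]
  rw [show (4 : ℝ≥0∞) ^ d = ENNReal.ofReal (4 ^ d) by rw [ofReal_pow (by norm_num)]; norm_num,
    ← ofReal_mul (by linarith)]
  congr 1; ring

lemma volume_closedBall_two_le : volume (closedBall (0 : Rd d) 2) ≤ ENNReal.ofReal (4 ^ d) := by
  refine (volume_closedBall_le 0 2 two_pos).trans (le_of_eq ?_)
  rw [← ofReal_pow (by norm_num)]; norm_num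

lemma norm_integral_char_le (a b : ℝ) {t : ℝ} (ht : t ≠ 0) :
    ‖∫ s in Ioc a b, (Real.fourierChar (-(s * t)) : ℂ)‖ ≤ 1 / |t| := by
  have hpi := Real.pi_gt_three
  rcases lt_or_ge b a with hab | hab
  · rw [Ioc_eq_empty (not_lt.2 hab.le)]; simp
  rw [← intervalIntegral.integral_of_le hab]
  set c : ℂ := (-(2 * Real.pi * t) : ℝ) * Complex.I with hc
  have hcn : ‖c‖ = 2 * Real.pi * |t| := by
    rw [hc, norm_mul, Complex.norm_I, Complex.norm_real, norm_neg, norm_mul, norm_mul, mul_one,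
      Real.norm_of_nonneg Real.pi_pos.le, Real.norm_two, Real.norm_eq_abs]
  have ht' : 0 < |t| := abs_pos.2 ht
  have hc0 : c ≠ 0 := by
    rw [← norm_pos_iff, hcn]; positivity
  have e : ∀ s : ℝ, (Real.fourierChar (-(s * t)) : ℂ) = Complex.exp (c * s) := by
    intro s
    rw [Real.fourierChar_apply, hc]; congr 1; push_cast; ring
  have en : ∀ s : ℝ, ‖Complex.exp (c * s)‖ = 1 := fun s => by rw [← e]; exact Circle.norm_coe _
  simp_rw [e]
  rw [integral_exp_mul_complex hc0, norm_div, hcn]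
  have := norm_sub_le (Complex.exp (c * b)) (Complex.exp (c * a))
  rw [en, en] at this
  rw [div_le_div_iff₀ (by positivity) ht']
  nlinarith

section
variable {Ω : Rd d → ℂ} {C : ℝ}

lemma norm_fourier_rk0_low (h : IsRoughKernel Ω C) (hC : 0 ≤ C) (hd : 1 ≤ d) (ξ : Rd d) :
    ‖𝓕 (rk0 Ω) ξ‖ ≤ 16 * 4 ^ d * C * ‖ξ‖ := by
  have hN := nice_rk0 h hC
  rw [← sub_zero (𝓕 (rk0 Ω) ξ), ← integral_rk0 h hd, Real.fourier_eq, ← integral_sub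
    ((Real.fourierIntegral_convergent_iff ξ).2 hN.integrable) hN.integrable]
  refine norm_integral_le_of_lintegral (by positivity) ?_
  have hpi := Real.pi_lt_d2
  calc ∫⁻ v, ‖Real.fourierChar (-(inner ℝ v ξ)) • rk0 Ω v - rk0 Ω v‖ₑ
      ≤ ∫⁻ v, (closedBall (0 : Rd d) 2).indicator (fun _ => ENNReal.ofReal (16 * ‖ξ‖ * C)) v := by
        refine lintegral_mono fun v => ?_
        rcases lt_or_ge 2 ‖v‖ with hv | hv
        · simp [rk0_eq_zero hv]
        rw [indicator_of_mem (mem_closedBall_zero_iff.2 hv), Circle.smul_def, smul_eq_mul, ← sub_one_mul,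
          enorm_mul, ofReal_mul (by positivity)]
        refine mul_le_mul' ?_ (by rw [← ofReal_norm]; exact ofReal_le_ofReal (norm_rk0_le h hC v))
        rw [← ofReal_norm]
        refine ofReal_le_ofReal ?_
        rw [Real.fourierChar_apply, mul_comm (_ : ℂ) Complex.I]
        refine (Real.norm_exp_I_mul_ofReal_sub_one_le).trans ?_
        rw [norm_mul, norm_neg, norm_mul, Real.norm_of_nonneg Real.pi_pos.le, Real.norm_two]
        have h1 : ‖(inner ℝ v ξ : ℝ)‖ ≤ 2 * ‖ξ‖ := (norm_inner_le_norm _ _).trans (by gcongr)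
        calc 2 * Real.pi * ‖(inner ℝ v ξ : ℝ)‖ ≤ 2 * 4 * (2 * ‖ξ‖) := by
              gcongr; linarith
          _ = _ := by ring
    _ ≤ ENNReal.ofReal (16 * ‖ξ‖ * C) * ENNReal.ofReal (4 ^ d) := by
        rw [lintegral_indicator isClosed_closedBall.measurableSet, lintegral_const,
          Measure.restrict_apply_univ]
        exact mul_le_mul_right (volume_closedBall_two_le) _
    _ = _ := by
        rw [← ofReal_mul (by positivity)]; congr 1; ring

/-- The scaled integral defining the Fourier transform of the truncated kernel. -/
def scaledKer (Ω : Rd d → ℂ) (ξ : Rd d) (s : ℝ) (y : Rd d) : ℂ :=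
  {z : ℝ × Rd d | 1 < z.1 * ‖z.2‖ ∧ z.1 * ‖z.2‖ ≤ 2}.indicator
    (fun z => (Real.fourierChar (-(z.1 * inner ℝ z.2 ξ)) : ℂ) * rk Ω z.2) (s, y)

lemma measurableSet_scaled :
    MeasurableSet {z : ℝ × Rd d | 1 < z.1 * ‖z.2‖ ∧ z.1 * ‖z.2‖ ≤ 2} := by
  have h : Measurable fun z : ℝ × Rd d => z.1 * ‖z.2‖ := by fun_prop
  exact (measurableSet_lt measurable_const h).inter (measurableSet_le h measurable_const)

lemma fourier_rk0_eq (h : IsRoughKernel Ω C) (hd : 1 ≤ d) (ξ : Rd d) {s : ℝ} (hs : 0 < s) :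
    𝓕 (rk0 Ω) ξ = ∫ y, scaledKer Ω ξ s y := by
  have e := Measure.integral_comp_smul (volume : Measure (Rd d))
    (fun x => Real.fourierChar (-(inner ℝ x ξ)) • rk0 Ω x) s
  rw [finrank_euclideanSpace, Fintype.card_fin, abs_of_nonneg (by positivity)] at e
  have hsd : ((s : ℂ) ^ d) ≠ 0 := pow_ne_zero _ (by exact_mod_cast hs.ne')
  rw [Real.fourier_eq]
  have e2 : ∫ x, Real.fourierChar (-(inner ℝ x ξ)) • rk0 Ω x =
      (s : ℂ) ^ d * ∫ x, Real.fourierChar (-(inner ℝ (s • x) ξ)) • rk0 Ω (s • x) := by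
    rw [e, Complex.real_smul, ← mul_assoc]
    push_cast
    rw [mul_inv_cancel₀ hsd, one_mul]
  rw [e2, ← integral_const_mul]
  refine integral_congr_ae ((ae_ne_zero hd).mono fun y hy => ?_)
  beta_reduce
  have : s • y ∈ {x : Rd d | 1 < ‖x‖ ∧ ‖x‖ ≤ 2} ↔
      (s, y) ∈ {z : ℝ × Rd d | 1 < z.1 * ‖z.2‖ ∧ z.1 * ‖z.2‖ ≤ 2} := by
    simp only [Set.mem_ofPred_eq, norm_smul, Real.norm_of_nonneg hs.le]
  rw [scaledKer, rk0]
  by_cases hx : s • y ∈ {x : Rd d | 1 < ‖x‖ ∧ ‖x‖ ≤ 2}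
  · rw [indicator_of_mem hx, indicator_of_mem (this.1 hx), rk_smul h hs hy, inner_smul_left,
      Circle.smul_def, smul_eq_mul]
    simp only [conj_trivial]
    push_cast
    field_simp
  · rw [indicator_of_notMem hx, indicator_of_notMem (mt this.2 hx), smul_zero, mul_zero]

lemma norm_rk_le_of_half_le (h : IsRoughKernel Ω C) (hC : 0 ≤ C) {y : Rd d} (hy : 1 / 2 ≤ ‖y‖) :
    ‖rk Ω y‖ ≤ 2 ^ d * C := by
  refine (norm_rk_le h (norm_pos_iff.1 (by linarith))).trans ?_
  rw [mul_comm]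
  refine mul_le_mul_of_nonneg_right ?_ hC
  rw [← inv_pow]
  refine pow_le_pow_left₀ (by positivity) ?_ d
  exact inv_le_of_inv_le₀ two_pos (by linarith)

lemma fourier_rk0_eq_avg (h : IsRoughKernel Ω C) (hC : 0 ≤ C) (hd : 1 ≤ d) (ξ : Rd d) :
    𝓕 (rk0 Ω) ξ = ∫ y in closedBall (0 : Rd d) 2, ∫ s in Ioc (1 : ℝ) 2, scaledKer Ω ξ s y := by
  rw [← integral_integral_swap]
  · have : ∀ s ∈ Ioc (1 : ℝ) 2, ∫ y in closedBall (0 : Rd d) 2, scaledKer Ω ξ s y =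
        𝓕 (rk0 Ω) ξ := by
      intro s hs
      rw [fourier_rk0_eq h hd ξ (zero_lt_one.trans hs.1)]
      refine setIntegral_eq_integral_of_forall_compl_eq_zero fun y hy => indicator_of_notMem ?_ _
      rintro ⟨h1, h2⟩
      rw [mem_closedBall_zero_iff, not_le] at hy
      dsimp only at h2
      nlinarith [hs.1, norm_nonneg y]
    rw [setIntegral_congr_fun measurableSet_Ioc this, setIntegral_const]
    simp [Measure.real]; norm_num
  · have : Fact (volume (closedBall (0 : Rd d) 2) < ⊤) := ⟨measure_closedBall_lt_top⟩
    have : Fact (volume (Ioc (1 : ℝ) 2) < ⊤) := ⟨measure_Ioc_lt_top⟩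
    have hm : Measurable (Function.uncurry (scaledKer Ω ξ)) := by
      have : Function.uncurry (scaledKer Ω ξ) =
        {z : ℝ × Rd d | 1 < z.1 * ‖z.2‖ ∧ z.1 * ‖z.2‖ ≤ 2}.indicator
        (fun z => (Real.fourierChar (-(z.1 * inner ℝ z.2 ξ)) : ℂ) * rk Ω z.2) := rfl
      rw [this]
      refine Measurable.indicator ?_ measurableSet_scaled
      refine Measurable.mul ?_ ((measurable_rk h.1).comp measurable_snd)
      have : Continuous fun z : ℝ × Rd d => (Real.fourierChar (-(z.1 * inner ℝ z.2 ξ)) : ℂ) := by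
        fun_prop
      exact this.measurable
    refine Integrable.of_bound hm.aestronglyMeasurable (2 ^ d * C) ?_
    rw [Measure.prod_restrict]
    refine (ae_restrict_iff' (measurableSet_Ioc.prod isClosed_closedBall.measurableSet)).2
      (ae_of_all _ ?_)
    rintro ⟨s, y⟩ ⟨hs, hy⟩
    rw [Function.uncurry_apply_pair, scaledKer, indicator_apply]
    split_ifs with hz
    · rw [norm_mul, Circle.norm_coe, one_mul]
      refine norm_rk_le_of_half_le h hC ?_
      have h1 := hz.1
      have h2 := hs.2
      dsimp only at h1 h2
      nlinarith [norm_nonneg y]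
    · rw [norm_zero]; positivity

end

section
variable {Ω : Rd d → ℂ} {C : ℝ}

lemma norm_integral_scaledKer_le (h : IsRoughKernel Ω C) (hC : 0 ≤ C) (ξ y : Rd d) {B : ℝ}
    (hB : 1 ≤ B ∨ (inner ℝ y ξ ≠ 0 ∧ 1 / |inner ℝ y ξ| ≤ B)) (hB0 : 0 ≤ B) :
    ‖∫ s in Ioc (1 : ℝ) 2, scaledKer Ω ξ s y‖ ≤ B * (2 ^ d * C) := by
  rcases lt_or_ge ‖y‖ (1 / 2) with hy | hy
  · rw [setIntegral_eq_zero_of_forall_eq_zero, norm_zero]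
    · positivity
    · intro s hs
      refine indicator_of_notMem ?_ _
      rintro ⟨h1, -⟩
      dsimp only at h1
      nlinarith [hs.2, norm_nonneg y]
  have hy0 : 0 < ‖y‖ := by linarith
  have e : ∀ s, scaledKer Ω ξ s y = (Ioc (1 / ‖y‖) (2 / ‖y‖)).indicator
      (fun s => (Real.fourierChar (-(s * inner ℝ y ξ)) : ℂ)) s * rk Ω y := by
    intro s
    have : (s, y) ∈ {z : ℝ × Rd d | 1 < z.1 * ‖z.2‖ ∧ z.1 * ‖z.2‖ ≤ 2} ↔
        s ∈ Ioc (1 / ‖y‖) (2 / ‖y‖) := by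
      rw [mem_Ioc, div_lt_iff₀ hy0, le_div_iff₀ hy0]; rfl
    rw [scaledKer]
    by_cases hs : s ∈ Ioc (1 / ‖y‖) (2 / ‖y‖)
    · rw [indicator_of_mem hs, indicator_of_mem (this.2 hs)]
    · rw [indicator_of_notMem hs, indicator_of_notMem (mt this.1 hs), zero_mul]
  simp_rw [e]
  rw [integral_mul_const, norm_mul]
  refine mul_le_mul ?_ (norm_rk_le_of_half_le h hC hy) (norm_nonneg _) hB0
  rw [setIntegral_indicator measurableSet_Ioc]
  rcases hB with hB | ⟨hB1, hB2⟩
  · refine le_trans ?_ hB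
    have h1 : volume (Ioc (1 : ℝ) 2 ∩ Ioc (1 / ‖y‖) (2 / ‖y‖)) ≤ 1 :=
      (measure_mono inter_subset_left).trans_eq (by rw [Real.volume_Ioc]; norm_num)
    refine (norm_setIntegral_le_of_norm_le_const (C := 1) (h1.trans_lt (by norm_num))
      fun s _ => (Circle.norm_coe _).le).trans ?_
    rw [one_mul]
    exact toReal_le_of_le_ofReal zero_le_one (by simpa using h1)
  · rw [Ioc_inter_Ioc]
    exact (norm_integral_char_le _ _ hB1).trans hB2

lemma norm_fourier_rk0_high (h : IsRoughKernel Ω C) (hC : 0 ≤ C) (hd : 1 ≤ d) {ξ : Rd d} (hξ : ξ ≠ 0) :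
    ‖𝓕 (rk0 Ω) ξ‖ ≤ 3 * 8 ^ d * C * ‖ξ‖ ^ (-(1 / 2) : ℝ) := by
  have hn : 0 < ‖ξ‖ := norm_pos_iff.2 hξ
  set τ : ℝ := ‖ξ‖ ^ (-(1 / 2) : ℝ) with hτ
  have hτ0 : 0 < τ := Real.rpow_pos_of_pos hn _
  have hττ : τ * ‖ξ‖ = τ⁻¹ := by
    rw [hτ, Real.rpow_neg hn.le, inv_inv, ← Real.sqrt_eq_rpow]
    have := Real.sqrt_pos.2 hn
    field_simp
    exact (Real.sq_sqrt hn.le).symm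
  set S : Set (Rd d) := {y : Rd d | ‖y‖ ≤ 2 ∧ |inner ℝ y ξ| ≤ τ * ‖ξ‖} with hS
  have hm : Measurable fun y : Rd d => |inner ℝ y ξ| := by fun_prop
  have hSm : MeasurableSet S := (measurableSet_le measurable_norm measurable_const).inter
    (measurableSet_le hm measurable_const)
  have hB := (isClosed_closedBall (x := (0 : Rd d)) (ε := 2)).measurableSet
  rw [fourier_rk0_eq_avg h hC hd, ← integral_indicator hB]
  refine norm_integral_le_of_lintegral (by positivity) ?_
  calc _ ≤ ∫⁻ y : Rd d, (S.indicator (fun _ => ENNReal.ofReal (2 ^ d * C)) y +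
        (closedBall (0 : Rd d) 2).indicator (fun _ => ENNReal.ofReal (τ * (2 ^ d * C))) y) := by
        refine lintegral_mono fun y => ?_
        by_cases hy : y ∈ closedBall (0 : Rd d) 2
        · rw [indicator_of_mem hy, indicator_of_mem hy, ← ofReal_norm]
          by_cases hyS : y ∈ S
          · rw [indicator_of_mem hyS]
            refine le_trans (ofReal_le_ofReal ?_) le_self_add
            have := norm_integral_scaledKer_le h hC ξ y (B := 1) (Or.inl le_rfl) zero_le_one
            rwa [one_mul] at this
          · refine le_trans (ofReal_le_ofReal ?_) le_add_self
            have h1 : τ⁻¹ < |inner ℝ y ξ| := by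
              rw [← hττ]; by_contra hc
              exact hyS ⟨mem_closedBall_zero_iff.1 hy, not_lt.1 hc⟩
            have h2 : 0 < |inner ℝ y ξ| := (inv_pos.2 hτ0).trans h1
            refine norm_integral_scaledKer_le h hC ξ y (Or.inr ⟨abs_pos.1 h2, ?_⟩) hτ0.le
            rw [one_div]
            exact inv_le_of_inv_le₀ hτ0 h1.le
        · rw [indicator_of_notMem hy, enorm_zero]; exact zero_le
    _ ≤ ENNReal.ofReal (2 ^ d * C) * ENNReal.ofReal (2 * 4 ^ d * τ) +
        ENNReal.ofReal (τ * (2 ^ d * C)) * ENNReal.ofReal (4 ^ d) := by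
        rw [lintegral_add_left (measurable_const.indicator hSm), lintegral_indicator hSm,
          lintegral_indicator hB, lintegral_const, lintegral_const, Measure.restrict_apply_univ,
          Measure.restrict_apply_univ]
        exact add_le_add (mul_le_mul_right (volume_slab_le hd hξ hτ0.le) _)
          (mul_le_mul_right volume_closedBall_two_le _)
    _ = _ := by
        rw [← ofReal_mul (by positivity), ← ofReal_mul (by positivity),
          ← ofReal_add (by positivity) (by positivity),
          show (8 : ℝ) ^ d = 2 ^ d * 4 ^ d by rw [← mul_pow]; norm_num]
        congr 1; ring

lemma norm_fourier_rk0_le (h : IsRoughKernel Ω C) (hC : 0 ≤ C) (hd : 1 ≤ d) {ξ : Rd d} (hξ : ξ ≠ 0) :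
    ‖𝓕 (rk0 Ω) ξ‖ ≤ 16 * 8 ^ d * C * min ‖ξ‖ (‖ξ‖ ^ (-(1 / 2) : ℝ)) := by
  rw [mul_min_of_nonneg _ _ (by positivity)]
  refine le_min ((norm_fourier_rk0_low h hC hd ξ).trans ?_) ((norm_fourier_rk0_high h hC hd hξ).trans ?_)
  · gcongr; norm_num
  · gcongr; norm_num

end

lemma lintegral_scale (i : ℤ) (g : Rd d → ℝ≥0∞) :
    ENNReal.ofReal (((2 : ℝ) ^ (-i)) ^ d) * ∫⁻ x, g ((2 : ℝ) ^ (-i) • x) = ∫⁻ x, g x := by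
  have h2 : (2 : ℝ) ^ (-i) ≠ 0 := by positivity
  have h := (Homeomorph.smulOfNeZero ((2 : ℝ) ^ (-i)) h2 : Rd d ≃ₜ Rd d).measurableEmbedding.lintegral_map
    (μ := volume) g
  have e : (⇑(Homeomorph.smulOfNeZero ((2 : ℝ) ^ (-i)) h2 : Rd d ≃ₜ Rd d)) =
    fun x => (2 : ℝ) ^ (-i) • x := rfl
  rw [e] at h
  rw [← h, Measure.map_addHaar_smul volume h2, lintegral_smul_measure, finrank_euclideanSpace,
    Fintype.card_fin, smul_eq_mul, ← mul_assoc, ← ofReal_mul (by positivity),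
    abs_of_nonneg (by positivity), mul_inv_cancel₀ (by positivity), ofReal_one, one_mul]

/-- Mollification at scale `2 ^ (-m)`. -/
def moll (m : ℕ) (h : Rd d → ℂ) : Rd d → ℂ := cv (dil (-(m : ℤ)) (phi d)) h

lemma enorm_dil (i : ℤ) (κ : Rd d → ℂ) (x : Rd d) :
    ‖dil i κ x‖ₑ = ENNReal.ofReal (((2 : ℝ) ^ (-i)) ^ d) * ‖κ ((2 : ℝ) ^ (-i) • x)‖ₑ := by
  rw [dil, enorm_mul, ← ofReal_norm, Complex.norm_real, Real.norm_of_nonneg (by positivity)]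

lemma Nice.moll {h : Rd d → ℂ} (hh : Nice h) (m : ℕ) : Nice (moll m h) :=
  (nice_phi.dil _).cv_nice hh

section
variable {h : Rd d → ℂ} {C : ℝ}

lemma norm_moll_le (hC0 : 0 ≤ C) (hC : ∀ x, ‖h x‖ ≤ C) (m : ℕ) (x : Rd d) : ‖moll m h x‖ ≤ C := by
  refine norm_integral_le_of_lintegral hC0 ?_
  calc _ ≤ ∫⁻ y : Rd d, ENNReal.ofReal C * ‖dil (-(m : ℤ)) (phi d) (x - y)‖ₑ := by
        refine lintegral_mono fun y => ?_
        rw [enorm_mul]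
        gcongr
        rw [← ofReal_norm]
        exact ofReal_le_ofReal (hC y)
    _ = ENNReal.ofReal C := by
        rw [lintegral_const_mul' _ _ ofReal_ne_top,
          lintegral_sub_left_eq_self (fun y => ‖dil (-(m : ℤ)) (phi d) y‖ₑ) x]
        simp_rw [enorm_dil]
        rw [lintegral_const_mul' _ _ ofReal_ne_top, lintegral_scale (-(m : ℤ)) fun y => ‖phi d y‖ₑ,
          lintegral_phi, mul_one]

lemma norm_moll_sub_le (hh : Nice h) (hC0 : 0 ≤ C) (hC : ∀ x, ‖h x‖ ≤ C) (m : ℕ) (x x' : Rd d) :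
    ‖moll m h x - moll m h x'‖ ≤ C * cphi d * 2 ^ m * ‖x - x'‖ := by
  have hp := nice_phi.dil (d := d) (-(m : ℤ))
  have hc : 0 ≤ cphi d := zero_le_one.trans one_le_cphi
  rw [moll, cv, cv, ← integral_sub (hp.integrable_cv hh x) (hp.integrable_cv hh x')]
  refine norm_integral_le_of_lintegral (by positivity) ?_
  calc _ ≤ ∫⁻ y : Rd d, ENNReal.ofReal C *
        ‖dil (-(m : ℤ)) (phi d) (x - y) - dil (-(m : ℤ)) (phi d) (x' - y)‖ₑ := by
        refine lintegral_mono fun y => ?_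
        rw [← mul_sub, enorm_mul]
        gcongr
        rw [← ofReal_norm]
        exact ofReal_le_ofReal (hC y)
    _ = ENNReal.ofReal C * ∫⁻ y : Rd d,
        ‖dil (-(m : ℤ)) (phi d) (y + (x - x')) - dil (-(m : ℤ)) (phi d) y‖ₑ := by
        rw [lintegral_const_mul' _ _ ofReal_ne_top,
          ← lintegral_sub_left_eq_self (fun y => ‖dil (-(m : ℤ)) (phi d) (y + (x - x')) -
            dil (-(m : ℤ)) (phi d) y‖ₑ) x']
        simp_rw [show ∀ y, x' - y + (x - x') = x - y from fun y => by abel]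
    _ = ENNReal.ofReal C * ∫⁻ y : Rd d,
        ‖phi d (y + (2 : ℝ) ^ m • (x - x')) - phi d y‖ₑ := by
        rw [← lintegral_scale (-(m : ℤ)) fun y => ‖phi d (y + (2 : ℝ) ^ m • (x - x')) - phi d y‖ₑ]
        congr 1
        rw [← lintegral_const_mul' _ _ ofReal_ne_top]
        refine lintegral_congr fun y => ?_
        rw [dil, dil, ← mul_sub, enorm_mul, ← ofReal_norm, Complex.norm_real,
          Real.norm_of_nonneg (by positivity), smul_add, neg_neg, zpow_natCast]
    _ ≤ ENNReal.ofReal C * ENNReal.ofReal (cphi d * ‖(2 : ℝ) ^ m • (x - x')‖) := by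
        gcongr; exact lintegral_phi_sub_le _
    _ = _ := by
        rw [← ofReal_mul hC0, norm_smul, Real.norm_of_nonneg (by positivity)]
        congr 1; ring

lemma moll_eq_zero {R : ℝ} (hR : ∀ x, R < ‖x‖ → h x = 0) (m : ℕ) {x : Rd d} (hx : R + 1 < ‖x‖) :
    moll m h x = 0 := by
  rw [moll, cv]
  refine integral_eq_zero_of_ae (Eventually.of_forall fun y => ?_)
  show h y * _ = 0
  rcases lt_or_ge R ‖y‖ with hy | hy
  · rw [hR y hy, zero_mul]
  · rw [dil_eq_zero (R := 1) (fun x hx => phi_eq_zero hx), mul_zero]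
    have h1 : ‖x‖ - ‖y‖ ≤ ‖x - y‖ := norm_sub_norm_le x y
    have h2 : (2 : ℝ) ^ (-(m : ℤ)) ≤ 1 := zpow_le_one_of_nonpos₀ one_le_two (by simp)
    linarith

lemma fourier_moll (hh : Nice h) (m : ℕ) (ξ : Rd d) :
    𝓕 (moll m h) ξ = 𝓕 (phi d) ((2 : ℝ) ^ (-(m : ℤ)) • ξ) * 𝓕 h ξ := by
  rw [moll, (nice_phi.dil _).fourier_cv hh, fourier_dil]

end

/-- Difference of two mollified symbols of the bump. -/
lemma norm_fourier_phi_sub_le {a b : ℕ} (hab : a ≤ b) {ξ : Rd d} :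
    ‖𝓕 (phi d) ((2 : ℝ) ^ (-(b : ℤ)) • ξ) - 𝓕 (phi d) ((2 : ℝ) ^ (-(a : ℤ)) • ξ)‖ ≤
      16 * ((2 : ℝ) ^ (-(a : ℤ)) * ‖ξ‖) ^ (1 / 4 : ℝ) := by
  set u := 𝓕 (phi d) ((2 : ℝ) ^ (-(b : ℤ)) • ξ)
  set v := 𝓕 (phi d) ((2 : ℝ) ^ (-(a : ℤ)) • ξ)
  set s := (2 : ℝ) ^ (-(a : ℤ)) * ‖ξ‖ with hs
  have hs0 : 0 ≤ s := by positivity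
  rcases le_or_gt 1 s with h1 | h1
  · have h2 : ‖u - v‖ ≤ 2 := (norm_sub_le _ _).trans (by
      linarith [norm_fourier_phi_le_one ((2 : ℝ) ^ (-(b : ℤ)) • ξ),
        norm_fourier_phi_le_one ((2 : ℝ) ^ (-(a : ℤ)) • ξ)])
    have := Real.one_le_rpow h1 (by norm_num : (0 : ℝ) ≤ 1 / 4)
    linarith
  · have hu := norm_fourier_phi_sub_one_le ((2 : ℝ) ^ (-(b : ℤ)) • ξ)
    have hv := norm_fourier_phi_sub_one_le ((2 : ℝ) ^ (-(a : ℤ)) • ξ)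
    rw [norm_zpow_smul] at hu hv
    have hba : (2 : ℝ) ^ (-(b : ℤ)) * ‖ξ‖ ≤ s := by
      rw [hs]; gcongr; simp
    have h2 : ‖u - v‖ ≤ ‖u - 1‖ + ‖v - 1‖ := by
      rw [show u - v = (u - 1) - (v - 1) by ring]; exact norm_sub_le _ _
    have h3 : s ≤ s ^ (1 / 4 : ℝ) := by
      rcases hs0.eq_or_lt with h0 | h0
      · rw [← h0]; positivity
      · conv_lhs => rw [← Real.rpow_one s]
        exact Real.rpow_le_rpow_of_exponent_ge h0 h1.le (by norm_num)
    have hπ := Real.pi_lt_four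
    have hπ0 := Real.pi_pos
    nlinarith [mul_le_mul_of_nonneg_left hba (by positivity : (0 : ℝ) ≤ 2 * Real.pi)]

lemma rpow_quarter_mul_min_le {t : ℝ} (ht : 0 < t) :
    t ^ (1 / 4 : ℝ) * min t (t ^ (-(1 / 2) : ℝ)) ≤ dec t := by
  rw [dec]
  refine le_min ?_ ?_
  · rcases le_or_gt t 1 with h | h
    · exact (mul_le_mul_of_nonneg_left ((min_le_left _ _).trans h) (by positivity)).trans_eq (mul_one _)
    · refine (mul_le_mul_of_nonneg_left ((min_le_right _ _).trans ?_) (by positivity)).trans_eq (mul_one _)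
      exact Real.rpow_le_one_of_one_le_of_nonpos h.le (by norm_num)
  · refine (mul_le_mul_of_nonneg_left (min_le_right _ _) (by positivity)).trans_eq ?_
    rw [← Real.rpow_add ht]; norm_num

lemma min_le_dec {t : ℝ} (ht : 0 < t) : min t (t ^ (-(1 / 2) : ℝ)) ≤ dec t := by
  rw [dec]
  rcases le_or_gt t 1 with h | h
  · refine (min_le_left _ _).trans (le_min ?_ ?_)
    · conv_lhs => rw [← Real.rpow_one t]
      exact Real.rpow_le_rpow_of_exponent_ge ht h (by norm_num)
    · exact h.trans (Real.one_le_rpow_of_pos_of_le_one_of_nonpos ht h (by norm_num))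
  · refine (min_le_right _ _).trans (le_min ?_ ?_)
    · exact Real.rpow_le_rpow_of_exponent_le h.le (by norm_num)
    · exact Real.rpow_le_rpow_of_exponent_le h.le (by norm_num)

/-- The constant in the kernel bounds for mollified rough kernels. -/
def cker (d : ℕ) (C : ℝ) : ℝ := 512 * 8 ^ d * C * cphi d

section
variable {Ω : Rd d → ℂ} {C : ℝ}

lemma ker_moll (h : IsRoughKernel Ω C) (hC : 0 ≤ C) (m : ℕ) : Ker (moll m (rk0 Ω)) (2 * C * cphi d) m where
  meas := ((nice_rk0 h hC).moll m).1
  supp x hx := moll_eq_zero (R := 2) (fun y hy => rk0_eq_zero hy) m (by linarith)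
  bdd x := (norm_moll_le hC (norm_rk0_le h hC) m x).trans (by
    nlinarith [one_le_cphi (d := d), mul_nonneg hC (zero_le_one.trans (one_le_cphi (d := d)))])
  lip x y := (norm_moll_sub_le (nice_rk0 h hC) hC (norm_rk0_le h hC) m x y).trans (by
    have := zero_le_one.trans (one_le_cphi (d := d))
    gcongr; linarith)

lemma ker_moll_sub (h : IsRoughKernel Ω C) (hC : 0 ≤ C) {a b : ℕ} (hab : a ≤ b) :
    Ker (fun x => moll b (rk0 Ω) x - moll a (rk0 Ω) x) (4 * C * cphi d) b where
  meas := ((nice_rk0 h hC).moll b).1.sub ((nice_rk0 h hC).moll a).1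
  supp x hx := by rw [(ker_moll h hC b).supp x hx, (ker_moll h hC a).supp x hx, sub_zero]
  bdd x := (norm_sub_le _ _).trans (by
    linarith [(ker_moll h hC b).bdd x, (ker_moll h hC a).bdd x])
  lip x y := by
    have h1 := (ker_moll h hC b).lip x y
    have h2 := (ker_moll h hC a).lip x y
    have h3 : 2 * C * cphi d * 2 ^ a * ‖x - y‖ ≤ 2 * C * cphi d * 2 ^ b * ‖x - y‖ := by
      have := zero_le_one.trans (one_le_cphi (d := d))
      gcongr; norm_num
    rw [sub_sub_sub_comm]
    exact (norm_sub_le _ _).trans ((add_le_add h1 (h2.trans h3)).trans_eq (by ring))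

end

lemma Ker.mono {κ : Rd d → ℂ} {A A' : ℝ} {N : ℕ} (h : Ker κ A N) (hA : A ≤ A') : Ker κ A' N where
  meas := h.meas
  supp := h.supp
  bdd x := (h.bdd x).trans hA
  lip x y := (h.lip x y).trans (by gcongr)

lemma le_cker {C : ℝ} (hC : 0 ≤ C) : 4 * C * cphi d ≤ cker d C := by
  have h1 : (1 : ℝ) ≤ 8 ^ d := one_le_pow₀ (by norm_num)
  have h2 : 0 ≤ C * cphi d := mul_nonneg hC (zero_le_one.trans one_le_cphi)
  rw [cker]; nlinarith

section
variable {Ω : Rd d → ℂ} {C : ℝ}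

lemma norm_fourier_moll_zero_le (h : IsRoughKernel Ω C) (hC : 0 ≤ C) (hd : 1 ≤ d) {ξ : Rd d} (hξ : ξ ≠ 0) :
    ‖𝓕 (moll 0 (rk0 Ω)) ξ‖ ≤ cker d C * 2 ^ (-((0 : ℕ) / 8 : ℝ)) * dec ‖ξ‖ := by
  have hn : 0 < ‖ξ‖ := norm_pos_iff.2 hξ
  have hK : 16 * 8 ^ d * C ≤ cker d C := by
    have h2 : 0 ≤ 8 ^ d * C := by positivity
    have := one_le_cphi (d := d)
    rw [cker]; nlinarith
  rw [fourier_moll (nice_rk0 h hC), norm_mul]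
  calc _ ≤ 1 * (16 * 8 ^ d * C * min ‖ξ‖ (‖ξ‖ ^ (-(1 / 2) : ℝ))) :=
        mul_le_mul (norm_fourier_phi_le_one _) (norm_fourier_rk0_le h hC hd hξ) (norm_nonneg _) zero_le_one
    _ ≤ cker d C * dec ‖ξ‖ := by
        rw [one_mul]
        have := dec_nonneg hn.le
        exact mul_le_mul hK (min_le_dec hn) (by positivity) (le_trans (by positivity) hK)
    _ = _ := by simp

lemma norm_fourier_moll_sub_le (h : IsRoughKernel Ω C) (hC : 0 ≤ C) (hd : 1 ≤ d) {a b : ℕ} (hab : a ≤ b)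
    (hba : b ≤ 2 * a + 1) {ξ : Rd d} (hξ : ξ ≠ 0) :
    ‖𝓕 (fun x => moll b (rk0 Ω) x - moll a (rk0 Ω) x) ξ‖ ≤ cker d C * 2 ^ (-(b / 8 : ℝ)) * dec ‖ξ‖ := by
  have hn : 0 < ‖ξ‖ := norm_pos_iff.2 hξ
  have hh := nice_rk0 h hC
  have hde := dec_nonneg hn.le
  rw [fourier_sub (hh.moll b) (hh.moll a), fourier_moll hh, fourier_moll hh, ← sub_mul, norm_mul]
  have h2 : ((2 : ℝ) ^ (-(a : ℤ))) ^ (1 / 4 : ℝ) ≤ 2 * 2 ^ (-(b / 8 : ℝ)) := by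
    rw [← Real.rpow_intCast, ← Real.rpow_mul (by norm_num)]
    calc _ ≤ (2 : ℝ) ^ (1 + -(b / 8 : ℝ)) := by
          refine Real.rpow_le_rpow_of_exponent_le (by norm_num) ?_
          have : (b : ℝ) ≤ 2 * a + 1 := by exact_mod_cast hba
          push_cast; linarith
      _ = _ := by rw [Real.rpow_add (by norm_num), Real.rpow_one]
  calc _ ≤ 16 * ((2 : ℝ) ^ (-(a : ℤ)) * ‖ξ‖) ^ (1 / 4 : ℝ) *
        (16 * 8 ^ d * C * min ‖ξ‖ (‖ξ‖ ^ (-(1 / 2) : ℝ))) :=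
        mul_le_mul (norm_fourier_phi_sub_le hab) (norm_fourier_rk0_le h hC hd hξ) (norm_nonneg _) (by positivity)
    _ = 256 * 8 ^ d * C * (((2 : ℝ) ^ (-(a : ℤ))) ^ (1 / 4 : ℝ) *
        (‖ξ‖ ^ (1 / 4 : ℝ) * min ‖ξ‖ (‖ξ‖ ^ (-(1 / 2) : ℝ)))) := by
        rw [Real.mul_rpow (by positivity) hn.le]; ring
    _ ≤ 256 * 8 ^ d * C * (2 * 2 ^ (-(b / 8 : ℝ)) * dec ‖ξ‖) := by
        gcongr; exact rpow_quarter_mul_min_le hn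
    _ = 512 * 8 ^ d * C * 1 * 2 ^ (-(b / 8 : ℝ)) * dec ‖ξ‖ := by ring
    _ ≤ _ := by rw [cker]; gcongr; exact one_le_cphi

end

lemma norm_moll_sub_self_le {h : Rd d → ℂ} (hh : Nice h) (m : ℕ) (x : Rd d)
    (hm : (0 : ℝ) < 2 ^ (-(m : ℤ))) :
    ‖moll m h x - h x‖ₑ ≤ ENNReal.ofReal (cphi d * 2 ^ d) * ((qvol (cubeAt x _ hm))⁻¹ *
      ∫⁻ y in (cubeAt x _ hm).set, ‖h y - h x‖ₑ) := by
  have hp := nice_phi.dil (d := d) (-(m : ℤ))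
  have hc : 0 ≤ cphi d := zero_le_one.trans one_le_cphi
  have e1 : ∫ y, dil (-(m : ℤ)) (phi d) (x - y) = 1 := by
    rw [integral_sub_left_eq_self (fun y => dil (-(m : ℤ)) (phi d) y) volume x]
    have := fourier_dil (phi d) (-(m : ℤ)) 0
    rw [smul_zero, Real.fourier_eq, Real.fourier_eq] at this
    simpa [integral_phi] using this
  have e2 : h x = ∫ y, h x * dil (-(m : ℤ)) (phi d) (x - y) := by
    rw [integral_const_mul, e1, mul_one]
  rw [moll, cv, e2, ← integral_sub (hp.integrable_cv hh x) ((hp.integrable.comp_sub_left x).const_mul _),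
    ← e2]
  refine (enorm_integral_le_lintegral_enorm _).trans ?_
  have hQ : qvol (cubeAt x _ hm) = ENNReal.ofReal ((2 * 2 ^ (-(m : ℤ))) ^ d) := by
    rw [qvol_cubeAt, ofReal_pow (by positivity)]
  calc _ ≤ ∫⁻ y in (cubeAt x _ hm).set, ENNReal.ofReal (((2 : ℝ) ^ (m : ℤ)) ^ d * cphi d) * ‖h y - h x‖ₑ := by
        rw [← lintegral_indicator (measurableSet_set _)]
        refine lintegral_mono fun y => ?_
        by_cases hy : y ∈ (cubeAt x _ hm).set
        · rw [indicator_of_mem hy, ← sub_mul, enorm_mul, mul_comm]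
          gcongr
          rw [← ofReal_norm]
          refine ofReal_le_ofReal ((norm_dil_le norm_phi_le _ _).trans_eq ?_)
          rw [neg_neg]
        · rw [indicator_of_notMem hy, dil_eq_zero (R := 1) (fun x hx => phi_eq_zero hx), mul_zero, mul_zero,
            sub_self, enorm_zero]
          by_contra hlt
          refine hy (closedBall_subset_cubeAt x _ hm ?_)
          rw [mem_closedBall, dist_comm, dist_eq_norm]
          linarith
    _ = _ := by
        rw [lintegral_const_mul' _ _ ofReal_ne_top, ← mul_assoc, hQ,
          ← ofReal_inv_of_pos (by positivity), ← ofReal_mul (by positivity)]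
        congr 2
        rw [zpow_neg, mul_pow, inv_pow]
        field_simp

lemma ae_tendsto_moll (hd : 1 ≤ d) {h : Rd d → ℂ} (hh : Nice h) :
    ∀ᵐ x, Tendsto (fun m : ℕ => moll m h x) atTop (𝓝 (h x)) := by
  filter_upwards [ae_lebesgue_point hd hh.integrable.locallyIntegrable] with x hx
  rw [tendsto_iff_edist_tendsto_0, ENNReal.tendsto_nhds_zero]
  intro ε hε
  set c := ENNReal.ofReal (cphi d * 2 ^ d) with hc
  have hc0 : c ≠ 0 := by
    rw [hc, Ne, ofReal_eq_zero, not_le]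
    have := one_le_cphi (d := d)
    positivity
  obtain ⟨r, hr, H⟩ := hx (ε / c) (ENNReal.div_pos hε.ne' ofReal_ne_top)
  obtain ⟨M, hM⟩ := exists_pow_lt_of_lt_one (half_pos hr) (by norm_num : (1 / 2 : ℝ) < 1)
  filter_upwards [eventually_ge_atTop M] with m hmM
  have hm : (0 : ℝ) < 2 ^ (-(m : ℤ)) := by positivity
  rw [edist_eq_enorm_sub]
  refine (norm_moll_sub_self_le hh m x hm).trans ?_
  rw [← hc]
  refine (mul_le_mul_right (H _ (mem_cubeAt x _ hm) ?_) c).trans_eq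
    (ENNReal.mul_div_cancel hc0 ofReal_ne_top)
  rw [cubeAt_side]
  have : (2 : ℝ) ^ (-(m : ℤ)) ≤ (1 / 2) ^ M := by
    rw [zpow_neg, zpow_natCast, one_div, inv_pow]
    gcongr; norm_num
  linarith

lemma tendsto_cv_moll (hd : 1 ≤ d) {h g : Rd d → ℂ} (hh : Nice h) (hg : Nice g) (i : ℤ) (x : Rd d) :
    Tendsto (fun m : ℕ => cv (dil i (moll m h)) g x) atTop (𝓝 (cv (dil i h) g x)) := by
  obtain ⟨M, hM0, hM⟩ := hh.bdd
  have hq : Measure.QuasiMeasurePreserving (fun y : Rd d => (2 : ℝ) ^ (-i) • (x - y)) volume volume :=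
    (Measure.quasiMeasurePreserving_smul volume (by positivity : (2 : ℝ) ^ (-i) ≠ 0)).comp
      (quasiMeasurePreserving_sub_left_of_right_invariant volume x)
  refine tendsto_integral_of_dominated_convergence (fun y => ‖g y‖ * (((2 : ℝ) ^ (-i)) ^ d * M))
    (fun m => ((((hh.moll m).dil i)).integrable_cv hg x).aestronglyMeasurable)
    (hg.integrable.norm.mul_const _) (fun m => Eventually.of_forall fun y => ?_) ?_
  · rw [norm_mul]
    exact mul_le_mul_of_nonneg_left (norm_dil_le (norm_moll_le hM0.le hM m) _ _) (norm_nonneg _)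
  · filter_upwards [hq.ae (ae_tendsto_moll hd hh)] with y hy
    exact (hy.const_mul _).const_mul _

lemma mx_le_liminf (hd : 1 ≤ d) {h g : Rd d → ℂ} (hh : Nice h) (hg : Nice g) (b l : ℤ) (x : Rd d)
    {N : ℕ → ℕ} (hN : Tendsto N atTop atTop) :
    mx h b l g x ≤ liminf (fun J => mx (moll (N J) h) b l g x) atTop := by
  refine iSup₂_le fun k hk => ?_
  have h1 : Tendsto (fun J => ‖tl (moll (N J) h) g k l x‖ₑ) atTop (𝓝 ‖tl h g k l x‖ₑ) := by
    refine Tendsto.enorm ?_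
    exact tendsto_finsetSum _ fun i _ => (tendsto_cv_moll hd hh hg i x).comp hN
  rw [← h1.liminf_eq]
  exact liminf_le_liminf (Eventually.of_forall fun J => le_iSup₂_of_le k hk le_rfl)

lemma tl_sub_left {κ κ' f : Rd d → ℂ} (hκ : Nice κ) (hκ' : Nice κ') (hf : Nice f) (k l : ℤ) (x : Rd d) :
    tl (fun y => κ y - κ' y) f k l x = tl κ f k l x - tl κ' f k l x := by
  rw [tl, tl, tl, ← Finset.sum_sub_distrib]
  refine Finset.sum_congr rfl fun i _ => ?_
  rw [← cv_sub_left (hκ.dil i) (hκ'.dil i) hf]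
  congr 1
  ext y
  rw [dil, dil, dil, mul_sub]

lemma mx_le_add_sub {κ κ' f : Rd d → ℂ} (hκ : Nice κ) (hκ' : Nice κ') (hf : Nice f) (b l : ℤ) (x : Rd d) :
    mx κ b l f x ≤ mx κ' b l f x + mx (fun y => κ y - κ' y) b l f x := by
  refine iSup₂_le fun k hk => ?_
  calc ‖tl κ f k l x‖ₑ = ‖tl κ' f k l x + tl (fun y => κ y - κ' y) f k l x‖ₑ := by
        rw [tl_sub_left hκ hκ' hf, add_sub_cancel]
    _ ≤ _ := (enorm_add_le _ _).trans (add_le_add (le_iSup₂_of_le k hk le_rfl) (le_iSup₂_of_le k hk le_rfl))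

section
variable {α : Type*} [MeasurableSpace α] {μ : Measure α} {p : ℝ}

lemma lintegral_add_rpow_le (hp : 1 ≤ p) {f g : α → ℝ≥0∞} (hf : Measurable f) (hg : Measurable g)
    {a b : ℝ≥0∞} (ha : ∫⁻ x, f x ^ p ∂μ ≤ a ^ p) (hb : ∫⁻ x, g x ^ p ∂μ ≤ b ^ p) :
    ∫⁻ x, (f x + g x) ^ p ∂μ ≤ (a + b) ^ p := by
  have hp0 : 0 < p := by linarith
  have h := lintegral_Lp_add_le (μ := μ) hf.aemeasurable hg.aemeasurable hp
  rw [one_div, rpow_inv_le_iff hp0] at h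
  refine h.trans (rpow_le_rpow (add_le_add ?_ ?_) hp0.le)
  · rwa [rpow_inv_le_iff hp0]
  · rwa [rpow_inv_le_iff hp0]

lemma lintegral_sum_rpow_le (hp : 1 ≤ p) {f : ℕ → α → ℝ≥0∞} (hf : ∀ j, Measurable (f j))
    {a : ℕ → ℝ≥0∞} (ha : ∀ j, ∫⁻ x, f j x ^ p ∂μ ≤ a j ^ p) (J : ℕ) :
    ∫⁻ x, (∑ j ∈ Finset.range J, f j x) ^ p ∂μ ≤ (∑ j ∈ Finset.range J, a j) ^ p := by
  have hp0 : 0 < p := by linarith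
  induction J with
  | zero => simp [zero_rpow_of_pos hp0]
  | succ J ih =>
    simp_rw [Finset.sum_range_succ]
    exact lintegral_add_rpow_le hp (Finset.measurable_fun_sum _ fun j _ => hf j) (hf J) ih (ha J)

lemma lintegral_tsum_rpow_le (hp : 1 ≤ p) {f : ℕ → α → ℝ≥0∞} (hf : ∀ j, Measurable (f j))
    {a : ℕ → ℝ≥0∞} (ha : ∀ j, ∫⁻ x, f j x ^ p ∂μ ≤ a j ^ p) :
    ∫⁻ x, (∑' j, f j x) ^ p ∂μ ≤ (∑' j, a j) ^ p := by
  have hp0 : 0 < p := by linarith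
  have e : ∀ x, (∑' j, f j x) ^ p = liminf (fun J => (∑ j ∈ Finset.range J, f j x) ^ p) atTop := fun x =>
    (((continuous_rpow_const (y := p)).tendsto _).comp
      (tendsto_nat_tsum fun j => f j x)).liminf_eq.symm
  simp_rw [e]
  refine (lintegral_liminf_le fun J =>
    (Finset.measurable_fun_sum _ fun j _ => hf j).pow_const p).trans ?_
  refine liminf_le_of_frequently_le' (Frequently.of_forall fun J => ?_)
  exact (lintegral_sum_rpow_le hp hf ha J).trans
    (rpow_le_rpow (ENNReal.sum_le_tsum _) hp0.le)

end

lemma avg_eq_lintegral (P : Cube d) (g : Rd d → ℝ≥0∞) :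
    (qvol P)⁻¹ * ∫⁻ x in P.set, g x = ∫⁻ x, g x ∂((qvol P)⁻¹ • volume.restrict P.set) := by
  rw [lintegral_smul_measure, smul_eq_mul]

lemma sum_two_pow_mul_le {x : ℝ} (h0 : 0 < x) (h1 : x < 1) (J : ℕ) :
    ∑ j ∈ Finset.range J, (2 : ℝ) ^ j * x ^ (2 ^ j - 1) ≤ 2 * (1 - x)⁻¹ := by
  have H : ∀ J : ℕ, ∑ j ∈ Finset.range (J + 1), (2 : ℝ) ^ j * x ^ (2 ^ j - 1) ≤
      2 * ∑ m ∈ Finset.range (2 ^ J), x ^ m := by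
    intro J
    induction J with
    | zero => norm_num
    | succ J ih =>
      rw [Finset.sum_range_succ]
      have e : ∑ m ∈ Finset.range (2 ^ (J + 1)), x ^ m =
          ∑ m ∈ Finset.range (2 ^ J), x ^ m + ∑ m ∈ Finset.range (2 ^ J), x ^ (2 ^ J + m) := by
        rw [pow_succ, mul_two, Finset.sum_range_add]
      have e2 : (2 : ℝ) ^ J * x ^ (2 ^ (J + 1) - 1) ≤ ∑ m ∈ Finset.range (2 ^ J), x ^ (2 ^ J + m) := by
        have := Finset.card_nsmul_le_sum (Finset.range (2 ^ J)) (fun m => x ^ (2 ^ J + m))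
          (x ^ (2 ^ (J + 1) - 1)) (fun m hm => by
            refine pow_le_pow_of_le_one h0.le h1.le ?_
            have := Finset.mem_range.1 hm
            rw [pow_succ]; omega)
        simpa using this
      rw [e, pow_succ]
      linarith
  have h2 : ∀ J, ∑ m ∈ Finset.range J, x ^ m ≤ (1 - x)⁻¹ := fun J => by
    rw [← tsum_geometric_of_lt_one h0.le h1]
    exact (summable_geometric_of_lt_one h0.le h1).sum_le_tsum _ fun i _ => by positivity
  calc _ ≤ ∑ j ∈ Finset.range (J + 1), (2 : ℝ) ^ j * x ^ (2 ^ j - 1) :=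
        Finset.sum_le_sum_of_subset_of_nonneg (Finset.range_mono (Nat.le_succ _))
          fun j _ _ => by positivity
    _ ≤ _ := (H J).trans (mul_le_mul_of_nonneg_left (h2 _) (by norm_num))

lemma one_sub_two_rpow_inv_le {c v : ℝ} (hc : 0 < c) (hv : 1 ≤ v) :
    (1 - (2 : ℝ) ^ (-(c / v)))⁻¹ ≤ (1 + (c * Real.log 2)⁻¹) * v := by
  have hl := Real.log_pos one_lt_two
  have hv0 : 0 < v := by linarith
  set y := c * Real.log 2 / v with hy
  have hy0 : 0 < y := by positivity
  have e : (2 : ℝ) ^ (-(c / v)) = (Real.exp y)⁻¹ := by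
    rw [← Real.exp_neg, Real.rpow_def_of_pos two_pos]; congr 1; rw [hy]; ring
  have h1 : 1 + y ≤ Real.exp y := by linarith [Real.add_one_le_exp y]
  have h2 : (Real.exp y)⁻¹ ≤ (1 + y)⁻¹ := inv_anti₀ (by positivity) h1
  have h3 : y / (1 + y) ≤ 1 - (2 : ℝ) ^ (-(c / v)) := by
    rw [e]
    have : y / (1 + y) = 1 - (1 + y)⁻¹ := by field_simp; ring
    linarith
  calc _ ≤ (y / (1 + y))⁻¹ := inv_anti₀ (by positivity) h3
    _ = 1 + y⁻¹ := by field_simp; ring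
    _ = 1 + (c * Real.log 2)⁻¹ * v := by rw [hy]; field_simp
    _ ≤ _ := by nlinarith

/-- Dyadic-scale kernels in the decomposition of a mollified rough kernel. -/
def kseq (Ω : Rd d → ℂ) : ℕ → Rd d → ℂ
  | 0 => moll 0 (rk0 Ω)
  | j + 1 => fun x => moll (2 ^ (j + 1) - 1) (rk0 Ω) x - moll (2 ^ j - 1) (rk0 Ω) x

section
variable {Ω : Rd d → ℂ} {C : ℝ}

lemma ker_kseq (h : IsRoughKernel Ω C) (hC : 0 ≤ C) (j : ℕ) : Ker (kseq Ω j) (cker d C) (2 ^ j - 1) := by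
  have hc := le_cker (d := d) hC
  cases j with
  | zero =>
    refine (ker_moll h hC 0).mono (le_trans ?_ hc)
    have := mul_nonneg hC (zero_le_one.trans (one_le_cphi (d := d)))
    linarith
  | succ j =>
    exact (ker_moll_sub h hC (Nat.sub_le_sub_right (Nat.pow_le_pow_right two_pos (Nat.le_succ j)) 1)).mono hc

lemma norm_fourier_kseq_le (h : IsRoughKernel Ω C) (hC : 0 ≤ C) (hd : 1 ≤ d) (j : ℕ) {ξ : Rd d} (hξ : ξ ≠ 0) :
    ‖𝓕 (kseq Ω j) ξ‖ ≤ cker d C * 2 ^ (-((2 ^ j - 1 : ℕ) / 8 : ℝ)) * dec ‖ξ‖ := by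
  cases j with
  | zero => exact norm_fourier_moll_zero_le h hC hd hξ
  | succ j =>
    refine norm_fourier_moll_sub_le h hC hd
      (Nat.sub_le_sub_right (Nat.pow_le_pow_right two_pos (Nat.le_succ j)) 1) ?_ hξ
    have := Nat.one_le_two_pow (n := j)
    rw [pow_succ]; omega

lemma mx_moll_le_sum (h : IsRoughKernel Ω C) (hC : 0 ≤ C) {f : Rd d → ℂ} (hf : Nice f) (b l : ℤ) (x : Rd d)
    (J : ℕ) : mx (moll (2 ^ J - 1) (rk0 Ω)) b l f x ≤ ∑ j ∈ Finset.range (J + 1), mx (kseq Ω j) b l f x := by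
  have hh := nice_rk0 h hC
  induction J with
  | zero => simp [kseq]
  | succ J ih =>
    rw [Finset.sum_range_succ]
    exact (mx_le_add_sub (hh.moll _) (hh.moll (2 ^ J - 1)) hf b l x).trans (add_le_add_left ih _)

end

theorem rough_mx (hd : 1 ≤ d) {r C : ℝ} (hr : 1 < r) (hr2 : r < 2) (hC : 0 < C) :
    ∃ K : ℝ, 0 < K ∧ ∀ Ω : Rd d → ℂ, IsRoughKernel Ω C → ∀ v : ℝ, 2 ≤ v →
      ∀ (b l : ℤ) (f : Rd d → ℂ), Nice f → ∃ G : Rd d → ℝ≥0∞, Measurable G ∧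
        ∫⁻ x, G x ^ r ≤ ENNReal.ofReal ((K * v) ^ r) * ∫⁻ x, ‖f x‖ₑ ^ r ∧
        ∀ (P : Cube d) (z : Rd d), z ∈ P.set →
          (qvol P)⁻¹ * ∫⁻ x in P.set, mx (rk0 Ω) b l (outer f P) x ^ v ≤ G z ^ v := by
  have hA : 0 < cker d C := by
    have := one_le_cphi (d := d)
    rw [cker]; positivity
  have hr0 : 0 < r := by linarith
  obtain ⟨C1, c, hC1, hc, H⟩ := Ker.grand hd hr hr2 hA
  have hl := Real.log_pos one_lt_two
  refine ⟨C1 * (2 * (1 + (c * Real.log 2)⁻¹)), by positivity, fun Ω hΩ v hv b l f hf => ?_⟩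
  have hv0 : 0 < v := by linarith
  choose G hGm hG1 hG2 using fun j => H (kseq Ω j) (2 ^ j - 1) (ker_kseq hΩ hC.le j)
    (fun ξ hξ => norm_fourier_kseq_le hΩ hC.le hd j hξ) v hv b l f hf
  refine ⟨fun x => ∑' j, G j x, Measurable.tsum hGm, ?_, fun P z hz => ?_⟩
  · set F := ∫⁻ x, ‖f x‖ₑ ^ r with hF
    set x : ℝ := 2 ^ (-(c / v)) with hx
    have hx0 : 0 < x := Real.rpow_pos_of_pos two_pos _
    have hx1 : x < 1 := Real.rpow_lt_one_of_one_lt_of_neg one_lt_two (neg_lt_zero.2 (by positivity))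
    set a : ℕ → ℝ≥0∞ := fun j => ENNReal.ofReal (C1 * (2 ^ j * x ^ (2 ^ j - 1))) with ha
    have h1 : ∀ j, ∫⁻ y, G j y ^ r ≤ (a j * F ^ r⁻¹) ^ r := by
      intro j
      refine (hG1 j).trans_eq ?_
      rw [mul_rpow_of_nonneg _ _ hr0.le, rpow_inv_rpow hr0.ne', ha]
      beta_reduce
      rw [ofReal_rpow_of_nonneg (by positivity) hr0.le]
      congr 3
      rw [mul_assoc]
      congr 2
      · have := Nat.one_le_two_pow (n := j)
        push_cast [Nat.cast_sub this]; ring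
      · rw [hx, ← Real.rpow_natCast, ← Real.rpow_mul (by norm_num)]
        congr 1; ring
    refine (lintegral_tsum_rpow_le hr.le hGm h1).trans ?_
    rw [ENNReal.tsum_mul_right, mul_rpow_of_nonneg _ _ hr0.le, rpow_inv_rpow hr0.ne',
      ← ofReal_rpow_of_nonneg (by positivity) hr0.le]
    gcongr
    refine tsum_le_of_sum_range_le fun J => ?_
    rw [ha, ← ofReal_sum_of_nonneg fun j _ => by positivity, ← Finset.mul_sum]
    refine ofReal_le_ofReal ?_
    rw [mul_assoc, mul_assoc]
    refine mul_le_mul_of_nonneg_left ((sum_two_pow_mul_le hx0 hx1 J).trans ?_) hC1.le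
    exact mul_le_mul_of_nonneg_left (one_sub_two_rpow_inv_le hc (by linarith)) (by norm_num)
  · have hh := nice_rk0 hΩ hC.le
    have ho := hf.outer P
    have hN : Tendsto (fun J : ℕ => 2 ^ J - 1) atTop atTop :=
      (tendsto_sub_atTop_nat 1).comp (tendsto_pow_atTop_atTop_of_one_lt _root_.one_lt_two)
    have h1 : ∀ J, (qvol P)⁻¹ * ∫⁻ x in P.set, mx (moll (2 ^ J - 1) (rk0 Ω)) b l (outer f P) x ^ v ≤
        (∑' j, G j z) ^ v := by
      intro J
      calc _ ≤ (qvol P)⁻¹ * ∫⁻ x in P.set,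
            (∑ j ∈ Finset.range (J + 1), mx (kseq Ω j) b l (outer f P) x) ^ v := by
            gcongr with x
            exact mx_moll_le_sum hΩ hC.le ho b l x J
        _ ≤ (∑ j ∈ Finset.range (J + 1), G j z) ^ v := by
            rw [avg_eq_lintegral]
            refine lintegral_sum_rpow_le (by linarith)
              (fun j => measurable_mx (ker_kseq hΩ hC.le j).nice ho b l) (fun j => ?_) (J + 1)
            rw [← avg_eq_lintegral]
            exact hG2 j P z hz
        _ ≤ _ := by gcongr; exact ENNReal.sum_le_tsum _
    calc _ ≤ (qvol P)⁻¹ * ∫⁻ x in P.set,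
          liminf (fun J => mx (moll (2 ^ J - 1) (rk0 Ω)) b l (outer f P) x ^ v) atTop := by
          gcongr with x
          refine (rpow_le_rpow (mx_le_liminf hd hh ho b l x hN) hv0.le).trans_eq ?_
          exact (orderIsoRpow v hv0).liminf_apply
      _ ≤ liminf (fun J => (qvol P)⁻¹ * ∫⁻ x in P.set,
          mx (moll (2 ^ J - 1) (rk0 Ω)) b l (outer f P) x ^ v) atTop := by
          simp_rw [avg_eq_lintegral]
          exact lintegral_liminf_le fun J => (measurable_mx (hh.moll _) ho b l).pow_const v
      _ ≤ _ := liminf_le_of_frequently_le' (Frequently.of_forall h1)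

/-- The truncated rough singular integral of a scalar function. -/
def tr (Ω : Rd d → ℂ) (δ : ℝ) (g : Rd d → ℂ) (x : Rd d) : ℂ :=
  ∫ y in {y : Rd d | δ < ‖x - y‖}, rk Ω (x - y) * g y

section
variable {Ω : Rd d → ℂ} {C : ℝ}

lemma measurableSet_trunc (δ : ℝ) (x : Rd d) : MeasurableSet {y : Rd d | δ < ‖x - y‖} :=
  (isOpen_lt continuous_const (continuous_const.sub continuous_id).norm).measurableSet

lemma integrableOn_rk_mul (h : IsRoughKernel Ω C) (hC : 0 ≤ C) {δ : ℝ} (hδ : 0 < δ) {g : Rd d → ℂ}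
    (hg : Nice g) (x : Rd d) : IntegrableOn (fun y => rk Ω (x - y) * g y) {y : Rd d | δ < ‖x - y‖} := by
  refine hg.integrable.integrableOn.bdd_mul (c := C * (δ ^ d)⁻¹)
    ((measurable_rk h.1).comp (measurable_const.sub measurable_id)).aestronglyMeasurable ?_
  filter_upwards [ae_restrict_mem (measurableSet_trunc δ x)] with y hy
  have hy' : δ < ‖x - y‖ := hy
  refine (norm_rk_le h (norm_pos_iff.1 (hδ.trans hy'))).trans ?_
  gcongr

lemma tl_rk0_eq (h : IsRoughKernel Ω C) (hC : 0 ≤ C) {g : Rd d → ℂ} (hg : Nice g) {k l : ℤ} {x : Rd d}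
    (hl : ∀ y, g y ≠ 0 → ‖x - y‖ ≤ (2 : ℝ) ^ l) : tr Ω ((2 : ℝ) ^ k) g x = tl (rk0 Ω) g k l x := by
  rw [tr, ← integral_indicator (measurableSet_trunc _ x)]
  rcases le_or_gt k l with hkl | hkl
  · have : tl (rk0 Ω) g k l x = ∫ y, g y * ∑ i ∈ Finset.Ico k l, dil i (rk0 Ω) (x - y) := by
      simp_rw [Finset.mul_sum]
      rw [integral_finsetSum _ fun i _ => ((nice_rk0 h hC).dil i).integrable_cv hg x]
      rfl
    rw [this]
    refine integral_congr_ae (Eventually.of_forall fun y => ?_)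
    beta_reduce
    rw [sum_dil_rk0 h hkl]
    by_cases hy : (2 : ℝ) ^ k < ‖x - y‖
    · rw [indicator_of_mem (show y ∈ {y : Rd d | (2 : ℝ) ^ k < ‖x - y‖} from hy)]
      by_cases hy0 : g y = 0
      · rw [hy0, mul_zero, zero_mul]
      · rw [indicator_of_mem (show x - y ∈ {u : Rd d | (2 : ℝ) ^ k < ‖u‖ ∧ ‖u‖ ≤ (2 : ℝ) ^ l} from
          ⟨hy, hl y hy0⟩), mul_comm]
    · rw [indicator_of_notMem (show y ∉ {y : Rd d | (2 : ℝ) ^ k < ‖x - y‖} from hy),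
        indicator_of_notMem fun h => hy h.1, mul_zero]
  · rw [tl, Finset.Ico_eq_empty (not_lt.2 hkl.le), Finset.sum_empty]
    refine integral_eq_zero_of_ae (Eventually.of_forall fun y => ?_)
    show _ = (0 : ℂ)
    by_cases hy : (2 : ℝ) ^ k < ‖x - y‖
    · by_cases hy0 : g y = 0
      · rw [indicator_of_mem (show y ∈ {y : Rd d | (2 : ℝ) ^ k < ‖x - y‖} from hy), hy0, mul_zero]
      · exact absurd (hy.trans_le (hl y hy0)) (not_lt.2 (zpow_le_zpow_right₀ one_le_two hkl.le))
    · rw [indicator_of_notMem (show y ∉ {y : Rd d | (2 : ℝ) ^ k < ‖x - y‖} from hy)]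

lemma outer_eq_zero_of_lt {f : Rd d → ℂ} {P : Cube d} {x y : Rd d} (hx : x ∈ P.set)
    (hy : ‖x - y‖ < P.side) : outer f P y = 0 := by
  refine indicator_of_notMem (fun hy' => ?_) _
  exact absurd (side_le_of_notMem_tri hx hy') (not_le.2 hy)

lemma enorm_tr_outer_le (h : IsRoughKernel Ω C) (hC : 0 ≤ C) (hd : 1 ≤ d) {f : Rd d → ℂ} (hf : Nice f)
    {P : Cube d} {x z : Rd d} (hx : x ∈ P.set) (hz : z ∈ P.set) {b l : ℤ} {δ : ℝ} (hδ : (2 : ℝ) ^ b ≤ δ)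
    (hl : ∀ y, f y ≠ 0 → ‖x - y‖ ≤ (2 : ℝ) ^ l) :
    ‖tr Ω δ (outer f P) x‖ₑ ≤ ENNReal.ofReal (C * (4 * d) ^ d) * HLM (fun y => ‖f y‖ₑ) z +
      mx (rk0 Ω) b l (outer f P) x := by
  have hδ0 : 0 < δ := lt_of_lt_of_le (by positivity) hδ
  obtain ⟨k, hk1, hk2⟩ := exists_mem_Ico_zpow hδ0 one_lt_two
  have hbk : b ≤ k + 1 := by
    have := (zpow_lt_zpow_iff_right₀ (one_lt_two (α := ℝ))).1 (hδ.trans_lt hk2)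
    exact this.le
  have hg := hf.outer P
  set g := outer f P with hgdef
  have hlg : ∀ y, g y ≠ 0 → ‖x - y‖ ≤ (2 : ℝ) ^ l := fun y hy => hl y fun h0 => hy (by
    have := enorm_outer_le f P y
    rw [h0, enorm_zero] at this
    exact enorm_eq_zero.1 (le_antisymm this zero_le))
  set S1 : Set (Rd d) := {y : Rd d | δ < ‖x - y‖ ∧ ‖x - y‖ ≤ (2 : ℝ) ^ (k + 1)} with hS1
  have hS1m : MeasurableSet S1 := by
    have e : S1 = {y : Rd d | δ < ‖x - y‖} \ {y : Rd d | (2 : ℝ) ^ (k + 1) < ‖x - y‖} := by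
      ext y; simp [hS1]
    rw [e]; exact (measurableSet_trunc _ _).diff (measurableSet_trunc _ _)
  have hsplit : tr Ω δ g x = (∫ y in S1, rk Ω (x - y) * g y) + tr Ω ((2 : ℝ) ^ (k + 1)) g x := by
    have e : {y : Rd d | δ < ‖x - y‖} = S1 ∪ {y : Rd d | (2 : ℝ) ^ (k + 1) < ‖x - y‖} := by
      ext y
      simp only [hS1, mem_union, mem_ofPred_eq]
      constructor
      · intro hy
        rcases le_or_gt ‖x - y‖ ((2 : ℝ) ^ (k + 1)) with h | h
        exacts [Or.inl ⟨hy, h⟩, Or.inr h]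
      · rintro (hy | hy)
        exacts [hy.1, hk2.trans hy]
    have hI := integrableOn_rk_mul h hC hδ0 hg x
    rw [tr, e]
    refine setIntegral_union ?_ (measurableSet_trunc _ _) (hI.mono_set ?_) (hI.mono_set ?_)
    · rw [disjoint_left]; intro y hy hy'
      exact absurd hy.2 (not_le.2 hy')
    · rw [e]; exact subset_union_left
    · rw [e]; exact subset_union_right
  rw [hsplit]
  refine (enorm_add_le _ _).trans (add_le_add ?_ ?_)
  · rcases lt_or_ge ((2 : ℝ) ^ (k + 1)) P.side with hP | hP
    · rw [setIntegral_eq_zero_of_forall_eq_zero, enorm_zero]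
      · exact zero_le
      · intro y hy
        rw [hgdef, outer_eq_zero_of_lt hx (lt_of_le_of_lt hy.2 hP), mul_zero]
    · have hd' : (1 : ℝ) ≤ d := by exact_mod_cast hd
      have hr : (0 : ℝ) < d * (2 : ℝ) ^ (k + 1) := by positivity
      set Q := cubeAt x _ hr with hQ
      have hzQ : z ∈ Q.set := by
        refine closedBall_subset_cubeAt x _ hr ?_
        rw [mem_closedBall, dist_eq_norm]
        exact (dist_le_of_mem_set hz hx).trans (by gcongr)
      have hsub : S1 ⊆ Q.set := fun y hy => by
        refine closedBall_subset_cubeAt x _ hr ?_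
        rw [mem_closedBall, dist_comm, dist_eq_norm]
        refine hy.2.trans ?_
        have : (0 : ℝ) < (2 : ℝ) ^ (k + 1) := by positivity
        nlinarith
      refine (enorm_integral_le_lintegral_enorm _).trans ?_
      calc _ ≤ ∫⁻ y in S1, ENNReal.ofReal (C * (((2 : ℝ) ^ k) ^ d)⁻¹) * ‖f y‖ₑ := by
            refine setLIntegral_mono' hS1m fun y hy => ?_
            rw [enorm_mul]
            refine mul_le_mul' ?_ (enorm_outer_le f P y)
            rw [← ofReal_norm]
            refine ofReal_le_ofReal ((norm_rk_le h (norm_pos_iff.1 (hδ0.trans hy.1))).trans ?_)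
            have := hk1.trans hy.1.le
            gcongr
        _ ≤ ∫⁻ y in Q.set, ENNReal.ofReal (C * (((2 : ℝ) ^ k) ^ d)⁻¹) * ‖f y‖ₑ := lintegral_mono_set hsub
        _ = ENNReal.ofReal (C * (4 * d) ^ d) * ((qvol Q)⁻¹ * ∫⁻ y in Q.set, ‖f y‖ₑ) := by
            rw [lintegral_const_mul' _ _ ofReal_ne_top, ← mul_assoc, hQ, qvol_cubeAt,
              ← ofReal_pow (by positivity), ← ofReal_inv_of_pos (by positivity),
              ← ofReal_mul (by positivity)]
            congr 2
            rw [zpow_add₀ two_ne_zero, zpow_one, mul_assoc, ← mul_inv_cancel_left₀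
              (show ((4 : ℝ) * d) ^ d ≠ 0 by positivity) ((((2 : ℝ) ^ k) ^ d)⁻¹), ← mul_inv, ← mul_pow]
            congr 4; ring
        _ ≤ _ := by gcongr; exact avg_le_HLM _ hzQ
  · rw [tl_rk0_eq h hC hg hlg]
    exact le_iSup₂_of_le (k + 1) hbk le_rfl

end

/-- The supremum of truncations with parameter at least `2 ^ b`. -/
def trsup (Ω : Rd d → ℂ) (b : ℤ) (g : Rd d → ℂ) (x : Rd d) : ℝ≥0∞ :=
  ⨆ (δ : ℝ) (_ : (2 : ℝ) ^ b ≤ δ), ‖tr Ω δ g x‖ₑ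

theorem rough_grand (hd : 1 ≤ d) {r C : ℝ} (hr : 1 < r) (hr2 : r < 2) (hC : 0 < C) :
    ∃ K : ℝ, 0 < K ∧ ∀ Ω : Rd d → ℂ, IsRoughKernel Ω C → ∀ v : ℝ, 2 ≤ v →
      ∀ (b : ℤ) (R0 : ℝ) (f : Rd d → ℂ), Nice f → ∃ G : Rd d → ℝ≥0∞, Measurable G ∧
        ∫⁻ x, G x ^ r ≤ ENNReal.ofReal ((K * v) ^ r) * ∫⁻ x, ‖f x‖ₑ ^ r ∧
        ∀ P : Cube d, P.set ⊆ closedBall 0 R0 → ∀ z ∈ P.set, 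
          (qvol P)⁻¹ * ∫⁻ x in P.set, trsup Ω b (outer f P) x ^ v ≤ G z ^ v := by
  have hr0 : 0 < r := by linarith
  obtain ⟨K, hK, H⟩ := rough_mx hd hr hr2 hC
  set M : ℝ := r / (r - 1) * (5 ^ d * 2 ^ r) with hM
  have hM0 : 0 < M := by
    have : 0 < r - 1 := by linarith
    positivity
  have hd' : (0 : ℝ) < d := by exact_mod_cast hd
  refine ⟨C * (4 * d) ^ d * M ^ r⁻¹ + K, by positivity, fun Ω hΩ v hv b R0 f hf => ?_⟩
  have hv0 : 0 < v := by linarith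
  obtain ⟨R1, hR1, hfR⟩ := hf.supp
  obtain ⟨l, hl⟩ : ∃ l : ℕ, |R0| + R1 < (2 : ℝ) ^ l := pow_unbounded_of_one_lt _ one_lt_two
  obtain ⟨G, hGm, hG1, hG2⟩ := H Ω hΩ v hv b l f hf
  set c := ENNReal.ofReal (C * (4 * d) ^ d) with hc
  set F := ∫⁻ x, ‖f x‖ₑ ^ r with hF
  have hHm := measurable_HLM fun y => ‖f y‖ₑ
  refine ⟨fun z => c * HLM (fun y => ‖f y‖ₑ) z + G z, (hHm.const_mul c).add hGm, ?_, fun P hP z hz => ?_⟩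
  · have h1 : ∫⁻ x, (c * HLM (fun y => ‖f y‖ₑ) x) ^ r ≤
        (ENNReal.ofReal (C * (4 * d) ^ d * M ^ r⁻¹) * F ^ r⁻¹) ^ r := by
      simp_rw [mul_rpow_of_nonneg _ _ hr0.le]
      rw [rpow_inv_rpow hr0.ne', lintegral_const_mul _ (hHm.pow_const r),
        ofReal_mul (by positivity), mul_rpow_of_nonneg _ _ hr0.le,
        ← ofReal_rpow_of_pos hM0, rpow_inv_rpow hr0.ne', mul_assoc]
      gcongr
      refine (HLM_strong hd hf.1.enorm hr).trans_eq ?_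
      rw [hM, ofReal_mul (div_nonneg hr0.le (by linarith))]
      congr 2
      rw [ofReal_mul (by positivity), ofReal_pow (by norm_num),
        ← ofReal_rpow_of_pos two_pos]
      norm_num
    have h2 : ∫⁻ x, G x ^ r ≤ (ENNReal.ofReal (K * v) * F ^ r⁻¹) ^ r := by
      rw [mul_rpow_of_nonneg _ _ hr0.le, rpow_inv_rpow hr0.ne',
        ofReal_rpow_of_nonneg (by positivity) hr0.le]
      exact hG1
    refine (lintegral_add_rpow_le hr.le (hHm.const_mul c) hGm h1 h2).trans ?_
    rw [← add_mul, ← ofReal_add (by positivity) (by positivity),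
      mul_rpow_of_nonneg _ _ hr0.le, rpow_inv_rpow hr0.ne',
      ofReal_rpow_of_nonneg (by positivity) hr0.le]
    gcongr
    rw [add_mul]
    refine add_le_add_left ?_ _
    exact le_mul_of_one_le_right (by positivity) (by linarith)
  · have h1 : ∀ x ∈ P.set, trsup Ω b (outer f P) x ≤
        c * HLM (fun y => ‖f y‖ₑ) z + mx (rk0 Ω) b l (outer f P) x := by
      refine fun x hx => iSup₂_le fun δ hδ => enorm_tr_outer_le hΩ hC.le hd hf hx hz hδ fun y hy => ?_
      have h2 : ‖x‖ ≤ R0 := mem_closedBall_zero_iff.1 (hP hx)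
      have h3 : ‖y‖ ≤ R1 := not_lt.1 fun h => hy (hfR y h)
      rw [zpow_natCast]
      linarith [norm_sub_le x y, le_abs_self R0]
    calc _ ≤ (qvol P)⁻¹ * ∫⁻ x in P.set,
          (c * HLM (fun y => ‖f y‖ₑ) z + mx (rk0 Ω) b l (outer f P) x) ^ v := by
          refine mul_le_mul_right ?_ _
          exact setLIntegral_mono' (measurableSet_set P) fun x hx => rpow_le_rpow (h1 x hx) hv0.le
      _ ≤ _ := by
          rw [avg_eq_lintegral]
          refine lintegral_add_rpow_le (by linarith) measurable_const
            (measurable_mx (nice_rk0 hΩ hC.le) (hf.outer P) b l) ?_ ?_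
          · rw [← avg_eq_lintegral, lintegral_const, Measure.restrict_apply_univ, volume_set, mul_comm,
              mul_assoc, ENNReal.mul_inv_cancel (qvol_ne_zero P) (qvol_ne_top P), mul_one]
          · rw [← avg_eq_lintegral]; exact hG2 P z hz

/-! ### An abstract stopping-time argument -/

lemma lt_qvol_of_mul_le {R : Cube d} {a : ℝ≥0∞} (h : 2 * a ≤ qvol R) : a < qvol R := by
  by_contra h'
  push Not at h'
  have h1 : qvol R + qvol R ≤ qvol R + 0 := by
    rw [← two_mul, add_zero]; exact (mul_le_mul_right h' 2).trans h
  exact qvol_ne_zero R (le_antisymm ((ENNReal.add_le_add_iff_left (qvol_ne_top R)).1 h1) (zero_le))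

lemma lintegral_child_le_of_glue (R : Cube d) {X G U : Rd d → ℝ≥0∞} {K L : ℝ≥0∞} {v : ℝ}
    (D : ℝ≥0∞) (E : Set (Rd d))
    (h : ∀ ε, ∃ (H : Set (Rd d)) (Θ : Rd d → ℝ≥0∞), MeasurableSet H ∧ Measurable Θ ∧
      H ⊆ hset (child R ε) ∧ volume H ≤ D * volume (E ∩ hset (child R ε)) ∧
      ∫⁻ x in hset (child R ε), Θ x ^ v ≤ L * qvol (child R ε) ∧
      ∫⁻ x in hset (child R ε), X x ≤
        (∫⁻ x in hset (child R ε), Θ x * G x) + K * ∫⁻ x in H, U x) :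
    ∃ (H : Set (Rd d)) (Θ : Rd d → ℝ≥0∞), MeasurableSet H ∧ Measurable Θ ∧
      H ⊆ hset R ∧ volume H ≤ D * volume (E ∩ hset R) ∧
      ∫⁻ x in hset R, Θ x ^ v ≤ L * qvol R ∧
      ∫⁻ x in hset R, X x ≤ (∫⁻ x in hset R, Θ x * G x) + K * ∫⁻ x in H, U x := by
  classical
  choose H Θ hHm hΘm hH hvol hL hX using h
  have hΘ : ∀ ε, ∀ x ∈ hset (child R ε),
      (∑ ε', (hset (child R ε')).indicator (Θ ε') x) = Θ ε x := by
    intro ε x hx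
    rw [Finset.sum_eq_single ε, indicator_of_mem hx]
    · intro ε' _ hne
      exact indicator_of_notMem (fun h' => Set.disjoint_left.1 (disjoint_child R hne) h' hx) _
    · simp
  refine ⟨⋃ ε, H ε, fun x => ∑ ε, (hset (child R ε)).indicator (Θ ε) x,
    MeasurableSet.iUnion hHm, Finset.measurable_fun_sum _ fun ε _ =>
      (hΘm ε).indicator (measurableSet_hset _),
    iUnion_subset fun ε => (hH ε).trans (hset_child_subset R ε), ?_, ?_, ?_⟩
  · rw [volume_inter_child, Finset.mul_sum]
    refine (measure_iUnion_le _).trans ?_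
    rw [tsum_fintype]
    exact Finset.sum_le_sum fun ε _ => hvol ε
  · have h1 : L * qvol R = ∑ ε, L * qvol (child R ε) := by
      have := volume_inter_child R univ
      simp only [univ_inter, volume_hset] at this
      rw [this, Finset.mul_sum]
    rw [lintegral_child, h1]
    refine Finset.sum_le_sum fun ε _ => le_trans (le_of_eq ?_) (hL ε)
    exact setLIntegral_congr_fun (measurableSet_hset _) fun x hx => by beta_reduce; rw [hΘ ε x hx]
  · rw [lintegral_child, lintegral_child, lintegral_iUnion hHm
      (fun i j hij => (disjoint_child R hij).mono (hH i) (hH j)), tsum_fintype, Finset.mul_sum,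
      ← Finset.sum_add_distrib]
    refine Finset.sum_le_sum fun ε _ => (hX ε).trans (le_of_eq ?_)
    congr 1
    exact setLIntegral_congr_fun (measurableSet_hset _) fun x hx => by beta_reduce; rw [hΘ ε x hx]

theorem stopping {X : Cube d → Rd d → ℝ≥0∞} {U : Rd d → ℝ≥0∞} {K : ℝ≥0∞} {v s0 : ℝ}
    (hU : Measurable U) (hs0 : 0 < s0)
    (hX0 : ∀ Q : Cube d, Q.side ≤ s0 → ∀ x ∈ hset Q, X Q x = 0)
    (hmain : ∀ Q : Cube d, ∃ (E : Set (Rd d)) (G : Rd d → ℝ≥0∞) (L m : ℝ≥0∞), 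
      Measurable G ∧ 2 ^ (d + 2) * volume (E ∩ hset Q) ≤ qvol Q ∧
      (∀ R : Cube d, hset R ⊆ hset Q → volume (E ∩ hset R) < qvol R →
        ∃ Θ : Rd d → ℝ≥0∞, Measurable Θ ∧ ∫⁻ x in hset R, Θ x ^ v ≤ L * qvol R ∧
          ∀ x ∈ hset R, X Q x ≤ X R x + Θ x * G x) ∧
      (∀ Θ : Rd d → ℝ≥0∞, Measurable Θ → ∫⁻ x in hset Q, Θ x ^ v ≤ L * qvol Q →
        ∫⁻ x in hset Q, Θ x * G x ≤ qvol Q / 2 * m) ∧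
      ∀ x ∈ hset Q, m ≤ K * U x) (Q : Cube d) :
    ∫⁻ x in hset Q, X Q x ≤ K * ∫⁻ x in hset Q, U x := by
  suffices ∀ N : ℕ, ∀ Q : Cube d, Q.side ≤ 2 ^ N * s0 →
      ∫⁻ x in hset Q, X Q x ≤ K * ∫⁻ x in hset Q, U x by
    obtain ⟨N, hN⟩ := pow_unbounded_of_one_lt (Q.side / s0) (_root_.one_lt_two)
    exact this N Q (by rw [div_lt_iff₀ hs0] at hN; exact hN.le)
  intro N
  induction N with
  | zero =>
    intro Q hQ
    rw [setLIntegral_congr_fun (measurableSet_hset Q) (hX0 Q (by simpa using hQ))]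
    simp
  | succ N IH =>
    intro Q hQ
    obtain ⟨E, G, L, m, hG, hEQ, hΘ, hm, hU'⟩ := hmain Q
    have key : ∀ k : ℕ, ∀ R : Cube d, hset R ⊆ hset Q → R.side ≤ 2 ^ k * s0 →
        R.side ≤ Q.side → 2 ^ (d + 1) * volume (E ∩ hset R) ≤ qvol R →
        ∃ (H : Set (Rd d)) (Θ : Rd d → ℝ≥0∞), MeasurableSet H ∧ Measurable Θ ∧
          H ⊆ hset R ∧ volume H ≤ 2 ^ (d + 1) * volume (E ∩ hset R) ∧
          ∫⁻ x in hset R, Θ x ^ v ≤ L * qvol R ∧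
          ∫⁻ x in hset R, X Q x ≤ (∫⁻ x in hset R, Θ x * G x) + K * ∫⁻ x in H, U x := by
      intro k
      induction k with
      | zero =>
        intro R hR hs _ hE
        obtain ⟨Θ, hΘm, hΘL, hX⟩ := hΘ R hR (lt_qvol_of_mul_le (le_trans
          (mul_le_mul_left (le_self_pow₀ (_root_.one_le_two (α := ℝ≥0∞)) (by omega)) _) hE))
        refine ⟨∅, Θ, MeasurableSet.empty, hΘm, empty_subset _, by simp, hΘL, ?_⟩
        simp only [Measure.restrict_empty, lintegral_zero_measure, mul_zero, add_zero]
        refine setLIntegral_mono' (measurableSet_hset R) fun x hx => (hX x hx).trans ?_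
        rw [hX0 R (by simpa using hs) x hx, zero_add]
      | succ k ih =>
        intro R hR hs hsQ hE
        refine lintegral_child_le_of_glue R _ E fun ε => ?_
        have hcR := (hset_child_subset R ε).trans hR
        by_cases hl : 2 ^ (d + 1) * volume (E ∩ hset (child R ε)) ≤ qvol (child R ε)
        · refine ih (child R ε) hcR ?_ ?_ hl
          · rw [child_side]; rw [pow_succ] at hs; linarith
          · rw [child_side]; linarith [R.side_pos]
        · push Not at hl
          have h1 : 2 * volume (E ∩ hset (child R ε)) ≤ qvol (child R ε) := by
            have h2 : 2 ^ d * (2 * volume (E ∩ hset (child R ε))) ≤ 2 ^ d * qvol (child R ε) := by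
              rw [qvol_child, ← mul_assoc, ← pow_succ]
              refine le_trans (mul_le_mul_right (measure_mono ?_) _) hE
              exact inter_subset_inter_right _ (hset_child_subset R ε)
            exact (ENNReal.mul_le_mul_iff_right (by simp) (by simp)).1 h2
          obtain ⟨Θ, hΘm, hΘL, hX⟩ := hΘ _ hcR (lt_qvol_of_mul_le h1)
          refine ⟨hset (child R ε), Θ, measurableSet_hset _, hΘm, le_rfl, ?_, hΘL, ?_⟩
          · rw [volume_hset]; exact hl.le
          · calc ∫⁻ x in hset (child R ε), X Q x
                ≤ ∫⁻ x in hset (child R ε), (Θ x * G x + X (child R ε) x) :=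
                  setLIntegral_mono' (measurableSet_hset _) fun x hx =>
                    (hX x hx).trans_eq (add_comm _ _)
              _ = (∫⁻ x in hset (child R ε), Θ x * G x) +
                    ∫⁻ x in hset (child R ε), X (child R ε) x :=
                  lintegral_add_left (hΘm.mul hG) _
              _ ≤ _ := by
                  refine add_le_add_right (IH _ ?_) _
                  rw [child_side]; rw [pow_succ] at hQ; linarith
    have hE1 : 2 * (2 ^ (d + 1) * volume (E ∩ hset Q)) ≤ qvol Q := by
      rw [← mul_assoc, ← pow_succ']; exact hEQ
    obtain ⟨H, Θ, hHm, hΘm, hHQ, hvol, hL, hX⟩ := key (N + 1) Q le_rfl hQ le_rfl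
      (lt_qvol_of_mul_le hE1).le
    have hH2 : volume H ≤ qvol Q / 2 := by
      rw [ENNReal.le_div_iff_mul_le (by simp) (by simp), mul_comm]
      exact (mul_le_mul_right hvol 2).trans hE1
    have hdiff : qvol Q / 2 ≤ volume (hset Q \ H) := by
      rw [measure_sdiff hHQ hHm.nullMeasurableSet
        (ne_top_of_le_ne_top (div_ne_top (qvol_ne_top Q) (by simp)) hH2), volume_hset]
      refine le_sub_of_add_le_left
        (ne_top_of_le_ne_top (div_ne_top (qvol_ne_top Q) (by simp)) hH2) ?_
      exact (add_le_add_left hH2 _).trans_eq (ENNReal.add_halves _)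
    have hfin : qvol Q / 2 * m ≤ K * ∫⁻ x in hset Q \ H, U x := by
      rw [← lintegral_const_mul _ hU]
      refine (mul_le_mul_left hdiff m).trans ?_
      rw [mul_comm, ← setLIntegral_const]
      exact setLIntegral_mono' ((measurableSet_hset Q).diff hHm) fun x hx => hU' x hx.1
    calc _ ≤ _ := hX
      _ ≤ K * (∫⁻ x in hset Q \ H, U x) + K * ∫⁻ x in H, U x :=
          add_le_add_left ((hm Θ hΘm hL).trans hfin) _
      _ = K * ∫⁻ x in hset Q, U x := by
          rw [← mul_add, ← lintegral_union hHm disjoint_sdiff_left, Set.sdiff_union_of_subset hHQ]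

/-! ### Reverse Hölder inequality for scalar `A∞` weights -/

lemma lintegral_mul_rpow_le_of_tail {α : Type*} [MeasurableSpace α] {μ : Measure α} [SFinite μ]
    {D φ : α → ℝ≥0∞} (hD : Measurable D) (hφ : Measurable φ) {A B : ℝ≥0∞} (hB : B ≠ ⊤) {s : ℝ}
    (hs : 0 < s)
    (H : ∀ t : ℝ, 0 < t → A ≤ ENNReal.ofReal t →
      ∫⁻ x in {x | ENNReal.ofReal t < D x}, φ x ∂μ ≤
        B * ENNReal.ofReal t * μ {x | ENNReal.ofReal t < D x}) :
    ∫⁻ x, φ x * D x ^ s ∂μ ≤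
      A ^ s * (∫⁻ x, φ x ∂μ) + ENNReal.ofReal s * B * ∫⁻ x, D x ^ (1 + s) ∂μ := by
  have hs0 : ENNReal.ofReal s ≠ 0 := by simpa using hs
  have h1 := lintegral_layer (μ := μ) hD hφ hs
  have h2 := lintegral_layer (μ := μ) (w := fun _ => 1) hD measurable_const
    (by linarith : 0 < 1 + s)
  have h3 := lintegral_layer_rpow A hs
  have h4 : (∫⁻ x, φ x * D x ^ s ∂μ) / ENNReal.ofReal s ≤
      A ^ s / ENNReal.ofReal s * (∫⁻ x, φ x ∂μ) + B * ∫⁻ x, D x ^ (1 + s) ∂μ := by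
    rw [← h1, ← h3]
    have h5 : ∫⁻ t in Ioi (0 : ℝ), ENNReal.ofReal (t ^ (1 + s - 1)) *
        ∫⁻ _ in {x | ENNReal.ofReal t < D x}, 1 ∂μ ≤ ∫⁻ x, D x ^ (1 + s) ∂μ := by
      rw [h2]
      simp only [one_mul]
      exact div_le_of_le_mul (le_mul_of_one_le_right (zero_le)
        (by rw [← ofReal_one]; exact ofReal_le_ofReal (by linarith)))
    refine le_trans ?_ (add_le_add_right (mul_le_mul_right h5 B) _)
    have hm1 : Measurable fun t : ℝ => {t : ℝ | ENNReal.ofReal t < A}.indicator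
        (fun t => ENNReal.ofReal (t ^ (s - 1))) t :=
      Measurable.indicator (by fun_prop)
        (measurableSet_lt measurable_ofReal measurable_const)
    rw [← lintegral_mul_const _ hm1, ← lintegral_const_mul' _ _ hB,
      ← lintegral_add_left (hm1.mul_const _)]
    refine setLIntegral_mono' measurableSet_Ioi fun t ht => ?_
    have ht : 0 < t := ht
    by_cases hA : ENNReal.ofReal t < A
    · rw [indicator_of_mem (show t ∈ {t : ℝ | ENNReal.ofReal t < A} from hA)]
      exact le_add_right (mul_le_mul_right (setLIntegral_le_lintegral _ _) _)
    · push Not at hA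
      refine le_add_left ((mul_le_mul_right (H t ht hA) _).trans_eq ?_)
      rw [setLIntegral_const, one_mul, show 1 + s - 1 = (s - 1) + 1 by ring,
        Real.rpow_add ht, Real.rpow_one, ofReal_mul (by positivity)]
      ring
  calc _ = ENNReal.ofReal s * ((∫⁻ x, φ x * D x ^ s ∂μ) / ENNReal.ofReal s) :=
        (ENNReal.mul_div_cancel hs0 ofReal_ne_top).symm
    _ ≤ _ := mul_le_mul_right h4 _
    _ = ENNReal.ofReal s * (A ^ s / ENNReal.ofReal s) * (∫⁻ x, φ x ∂μ) +
        ENNReal.ofReal s * B * ∫⁻ x, D x ^ (1 + s) ∂μ := by ring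
    _ = _ := by rw [ENNReal.mul_div_cancel hs0 ofReal_ne_top]

def av (w : Rd d → ℝ≥0∞) (Q : Cube d) : ℝ≥0∞ := (qvol Q)⁻¹ * ∫⁻ x in Q.set, w x

lemma qvol_mul_av (w : Rd d → ℝ≥0∞) (Q : Cube d) : qvol Q * av w Q = ∫⁻ x in Q.set, w x := by
  rw [av, ← mul_assoc, ENNReal.mul_inv_cancel (qvol_ne_zero Q) (qvol_ne_top Q), one_mul]

lemma lintegral_child_le (w : Rd d → ℝ≥0∞) (Q : Cube d) (ε : Fin d → Bool) :
    ∫⁻ x in (child Q ε).set, w x ≤ ∫⁻ x in Q.set, w x :=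
  lintegral_mono_set (child_set_subset Q ε)

lemma av_child_le (w : Rd d → ℝ≥0∞) (Q : Cube d) (ε : Fin d → Bool) :
    av w (child Q ε) ≤ 2 ^ d * av w Q := by
  refine (ENNReal.mul_le_mul_iff_right (qvol_ne_zero (child Q ε)) (qvol_ne_top _)).1 ?_
  rw [← mul_assoc, mul_comm (qvol _) (2 ^ d), qvol_child, qvol_mul_av, qvol_mul_av]
  exact lintegral_child_le w Q ε

/-- The dyadic maximal function of `w` over `k` generations of subcubes. -/
def dmx (w : Rd d → ℝ≥0∞) : ℕ → Cube d → Rd d → ℝ≥0∞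
  | 0, Q, _ => av w Q
  | k + 1, Q, x => max (av w Q) (∑ ε, (hset (child Q ε)).indicator (dmx w k (child Q ε)) x)

lemma dmx_succ (w : Rd d → ℝ≥0∞) (k : ℕ) (Q : Cube d) (ε : Fin d → Bool) {x : Rd d}
    (hx : x ∈ hset (child Q ε)) :
    dmx w (k + 1) Q x = max (av w Q) (dmx w k (child Q ε) x) := by
  rw [dmx, Finset.sum_eq_single ε, indicator_of_mem hx]
  · intro ε' _ hne
    exact indicator_of_notMem (fun h' => Set.disjoint_left.1 (disjoint_child Q hne) h' hx) _
  · simp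

lemma exists_child {Q : Cube d} {x : Rd d} (hx : x ∈ hset Q) : ∃ ε, x ∈ hset (child Q ε) := by
  rw [← iUnion_child Q] at hx; simpa using hx

lemma measurable_dmx (w : Rd d → ℝ≥0∞) (k : ℕ) : ∀ Q : Cube d, Measurable (dmx w k Q) := by
  induction k with
  | zero => intro Q; exact measurable_const
  | succ k ih =>
    intro Q
    exact measurable_const.max (Finset.measurable_fun_sum _ fun ε _ =>
      (ih _).indicator (measurableSet_hset _))

lemma av_le_dmx (w : Rd d → ℝ≥0∞) (k : ℕ) (Q : Cube d) (x : Rd d) : av w Q ≤ dmx w k Q x := by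
  cases k with
  | zero => exact le_rfl
  | succ k => exact le_max_left _ _

lemma dmx_le (w : Rd d → ℝ≥0∞) (k : ℕ) : ∀ Q : Cube d, ∀ x ∈ hset Q,
    dmx w k Q x ≤ (2 ^ d) ^ k * av w Q := by
  induction k with
  | zero => intro Q x _; simp [dmx]
  | succ k ih =>
    intro Q x hx
    obtain ⟨ε, hε⟩ := exists_child hx
    rw [dmx_succ w k Q ε hε]
    refine max_le (le_mul_of_one_le_left (zero_le)
      (one_le_pow₀ (one_le_pow₀ (_root_.one_le_two)))) ((ih _ x hε).trans ?_)
    rw [pow_succ, mul_assoc]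
    exact mul_le_mul_right (av_child_le w Q ε) _

lemma dmx_le_HLM (w : Rd d → ℝ≥0∞) (P : Cube d) (k : ℕ) : ∀ Q : Cube d, Q.set ⊆ P.set →
    ∀ x ∈ hset Q, dmx w k Q x ≤ HLM (P.set.indicator w) x := by
  have h0 : ∀ Q : Cube d, Q.set ⊆ P.set → ∀ x ∈ hset Q,
      av w Q ≤ HLM (P.set.indicator w) x := by
    intro Q hQ x hx
    refine le_trans (le_of_eq ?_) (avg_le_HLM _ (hset_subset_set Q hx))
    rw [av]; congr 1
    exact setLIntegral_congr_fun (measurableSet_set Q) fun y hy =>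
      (indicator_of_mem (hQ hy) w).symm
  induction k with
  | zero => exact h0
  | succ k ih =>
    intro Q hQ x hx
    obtain ⟨ε, hε⟩ := exists_child hx
    rw [dmx_succ w k Q ε hε]
    exact max_le (h0 Q hQ x hx) (ih _ ((child_set_subset Q ε).trans hQ) x hε)

lemma lintegral_dmx_le {w : Rd d → ℝ≥0∞} {S : ℝ≥0∞}
    (hS : ∀ R : Cube d, ∫⁻ x in R.set, HLM (R.set.indicator w) x ≤ S * ∫⁻ x in R.set, w x)
    (k : ℕ) (Q : Cube d) : ∫⁻ x in hset Q, dmx w k Q x ≤ S * ∫⁻ x in Q.set, w x := by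
  refine le_trans ?_ (hS Q)
  rw [← lintegral_hset]
  exact setLIntegral_mono' (measurableSet_hset Q) (dmx_le_HLM w Q k Q le_rfl)

lemma dmx_tail {w : Rd d → ℝ≥0∞} (hw : Measurable w) {S : ℝ≥0∞}
    (hS : ∀ R : Cube d, ∫⁻ x in R.set, HLM (R.set.indicator w) x ≤ S * ∫⁻ x in R.set, w x)
    (a b l : ℝ≥0∞) (k : ℕ) : ∀ Q : Cube d, av w Q ≤ l →
      ∫⁻ x in {x | l < dmx w k Q x} ∩ hset Q, (a * dmx w k Q x + b * w x) ≤
        2 ^ d * (a * S + b) * l * volume ({x | l < dmx w k Q x} ∩ hset Q) := by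
  induction k with
  | zero =>
    intro Q hQ
    have : {x | l < dmx w 0 Q x} ∩ hset Q = ∅ := by
      ext x; simp [dmx, hQ.not_gt]
    simp [this]
  | succ k ih =>
    intro Q hQ
    have hm := fun k Q => measurableSet_lt (measurable_const (a := l)) (measurable_dmx w k Q)
    have hc : ∀ ε, {x | l < dmx w (k + 1) Q x} ∩ hset (child Q ε) =
        {x | l < dmx w k (child Q ε) x} ∩ hset (child Q ε) := by
      intro ε
      ext x
      simp only [mem_inter_iff, Set.mem_ofPred_eq, and_congr_left_iff]
      intro hx
      rw [dmx_succ w k Q ε hx, lt_max_iff]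
      exact or_iff_right hQ.not_gt
    rw [volume_inter_child, Finset.mul_sum, ← Measure.restrict_restrict (hm (k + 1) Q),
      ← lintegral_indicator (hm (k + 1) Q), lintegral_child]
    refine Finset.sum_le_sum fun ε _ => ?_
    rw [lintegral_indicator (hm (k + 1) Q), Measure.restrict_restrict (hm (k + 1) Q), hc ε]
    have h1 : ∫⁻ x in {x | l < dmx w k (child Q ε) x} ∩ hset (child Q ε),
        (a * dmx w (k + 1) Q x + b * w x) =
        ∫⁻ x in {x | l < dmx w k (child Q ε) x} ∩ hset (child Q ε),
        (a * dmx w k (child Q ε) x + b * w x) := by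
      refine setLIntegral_congr_fun ((hm k _).inter (measurableSet_hset _)) fun x hx => ?_
      rw [dmx_succ w k Q ε hx.2, max_eq_right (hQ.trans (le_of_lt hx.1))]
    rw [h1]
    by_cases hl : av w (child Q ε) ≤ l
    · exact ih _ hl
    · push Not at hl
      have h2 : {x | l < dmx w k (child Q ε) x} ∩ hset (child Q ε) = hset (child Q ε) :=
        inter_eq_right.2 fun x _ => hl.trans_le (av_le_dmx w k _ x)
      rw [h2, volume_hset, lintegral_add_right _ (hw.const_mul b),
        lintegral_const_mul _ (measurable_dmx w k _), lintegral_const_mul _ hw]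
      have h3 : ∫⁻ x in (child Q ε).set, w x ≤ 2 ^ d * l * qvol (child Q ε) := by
        refine (lintegral_child_le w Q ε).trans ?_
        rw [← qvol_mul_av, ← qvol_child Q ε]
        exact (mul_le_mul_right hQ _).trans_eq (by ring)
      calc _ ≤ a * (S * ∫⁻ x in (child Q ε).set, w x) + b * ∫⁻ x in (child Q ε).set, w x := by
            rw [lintegral_hset _ w]
            exact add_le_add_left (mul_le_mul_right (lintegral_dmx_le hS k _) a) _
        _ = (a * S + b) * ∫⁻ x in (child Q ε).set, w x := by ring
        _ ≤ _ := (mul_le_mul_right h3 _).trans_eq (by ring)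

lemma exists_av_le_dmx (w : Rd d → ℝ≥0∞) (k : ℕ) : ∀ Q : Cube d, ∀ x ∈ hset Q,
    ∃ R : Cube d, x ∈ R.set ∧ R.set ⊆ Q.set ∧ R.side = Q.side / 2 ^ k ∧ av w R ≤ dmx w k Q x := by
  induction k with
  | zero => intro Q x hx; exact ⟨Q, hset_subset_set Q hx, le_rfl, by simp, le_rfl⟩
  | succ k ih =>
    intro Q x hx
    obtain ⟨ε, hε⟩ := exists_child hx
    obtain ⟨R, h1, h2, h3, h4⟩ := ih _ x hε
    refine ⟨R, h1, h2.trans (child_set_subset Q ε), ?_, ?_⟩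
    · rw [h3, child_side, pow_succ]; field_simp
    · rw [dmx_succ w k Q ε hε]; exact h4.trans (le_max_right _ _)

lemma le_liminf_dmx (hd : 1 ≤ d) {w : Rd d → ℝ≥0∞} (hw : Measurable w) {Q : Cube d}
    (hQ : ∫⁻ x in Q.set, w x ≠ ⊤) :
    ∀ᵐ x ∂volume.restrict (hset Q), w x ≤ liminf (fun k => dmx w k Q x) atTop := by
  have hfin : ∀ᵐ x ∂volume.restrict Q.set, w x < ⊤ := ae_lt_top hw hQ
  have hQm := measurableSet_set Q
  set h : Rd d → ℂ := Q.set.indicator fun x => ((w x).toReal : ℂ) with hh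
  have hInt : Integrable h := by
    rw [hh, integrable_indicator_iff hQm]
    exact (integrable_toReal_of_lintegral_ne_top hw.aemeasurable hQ).ofReal
  have hL := ae_restrict_of_ae (s := hset Q) (ae_lebesgue_point hd hInt.locallyIntegrable)
  filter_upwards [hL, ae_restrict_of_ae_restrict_of_subset (hset_subset_set Q) hfin,
    ae_restrict_mem (measurableSet_hset Q)] with x hx hxf hxQ
  have hxQ' := hset_subset_set Q hxQ
  refine ENNReal.le_of_forall_pos_le_add fun ε hε _ => ?_
  obtain ⟨r, hr, H⟩ := hx ε (by exact_mod_cast hε)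
  obtain ⟨N, hN⟩ := pow_unbounded_of_one_lt (Q.side / r) (_root_.one_lt_two)
  have key : ∀ k ≥ N, w x - ε ≤ dmx w k Q x := by
    intro k hk
    obtain ⟨R, h1, h2, h3, h4⟩ := exists_av_le_dmx w k Q x hxQ
    refine le_trans ?_ h4
    have hRr : R.side < r := by
      rw [h3, div_lt_iff₀ (by positivity)]
      rw [div_lt_iff₀ hr] at hN
      have := pow_le_pow_right₀ (_root_.one_le_two (α := ℝ)) hk
      nlinarith
    have h5 := H R h1 hRr
    rw [tsub_le_iff_right]
    refine le_trans ?_ (add_le_add_right h5 _)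
    rw [av, ← mul_add, ← lintegral_add_left hw]
    have h6 : w x = (qvol R)⁻¹ * ∫⁻ _ in R.set, w x := by
      rw [setLIntegral_const, volume_set, mul_comm (w x), ← mul_assoc,
        ENNReal.inv_mul_cancel (qvol_ne_zero R) (qvol_ne_top R), one_mul]
    nth_rewrite 1 [h6]
    refine mul_le_mul_right (lintegral_mono_ae ?_) _
    filter_upwards [ae_restrict_of_ae_restrict_of_subset h2 hfin,
      ae_restrict_mem (measurableSet_set R)] with y hy hyR
    rw [hh, indicator_of_mem (h2 hyR), indicator_of_mem hxQ', ← Complex.ofReal_sub]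
    rw [← ofReal_toReal hxf.ne, ← ofReal_toReal hy.ne,
      ← ofReal_norm, toReal_ofReal toReal_nonneg,
      toReal_ofReal toReal_nonneg,
      ← ofReal_add toReal_nonneg (norm_nonneg _), Complex.norm_real]
    refine ofReal_le_ofReal ?_
    have := neg_abs_le ((w y).toReal - (w x).toReal)
    rw [Real.norm_eq_abs]; linarith
  rw [← tsub_le_iff_right]
  exact le_liminf_of_le (by isBoundedDefault) (eventually_atTop.2 ⟨N, key⟩)

theorem reverse_holder (hd : 1 ≤ d) {w : Rd d → ℝ≥0∞} (hw : Measurable w) {S : ℝ≥0∞}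
    (hS : ∀ R : Cube d, ∫⁻ x in R.set, HLM (R.set.indicator w) x ≤ S * ∫⁻ x in R.set, w x)
    {ε : ℝ} (hε : 0 < ε) (hεS : ENNReal.ofReal ε * (2 ^ (d + 1) * S) ≤ 1) {Q : Cube d}
    (hQ : ∫⁻ x in Q.set, w x ≠ ⊤) :
    av (fun x => w x ^ (1 + ε)) Q ≤ 2 * av w Q ^ (1 + ε) := by
  have hST : S ≠ ⊤ := by
    rintro rfl
    rw [mul_top (by simp), mul_top (by simpa using hε)] at hεS
    simp at hεS
  set A := av w Q with hA
  have hAt : A ≠ ⊤ := mul_ne_top (inv_ne_top.2 (qvol_ne_zero Q)) hQ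
  have hAw : ∫⁻ x in hset Q, w x = qvol Q * A := by rw [lintegral_hset, hA, qvol_mul_av]
  have hApow : A ^ ε * A = A ^ (1 + ε) := by
    rw [add_comm, rpow_add_of_nonneg _ _ hε.le zero_le_one, rpow_one]
  have bound : ∀ k, ∫⁻ x in hset Q, w x * dmx w k Q x ^ ε ≤ 2 * A ^ (1 + ε) * qvol Q := by
    intro k
    have hDm := measurable_dmx w k Q
    have hm := fun l : ℝ≥0∞ => measurableSet_lt (measurable_const (a := l)) hDm
    have t1 := lintegral_mul_rpow_le_of_tail (μ := volume.restrict (hset Q)) (A := A)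
      (B := 2 ^ d * S) hDm hDm (mul_ne_top (by simp) hST) hε (fun t _ htA => by
        have := dmx_tail hw hS 1 0 (ENNReal.ofReal t) k Q htA
        rw [Measure.restrict_restrict (hm _), Measure.restrict_apply (hm _)]
        simpa using this)
    have t2 := lintegral_mul_rpow_le_of_tail (μ := volume.restrict (hset Q)) (A := A)
      (B := 2 ^ d) hDm hw (by simp) hε (fun t _ htA => by
        have := dmx_tail hw hS 0 1 (ENNReal.ofReal t) k Q htA
        rw [Measure.restrict_restrict (hm _), Measure.restrict_apply (hm _)]
        simpa using this)
    set I := ∫⁻ x in hset Q, dmx w k Q x ^ (1 + ε) with hI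
    have hIt : I ≠ ⊤ := by
      refine ne_top_of_le_ne_top (b := ((2 ^ d) ^ k * A) ^ (1 + ε) * qvol Q) ?_ ?_
      · exact mul_ne_top (rpow_ne_top_of_nonneg (by linarith)
          (mul_ne_top (by simp) hAt)) (qvol_ne_top Q)
      · rw [← volume_hset, ← setLIntegral_const]
        exact setLIntegral_mono' (measurableSet_hset Q) fun x hx =>
          rpow_le_rpow (dmx_le w k Q x hx) (by linarith)
    have hI2 : I ≤ 2 * (S * A ^ (1 + ε) * qvol Q) := by
      have e1 : ∫⁻ x in hset Q, dmx w k Q x * dmx w k Q x ^ ε = I := by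
        rw [hI]; congr 1; ext x
        rw [rpow_add_of_nonneg _ _ zero_le_one hε.le, rpow_one]
      have e2 : 2 * (ENNReal.ofReal ε * (2 ^ d * S) * I) ≤ I := by
        calc _ = ENNReal.ofReal ε * (2 ^ (d + 1) * S) * I := by ring
          _ ≤ 1 * I := mul_le_mul_left hεS I
          _ = I := one_mul I
      have e3 : A ^ ε * ∫⁻ x in hset Q, dmx w k Q x ≤ S * A ^ (1 + ε) * qvol Q := by
        refine (mul_le_mul_right (lintegral_dmx_le hS k Q) _).trans_eq ?_
        rw [← lintegral_hset, hAw, ← hApow]; ring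
      rw [e1] at t1
      have e4 : I + I ≤ 2 * (S * A ^ (1 + ε) * qvol Q) + I := by
        rw [← two_mul]
        calc 2 * I ≤ 2 * (S * A ^ (1 + ε) * qvol Q + ENNReal.ofReal ε * (2 ^ d * S) * I) :=
              mul_le_mul_right (t1.trans (add_le_add_left e3 _)) 2
          _ = 2 * (S * A ^ (1 + ε) * qvol Q) + 2 * (ENNReal.ofReal ε * (2 ^ d * S) * I) := by ring
          _ ≤ _ := add_le_add_right e2 _
      exact (ENNReal.add_le_add_iff_right hIt).1 e4
    refine t2.trans ?_
    rw [hAw]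
    calc _ ≤ A ^ ε * (qvol Q * A) + ENNReal.ofReal ε * 2 ^ d * (2 * (S * A ^ (1 + ε) * qvol Q)) :=
          add_le_add_right (mul_le_mul_right hI2 _) _
      _ = (A ^ ε * A) * qvol Q +
          ENNReal.ofReal ε * (2 ^ (d + 1) * S) * (A ^ (1 + ε) * qvol Q) := by ring
      _ ≤ A ^ (1 + ε) * qvol Q + 1 * (A ^ (1 + ε) * qvol Q) := by
          rw [hApow]; exact add_le_add_right (mul_le_mul_left hεS _) _
      _ = _ := by ring
  have hlim : ∫⁻ x in hset Q, w x ^ (1 + ε) ≤ 2 * A ^ (1 + ε) * qvol Q := by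
    calc _ ≤ ∫⁻ x in hset Q, liminf (fun k => w x * dmx w k Q x ^ ε) atTop := by
          have hfin : ∀ᵐ x ∂volume.restrict (hset Q), w x < ⊤ :=
            ae_lt_top hw (by rwa [lintegral_hset])
          refine lintegral_mono_ae ?_
          filter_upwards [le_liminf_dmx hd hw hQ, hfin] with x hx hxf
          rw [rpow_add_of_nonneg _ _ zero_le_one hε.le, rpow_one]
          have h1 : w x ^ ε ≤ liminf (fun k => dmx w k Q x ^ ε) atTop := by
            have h2 := (orderIsoRpow ε hε).liminf_apply (u := fun k => dmx w k Q x)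
              (f := atTop)
            simp only [orderIsoRpow_apply] at h2
            rw [← h2]; exact rpow_le_rpow hx hε.le
          refine (mul_le_mul_right h1 _).trans ?_
          rw [liminf_const_mul_of_ne_top hxf.ne]
      _ ≤ liminf (fun k => ∫⁻ x in hset Q, w x * dmx w k Q x ^ ε) atTop :=
          lintegral_liminf_le fun k => hw.mul ((measurable_dmx w k Q).pow_const ε)
      _ ≤ _ := liminf_le_of_frequently_le' (Frequently.of_forall bound)
  rw [av, ← lintegral_hset]
  calc _ ≤ _ := mul_le_mul_right hlim _
    _ = (2 * A ^ (1 + ε)) * ((qvol Q)⁻¹ * qvol Q) := by ring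
    _ = _ := by rw [ENNReal.inv_mul_cancel (qvol_ne_zero Q) (qvol_ne_top Q), mul_one]

/-! ### The Fujii–Wilson characteristic -/

lemma HLM_zero (x : Rd d) : HLM (fun _ => 0) x = 0 := by simp [HLM]

lemma lintegral_HLM_le_of_AInftyConst {w : Rd d → ℝ≥0∞} (hw : Measurable w) {S : ℝ≥0∞}
    (hS0 : S ≠ 0) (hS : AInftyConst w ≤ S) (R : Cube d) :
    ∫⁻ x in R.set, HLM (R.set.indicator w) x ≤ S * ∫⁻ x in R.set, w x := by
  by_cases h0 : ∫⁻ x in R.set, w x = 0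
  · have h1 : R.set.indicator w =ᵐ[volume] fun _ => 0 := by
      rw [lintegral_eq_zero_iff hw] at h0
      exact (indicator_ae_eq_zero_of_restrict_ae_eq_zero (measurableSet_set R) h0)
    rw [HLM_congr_ae h1]
    simp [HLM_zero]
  by_cases ht : ∫⁻ x in R.set, w x = ⊤
  · rw [ht, mul_top hS0]; exact le_top
  · rw [← ENNReal.div_le_iff h0 ht, div_eq_mul_inv, mul_comm]
    exact (le_iSup (fun Q : Cube d => (∫⁻ x in Q.set, w x)⁻¹ *
      ∫⁻ x in Q.set, HLM (Q.set.indicator w) x) R).trans hS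

lemma AInftyConst_le {w : Rd d → ℝ≥0∞} {S : ℝ≥0∞}
    (hS : ∀ R : Cube d, ∫⁻ x in R.set, HLM (R.set.indicator w) x ≤ S * ∫⁻ x in R.set, w x) :
    AInftyConst w ≤ S := by
  refine iSup_le fun Q => (mul_le_mul_right (hS Q) _).trans ?_
  calc _ = S * ((∫⁻ x in Q.set, w x)⁻¹ * ∫⁻ x in Q.set, w x) := by ring
    _ ≤ S * 1 := mul_le_mul_right (ENNReal.inv_mul_le_one _) S
    _ = S := mul_one S

lemma one_le_AInftyConst {w : Rd d → ℝ≥0∞} {Q : Cube d} (h0 : ∫⁻ x in Q.set, w x ≠ 0)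
    (ht : ∫⁻ x in Q.set, w x ≠ ⊤) : 1 ≤ AInftyConst w := by
  refine le_trans ?_ (le_iSup (fun Q : Cube d => (∫⁻ x in Q.set, w x)⁻¹ *
      ∫⁻ x in Q.set, HLM (Q.set.indicator w) x) Q)
  rw [← ENNReal.inv_mul_cancel h0 ht]
  refine mul_le_mul_right ?_ _
  rw [← qvol_mul_av, ← volume_set, mul_comm, ← setLIntegral_const]
  refine setLIntegral_mono' (measurableSet_set Q) fun x hx =>
    le_trans (le_of_eq ?_) (avg_le_HLM _ hx)
  rw [av]; congr 1
  exact setLIntegral_congr_fun (measurableSet_set Q) fun y hy => (indicator_of_mem hy w).symm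

lemma exists_subcube {Q R : Cube d} (h : R.side ≤ Q.side) :
    ∃ R' : Cube d, R'.side = R.side ∧ R'.set ⊆ Q.set ∧ R.set ∩ Q.set ⊆ R'.set := by
  refine ⟨⟨WithLp.toLp 2 fun i => max (Q.corner i) (min (R.corner i)
    (Q.corner i + Q.side - R.side)), R.side, R.side_pos⟩, rfl, fun x hx i => ?_,
    fun x hx i => ?_⟩
  · have := hx i
    simp only at this
    rcases max_cases (Q.corner i) (min (R.corner i) (Q.corner i + Q.side - R.side)) with h1 | h1 <;>
    rcases min_cases (R.corner i) (Q.corner i + Q.side - R.side) with h2 | h2 <;>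
    constructor <;> linarith
  · have h3 := hx.1 i
    have h4 := hx.2 i
    simp only
    rcases max_cases (Q.corner i) (min (R.corner i) (Q.corner i + Q.side - R.side)) with h1 | h1 <;>
    rcases min_cases (R.corner i) (Q.corner i + Q.side - R.side) with h2 | h2 <;>
    constructor <;> linarith

lemma qvol_mono {Q R : Cube d} (h : R.side ≤ Q.side) : qvol R ≤ qvol Q :=
  pow_le_pow_left' (ofReal_le_ofReal h) d

lemma exists_av_le {Q : Cube d} {x : Rd d} (hx : x ∈ Q.set) (w : Rd d → ℝ≥0∞) (R : Cube d)
    (hxR : x ∈ R.set) : ∃ R' : Cube d, x ∈ R'.set ∧ R'.set ⊆ Q.set ∧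
      av (Q.set.indicator w) R ≤ av w R' := by
  have h0 : ∫⁻ y in R.set, Q.set.indicator w y = ∫⁻ y in R.set ∩ Q.set, w y := by
    rw [lintegral_indicator (measurableSet_set Q), Measure.restrict_restrict (measurableSet_set Q),
      inter_comm]
  rcases le_total R.side Q.side with h | h
  · obtain ⟨R', h1, h2, h3⟩ := exists_subcube h
    refine ⟨R', h3 ⟨hxR, hx⟩, h2, ?_⟩
    rw [av, av, h0]
    exact mul_le_mul' (ENNReal.inv_le_inv.2 (qvol_mono h1.le)) (lintegral_mono_set h3)
  · refine ⟨Q, hx, le_rfl, ?_⟩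
    rw [av, av, h0]
    exact mul_le_mul' (ENNReal.inv_le_inv.2 (qvol_mono h)) (lintegral_mono_set inter_subset_right)

/-- A weight whose averages are controlled by the squares of the averages of its square root
satisfies a Fujii–Wilson `A∞` condition. -/
lemma lintegral_HLM_le_of_av_sqrt (hd : 1 ≤ d) {w : Rd d → ℝ≥0∞} (hw : Measurable w) {C : ℝ≥0∞}
    (H : ∀ R : Cube d, av w R ≤ C * av (fun x => w x ^ (1 / 2 : ℝ)) R ^ (2 : ℝ)) (hC : C ≠ ⊤)
    (Q : Cube d) : ∫⁻ x in Q.set, HLM (Q.set.indicator w) x ≤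
      5 ^ d * 8 * C * ∫⁻ x in Q.set, w x := by
  set g : Rd d → ℝ≥0∞ := Q.set.indicator fun x => w x ^ (1 / 2 : ℝ) with hg
  have h1 : ∀ x ∈ Q.set, HLM (Q.set.indicator w) x ≤ C * HLM g x ^ (2 : ℝ) := by
    intro x hx
    refine HLM_le_iff.2 fun R hR => ?_
    obtain ⟨R', h1, h2, h3⟩ := exists_av_le hx w R hR
    refine h3.trans ((H R').trans (mul_le_mul_right (rpow_le_rpow ?_ (by norm_num)) _))
    refine le_trans (le_of_eq ?_) (avg_le_HLM g h1)
    rw [av]; congr 1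
    exact setLIntegral_congr_fun (measurableSet_set _) fun y hy => by
      rw [hg, indicator_of_mem (h2 hy)]
  have hgm : Measurable g := (hw.pow_const _).indicator (measurableSet_set Q)
  calc _ ≤ ∫⁻ x in Q.set, C * HLM g x ^ (2 : ℝ) := setLIntegral_mono' (measurableSet_set Q) h1
    _ ≤ ∫⁻ x, C * HLM g x ^ (2 : ℝ) := setLIntegral_le_lintegral _ _
    _ = C * ∫⁻ x, HLM g x ^ (2 : ℝ) := lintegral_const_mul' _ _ hC
    _ ≤ C * (ENNReal.ofReal (2 / (2 - 1)) * (5 ^ d * 2 ^ (2 : ℝ)) * ∫⁻ x, g x ^ (2 : ℝ)) :=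
        mul_le_mul_right (HLM_strong hd hgm (_root_.one_lt_two)) _
    _ = _ := by
        have h2 : ∫⁻ x, g x ^ (2 : ℝ) = ∫⁻ x in Q.set, w x := by
          rw [← lintegral_indicator (measurableSet_set Q)]
          congr 1; ext x
          by_cases hx : x ∈ Q.set
          · rw [hg, indicator_of_mem hx, indicator_of_mem hx, ← rpow_mul]; norm_num
          · rw [hg, indicator_of_notMem hx, indicator_of_notMem hx]; simp
        rw [h2]
        have h3 : ENNReal.ofReal (2 / (2 - 1)) = 2 := by norm_num
        rw [h3, show (2 : ℝ) = ((2 : ℕ) : ℝ) by norm_num, rpow_natCast]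
        ring

/-! ### Powers of positive definite matrices -/

open scoped Matrix.Norms.L2Operator MatrixOrder

variable {n : ℕ}

instance : MeasurableSpace (Mat n) := inferInstanceAs (MeasurableSpace (Fin n → Fin n → ℂ))
instance : BorelSpace (Mat n) := inferInstanceAs (BorelSpace (Fin n → Fin n → ℂ))
instance : SecondCountableTopology (Mat n) :=
  inferInstanceAs (SecondCountableTopology (Fin n → Fin n → ℂ))

lemma measurable_mat {α : Type*} [MeasurableSpace α] {W : α → Mat n} 
    (h : ∀ i j, Measurable fun x => W x i j) : Measurable W :=
  measurable_pi_iff.2 fun i => measurable_pi_iff.2 fun j => h i j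

lemma ofReal_opNorm (A : Mat n) : ENNReal.ofReal (opNorm A) = ‖A‖ₑ := ofReal_norm A

lemma matPow_eq_cfc {A : Mat n} (hA : A.PosDef) (s : ℝ) :
    matPow A s = cfc (fun x : ℝ => x ^ s) A := by
  rw [matPow, dif_pos hA.isHermitian, hA.isHermitian.cfc_eq]
  rfl

lemma matPow_eq_rpow {A : Mat n} (hA : A.PosDef) (s : ℝ) : matPow A s = A ^ s := by
  rw [matPow_eq_cfc hA, CFC.rpow_eq_cfc_real hA.isStrictlyPositive.nonneg]

lemma posDef_matPow {A : Mat n} (hA : A.PosDef) (s : ℝ) : (matPow A s).PosDef := by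
  rw [matPow_eq_rpow hA]
  exact Matrix.isStrictlyPositive_iff_posDef.1
    (IsStrictlyPositive.rpow A s hA.isStrictlyPositive)

lemma matPow_mul {A : Mat n} (hA : A.PosDef) (s t : ℝ) :
    matPow A s * matPow A t = matPow A (s + t) := by
  simp only [matPow_eq_rpow hA]
  exact (CFC.rpow_add hA.isStrictlyPositive.isUnit).symm

lemma matPow_zero {A : Mat n} (hA : A.PosDef) : matPow A 0 = 1 := by
  rw [matPow_eq_rpow hA, CFC.rpow_zero A hA.isStrictlyPositive.nonneg]

lemma matPow_one {A : Mat n} (hA : A.PosDef) : matPow A 1 = A := by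
  rw [matPow_eq_rpow hA, CFC.rpow_one A hA.isStrictlyPositive.nonneg]

lemma matPow_mul_neg {A : Mat n} (hA : A.PosDef) (s : ℝ) : matPow A s * matPow A (-s) = 1 := by
  rw [matPow_mul hA, add_neg_cancel, matPow_zero hA]

lemma matPow_neg_mul {A : Mat n} (hA : A.PosDef) (s : ℝ) : matPow A (-s) * matPow A s = 1 := by
  rw [matPow_mul hA, neg_add_cancel, matPow_zero hA]

lemma matPow_matPow {A : Mat n} (hA : A.PosDef) {s : ℝ} (hs : s ≠ 0) (t : ℝ) :
    matPow (matPow A s) t = matPow A (s * t) := by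
  rw [matPow_eq_rpow (posDef_matPow hA s), matPow_eq_rpow hA, matPow_eq_rpow hA,
    CFC.rpow_rpow A s t hs hA.isStrictlyPositive]

lemma measurable_matPow {α : Type*} [MeasurableSpace α] {W : α → Mat n} (hW : Measurable W)
    (hp : ∀ x, (W x).PosDef) (s : ℝ) : Measurable fun x => matPow (W x) s := by
  have hc : Continuous fun A : {A : Mat n // A.PosDef} => cfc (fun x : ℝ => x ^ s) A.1 := by
    rw [← continuousOn_univ]
    refine ContinuousOn.cfc_of_mem_nhdsSet (s := Ioi 0) (p := IsSelfAdjoint) _ ?_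
      continuous_subtype_val.continuousOn (fun A _ => A.2.isHermitian) ?_
    · refine (isOpen_Ioi.mem_nhdsSet).2 (iUnion₂_subset fun A _ => ?_)
      rw [A.2.isHermitian.spectrum_real_eq_range_eigenvalues]
      rintro _ ⟨i, rfl⟩
      exact A.2.eigenvalues_pos i
    · exact continuousOn_id.rpow_const fun x hx => Or.inl (ne_of_gt hx)
  have h1 : (fun x => matPow (W x) s) = (fun A : {A : Mat n // A.PosDef} =>
      cfc (fun x : ℝ => x ^ s) A.1) ∘ fun x => ⟨W x, hp x⟩ := by
    ext1 x; exact matPow_eq_cfc (hp x) s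
  rw [h1]
  exact hc.measurable.comp (hW.subtype_mk)

lemma posDef_smul {A : Mat n} (hA : A.PosDef) {c : ℝ} (hc : 0 < c) : (c • A).PosDef := by
  simpa using hA.smul (show (0:ℂ) < (c:ℂ) by exact_mod_cast hc)

lemma matPow_smul {A : Mat n} (hA : A.PosDef) {c : ℝ} (hc : 0 < c) (s : ℝ) :
    matPow (c • A) s = c ^ s • matPow A s := by
  have hcont : ∀ X : Mat n, X.PosDef → ContinuousOn (fun x : ℝ => x ^ s) (spectrum ℝ X) := by
    intro X hX
    refine continuousOn_id.rpow_const fun x hx => Or.inl ?_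
    rw [hX.isHermitian.spectrum_real_eq_range_eigenvalues] at hx
    obtain ⟨i, rfl⟩ := hx
    exact (hX.eigenvalues_pos i).ne'
  have hpos : ∀ x ∈ spectrum ℝ A, 0 ≤ x := fun x hx =>
    spectrum_nonneg_of_nonneg hA.isStrictlyPositive.nonneg hx
  have hfin : (spectrum ℝ A).Finite := Matrix.finite_real_spectrum
  rw [matPow_eq_cfc (posDef_smul hA hc), matPow_eq_cfc hA]
  have h1 := cfc_comp_smul c (fun x : ℝ => x ^ s) A ((hfin.image _).continuousOn _)
    hA.isHermitian
  have h2 := cfc_smul (c ^ s) (fun x : ℝ => x ^ s) A (hcont A hA)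
  refine Eq.trans (Eq.symm h1) (Eq.trans (cfc_congr fun x hx => ?_) h2)
  simp only [smul_eq_mul]
  rw [Real.mul_rpow hc.le (hpos x hx)]

lemma norm_le_one_iff_mul_self_le {X : Mat n} : ‖X‖ ≤ 1 ↔ X * star X ≤ 1 := by
  have h1 : ‖X‖ ≤ 1 ↔ ‖X * star X‖ ≤ 1 := by
    rw [CStarRing.norm_self_mul_star]
    constructor <;> intro h <;> nlinarith [norm_nonneg X]
  rw [h1, CStarAlgebra.norm_le_iff_le_algebraMap _ zero_le_one (mul_star_self_nonneg X), map_one]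

/-- Cordes' inequality. -/
lemma norm_matPow_mul_matPow_le {A B : Mat n} (hA : A.PosDef) (hB : B.PosDef) {s : ℝ}
    (hs0 : 0 < s) (hs1 : s ≤ 1) : ‖matPow A s * matPow B s‖ ≤ ‖A * B‖ ^ s := by
  have sa : ∀ {X : Mat n}, X.PosDef → star X = X := fun hX => hX.isHermitian
  rcases (norm_nonneg (A * B)).eq_or_lt with h0 | h0
  · have h1 : A * B = 0 := norm_eq_zero.1 h0.symm
    have h2 : (1 : Mat n) = 0 := by
      have h3 := matPow_mul_neg hB 1
      have h4 := matPow_neg_mul hA 1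
      rw [matPow_one hB] at h3
      rw [matPow_one hA] at h4
      calc (1 : Mat n) = matPow A (-1) * A * (B * matPow B (-1)) := by rw [h3, h4, one_mul]
        _ = matPow A (-1) * (A * B) * matPow B (-1) := by noncomm_ring
        _ = 0 := by rw [h1]; simp
    rw [← mul_one (matPow A s * matPow B s), h2, mul_zero, norm_zero]
    positivity
  set c := ‖A * B‖ with hc
  have hci : 0 < c⁻¹ := inv_pos.2 h0
  have main : ∀ B' : Mat n, B'.PosDef → ‖A * B'‖ ≤ 1 → ‖matPow A s * matPow B' s‖ ≤ 1 := by
    intro B' hB' h1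
    rw [norm_le_one_iff_mul_self_le, star_mul, sa hA, sa hB'] at h1
    have h2 := IsSelfAdjoint.conjugate_le_conjugate h1 (sa (posDef_matPow hA (-1)))
    have h3 : B' * B' ≤ matPow A (-2) := by
      have h5 := matPow_mul_neg hA 1
      have h4 := matPow_neg_mul hA 1
      rw [matPow_one hA] at h4 h5
      calc B' * B' = (matPow A (-1) * A) * (B' * B') * (A * matPow A (-1)) := by
            rw [h4, h5]; simp
        _ = matPow A (-1) * (A * B' * (B' * A)) * matPow A (-1) := by noncomm_ring
        _ ≤ _ := h2
        _ = _ := by rw [mul_one, matPow_mul hA]; norm_num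
    have h4 : B' * B' = matPow B' 2 := by
      nth_rewrite 1 2 [← matPow_one hB']
      rw [matPow_mul hB']; norm_num
    rw [h4] at h3
    have h5 := CFC.rpow_le_rpow (p := s) ⟨hs0.le, hs1⟩ h3
    rw [← matPow_eq_rpow (posDef_matPow hB' 2), ← matPow_eq_rpow (posDef_matPow hA (-2)),
      matPow_matPow hB' two_ne_zero, matPow_matPow hA (by norm_num)] at h5
    have h6 := IsSelfAdjoint.conjugate_le_conjugate h5 (sa (posDef_matPow hA s))
    rw [norm_le_one_iff_mul_self_le, star_mul, sa (posDef_matPow hA s), sa (posDef_matPow hB' s)]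
    calc matPow A s * matPow B' s * (matPow B' s * matPow A s)
        = matPow A s * (matPow B' s * matPow B' s) * matPow A s := by noncomm_ring
      _ = matPow A s * matPow B' (2 * s) * matPow A s := by rw [matPow_mul hB', two_mul]
      _ ≤ _ := h6
      _ = 1 := by
        rw [matPow_mul hA, matPow_mul hA, show s + -2 * s + s = 0 by ring, matPow_zero hA]
  have h1 := main (c⁻¹ • B) (posDef_smul hB hci) (by
    rw [mul_smul_comm, norm_smul, ← hc, Real.norm_of_nonneg hci.le, inv_mul_cancel₀ h0.ne'])
  rw [matPow_smul hB hci, mul_smul_comm, norm_smul, Real.norm_of_nonneg (by positivity),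
    Real.inv_rpow h0.le, inv_mul_le_iff₀ (by positivity), mul_one] at h1
  exact h1

lemma norm_mvec_le (A : Mat n) (v : Vec n) : ‖mvec A v‖ ≤ ‖A‖ * ‖v‖ :=
  (Matrix.toEuclideanCLM (𝕜 := ℂ) (n := Fin n) A).le_opNorm v

lemma mvec_mvec (A B : Mat n) (v : Vec n) : mvec A (mvec B v) = mvec (A * B) v := by
  simp [mvec, Matrix.toLpLin_apply, Matrix.mulVec_mulVec]

lemma mvec_one (v : Vec n) : mvec 1 v = v := by simp [mvec]

lemma norm_mul_comm_of_posDef {A B : Mat n} (hA : A.PosDef) (hB : B.PosDef) :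
    ‖A * B‖ = ‖B * A‖ := by
  rw [← norm_star (A * B), star_mul]
  congr 2
  · exact hB.isHermitian
  · exact hA.isHermitian

lemma norm_le_sum_mvec (A : Mat n) :
    ‖A‖ ≤ ∑ j, ‖mvec A (EuclideanSpace.single j 1)‖ := by
  refine ContinuousLinearMap.opNorm_le_bound
    (Matrix.toEuclideanCLM (𝕜 := ℂ) (n := Fin n) A) (by positivity) fun v => ?_
  have h1 : v = ∑ j, v j • EuclideanSpace.single j (1:ℂ) := by
    ext i
    simp [Finset.sum_apply, Pi.single_apply]
  have h2 : Matrix.toEuclideanCLM (𝕜 := ℂ) (n := Fin n) A v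
      = ∑ j, v j • mvec A (EuclideanSpace.single j 1) := by
    conv_lhs => rw [h1]
    rw [map_sum]
    refine Finset.sum_congr rfl fun j _ => ?_
    rw [map_smul]
    rfl
  rw [h2, Finset.sum_mul]
  refine (norm_sum_le _ _).trans (Finset.sum_le_sum fun j _ => ?_)
  rw [norm_smul, mul_comm]
  exact mul_le_mul_of_nonneg_left (PiLp.norm_apply_le v j) (norm_nonneg _)

section

open scoped Matrix.Norms.L2Operator MatrixOrder

variable {n : ℕ}

/-! ### Reducing matrices -/

lemma mvec_apply (A : Mat n) (v : Vec n) (i : Fin n) : mvec A v i = (A.mulVec v) i := rfl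

lemma exists_auerbach {N : Vec n → ℝ} (hN : ∀ (t : ℝ) u, 0 ≤ t → N (t • u) = t * N u)
    {c : ℝ} (hc : 0 < c) (hcN : ∀ u, c * ‖u‖ ≤ N u) :
    ∃ E : Mat n, E.det ≠ 0 ∧ (∀ j, N (mvec E (EuclideanSpace.single j 1)) ≤ 1) ∧
      ∀ u i, ‖mvec E⁻¹ u i‖ ≤ 2 * N u := by
  have hN0 : ∀ u, 0 ≤ N u := fun u => (mul_nonneg hc.le (norm_nonneg u)).trans (hcN u)
  let K : Set (Mat n) := {E | ∀ j, N (WithLp.toLp 2 (E.col j)) ≤ 1}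
  have hcol : ∀ (E : Mat n) j, mvec E (EuclideanSpace.single j 1) = WithLp.toLp 2 (E.col j) := by
    intro E j; ext i; simp [mvec_apply]
  have hbdd : BddAbove ((fun E : Mat n => ‖E.det‖) '' K) := by
    refine ⟨(Fintype.card (Fin n)).factorial • c⁻¹ ^ Fintype.card (Fin n), ?_⟩
    rintro _ ⟨E, hE, rfl⟩
    refine Matrix.det_le (A := E) (abv := NormedField.toAbsoluteValue ℂ) (x := c⁻¹) fun i j => ?_
    have h1 := (hcN _).trans (hE j)
    rw [← le_div_iff₀' hc, one_div] at h1
    exact (PiLp.norm_apply_le (WithLp.toLp 2 (E.col j)) i).trans h1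
  obtain ⟨E0, hE0, hE0d⟩ : ∃ E ∈ K, E.det ≠ 0 := by
    let T := ∑ j, N (EuclideanSpace.single j (1:ℂ))
    have hT : 0 ≤ T := Finset.sum_nonneg fun j _ => hN0 _
    refine ⟨Matrix.diagonal fun _ => (((1 + T)⁻¹ : ℝ) : ℂ), fun j => ?_, ?_⟩
    · have h1 : WithLp.toLp 2 ((Matrix.diagonal fun _ : Fin n => (((1 + T)⁻¹ : ℝ) : ℂ)).col j)
          = (1 + T)⁻¹ • EuclideanSpace.single j (1:ℂ) := by
        ext i
        simp only [Matrix.col_apply, Matrix.diagonal_apply, PiLp.smul_apply,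
          PiLp.single_apply]
        split_ifs with h <;> simp
      rw [h1, hN _ _ (by positivity), inv_mul_le_iff₀ (by positivity), mul_one]
      have := Finset.single_le_sum (f := fun j => N (EuclideanSpace.single j (1:ℂ)))
        (fun j _ => hN0 _) (Finset.mem_univ j)
      simp only [T]; linarith
    · rw [Matrix.det_diagonal]
      simp only [Finset.prod_const]
      refine pow_ne_zero _ ?_
      have : (1 + T)⁻¹ ≠ 0 := by positivity
      exact_mod_cast this
  set s := sSup ((fun E : Mat n => ‖E.det‖) '' K)
  have hs : 0 < s := (norm_pos_iff.2 hE0d).trans_le (le_csSup hbdd ⟨E0, hE0, rfl⟩)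
  obtain ⟨_, ⟨E, hE, rfl⟩, hEs⟩ := exists_lt_of_lt_csSup (⟨_, E0, hE0, rfl⟩ :
    ((fun E : Mat n => ‖E.det‖) '' K).Nonempty) (half_lt_self hs)
  have hd : E.det ≠ 0 := norm_pos_iff.1 ((half_pos hs).trans hEs)
  refine ⟨E, hd, fun j => by rw [hcol]; exact hE j, fun u i => ?_⟩
  rcases (hN0 u).eq_or_lt with h0 | h0
  · have : u = 0 := by
      have := hcN u
      rw [← h0] at this
      exact norm_eq_zero.1 (le_antisymm (by nlinarith) (norm_nonneg u))
    rw [← h0, this]; simp [mvec]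
  · have hmem : E.updateCol i ((N u)⁻¹ • u : Vec n) ∈ K := by
      intro j
      by_cases hj : j = i
      · subst hj
        have h1 : WithLp.toLp 2 ((E.updateCol j ((N u)⁻¹ • u : Vec n)).col j) = (N u)⁻¹ • u := by
          ext k; simp [Matrix.col_apply]
        rw [h1, hN _ _ (by positivity), inv_mul_cancel₀ h0.ne']
      · have h1 : (E.updateCol i ((N u)⁻¹ • u : Vec n)).col j = E.col j := by
          ext k; simp [Matrix.col_apply, Matrix.updateCol_ne hj]
        rw [h1]; exact hE j
    have h1 : ‖(E.updateCol i ((N u)⁻¹ • u : Vec n)).det‖ ≤ s := le_csSup hbdd ⟨_, hmem, rfl⟩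
    have h2 : (E.updateCol i ((N u)⁻¹ • u : Vec n)).det
        = ((N u)⁻¹ : ℝ) * (E.det * mvec E⁻¹ u i) := by
      rw [← Matrix.cramer_apply, ← Matrix.det_smul_inv_mulVec_eq_cramer _ _ (Ne.isUnit hd)]
      have : (((N u)⁻¹ • u : Vec n) : Fin n → ℂ) = (((N u)⁻¹ : ℝ) : ℂ) • (u : Fin n → ℂ) := by
        ext k; simp
      rw [this, Matrix.mulVec_smul]
      simp only [Pi.smul_apply, smul_eq_mul, mvec_apply]
      ring
    rw [h2, norm_mul, norm_mul, Complex.norm_real, Real.norm_of_nonneg (by positivity),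
      inv_mul_le_iff₀ h0] at h1
    simp only at hEs
    have h3 : 0 ≤ ‖mvec E⁻¹ u i‖ := norm_nonneg _
    have h4 : ‖E.det‖ * ‖mvec E⁻¹ u i‖ ≤ ‖E.det‖ * (2 * N u) := by nlinarith
    exact le_of_mul_le_mul_left h4 (norm_pos_iff.2 hd)

lemma norm_eq_of_mul_star_eq {X Y : Mat n} (h : X * star X = Y * star Y) : ‖X‖ = ‖Y‖ := by
  have h1 := congrArg norm h
  rw [CStarRing.norm_self_mul_star, CStarRing.norm_self_mul_star] at h1
  nlinarith [norm_nonneg X, norm_nonneg Y]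

lemma norm_eq_of_star_mul_eq {X Y : Mat n} (h : star X * X = star Y * Y) : ‖X‖ = ‖Y‖ := by
  rw [← norm_star X, ← norm_star Y]
  exact norm_eq_of_mul_star_eq (by simpa using h)

lemma av_mono {f g : Rd d → ℝ≥0∞} (P : Cube d) (h : ∀ x ∈ P.set, f x ≤ g x) : av f P ≤ av g P :=
  mul_le_mul_right (setLIntegral_mono' (measurableSet_set P) h) _

lemma av_const_mul (P : Cube d) {c : ℝ≥0∞} (hc : c ≠ ⊤) (f : Rd d → ℝ≥0∞) :
    av (fun x => c * f x) P = c * av f P := by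
  rw [av, av, lintegral_const_mul' _ _ hc]; ring

lemma av_const (P : Cube d) (c : ℝ≥0∞) : av (fun _ => c) P = c := by
  rw [av, setLIntegral_const, volume_set, mul_comm c, ← mul_assoc,
    ENNReal.inv_mul_cancel (qvol_ne_zero P) (qvol_ne_top P), one_mul]

lemma mvec_real_smul (A : Mat n) (t : ℝ) (u : Vec n) : mvec A (t • u) = t • mvec A u :=
  LinearMap.map_smul_of_tower (Matrix.toEuclideanLin A) t u

lemma measurable_enorm_mul_left {α : Type*} [MeasurableSpace α] {V : α → Mat n}
    (hV : Measurable V) (A : Mat n) : Measurable fun x => ‖A * V x‖ₑ :=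
  (by fun_prop : Continuous fun X : Mat n => ‖A * X‖ₑ).measurable.comp hV

lemma measurable_enorm_mul_right {α : Type*} [MeasurableSpace α] {V : α → Mat n}
    (hV : Measurable V) (A : Mat n) : Measurable fun x => ‖V x * A‖ₑ :=
  (by fun_prop : Continuous fun X : Mat n => ‖X * A‖ₑ).measurable.comp hV

lemma continuous_mvec_left (u : Vec n) : Continuous fun X : Mat n => mvec X u := by
  have : (fun X : Mat n => mvec X u) = fun X => WithLp.toLp 2 (X.mulVec u) := rfl
  rw [this]
  fun_prop

lemma measurable_mvec {α : Type*} [MeasurableSpace α] {V : α → Mat n}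
    (hV : Measurable V) (u : Vec n) : Measurable fun x => mvec (V x) u :=
  (continuous_mvec_left u).measurable.comp hV

lemma enorm_le_sum_mvec (A : Mat n) :
    ‖A‖ₑ ≤ ∑ j, ‖mvec A (EuclideanSpace.single j 1)‖ₑ := by
  rw [← ofReal_norm]
  refine (ofReal_le_ofReal (norm_le_sum_mvec A)).trans ?_
  rw [ofReal_sum_of_nonneg fun _ _ => norm_nonneg _]
  simp [ofReal_norm]

lemma sum_rpow_le {r : ℝ} (hr : 1 ≤ r) (f : Fin n → ℝ≥0∞) :
    (∑ j, f j) ^ r ≤ (n : ℝ≥0∞) ^ r * ∑ j, f j ^ r := by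
  have h1 : ∑ j, f j ≤ n * (Finset.univ.sup f) := by
    refine (Finset.sum_le_card_nsmul _ _ _ fun j _ => Finset.le_sup (Finset.mem_univ j)).trans ?_
    simp
  have h2 : (Finset.univ.sup f) ^ r ≤ ∑ j, f j ^ r := by
    rcases Finset.univ.eq_empty_or_nonempty (α := Fin n) with h | h
    · rw [h]; simp [show 0 < r by linarith]
    · obtain ⟨j, hj, hj'⟩ := Finset.exists_mem_eq_sup _ h f
      rw [hj']
      exact Finset.single_le_sum (f := fun j => f j ^ r) (fun _ _ => zero_le) hj
  calc _ ≤ (n * (Finset.univ.sup f)) ^ r := rpow_le_rpow h1 (by linarith)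
    _ = (n : ℝ≥0∞) ^ r * (Finset.univ.sup f) ^ r := mul_rpow_of_nonneg _ _ (by linarith)
    _ ≤ _ := mul_le_mul_right h2 _

lemma exists_reducing {q : ℝ} (hq : 1 < q) {V Vi : Rd d → Mat n}
    (hV : Measurable V) (hVi : Measurable Vi) (hp : ∀ x, (V x).PosDef) (hpi : ∀ x, (Vi x).PosDef)
    (h1 : ∀ x, V x * Vi x = 1) (P : Cube d)
    (hT : av (fun x => av (fun y => ‖V x * Vi y‖ₑ ^ (q / (q - 1))) P ^ (q - 1)) P ≠ ⊤) :
    ∃ D : Mat n, D.PosDef ∧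
      av (fun y => ‖matPow D (-1) * Vi y‖ₑ ^ (q / (q - 1))) P ≤ (n:ℝ≥0∞) ^ (q / (q - 1)) * n ∧
      av (fun x => ‖V x * D‖ₑ ^ q) P ≤ (2 * n * n : ℝ≥0∞) ^ q *
        av (fun x => av (fun y => ‖V x * Vi y‖ₑ ^ (q / (q - 1))) P ^ (q - 1)) P := by
  have hq1 : 0 < q - 1 := by linarith
  set q' := q / (q - 1) with hq'
  have hq'1 : 1 ≤ q' := by rw [hq', le_div_iff₀ hq1]; linarith
  have hq'0 : 0 < q' := by linarith
  let NE : Vec n → ℝ≥0∞ := fun u => av (fun y => ‖mvec (Vi y) u‖ₑ ^ q') P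
  have hmeas : ∀ u, Measurable fun y => ‖mvec (Vi y) u‖ₑ ^ q' := fun u =>
    (measurable_mvec hVi u).enorm.pow_const _
  have hVV : ∀ x u, NE (mvec (V x) u) ≤ av (fun y => ‖V x * Vi y‖ₑ ^ q') P * ‖u‖ₑ ^ q' := by
    intro x u
    rw [mul_comm, ← av_const_mul P (by finiteness)]
    refine av_mono P fun y _ => ?_
    rw [← mul_rpow_of_nonneg _ _ hq'0.le, mvec_mvec]
    refine rpow_le_rpow ?_ hq'0.le
    rw [mul_comm, ← ofReal_norm, ← ofReal_norm, ← ofReal_norm, norm_mul_comm_of_posDef (hp x) (hpi y),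
      ← ofReal_mul (norm_nonneg _)]
    exact ofReal_le_ofReal (norm_mvec_le _ _)
  have hfin : ∀ u, NE u ≠ ⊤ := by
    obtain ⟨x, hx⟩ : ∃ x, av (fun y => ‖V x * Vi y‖ₑ ^ q') P ≠ ⊤ := by
      by_contra! hcon
      refine hT ?_
      simp only [hcon, top_rpow_of_pos hq1]
      exact av_const P ⊤
    intro u
    have h3 := hVV x (mvec (Vi x) u)
    rw [mvec_mvec, h1, mvec_one] at h3
    exact ne_top_of_le_ne_top (mul_ne_top hx (by finiteness)) h3
  let N : Vec n → ℝ := fun u => (NE u ^ (1 / q')).toReal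
  have hNE : ∀ u, NE u = ENNReal.ofReal (N u) ^ q' := by
    intro u
    rw [ofReal_toReal (by have := hfin u; finiteness), ← rpow_mul,
      one_div_mul_cancel hq'0.ne', rpow_one]
  have hN : ∀ (t : ℝ) u, 0 ≤ t → N (t • u) = t * N u := by
    intro t u ht
    have h3 : NE (t • u) = ENNReal.ofReal t ^ q' * NE u := by
      simp only [NE, mvec_real_smul, enorm_smul, mul_rpow_of_nonneg _ _ hq'0.le]
      rw [av_const_mul P (by finiteness), Real.enorm_eq_ofReal ht]
    simp only [N]
    rw [h3, mul_rpow_of_nonneg _ _ (by positivity), ← rpow_mul,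
      mul_one_div_cancel hq'0.ne', rpow_one, toReal_mul, toReal_ofReal ht]
  let c0 : ℝ≥0∞ := min 1 (av (fun y => ‖V y‖ₑ⁻¹ ^ q') P)
  have hc0 : c0 ≠ 0 := by
    simp only [c0, ne_eq, min_eq_iff, not_or, not_and_or]
    refine ⟨Or.inl one_ne_zero, Or.inl ?_⟩
    refine mul_ne_zero (ENNReal.inv_ne_zero.2 (qvol_ne_top P)) ?_
    have hm : Measurable fun y => ‖V y‖ₑ⁻¹ ^ q' := (hV.enorm.inv).pow_const _
    rw [← pos_iff_ne_zero, setLIntegral_pos_iff hm]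
    have : Function.support (fun y => ‖V y‖ₑ⁻¹ ^ q') = univ := by
      ext y
      simp [hq'0.le, hq'0]
    rw [this, univ_inter, volume_set]
    exact qvol_pos P
  have hc0t : c0 ≠ ⊤ := ne_top_of_le_ne_top one_ne_top (min_le_left _ _)
  have hlow : ∀ u, c0 * ‖u‖ₑ ^ q' ≤ NE u := by
    intro u
    refine (mul_le_mul_left (min_le_right _ _) _).trans ?_
    rw [mul_comm, ← av_const_mul P (by finiteness)]
    refine av_mono P fun y _ => ?_
    rw [← mul_rpow_of_nonneg _ _ hq'0.le]
    refine rpow_le_rpow ?_ hq'0.le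
    rw [← div_eq_mul_inv]
    refine div_le_of_le_mul' ?_
    have h3 := norm_mvec_le (V y) (mvec (Vi y) u)
    rw [mvec_mvec, h1, mvec_one] at h3
    rw [← ofReal_norm, ← ofReal_norm, ← ofReal_norm, ← ofReal_mul (norm_nonneg _)]
    exact ofReal_le_ofReal h3
  have hcN : ∀ u, (c0 ^ (1 / q')).toReal * ‖u‖ ≤ N u := by
    intro u
    simp only [N]
    rw [← toReal_enorm u, ← toReal_mul]
    refine toReal_mono (by have := hfin u; finiteness) ?_
    have h3 := rpow_le_rpow (hlow u) (show 0 ≤ 1 / q' by positivity)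
    rwa [mul_rpow_of_nonneg _ _ (by positivity), ← rpow_mul,
      mul_one_div_cancel hq'0.ne', rpow_one] at h3
  obtain ⟨E, hE, hE1, hE2⟩ := exists_auerbach hN
    (toReal_pos (by simp [hc0, hc0t]) (by finiteness)) hcN
  have hEi : E * E⁻¹ = 1 := Matrix.mul_nonsing_inv E hE.isUnit
  have hEi' : E⁻¹ * E = 1 := Matrix.nonsing_inv_mul E hE.isUnit
  let M : Mat n := star E⁻¹ * E⁻¹
  have hMinv : M * (E * star E) = 1 := by
    calc M * (E * star E) = star E⁻¹ * (E⁻¹ * E) * star E := by simp only [M]; noncomm_ring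
      _ = star (E * E⁻¹) := by rw [hEi', mul_one, star_mul]
      _ = 1 := by rw [hEi, star_one]
  have hM : M.PosDef := Matrix.isStrictlyPositive_iff_posDef.1
    ⟨star_mul_self_nonneg _, IsUnit.of_mul_eq_one _ hMinv⟩
  have hMi : matPow M (-1) = E * star E := by
    have h3 := matPow_neg_mul hM 1
    rw [matPow_one hM] at h3
    calc matPow M (-1) = matPow M (-1) * (M * (E * star E)) := by rw [hMinv, mul_one]
      _ = _ := by rw [← mul_assoc, h3, one_mul]
  have hD : (matPow M (1/2)).PosDef := posDef_matPow hM _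
  have hDi : (matPow (matPow M (1/2)) (-1)).PosDef := posDef_matPow hD _
  have hsq : matPow M (1/2) * matPow M (1/2) = M := by
    rw [matPow_mul hM]; norm_num [matPow_one hM]
  have hsqi : matPow (matPow M (1/2)) (-1) * matPow (matPow M (1/2)) (-1) = E * star E := by
    rw [matPow_mul hD, matPow_matPow hM (by norm_num), ← hMi]; norm_num
  have sa : ∀ {X : Mat n}, X.PosDef → star X = X := fun hX => hX.isHermitian
  refine ⟨matPow M (1/2), hD, ?_, ?_⟩
  · have h3 : ∀ y, ‖matPow (matPow M (1/2)) (-1) * Vi y‖ₑ ^ q' ≤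
        (n:ℝ≥0∞) ^ q' * ∑ j, ‖mvec (Vi y) (mvec E (EuclideanSpace.single j 1))‖ₑ ^ q' := by
      intro y
      have h4 : ‖matPow (matPow M (1/2)) (-1) * Vi y‖ = ‖Vi y * E‖ := by
        rw [norm_mul_comm_of_posDef hDi (hpi y)]
        refine norm_eq_of_mul_star_eq ?_
        rw [star_mul, star_mul, sa hDi, mul_assoc, ← mul_assoc _ _ (star (Vi y)), hsqi]
        noncomm_ring
      rw [← ofReal_norm, h4, ofReal_norm]
      refine (rpow_le_rpow (enorm_le_sum_mvec _) hq'0.le).trans ?_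
      refine (sum_rpow_le hq'1 _).trans (le_of_eq ?_)
      simp only [mvec_mvec]
    refine (av_mono P fun y _ => h3 y).trans ?_
    rw [av_const_mul P (by finiteness)]
    refine mul_le_mul_right ?_ _
    rw [av, lintegral_finsetSum _ fun j _ => hmeas _, Finset.mul_sum]
    refine (Finset.sum_le_card_nsmul _ _ 1 fun j _ => ?_).trans (by simp)
    change NE _ ≤ 1
    rw [hNE]
    refine rpow_le_one ?_ hq'0.le
    exact ofReal_le_one.2 (hE1 j)
  · rw [← av_const_mul P (by finiteness)]
    refine av_mono P fun x _ => ?_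
    have h4 : ‖V x * matPow M (1/2)‖ = ‖E⁻¹ * V x‖ := by
      rw [norm_mul_comm_of_posDef (hp x) hD]
      refine norm_eq_of_star_mul_eq ?_
      rw [star_mul, star_mul, sa hD, mul_assoc, ← mul_assoc _ _ (V x), hsq]
      simp only [M]; noncomm_ring
    set a := av (fun y => ‖V x * Vi y‖ₑ ^ q') P
    have h5 : ∀ j i, ‖mvec E⁻¹ (mvec (V x) (EuclideanSpace.single j 1)) i‖ₑ ≤ 2 * a ^ (1 / q') := by
      intro j i
      rw [← ofReal_norm]
      refine (ofReal_le_ofReal (hE2 _ i)).trans ?_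
      rw [ofReal_mul zero_le_two, ofReal_ofNat]
      refine mul_le_mul_right ?_ _
      rw [← rpow_rpow_inv hq'0.ne' (ENNReal.ofReal _), ← hNE, one_div]
      refine rpow_le_rpow ((hVV x _).trans ?_) (by positivity)
      have h10 : ‖EuclideanSpace.single j (1:ℂ)‖ₑ = 1 := by simp [← ofReal_norm]
      rw [h10, one_rpow, mul_one]
    have h6 : ‖E⁻¹ * V x‖ₑ ≤ 2 * n * n * a ^ (1 / q') := by
      refine (enorm_le_sum_mvec _).trans ?_
      refine (Finset.sum_le_card_nsmul _ _ (n * (2 * a ^ (1 / q'))) fun j _ => ?_).trans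
        (le_of_eq (by simp; ring))
      rw [← mvec_mvec]
      set w := mvec E⁻¹ (mvec (V x) (EuclideanSpace.single j 1))
      have h7 : ‖w‖ₑ ≤ ∑ i, ‖w i‖ₑ := by
        have h8 : w = ∑ i, w i • EuclideanSpace.single i (1:ℂ) := by
          ext i
          simp [Finset.sum_apply, Pi.single_apply]
        conv_lhs => rw [h8]
        refine (enorm_sum_le _ _).trans (Finset.sum_le_sum fun i _ => ?_)
        rw [enorm_smul]
        simp [← ofReal_norm]
      refine h7.trans ((Finset.sum_le_card_nsmul _ _ _ fun i _ => h5 j i).trans (by simp))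
    rw [← ofReal_norm, h4, ofReal_norm]
    refine (rpow_le_rpow h6 (by linarith)).trans ?_
    rw [mul_rpow_of_nonneg _ _ (by linarith), ← rpow_mul]
    refine le_of_eq ?_
    congr 2
    rw [hq']; field_simp

/-! ### Consequences of the matrix `A_q` condition -/

/-- The scalar weight `|W^{1/q} e|^q`. -/
def wt (W : Rd d → Mat n) (q : ℝ) (e : Vec n) (x : Rd d) : ℝ≥0∞ := ‖mvec (matPow (W x) (1 / q)) e‖ₑ ^ q

lemma measurable_wt {W : Rd d → Mat n} (hW : Measurable W) (hp : ∀ x, (W x).PosDef) (q : ℝ)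
    (e : Vec n) : Measurable (wt W q e) :=
  (measurable_mvec (measurable_matPow hW hp _) e).enorm.pow_const _

lemma av_le_AqConst (W : Rd d → Mat n) (q : ℝ) (P : Cube d) :
    av (fun x => av (fun y => ‖matPow (W x) (1 / q) * matPow (W y) (-(1 / q))‖ₑ ^ (q / (q - 1))) P
      ^ (q - 1)) P ≤ AqConst W q := by
  refine le_trans (le_of_eq ?_) (le_iSup _ P)
  simp only [av, volume_set, ofReal_opNorm]

lemma av_mul_rpow_le {f g : Rd d → ℝ≥0∞} (hf : Measurable f) (hg : Measurable g) {a b : ℝ}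
    (ha : 0 ≤ a) (hb : 0 ≤ b) (hab : a + b = 1) (P : Cube d) :
    av (fun x => f x ^ a * g x ^ b) P ≤ av f P ^ a * av g P ^ b := by
  simp only [av, avg_eq_lintegral]
  exact lintegral_mul_norm_pow_le hf.aemeasurable hg.aemeasurable ha hb hab

lemma enorm_mvec_le (A : Mat n) (v : Vec n) : ‖mvec A v‖ₑ ≤ ‖A‖ₑ * ‖v‖ₑ := by
  rw [← ofReal_norm, ← ofReal_norm, ← ofReal_norm, ← ofReal_mul (norm_nonneg _)]
  exact ofReal_le_ofReal (norm_mvec_le A v)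

lemma av_wt_le {W : Rd d → Mat n} (hW : Measurable W) (hp : ∀ x, (W x).PosDef) {q : ℝ}
    (hq : 1 < q) (e : Vec n) (P : Cube d) :
    av (wt W q e) P ≤ AqConst W q * av (fun x => wt W q e x ^ (1 / 2 : ℝ)) P ^ (2 : ℝ) := by
  have hq1 : 0 < q - 1 := by linarith
  have hq0 : 0 < q := by linarith
  set J := av (fun x => wt W q e x ^ (1 / 2 : ℝ)) P with hJ
  have hmV := measurable_matPow hW hp (1 / q)
  have hmVi := measurable_matPow hW hp (-(1 / q))
  set I : Rd d → ℝ≥0∞ := fun x =>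
    av (fun y => ‖matPow (W x) (1 / q) * matPow (W y) (-(1 / q))‖ₑ ^ (q / (q - 1))) P with hI
  have hIm : Measurable I := by
    have h1 : Measurable fun z : Rd d × Rd d =>
        ‖matPow (W z.1) (1 / q) * matPow (W z.2) (-(1 / q))‖ₑ ^ (q / (q - 1)) :=
      ((by fun_prop : Continuous fun X : Mat n × Mat n => ‖X.1 * X.2‖ₑ).measurable.comp
        (hmV.prodMap hmVi)).pow_const _
    exact (h1.lintegral_prod_right').const_mul _
  have hpt : ∀ x, wt W q e x ≤ I x ^ (q - 1) * J ^ (2:ℝ) := by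
    intro x
    set θ := q / (q + 1) with hθ
    have hθ0 : 0 < θ := by positivity
    have h1 : ∀ y, ‖mvec (matPow (W x) (1 / q)) e‖ₑ ^ θ ≤
        (‖matPow (W x) (1 / q) * matPow (W y) (-(1 / q))‖ₑ ^ (q / (q - 1))) ^ ((q - 1) / (q + 1)) *
          (wt W q e y ^ (1 / 2 : ℝ)) ^ (2 / (q + 1)) := by
      intro y
      rw [wt, ← rpow_mul, ← rpow_mul, ← rpow_mul,
        show q / (q - 1) * ((q - 1) / (q + 1)) = θ by rw [hθ]; field_simp,
        show q * (1 / 2 * (2 / (q + 1))) = θ by rw [hθ]; field_simp,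
        ← mul_rpow_of_nonneg _ _ hθ0.le]
      refine rpow_le_rpow ?_ hθ0.le
      refine le_trans (le_of_eq ?_) (enorm_mvec_le _ _)
      rw [mvec_mvec, mul_assoc, matPow_neg_mul (hp y), mul_one]
    have h2 := (av_mono P fun y _ => h1 y).trans (av_mul_rpow_le
      ((measurable_enorm_mul_left hmVi _).pow_const _) ((measurable_wt hW hp q e).pow_const _)
      (by positivity) (by positivity) (by field_simp; ring) P)
    rw [av_const] at h2
    have h3 := rpow_le_rpow h2 (show 0 ≤ q + 1 by linarith)
    rw [← rpow_mul, mul_rpow_of_nonneg _ _ (by linarith), ← rpow_mul,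
      ← rpow_mul, hθ, div_mul_cancel₀ _ (by linarith), div_mul_cancel₀ _ (by linarith),
      div_mul_cancel₀ _ (by linarith)] at h3
    exact h3
  calc av (wt W q e) P ≤ av (fun x => I x ^ (q - 1) * J ^ (2:ℝ)) P := av_mono P fun x _ => hpt x
    _ = av (fun x => I x ^ (q - 1)) P * J ^ (2:ℝ) := by
      rw [av, av, lintegral_mul_const _ (hIm.pow_const _), mul_assoc]
    _ ≤ _ := mul_le_mul_left (av_le_AqConst W q P) _

lemma AqScConst_eq (W : Rd d → Mat n) (q : ℝ) : AqScConst W q = ⨆ e, AInftyConst (wt W q e) := rfl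

lemma AqScConst_le (hd : 1 ≤ d) {W : Rd d → Mat n} (hW : Measurable W) (hp : ∀ x, (W x).PosDef)
    {q : ℝ} (hq : 1 < q) (hA : AqConst W q ≠ ⊤) : AqScConst W q ≤ 5 ^ d * 8 * AqConst W q :=
  iSup_le fun e => AInftyConst_le fun R =>
    lintegral_HLM_le_of_av_sqrt hd (measurable_wt hW hp q e) (av_wt_le hW hp hq e) hA R

lemma exists_interface {p q : ℝ} (hq : 1 < q) (hqp : q < p) {W : Rd d → Mat n}
    (hW : Measurable W) (hp : ∀ x, (W x).PosDef) (hA : AqConst W q ≠ ⊤) (P : Cube d) :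
    ∃ (A A' : Mat n) (e : Fin n → Vec n), A * A' = 1 ∧
      av (fun x => ‖A' * matPow (W x) (-(1 / p))‖ₑ ^ (p / (q - 1))) P ≤
        (n:ℝ≥0∞) ^ (q / (q - 1)) * n ∧
      (∀ j, av (wt W q (e j)) P ≤ (2 * n * n : ℝ≥0∞) ^ q * AqConst W q) ∧
      ∀ x, ‖matPow (W x) (1 / p) * A‖ₑ ^ p ≤ (n:ℝ≥0∞) ^ q * ∑ j, wt W q (e j) x := by
  have hq1 : 0 < q - 1 := by linarith
  have hp0 : 0 < p := by linarith
  have hq0 : 0 < q := by linarith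
  have hqp1 : q / p ≤ 1 := by rw [div_le_one hp0]; exact hqp.le
  have hpow : ∀ X Y : Mat n, X.PosDef → Y.PosDef → ∀ r, 0 ≤ r →
      ‖matPow X (q / p) * matPow Y (q / p)‖ₑ ^ r ≤ ‖X * Y‖ₑ ^ (q / p * r) := by
    intro X Y hX hY r hr
    rw [rpow_mul]
    refine rpow_le_rpow ?_ hr
    rw [← ofReal_norm, ← ofReal_norm, ofReal_rpow_of_nonneg (norm_nonneg _) (by positivity)]
    exact ofReal_le_ofReal (norm_matPow_mul_matPow_le hX hY (by positivity) hqp1)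
  obtain ⟨D, hD, h1, h2⟩ := exists_reducing hq (measurable_matPow hW hp (1 / q))
    (measurable_matPow hW hp (-(1 / q))) (fun x => posDef_matPow (hp x) _)
    (fun x => posDef_matPow (hp x) _) (fun x => matPow_mul_neg (hp x) _) P
    (ne_top_of_le_ne_top hA (av_le_AqConst W q P))
  refine ⟨matPow D (q / p), matPow D (-(q / p)), fun j => mvec D (EuclideanSpace.single j 1),
    matPow_mul_neg hD _, ?_, fun j => ?_, fun x => ?_⟩
  · refine (av_mono P fun x _ => ?_).trans h1
    have h3 := hpow _ _ (posDef_matPow hD (-1)) (posDef_matPow (hp x) (-(1 / q))) (p / (q - 1))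
      (by positivity)
    rw [matPow_matPow hD (by norm_num), matPow_matPow (hp x) (by simp [hq0.ne']),
      show -1 * (q / p) = -(q / p) by ring, show -(1 / q) * (q / p) = -(1 / p) by field_simp,
      show q / p * (p / (q - 1)) = q / (q - 1) by field_simp] at h3
    exact h3
  · refine (av_mono P fun x _ => ?_).trans (h2.trans (mul_le_mul_right (av_le_AqConst W q P) _))
    refine rpow_le_rpow ?_ hq0.le
    rw [mvec_mvec]
    refine (enorm_mvec_le _ _).trans (le_of_eq ?_)
    have h10 : ‖EuclideanSpace.single j (1:ℂ)‖ₑ = 1 := by simp [← ofReal_norm]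
    rw [h10, mul_one]
  · have h3 := hpow _ _ (posDef_matPow (hp x) (1 / q)) hD p hp0.le
    rw [matPow_matPow (hp x) (by simp [hq0.ne']), div_mul_cancel₀ _ hp0.ne',
      show 1 / q * (q / p) = 1 / p by field_simp] at h3
    refine h3.trans ((rpow_le_rpow (enorm_le_sum_mvec _) hq0.le).trans ?_)
    refine (sum_rpow_le hq.le _).trans (le_of_eq ?_)
    simp only [wt, mvec_mvec]

/-! ### Vector-valued truncations -/

/-- Componentwise bounded measurable vector functions with bounded support. -/
def NiceV (F : Rd d → Vec n) : Prop := ∀ i, Nice fun x => F x i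

lemma NiceV.mvec {F : Rd d → Vec n} (hF : NiceV F) (A : Mat n) : NiceV fun x => mvec A (F x) := by
  intro i
  have h1 : (fun x => _root_.mvec A (F x) i) = fun x => ∑ j, A i j * F x j := by
    ext1 x; simp [mvec_apply, Matrix.mulVec, dotProduct]
  rw [h1]
  exact Nice.sum _ fun j _ => (hF j).const_mul _

lemma NiceV.indicator {F : Rd d → Vec n} (hF : NiceV F) {s : Set (Rd d)} (hs : MeasurableSet s) :
    NiceV (s.indicator F) := by
  intro i
  have h1 : (fun x => s.indicator F x i) = s.indicator fun x => F x i := by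
    ext1 x; by_cases hx : x ∈ s <;> simp [hx]
  rw [h1]
  exact (hF i).indicator hs

lemma NiceV.measurable {F : Rd d → Vec n} (hF : NiceV F) : Measurable F := by
  have h1 : F = fun x => WithLp.toLp 2 fun i => F x i := rfl
  rw [h1]
  have h2 : Measurable fun x => (fun i => F x i) := measurable_pi_iff.2 fun i => (hF i).1
  exact (PiLp.continuous_toLp 2 _).measurable.comp h2

lemma truncRough_eq (Ω : Rd d → ℂ) (δ : ℝ) (F : Rd d → Vec n) (x : Rd d) :
    truncRough Ω δ F x = ∫ y in {y : Rd d | δ < ‖x - y‖}, rk Ω (x - y) • F y := by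
  simp only [truncRough, rk, Real.rpow_natCast]

section
variable {Ω : Rd d → ℂ} {C : ℝ}

lemma NiceV.integrableOn (h : IsRoughKernel Ω C) (hC : 0 ≤ C) {δ : ℝ} (hδ : 0 < δ)
    {F : Rd d → Vec n} (hF : NiceV F) (x : Rd d) :
    IntegrableOn (fun y => rk Ω (x - y) • F y) {y : Rd d | δ < ‖x - y‖} :=
  Integrable.of_eval_piLp fun i => integrableOn_rk_mul h hC hδ (hF i) x

lemma truncRough_apply (h : IsRoughKernel Ω C) (hC : 0 ≤ C) {δ : ℝ} (hδ : 0 < δ)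
    {F : Rd d → Vec n} (hF : NiceV F) (x : Rd d) (i : Fin n) :
    truncRough Ω δ F x i = tr Ω δ (fun y => F y i) x := by
  rw [truncRough_eq]
  exact eval_integral_piLp (f := fun y => rk Ω (x - y) • F y)
    (fun i => integrableOn_rk_mul h hC hδ (hF i) x) i

lemma mvec_truncRough (h : IsRoughKernel Ω C) (hC : 0 ≤ C) {δ : ℝ} (hδ : 0 < δ)
    {F : Rd d → Vec n} (hF : NiceV F) (A : Mat n) (x : Rd d) :
    mvec A (truncRough Ω δ F x) = truncRough Ω δ (fun y => mvec A (F y)) x := by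
  rw [truncRough_eq, truncRough_eq]
  have h1 := (Matrix.toEuclideanCLM (𝕜 := ℂ) (n := Fin n) A).integral_comp_comm
    (hF.integrableOn h hC hδ x)
  refine h1.symm.trans (integral_congr_ae (Eventually.of_forall fun y => ?_))
  exact map_smul _ _ _

lemma truncRough_add (h : IsRoughKernel Ω C) (hC : 0 ≤ C) {δ : ℝ} (hδ : 0 < δ)
    {F G : Rd d → Vec n} (hF : NiceV F) (hG : NiceV G) (x : Rd d) :
    truncRough Ω δ (fun y => F y + G y) x = truncRough Ω δ F x + truncRough Ω δ G x := by
  simp only [truncRough_eq, smul_add]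
  exact integral_add (hF.integrableOn h hC hδ x) (hG.integrableOn h hC hδ x)

lemma measurable_tr (h : IsRoughKernel Ω C) {δ : ℝ} {g : Rd d → ℂ} (hg : Measurable g) :
    Measurable (tr Ω δ g) := by
  have hm : Measurable fun z : Rd d × Rd d =>
      {z : Rd d × Rd d | δ < ‖z.1 - z.2‖}.indicator (fun z => rk Ω (z.1 - z.2) * g z.2) z := by
    refine Measurable.indicator ?_ (isOpen_lt (by fun_prop) (by fun_prop)).measurableSet
    exact ((measurable_rk h.1).comp (measurable_fst.sub measurable_snd)).mul
      (hg.comp measurable_snd)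
  have h1 : tr Ω δ g = fun x => ∫ y,
      {z : Rd d × Rd d | δ < ‖z.1 - z.2‖}.indicator (fun z => rk Ω (z.1 - z.2) * g z.2) (x, y) := by
    ext1 x
    rw [tr, ← integral_indicator (measurableSet_trunc δ x)]
    rfl
  rw [h1]
  exact hm.stronglyMeasurable.integral_prod_right'.measurable

lemma measurable_truncRough (h : IsRoughKernel Ω C) (hC : 0 ≤ C) {δ : ℝ} (hδ : 0 < δ)
    {F : Rd d → Vec n} (hF : NiceV F) : Measurable (truncRough Ω δ F) := by
  have h1 : truncRough Ω δ F = fun x => WithLp.toLp 2 fun i => tr Ω δ (fun y => F y i) x := by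
    ext x i; exact truncRough_apply h hC hδ hF x i
  rw [h1]
  have h2 : Measurable fun x => (fun i => tr Ω δ (fun y => F y i) x) :=
    measurable_pi_iff.2 fun i => measurable_tr h (hF i).1
  exact (PiLp.continuous_toLp 2 _).measurable.comp h2

lemma continuous_mvec : Continuous fun X : Mat n × Vec n => mvec X.1 X.2 := by
  have : (fun X : Mat n × Vec n => mvec X.1 X.2) =
    fun X => WithLp.toLp 2 (X.1.mulVec X.2.ofLp) := rfl
  rw [this]
  fun_prop

/-- The maximal operator over rational truncations at scale at least `2 ^ b`. -/
def tmax (B : Rd d → Mat n) (Ω : Rd d → ℂ) (b : ℤ) (F : Rd d → Vec n) (x : Rd d) : ℝ≥0∞ :=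
  ⨆ (δ : ℚ) (_ : (2:ℝ) ^ b ≤ δ), ‖mvec (B x) (truncRough Ω δ F x)‖ₑ

lemma measurable_tmax (h : IsRoughKernel Ω C) (hC : 0 ≤ C) {B : Rd d → Mat n} (hB : Measurable B)
    {F : Rd d → Vec n} (hF : NiceV F) (b : ℤ) : Measurable (tmax B Ω b F) := by
  refine Measurable.iSup fun δ => Measurable.iSup fun hδ => ?_
  have h0 : (0:ℝ) < δ := lt_of_lt_of_le (by positivity) hδ
  exact (continuous_mvec.measurable.comp
    (hB.prodMk (measurable_truncRough h hC h0 hF))).enorm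

/-- The scalar version of `tmax`. -/
def trq (Ω : Rd d → ℂ) (b : ℤ) (g : Rd d → ℂ) (x : Rd d) : ℝ≥0∞ :=
  ⨆ (δ : ℚ) (_ : (2:ℝ) ^ b ≤ δ), ‖tr Ω δ g x‖ₑ

lemma measurable_trq (h : IsRoughKernel Ω C) {g : Rd d → ℂ} (hg : Measurable g) (b : ℤ) :
    Measurable (trq Ω b g) :=
  Measurable.iSup fun _ => Measurable.iSup fun _ => (measurable_tr h hg).enorm

lemma trq_le_trsup (Ω : Rd d → ℂ) (b : ℤ) (g : Rd d → ℂ) (x : Rd d) :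
    trq Ω b g x ≤ trsup Ω b g x :=
  iSup₂_le fun δ hδ => le_iSup₂ (f := fun (δ : ℝ) (_ : (2:ℝ) ^ b ≤ δ) => ‖tr Ω δ g x‖ₑ) (δ:ℝ) hδ

lemma enorm_vec_le (w : Vec n) : ‖w‖ₑ ≤ ∑ i, ‖w i‖ₑ := by
  have h8 : w = ∑ i, w i • EuclideanSpace.single i (1:ℂ) := by
    ext i
    simp [Finset.sum_apply, Pi.single_apply]
  conv_lhs => rw [h8]
  refine (enorm_sum_le _ _).trans (Finset.sum_le_sum fun i _ => ?_)
  rw [enorm_smul]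
  simp [← ofReal_norm]

lemma tmax_le (h : IsRoughKernel Ω C) (hC : 0 ≤ C) {F : Rd d → Vec n} (hF : NiceV F)
    (B : Rd d → Mat n) (b : ℤ) {A A' : Mat n} (hA : A * A' = 1) {Q R : Cube d}
    (hRQ : (tri R).set ⊆ (tri Q).set) (x : Rd d) :
    tmax B Ω b ((tri Q).set.indicator F) x ≤ tmax B Ω b ((tri R).set.indicator F) x +
      ‖B x * A‖ₑ * ∑ i, trq Ω b
        (outer (fun y => mvec A' ((tri Q).set.indicator F y) i) R) x := by
  refine iSup₂_le fun δ hδ => ?_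
  have h0 : (0:ℝ) < δ := lt_of_lt_of_le (by positivity) hδ
  have hQ := hF.indicator (measurableSet_set (tri Q))
  have hR := hF.indicator (measurableSet_set (tri R))
  have hH : NiceV ((tri R).setᶜ.indicator fun y => mvec A' ((tri Q).set.indicator F y)) :=
    (hQ.mvec A').indicator (measurableSet_set (tri R)).compl
  have h1 : (tri Q).set.indicator F = fun y => (tri R).set.indicator F y +
      mvec A ((tri R).setᶜ.indicator (fun y => mvec A' ((tri Q).set.indicator F y)) y) := by
    ext1 y
    by_cases hy : y ∈ (tri R).set
    · simp [hy, hRQ hy, mvec]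
    · simp [hy, mvec_mvec, hA, mvec_one]
  have h2 : truncRough Ω δ ((tri Q).set.indicator F) x = truncRough Ω δ ((tri R).set.indicator F) x
      + mvec A (truncRough Ω δ
        ((tri R).setᶜ.indicator fun y => mvec A' ((tri Q).set.indicator F y)) x) := by
    conv_lhs => rw [h1]
    rw [truncRough_add h hC h0 hR (hH.mvec A), mvec_truncRough h hC h0 hH]
  have h3 : ∀ i, (fun y => (tri R).setᶜ.indicator
      (fun y => mvec A' ((tri Q).set.indicator F y)) y i) =
      outer (fun y => mvec A' ((tri Q).set.indicator F y) i) R := by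
    intro i; ext1 y
    by_cases hy : y ∈ (tri R).set <;> simp [outer, hy]
  have hadd : ∀ u v : Vec n, mvec (B x) (u + v) = mvec (B x) u + mvec (B x) v := fun u v =>
    map_add _ _ _
  rw [h2, hadd, mvec_mvec]
  refine (enorm_add_le _ _).trans (add_le_add
    (le_iSup₂ (f := fun (δ : ℚ) (_ : (2:ℝ) ^ b ≤ δ) => ‖mvec (B x) (truncRough Ω δ
      ((tri R).set.indicator F) x)‖ₑ) δ hδ) ((enorm_mvec_le _ _).trans (mul_le_mul_right ?_ _)))
  refine (enorm_vec_le _).trans (Finset.sum_le_sum fun i _ => ?_)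
  rw [truncRough_apply h hC h0 hH, h3]
  exact le_iSup₂ (f := fun (δ : ℚ) (_ : (2:ℝ) ^ b ≤ δ) => ‖tr Ω δ
    (outer (fun y => mvec A' ((tri Q).set.indicator F y) i) R) x‖ₑ) δ hδ

lemma tmax_eq_zero (B : Rd d → Mat n) {b : ℤ} {Q : Cube d} (hQ : d * (3 * Q.side) ≤ 2 ^ b)
    (F : Rd d → Vec n) {x : Rd d} (hx : x ∈ hset Q) :
    tmax B Ω b ((tri Q).set.indicator F) x = 0 := by
  refine le_antisymm (iSup₂_le fun δ hδ => ?_) (zero_le)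
  have h1 : truncRough Ω δ ((tri Q).set.indicator F) x = 0 := by
    rw [truncRough_eq]
    refine setIntegral_eq_zero_of_forall_eq_zero fun y hy => ?_
    rw [indicator_of_notMem, smul_zero]
    intro hy'
    have h2 := dist_le_of_mem_set (set_subset_tri Q (hset_subset_set Q hx)) hy'
    rw [tri_side] at h2
    exact absurd (h2.trans (hQ.trans hδ)) (not_le.2 hy)
  rw [h1]; simp [mvec]

end

/-! ### Local estimates for the stopping argument -/

lemma tri_subset_of_hset_subset {Q R : Cube d} (h : hset R ⊆ hset Q) :
    (tri R).set ⊆ (tri Q).set := by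
  have hc : R.corner ∈ hset R := fun i => ⟨le_rfl, by have := R.side_pos; linarith⟩
  have h1 : ∀ i, R.corner i + R.side ≤ Q.corner i + Q.side := by
    intro i
    by_contra! hlt
    have h2 : WithLp.toLp 2 (Function.update R.corner.ofLp i
        (max (R.corner i) (Q.corner i + Q.side))) ∈ hset R := by
      intro j
      by_cases hj : j = i
      · subst hj
        simp only [Function.update_self]
        exact ⟨le_max_left _ _, max_lt (by have := R.side_pos; linarith) hlt⟩
      · simp only [Function.update_of_ne hj]
        exact hc j
    have h3 := (h h2 i).2
    simp only [Function.update_self] at h3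
    exact absurd (le_max_right _ _) (not_le.2 h3)
  intro x hx i
  have h2 := hx i
  have h3 := (h hc i).1
  have h4 := h1 i
  simp only [tri_corner, tri_side] at h2 ⊢
  constructor <;> linarith

lemma av_mul_rpow_inv_le {f g : Rd d → ℝ≥0∞} (hf : Measurable f) (hg : Measurable g) {s a u : ℝ}
    (hs : 0 < s) (ha : 0 < a) (hu : 0 < u) (h : 1 / s = 1 / a + 1 / u) (P : Cube d) :
    av (fun x => (f x * g x) ^ s) P ^ (1 / s) ≤
      av (fun x => f x ^ a) P ^ (1 / a) * av (fun x => g x ^ u) P ^ (1 / u) := by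
  have h1 : s / a + s / u = 1 := by
    have : s * (1 / s) = s * (1 / a + 1 / u) := by rw [h]
    rw [mul_one_div_cancel hs.ne'] at this
    rw [this]; ring
  have h2 := av_mul_rpow_le (hf.pow_const a) (hg.pow_const u) (a := s / a) (b := s / u)
    (by positivity) (by positivity) h1 P
  have h3 := rpow_le_rpow h2 (show 0 ≤ 1 / s by positivity)
  rw [mul_rpow_of_nonneg _ _ (by positivity), ← rpow_mul, ← rpow_mul,
    show s / a * (1 / s) = 1 / a by field_simp, show s / u * (1 / s) = 1 / u by field_simp] at h3
  refine le_trans (le_of_eq ?_) h3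
  congr 2
  ext1 x
  rw [← rpow_mul, ← rpow_mul, mul_div_cancel₀ _ ha.ne', mul_div_cancel₀ _ hu.ne',
    mul_rpow_of_nonneg _ _ hs.le]

lemma av_rpow_le_of_sum {T : Rd d → ℝ≥0∞} {w : Fin n → Rd d → ℝ≥0∞} (hw : ∀ j, Measurable (w j))
    (hn : 1 ≤ n) {p ε : ℝ} (hp : 0 < p) (hε : 0 < ε) {N M : ℝ≥0∞} (hN : N ≠ ⊤) {Q : Cube d}
    (hRH : ∀ j, av (fun x => w j x ^ (1 + ε)) Q ≤ 2 * av (w j) Q ^ (1 + ε))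
    (hM : ∀ j, av (w j) Q ≤ M) (hT : ∀ x, T x ^ p ≤ N * ∑ j, w j x) :
    av (fun x => T x ^ (p * (1 + ε))) Q ^ (1 / (p * (1 + ε))) ≤
      (2 * n * n * N * M) ^ (1 / p) := by
  have h1 : ∀ x, T x ^ (p * (1 + ε)) ≤ (N * n) ^ (1 + ε) * ∑ j, w j x ^ (1 + ε) := by
    intro x
    rw [rpow_mul]
    refine (rpow_le_rpow (hT x) (by linarith)).trans ?_
    rw [mul_rpow_of_nonneg _ _ (by linarith), mul_rpow_of_nonneg _ _ (by linarith),
      mul_assoc]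
    exact mul_le_mul_right (sum_rpow_le (by linarith) _) _
  have h2 : av (fun x => T x ^ (p * (1 + ε))) Q ≤ (2 * n * n * N * M) ^ (1 + ε) := by
    calc _ ≤ av (fun x => (N * n) ^ (1 + ε) * ∑ j, w j x ^ (1 + ε)) Q := av_mono Q fun x _ => h1 x
      _ = (N * n) ^ (1 + ε) * ∑ j, av (fun x => w j x ^ (1 + ε)) Q := by
        have : N * n ≠ ⊤ := mul_ne_top hN (by finiteness)
        rw [av_const_mul Q (rpow_ne_top_of_nonneg (by linarith) this)]
        congr 1
        rw [av, lintegral_finsetSum _ fun j _ => (hw j).pow_const _, Finset.mul_sum]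
        rfl
      _ ≤ (N * n) ^ (1 + ε) * (n * (2 * M ^ (1 + ε))) := by
        refine mul_le_mul_right ?_ _
        refine (Finset.sum_le_card_nsmul _ _ (2 * M ^ (1 + ε)) fun j _ => (hRH j).trans ?_).trans
          (by simp)
        exact mul_le_mul_right (rpow_le_rpow (hM j) (by linarith)) _
      _ ≤ (N * n) ^ (1 + ε) * ((2 * n) ^ (1 + ε) * M ^ (1 + ε)) := by
        refine mul_le_mul_right ?_ _
        rw [← mul_assoc]
        refine mul_le_mul_left ?_ _
        have h3 : (1:ℝ≥0∞) ≤ 2 * n := by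
          have : (1:ℝ≥0∞) ≤ n := by exact_mod_cast hn
          calc (1:ℝ≥0∞) ≤ 1 * n := by simpa using this
            _ ≤ 2 * n := mul_le_mul_left _root_.one_le_two _
        calc (n:ℝ≥0∞) * 2 = (2 * n) ^ (1:ℝ) := by rw [rpow_one]; ring
          _ ≤ _ := rpow_le_rpow_of_exponent_le h3 (by linarith)
      _ = _ := by
        rw [← mul_rpow_of_nonneg _ _ (by linarith),
          ← mul_rpow_of_nonneg _ _ (by linarith)]
        congr 1; ring
  refine (rpow_le_rpow h2 (by positivity)).trans (le_of_eq ?_)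
  rw [← rpow_mul]
  congr 1
  field_simp

lemma volume_exceptional_le {G : Fin n → Rd d → ℝ≥0∞} (hG : ∀ i, Measurable (G i)) {r : ℝ}
    (hr : 0 < r) {l c Z : ℝ≥0∞} (hc : c ≠ ⊤) (hi : ∀ i, ∫⁻ x, G i x ^ r ≤ c * Z)
    (hl : l ^ r = n * 2 ^ (d + 2) * c) :
    2 ^ (d + 2) * volume {x | ∃ i, l < G i x} ≤ Z := by
  rcases n.eq_zero_or_pos with rfl | hn
  · simp
  have hn0 : (n:ℝ≥0∞) ≠ 0 := by exact_mod_cast hn.ne'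
  have h1 : ∀ i, n * 2 ^ (d + 2) * volume {x | l < G i x} ≤ Z := by
    intro i
    rcases eq_or_ne c 0 with h0 | h0
    · have h2 := hi i
      rw [h0, zero_mul, nonpos_iff_eq_zero, lintegral_eq_zero_iff ((hG i).pow_const r)] at h2
      have h3 : volume {x | l < G i x} = 0 := by
        refine measure_mono_null (fun x hx => ?_) h2
        intro h4
        have h5 : G i x ^ r = 0 := h4
        rw [rpow_eq_zero_iff_of_pos hr] at h5
        exact _root_.not_lt_zero (h5 ▸ (show l < G i x from hx))
      rw [h3, mul_zero]; exact zero_le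
    · have h2 := mul_meas_ge_le_lintegral (μ := volume) ((hG i).pow_const r) (l ^ r)
      have h3 : c * (n * 2 ^ (d + 2) * volume {x | l < G i x}) ≤ c * Z := by
        calc _ = l ^ r * volume {x | l < G i x} := by rw [hl]; ring
          _ ≤ l ^ r * volume {x | l ^ r ≤ G i x ^ r} := by
            refine mul_le_mul_right (measure_mono fun x hx => ?_) _
            exact rpow_le_rpow (le_of_lt hx) hr.le
          _ ≤ _ := h2.trans (hi i)
      exact (ENNReal.mul_le_mul_iff_right h0 hc).1 h3
  have h2 : {x | ∃ i, l < G i x} = ⋃ i, {x | l < G i x} := by ext; simp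
  have h3 : n * (2 ^ (d + 2) * volume {x | ∃ i, l < G i x}) ≤ n * Z := by
    calc (n:ℝ≥0∞) * (2 ^ (d + 2) * volume {x | ∃ i, l < G i x})
        ≤ n * (2 ^ (d + 2) * ∑ i, volume {x | l < G i x}) := by
          rw [h2]; gcongr; exact measure_iUnion_fintype_le _ _
      _ = ∑ i, n * 2 ^ (d + 2) * volume {x | l < G i x} := by
          rw [← mul_assoc, Finset.mul_sum]
      _ ≤ _ := (Finset.sum_le_card_nsmul _ _ Z fun i _ => h1 i).trans (by simp)
  exact (ENNReal.mul_le_mul_iff_right hn0 (by finiteness)).1 h3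

/-! ### The sparse-type form bound -/

lemma av_le_tri (w : Rd d → ℝ≥0∞) (Q : Cube d) : av w Q ≤ 3 ^ d * av w (tri Q) := by
  have h0 : (3 : ℝ≥0∞) ^ d ≠ 0 := by positivity
  have h1 : (3 : ℝ≥0∞) ^ d ≠ ⊤ := by finiteness
  have h2 := qvol_mul_av w (tri Q)
  rw [qvol_tri, mul_comm ((3 : ℝ≥0∞) ^ d), mul_assoc] at h2
  refine (ENNReal.mul_le_mul_iff_right (qvol_ne_zero Q) (qvol_ne_top Q)).1 ?_
  rw [h2, qvol_mul_av]
  exact lintegral_mono_set (set_subset_tri Q)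

lemma av_rpow_le_HLM (g : Rd d → ℝ≥0∞) {t : ℝ} (ht : 0 < t) {Q : Cube d} {x : Rd d}
    (hx : x ∈ Q.set) :
    av (fun y => g y ^ t) Q ^ (1 / t) ≤ HLM (fun y => g y ^ t) x ^ (1 / t) :=
  rpow_le_rpow (avg_le_HLM _ hx) (by positivity)

lemma lintegral_mul_le_av {Θ G : Rd d → ℝ≥0∞} (hΘ : Measurable Θ) (hG : Measurable G) {v s : ℝ}
    (hv : v.HolderConjugate s) {l : ℝ≥0∞} {Q : Cube d}
    (h : ∫⁻ x in hset Q, Θ x ^ v ≤ l ^ v * qvol Q) :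
    ∫⁻ x in hset Q, Θ x * G x ≤ qvol Q / 2 * (2 * l * av (fun x => G x ^ s) Q ^ (1 / s)) := by
  have hv0 := hv.pos
  have hs0 := hv.symm.pos
  have h2 : ∫⁻ x in hset Q, G x ^ s = qvol Q * av (fun x => G x ^ s) Q := by
    rw [qvol_mul_av, lintegral_hset]
  calc ∫⁻ x in hset Q, Θ x * G x
      ≤ (∫⁻ x in hset Q, Θ x ^ v) ^ (1 / v) * (∫⁻ x in hset Q, G x ^ s) ^ (1 / s) :=
        lintegral_mul_le_Lp_mul_Lq _ hv hΘ.aemeasurable hG.aemeasurable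
    _ ≤ (l ^ v * qvol Q) ^ (1 / v) * (qvol Q * av (fun x => G x ^ s) Q) ^ (1 / s) := by
        rw [h2]; gcongr
    _ = (qvol Q ^ (1 / v) * qvol Q ^ (1 / s)) * (l * av (fun x => G x ^ s) Q ^ (1 / s)) := by
        rw [mul_rpow_of_nonneg _ _ (by positivity),
          mul_rpow_of_nonneg _ _ (by positivity), one_div v, rpow_rpow_inv hv0.ne']
        ring
    _ = _ := by
        rw [← rpow_add _ _ (qvol_ne_zero Q) (qvol_ne_top Q)]
        rw [one_div, one_div, hv.inv_add_inv_eq_one, rpow_one, div_eq_mul_inv]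
        rw [show qvol Q * 2⁻¹ * (2 * l * av (fun x => G x ^ s) Q ^ s⁻¹)
          = (2⁻¹ * 2) * (qvol Q * (l * av (fun x => G x ^ s) Q ^ s⁻¹)) by ring,
          ENNReal.inv_mul_cancel (by norm_num) (by norm_num), one_mul]

lemma av_mvec_le {p q r t : ℝ} (hq : 1 < q) (hp : 0 < p) (hr : 0 < r) (ht : 0 < t)
    (hrt : 1 / r = (q - 1) / p + 1 / t) {W : Rd d → Mat n} (hW : Measurable W)
    (hpd : ∀ x, (W x).PosDef) {F : Rd d → Vec n} (hF : Measurable F) {A' : Mat n} {P : Cube d}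
    {c : ℝ≥0∞} (hA : av (fun x => ‖A' * matPow (W x) (-(1 / p))‖ₑ ^ (p / (q - 1))) P ≤ c) :
    av (fun x => ‖mvec A' (F x)‖ₑ ^ r) P ^ (1 / r) ≤ c ^ ((q - 1) / p) *
      av (fun x => ‖mvec (matPow (W x) (1 / p)) (F x)‖ₑ ^ t) P ^ (1 / t) := by
  have hq0 : 0 < q - 1 := by linarith
  have h1 : Measurable fun x => ‖A' * matPow (W x) (-(1 / p))‖ₑ :=
    measurable_enorm_mul_left (measurable_matPow hW hpd _) A'
  have h2 : Measurable fun x => ‖mvec (matPow (W x) (1 / p)) (F x)‖ₑ :=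
    (continuous_mvec.measurable.comp ((measurable_matPow hW hpd _).prodMk hF)).enorm
  have h3 := av_mul_rpow_inv_le h1 h2 hr (div_pos hp hq0) ht (by rw [hrt, one_div_div]) P
  rw [one_div_div] at h3
  refine le_trans ?_ (h3.trans (mul_le_mul_left (rpow_le_rpow hA (by positivity)) _))
  refine rpow_le_rpow (av_mono P fun x _ => rpow_le_rpow ?_ hr.le) (by positivity)
  have h4 : mvec A' (F x) = mvec (A' * matPow (W x) (-(1 / p))) (mvec (matPow (W x) (1 / p)) (F x)) := by
    rw [mvec_mvec, mul_assoc, matPow_neg_mul (hpd x), mul_one]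
  rw [h4]
  exact enorm_mvec_le _ _

lemma av_mul_le {p q s u ε : ℝ} (hp : 0 < p) (hs : 0 < s) (hu : 0 < u) (hε : 0 < ε)
    (h : 1 / s = 1 / (p * (1 + ε)) + 1 / u) (hd : 1 ≤ d) (hn : 1 ≤ n) {W : Rd d → Mat n}
    (hW : Measurable W) (hpd : ∀ x, (W x).PosDef) (hS0 : AqScConst W q ≠ 0)
    (hεS : ENNReal.ofReal ε * (2 ^ (d + 1) * AqScConst W q) ≤ 1) {g : Rd d → ℝ≥0∞}
    (hg : Measurable g) {A : Mat n} {e : Fin n → Vec n} {M N : ℝ≥0∞} (hM : M ≠ ⊤) (hN : N ≠ ⊤)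
    {Q : Cube d} (hMe : ∀ j, av (wt W q (e j)) (tri Q) ≤ M)
    (hT : ∀ x, ‖matPow (W x) (1 / p) * A‖ₑ ^ p ≤ N * ∑ j, wt W q (e j) x) :
    av (fun x => (‖matPow (W x) (1 / p) * A‖ₑ * g x) ^ s) Q ^ (1 / s) ≤
      (2 * n * n * N * (3 ^ d * M)) ^ (1 / p) * av (fun x => g x ^ u) Q ^ (1 / u) := by
  have h1 : Measurable fun x => ‖matPow (W x) (1 / p) * A‖ₑ :=
    measurable_enorm_mul_right (measurable_matPow hW hpd _) A
  have hw : ∀ j, Measurable (wt W q (e j)) := fun j => measurable_wt hW hpd q _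
  have h2 : ∀ j, av (wt W q (e j)) Q ≤ 3 ^ d * M := fun j =>
    (av_le_tri _ Q).trans (mul_le_mul_right (hMe j) _)
  have hRH : ∀ j, av (fun x => wt W q (e j) x ^ (1 + ε)) Q ≤ 2 * av (wt W q (e j)) Q ^ (1 + ε) := by
    intro j
    refine reverse_holder hd (hw j) (lintegral_HLM_le_of_AInftyConst (hw j) hS0 ?_) hε hεS ?_
    · rw [AqScConst_eq]; exact le_iSup (fun e => AInftyConst (wt W q e)) _
    · rw [← qvol_mul_av]
      exact mul_ne_top (qvol_ne_top Q) (ne_top_of_le_ne_top (by finiteness) (h2 j))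
  refine (av_mul_rpow_inv_le h1 hg hs (by positivity) hu h Q).trans (mul_le_mul_left ?_ _)
  exact av_rpow_le_of_sum hw hn hp hε hN hRH h2 hT

lemma lintegral_sum_trq_le {C : ℝ} {Ω : Rd d → ℂ} (hΩ : IsRoughKernel Ω C) {b : ℤ} {v : ℝ}
    (hv : 1 ≤ v) {h : Fin n → Rd d → ℂ} (hh : ∀ i, Measurable (h i)) {l : ℝ≥0∞} {R : Cube d}
    (H : ∀ i, (qvol R)⁻¹ * ∫⁻ x in R.set, trsup Ω b (h i) x ^ v ≤ l ^ v) :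
    ∫⁻ x in hset R, (∑ i, trq Ω b (h i) x) ^ v ≤ (n * n * l) ^ v * qvol R := by
  have hv0 : 0 ≤ v := by linarith
  have h1 : ∀ i, ∫⁻ x in hset R, trq Ω b (h i) x ^ v ≤ l ^ v * qvol R := by
    intro i
    rw [lintegral_hset]
    calc ∫⁻ x in R.set, trq Ω b (h i) x ^ v ≤ ∫⁻ x in R.set, trsup Ω b (h i) x ^ v :=
          lintegral_mono fun x => rpow_le_rpow (trq_le_trsup Ω b _ x) hv0
      _ = ((qvol R)⁻¹ * ∫⁻ x in R.set, trsup Ω b (h i) x ^ v) * qvol R := by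
          rw [mul_comm, ← mul_assoc, ENNReal.mul_inv_cancel (qvol_ne_zero R) (qvol_ne_top R), one_mul]
      _ ≤ _ := mul_le_mul_left (H i) _
  calc ∫⁻ x in hset R, (∑ i, trq Ω b (h i) x) ^ v
      ≤ ∫⁻ x in hset R, (n:ℝ≥0∞) ^ v * ∑ i, trq Ω b (h i) x ^ v :=
        lintegral_mono fun x => sum_rpow_le hv _
    _ = (n:ℝ≥0∞) ^ v * ∑ i, ∫⁻ x in hset R, trq Ω b (h i) x ^ v := by
        rw [lintegral_const_mul' _ _ (by finiteness), lintegral_finsetSum]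
        exact fun i _ => (measurable_trq hΩ (hh i) b).pow_const v
    _ ≤ (n:ℝ≥0∞) ^ v * (n * (l ^ v * qvol R)) := by
        gcongr
        exact (Finset.sum_le_card_nsmul _ _ _ fun i _ => h1 i).trans (by simp)
    _ ≤ (n:ℝ≥0∞) ^ v * ((n:ℝ≥0∞) ^ v * (l ^ v * qvol R)) := by
        gcongr
        rcases Nat.eq_zero_or_pos n with rfl | hn
        · simp
        · simpa using rpow_le_rpow_of_exponent_le (x := (n:ℝ≥0∞)) (by exact_mod_cast hn) hv
    _ = _ := by
        rw [mul_rpow_of_nonneg _ _ hv0, mul_rpow_of_nonneg _ _ hv0]; ring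

lemma tri_subset_closedBall (Q : Cube d) : ∃ R0 : ℝ, (tri Q).set ⊆ closedBall 0 R0 := by
  refine ⟨‖Q.corner‖ + d * (tri Q).side, fun x hx => ?_⟩
  have h1 : Q.corner ∈ (tri Q).set := set_subset_tri Q (hset_subset_set Q (by
    intro i; exact ⟨le_rfl, by linarith [Q.side_pos]⟩))
  have h2 := dist_le_of_mem_set hx h1
  rw [mem_closedBall_zero_iff]
  calc ‖x‖ = ‖Q.corner + (x - Q.corner)‖ := by congr 1; abel
    _ ≤ _ := (norm_add_le _ _).trans (by gcongr)

/-- The exceptional set of one stopping step: outside it the grand maximal functions of all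
components are below the threshold `l`. -/
lemma exists_exceptional {r C K0 : ℝ} (hr : 1 < r)
    {Ω : Rd d → ℂ} (hΩ : IsRoughKernel Ω C) {v : ℝ} (hv : 2 ≤ v) (b : ℤ)
    (hK0 : ∀ (b : ℤ) (R0 : ℝ) (f : Rd d → ℂ), Nice f → ∃ G : Rd d → ℝ≥0∞, Measurable G ∧
      ∫⁻ x, G x ^ r ≤ ENNReal.ofReal ((K0 * v) ^ r) * ∫⁻ x, ‖f x‖ₑ ^ r ∧
      ∀ P : Cube d, P.set ⊆ closedBall 0 R0 → ∀ z ∈ P.set,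
        (qvol P)⁻¹ * ∫⁻ x in P.set, trsup Ω b (outer f P) x ^ v ≤ G z ^ v)
    (hK : 0 < K0) {F : Rd d → Vec n} (hF : NiceV F) (A' : Mat n) (Q : Cube d) :
    ∃ (m : ℝ≥0∞) (E : Set (Rd d)), m = n * n * ((n * 2 ^ (d + 2) * 3 ^ d : ℝ≥0∞) ^ (1 / r) *
        ENNReal.ofReal (K0 * v) * av (fun x => ‖mvec A' (F x)‖ₑ ^ r) (tri Q) ^ (1 / r)) ∧
      2 ^ (d + 2) * volume E ≤ qvol Q ∧
      ∀ R : Cube d, hset R ⊆ hset Q → volume (E ∩ hset R) < qvol R →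
        ∫⁻ x in hset R, (∑ i, trq Ω b
          (outer (fun y => mvec A' ((tri Q).set.indicator F y) i) R) x) ^ v ≤ m ^ v * qvol R := by
  have hr0 : 0 < r := by linarith
  have hv0 : 0 < v := by linarith
  have hh : ∀ i, Nice fun y => mvec A' ((tri Q).set.indicator F y) i := fun i =>
    (hF.indicator (measurableSet_set _)).mvec A' i
  obtain ⟨R0, hR0⟩ := tri_subset_closedBall Q
  choose G hG hGi hGP using fun i => hK0 b R0 _ (hh i)
  set a := av (fun x => ‖mvec A' (F x)‖ₑ ^ r) (tri Q) with ha
  set l := (n * 2 ^ (d + 2) * 3 ^ d : ℝ≥0∞) ^ (1 / r) * ENNReal.ofReal (K0 * v) * a ^ (1 / r)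
    with hl
  have h1 : ∀ i, ∫⁻ x, ‖mvec A' ((tri Q).set.indicator F x) i‖ₑ ^ r ≤ qvol (tri Q) * a := by
    intro i
    rw [ha, qvol_mul_av, ← lintegral_indicator (measurableSet_set _)]
    refine lintegral_mono fun x => ?_
    by_cases hx : x ∈ (tri Q).set
    · rw [indicator_of_mem hx, indicator_of_mem hx]
      exact rpow_le_rpow (PiLp.enorm_apply_le _ i) hr0.le
    · rw [indicator_of_notMem hx, indicator_of_notMem hx]
      simp [mvec, hr0]
  have ha1 : a ≠ ⊤ := by
    have h2 : ∫⁻ x in (tri Q).set, ‖mvec A' (F x)‖ₑ ^ r ≠ ⊤ := by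
      refine ne_top_of_le_ne_top ?_ ((setLIntegral_le_lintegral _ _).trans (lintegral_mono fun x =>
        (rpow_le_rpow (enorm_vec_le _) hr0.le).trans (sum_rpow_le hr.le _)))
      rw [lintegral_const_mul' _ _ (by finiteness), lintegral_finsetSum]
      · refine mul_ne_top (by finiteness) (sum_ne_top.2 fun i _ => ?_)
        exact ((hF.mvec A' i).lintegral_rpow_lt_top hr0).ne
      · exact fun i _ => ((hF.mvec A' i).1.enorm).pow_const r
    rw [ha]
    exact mul_ne_top (inv_ne_top.2 (qvol_ne_zero _)) h2
  have h3 : ∀ i, ∫⁻ x, G i x ^ r ≤ (ENNReal.ofReal (K0 * v) ^ r * 3 ^ d * a) * qvol Q := by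
    intro i
    refine (hGi i).trans ?_
    rw [ofReal_rpow_of_pos (by positivity)]
    calc _ ≤ _ := mul_le_mul_right (h1 i) _
      _ = _ := by rw [qvol_tri]; ring
  have h4 : l ^ r = n * 2 ^ (d + 2) * (ENNReal.ofReal (K0 * v) ^ r * 3 ^ d * a) := by
    rw [hl, mul_rpow_of_nonneg _ _ hr0.le, mul_rpow_of_nonneg _ _ hr0.le, one_div,
      rpow_inv_rpow hr0.ne', rpow_inv_rpow hr0.ne']
    ring
  refine ⟨_, {x | ∃ i, l < G i x}, rfl, volume_exceptional_le hG hr0 (by finiteness) h3 h4, ?_⟩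
  intro R hR hlt
  obtain ⟨z, hz, hzE⟩ : ∃ z ∈ hset R, z ∉ {x | ∃ i, l < G i x} := by
    by_contra! hcon
    rw [inter_eq_self_of_subset_right hcon, volume_hset] at hlt
    exact hlt.false
  have hsub : R.set ⊆ closedBall 0 R0 :=
    (set_subset_tri R).trans ((tri_subset_of_hset_subset hR).trans hR0)
  refine lintegral_sum_trq_le hΩ (by linarith)
    (fun i => ((hh i).indicator (measurableSet_set _).compl).1) fun i => ?_
  refine (hGP i R hsub z (hset_subset_set R hz)).trans (rpow_le_rpow ?_ hv0.le)
  exact not_lt.1 fun h => hzE ⟨i, h⟩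

/-- The bilinear form bound with explicit dependence on the weight. -/
theorem form_bound (hd : 1 ≤ d) (hn : 1 ≤ n) {p q C : ℝ} (hq : 1 < q) (hqp : q < p)
    (hC : 0 < C) : ∃ K : ℝ≥0∞, K ≠ ⊤ ∧ ∃ t : ℝ, 0 < t ∧ t < p ∧
      ∀ Ω : Rd d → ℂ, IsRoughKernel Ω C → ∀ W : Rd d → Mat n, Measurable W →
      (∀ x, (W x).PosDef) → AqConst W q ≠ ⊤ → AqScConst W q ≠ 0 → ∀ v ε u : ℝ, 2 ≤ v → 0 < ε →
      0 < u → 1 / v = ε / (2 * p * (1 + ε)) → 1 / u = 1 - 1 / p + 1 / v →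
      ENNReal.ofReal ε * (2 ^ (d + 1) * AqScConst W q) ≤ 1 →
      ∀ F : Rd d → Vec n, NiceV F → ∀ (b : ℤ) (g : Rd d → ℝ≥0∞), Measurable g → ∀ Q : Cube d,
      ∫⁻ x in hset Q, tmax (fun x => matPow (W x) (1 / p)) Ω b ((tri Q).set.indicator F) x * g x ≤
        K * ENNReal.ofReal v * AqConst W q ^ (1 / p) * ∫⁻ x in hset Q,
          HLM (fun y => ‖mvec (matPow (W y) (1 / p)) (F y)‖ₑ ^ t) x ^ (1 / t) *
          HLM (fun y => g y ^ u) x ^ (1 / u) := by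
  have hq0 : 0 < q := by linarith
  have hp0 : 0 < p := by linarith
  have hpq : 1 < p / q := by rwa [one_lt_div hq0]
  obtain ⟨r, hr1, hr2, hrp⟩ : ∃ r : ℝ, 1 < r ∧ r < 2 ∧ r < p / q := by
    obtain ⟨r, h1, h2⟩ := exists_between (lt_min _root_.one_lt_two hpq)
    exact ⟨r, h1, h2.trans_le (min_le_left _ _), h2.trans_le (min_le_right _ _)⟩
  have hr0 : 0 < r := by linarith
  have htp : 1 / p < 1 / r - (q - 1) / p := by
    have h1 : q / p < 1 / r := by
      rw [lt_div_iff₀ hq0] at hrp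
      rw [div_lt_div_iff₀ hp0 hr0]; linarith
    have : q / p = 1 / p + (q - 1) / p := by ring
    linarith
  obtain ⟨t, ht⟩ : ∃ t : ℝ, 1 / t = 1 / r - (q - 1) / p := ⟨_, one_div_one_div _⟩
  have ht0 : 0 < t := one_div_pos.1 (ht ▸ (one_div_pos.2 hp0).trans htp)
  have htp' : t < p := lt_of_one_div_lt_one_div hp0 (ht ▸ htp)
  obtain ⟨K0, hK0, hgrand⟩ := rough_grand hd hr1 hr2 hC
  have hq1 : 0 < q - 1 := by linarith
  refine ⟨2 * (n * n * ((n * 2 ^ (d + 2) * 3 ^ d : ℝ≥0∞) ^ (1 / r) * ENNReal.ofReal K0 *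
    ((n:ℝ≥0∞) ^ (q / (q - 1)) * n) ^ ((q - 1) / p))) *
    (2 * n * n * (n:ℝ≥0∞) ^ q * (3 ^ d * (2 * n * n : ℝ≥0∞) ^ q)) ^ (1 / p), ?_, t, ht0, htp', ?_⟩
  · have : 0 ≤ q / (q - 1) := by positivity
    have : 0 ≤ (q - 1) / p := by positivity
    have : 0 ≤ 1 / r := by positivity
    have : 0 ≤ 1 / p := by positivity
    refine mul_ne_top (mul_ne_top (by finiteness) (mul_ne_top (by finiteness)
      (mul_ne_top (mul_ne_top ?_ (by finiteness)) ?_))) ?_ <;>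
    exact rpow_ne_top_of_nonneg (by assumption) (by finiteness)
  intro Ω hΩ W hW hpd hA hS0 v ε u hv hε hu hvε huv hεS F hF b g hg Q
  have hB := measurable_matPow hW hpd (1 / p)
  have hv0 : 0 < v := by linarith
  have hconj : v.HolderConjugate (v / (v - 1)) :=
    Real.HolderConjugate.conjExponent (by linarith)
  have hs0 := hconj.symm.pos
  refine stopping (X := fun Q x => tmax (fun x => matPow (W x) (1 / p)) Ω b
    ((tri Q).set.indicator F) x * g x) (v := v) (s0 := 2 ^ b / (3 * d)) (by
      exact ((measurable_HLM _).pow_const _).mul ((measurable_HLM _).pow_const _))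
    (by have : (1:ℝ) ≤ d := by exact_mod_cast hd
        positivity) ?_ ?_ Q
  · intro Q hQ x hx
    have : (0:ℝ) < d := by exact_mod_cast hd
    rw [le_div_iff₀ (by positivity)] at hQ
    rw [tmax_eq_zero _ (by linarith) F hx, zero_mul]
  intro Q
  obtain ⟨A, A', e, hAA, h1, h2, h3⟩ := exists_interface hq hqp hW hpd hA (tri Q)
  obtain ⟨l, E, hl, hE, hER⟩ := exists_exceptional hr1 hΩ hv b
    (fun b R0 f hf => hgrand Ω hΩ v hv b R0 f hf) hK0 hF A' Q
  have hGm : Measurable fun x => ‖matPow (W x) (1 / p) * A‖ₑ * g x :=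
    (measurable_enorm_mul_right hB A).mul hg
  refine ⟨E, fun x => ‖matPow (W x) (1 / p) * A‖ₑ * g x, l ^ v, _, hGm,
    (mul_le_mul_right (measure_mono inter_subset_left) _).trans hE, ?_,
    fun Θ hΘ h => lintegral_mul_le_av hΘ hGm hconj h, ?_⟩
  · intro R hR hlt
    refine ⟨_, ?_, hER R hR hlt, fun x _ => ?_⟩
    · exact Finset.measurable_fun_sum _ fun i _ => measurable_trq hΩ
        (((hF.indicator (measurableSet_set _)).mvec A' i).indicator
          (measurableSet_set _).compl).1 b
    · refine (mul_le_mul_left (tmax_le hΩ hC.le hF (fun x => matPow (W x) (1 / p)) b hAA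
        (tri_subset_of_hset_subset hR) x) _).trans (le_of_eq ?_)
      ring
  · intro x hx
    have hxQ := hset_subset_set Q hx
    have h4 := av_mvec_le hq hp0 hr0 ht0 (by rw [ht]; ring) hW hpd hF.measurable h1
    have h5 := av_mul_le (q := q) (s := v / (v - 1)) hp0 hs0 hu hε (by
      rw [huv, one_div_div, hvε]
      have h6 : (v - 1) / v = 1 - 1 / v := by field_simp
      rw [h6, hvε]
      have : 0 < 1 + ε := by linarith
      field_simp
      ring) hd hn hW hpd hS0 hεS hg (by finiteness) (by finiteness) h2 h3
    rw [hl]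
    calc _ ≤ 2 * (n * n * ((n * 2 ^ (d + 2) * 3 ^ d : ℝ≥0∞) ^ (1 / r) * ENNReal.ofReal (K0 * v) *
          (((n:ℝ≥0∞) ^ (q / (q - 1)) * n) ^ ((q - 1) / p) *
            HLM (fun y => ‖mvec (matPow (W y) (1 / p)) (F y)‖ₑ ^ t) x ^ (1 / t)))) *
          ((2 * n * n * (n:ℝ≥0∞) ^ q * (3 ^ d * ((2 * n * n : ℝ≥0∞) ^ q * AqConst W q))) ^ (1 / p) *
            HLM (fun y => g y ^ u) x ^ (1 / u)) := by
          gcongr ?_ * ?_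
          · gcongr 2 * (_ * (_ * ?_))
            exact h4.trans (mul_le_mul_right (av_rpow_le_HLM _ ht0 (set_subset_tri Q hxQ)) _)
          · exact h5.trans (mul_le_mul_right (av_rpow_le_HLM _ hu hxQ) _)
      _ = _ := by
          rw [show (2 * n * n * (n:ℝ≥0∞) ^ q * (3 ^ d * ((2 * n * n : ℝ≥0∞) ^ q * AqConst W q)))
            = (2 * n * n * (n:ℝ≥0∞) ^ q * (3 ^ d * (2 * n * n : ℝ≥0∞) ^ q)) * AqConst W q by ring,
            mul_rpow_of_nonneg _ (AqConst W q) (by positivity),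
            ofReal_mul hK0.le]
          ring

lemma lintegral_HLM_rpow_le (hd : 1 ≤ d) {p t : ℝ} (ht : 0 < t) (htp : t < p)
    {φ : Rd d → ℝ≥0∞} (hφ : Measurable φ) :
    ∫⁻ x, (HLM (fun y => φ y ^ t) x ^ (1 / t)) ^ p ≤
      ENNReal.ofReal (p / t / (p / t - 1)) * (5 ^ d * 2 ^ (p / t)) * ∫⁻ x, φ x ^ p := by
  have h := HLM_strong hd (hφ.pow_const t) ((one_lt_div ht).2 htp)
  simp_rw [← rpow_mul, mul_div_cancel₀ p ht.ne'] at h ⊢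
  rwa [one_div_mul_eq_div]

lemma lintegral_HLM_mul_HLM_le (hd : 1 ≤ d) {p t v u : ℝ} (ht : 0 < t) (htp : t < p) (hp : 1 < p)
    (hv : 2 ≤ v) (hu : 0 < u) (huv : 1 / u = 1 - 1 / p + 1 / v) {φ g : Rd d → ℝ≥0∞}
    (hφ : Measurable φ) (hg : Measurable g) :
    ∫⁻ x, HLM (fun y => φ y ^ t) x ^ (1 / t) * HLM (fun y => g y ^ u) x ^ (1 / u) ≤
      (ENNReal.ofReal (p / t / (p / t - 1)) * (5 ^ d * 2 ^ (p / t))) ^ (1 / p) *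
      (2 * (5 ^ d * 2 ^ (1 + p / (p - 1)))) ^ ((p - 1) / p) *
      ENNReal.ofReal v ^ ((p - 1) / p) * (∫⁻ x, φ x ^ p) ^ (1 / p) *
      (∫⁻ x, g x ^ (p / (p - 1))) ^ ((p - 1) / p) := by
  have hp0 : 0 < p := by linarith
  have hp1 : 0 < p - 1 := by linarith
  have hv0 : 0 < v := by linarith
  set s := p / (p - 1) with hs
  have hs0 : 0 < s := by positivity
  have hs1 : 1 < s := by rw [hs, one_lt_div hp1]; linarith
  have hsi : (p - 1) / p = 1 / s := by rw [hs, one_div_div]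
  have hsu : s / u = 1 + s / v := by
    rw [div_eq_mul_one_div, huv, show 1 - 1 / p = 1 / s by rw [← hsi]; field_simp]
    field_simp
  have hus : u < s := by
    rw [← one_lt_div hu, hsu]
    have : 0 < s / v := by positivity
    linarith
  have h2 : ∫⁻ x, (HLM (fun y => g y ^ u) x ^ (1 / u)) ^ s ≤
      ENNReal.ofReal v * (2 * (5 ^ d * 2 ^ (1 + s))) * ∫⁻ x, g x ^ s := by
    refine (lintegral_HLM_rpow_le hd hu hus hg).trans (mul_le_mul_left ?_ _)
    have h3 : s / u / (s / u - 1) ≤ v * 2 := by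
      have h4 : s / u / (s / u - 1) = v / s + 1 := by
        rw [hsu, add_sub_cancel_left]; field_simp
      have h5 : v / s ≤ v := div_le_self hv0.le hs1.le
      rw [h4]; linarith
    have h6 : s / u ≤ 1 + s := by rw [hsu]; gcongr; exact div_le_self hs0.le (by linarith)
    calc _ ≤ ENNReal.ofReal (v * 2) * (5 ^ d * 2 ^ (1 + s)) := by
          gcongr
          exact _root_.one_le_two
      _ = _ := by
          rw [ofReal_mul hv0.le, ofReal_ofNat]; ring
  have hconj : p.HolderConjugate s := Real.HolderConjugate.conjExponent hp
  rw [hsi]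
  calc _ ≤ (∫⁻ x, (HLM (fun y => φ y ^ t) x ^ (1 / t)) ^ p) ^ (1 / p) *
        (∫⁻ x, (HLM (fun y => g y ^ u) x ^ (1 / u)) ^ s) ^ (1 / s) :=
        lintegral_mul_le_Lp_mul_Lq _ hconj ((measurable_HLM _).pow_const _).aemeasurable
          ((measurable_HLM _).pow_const _).aemeasurable
    _ ≤ _ := mul_le_mul' (rpow_le_rpow (lintegral_HLM_rpow_le hd ht htp hφ) (by positivity))
        (rpow_le_rpow h2 (by positivity))
    _ = _ := by
        rw [mul_rpow_of_nonneg (_ * (_ * _)) _ (by positivity),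
          mul_rpow_of_nonneg (_ * (_ * _)) (∫⁻ x, g x ^ s) (by positivity),
          mul_rpow_of_nonneg (ENNReal.ofReal v) _ (by positivity)]
        ring

lemma lintegral_rpow_le_of_duality {p : ℝ} (hp : 1 < p) {Y : Rd d → ℝ≥0∞} (hY : Measurable Y)
    {M : ℝ≥0∞} (H : ∀ (N : ℕ) (g : Rd d → ℝ≥0∞), Measurable g → (∀ x, (N : ℝ) < ‖x‖ → g x = 0) →
      ∫⁻ x, Y x * g x ≤ M * (∫⁻ x, g x ^ (p / (p - 1))) ^ ((p - 1) / p)) :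
    ∫⁻ x, Y x ^ p ≤ M ^ p := by
  have hp0 : 0 < p := by linarith
  have hp1 : 0 < p - 1 := by linarith
  set J : ℕ → Rd d → ℝ≥0∞ := fun N =>
    (closedBall 0 N).indicator fun x => min (Y x) N ^ p with hJ
  have hJm : ∀ N, Measurable (J N) := fun N =>
    ((hY.min measurable_const).pow_const p).indicator measurableSet_closedBall
  have h1 : ∀ N, ∫⁻ x, J N x ≤ M ^ p := by
    intro N
    set I := ∫⁻ x, J N x with hI
    have hIt : I ≠ ⊤ := by
      have h2 : I ≤ (N:ℝ≥0∞) ^ p * volume (closedBall (0 : Rd d) N) := by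
        rw [hI, hJ, lintegral_indicator measurableSet_closedBall, ← setLIntegral_const]
        exact lintegral_mono fun x => rpow_le_rpow (min_le_right _ _) hp0.le
      refine ne_top_of_le_ne_top (mul_ne_top (by finiteness) ?_) h2
      exact measure_closedBall_lt_top.ne
    have h3 := H N ((closedBall 0 N).indicator fun x => min (Y x) N ^ (p - 1))
      (((hY.min measurable_const).pow_const _).indicator measurableSet_closedBall)
      fun x hx => indicator_of_notMem (by simpa using hx) _
    have h4 : ∀ x, ((closedBall 0 N).indicator (fun x => min (Y x) (N:ℝ≥0∞) ^ (p - 1)) x)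
        ^ (p / (p - 1)) = J N x := by
      intro x
      by_cases hx : x ∈ closedBall (0 : Rd d) N
      · simp only [hJ, indicator_of_mem hx]
        rw [← rpow_mul, mul_div_cancel₀ p hp1.ne']
      · simp only [hJ, indicator_of_notMem hx]
        exact zero_rpow_of_pos (by positivity)
    simp_rw [h4] at h3
    have h5 : I ≤ M * I ^ ((p - 1) / p) := by
      refine le_trans (lintegral_mono fun x => ?_) h3
      by_cases hx : x ∈ closedBall (0 : Rd d) N
      · simp only [hJ, indicator_of_mem hx]
        calc min (Y x) (N:ℝ≥0∞) ^ p = min (Y x) (N:ℝ≥0∞) * min (Y x) (N:ℝ≥0∞) ^ (p - 1) := by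
              conv_rhs => enter [1]; rw [← rpow_one (min (Y x) (N:ℝ≥0∞))]
              rw [← rpow_add_of_nonneg _ _ zero_le_one hp1.le]; congr 1; ring
          _ ≤ _ := mul_le_mul_left (min_le_left _ _) _
      · simp only [hJ, indicator_of_notMem hx]; exact zero_le
    rcases eq_or_ne I 0 with h0 | h0
    · rw [h0]; exact zero_le
    have h6 : I = I ^ (1 / p) * I ^ ((p - 1) / p) := by
      rw [← rpow_add _ _ h0 hIt, ← add_div, add_sub_cancel, div_self hp0.ne',
        rpow_one]
    have h7 : I ^ ((p - 1) / p) * I ^ (1 / p) ≤ I ^ ((p - 1) / p) * M := by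
      rw [mul_comm, ← h6, mul_comm]; exact h5
    have h8 := (ENNReal.mul_le_mul_iff_right
      (by simp [h0, hIt]) (rpow_ne_top_of_nonneg (by positivity) hIt)).1 h7
    rwa [one_div, rpow_inv_le_iff hp0] at h8
  have h9 : ∀ x, Y x ^ p ≤ liminf (fun N => J N x) atTop := by
    intro x
    have h10 : Tendsto (fun N : ℕ => min (Y x) (N:ℝ≥0∞) ^ p) atTop (𝓝 (Y x ^ p)) := by
      refine (continuous_rpow_const.tendsto _).comp ?_
      simpa using tendsto_const_nhds.min tendsto_nat_nhds_top
    rw [← h10.liminf_eq]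
    refine liminf_le_liminf ?_
    filter_upwards [eventually_ge_atTop ⌈‖x‖⌉₊] with N hN
    have : x ∈ closedBall (0 : Rd d) N := by
      rw [mem_closedBall_zero_iff]; exact Nat.ceil_le.1 hN
    simp only [hJ, indicator_of_mem this, le_refl]
  calc ∫⁻ x, Y x ^ p ≤ ∫⁻ x, liminf (fun N => J N x) atTop := lintegral_mono h9
    _ ≤ liminf (fun N => ∫⁻ x, J N x) atTop := lintegral_liminf_le hJm
    _ ≤ M ^ p := liminf_le_of_frequently_le' (Frequently.of_forall h1)

lemma one_le_AqScConst (hn : 1 ≤ n) {q : ℝ} (hq : 1 < q) {W : Rd d → Mat n} (hW : Measurable W)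
    (hpd : ∀ x, (W x).PosDef) (hA : AqConst W q ≠ ⊤) : 1 ≤ AqScConst W q := by
  let Q : Cube d := ⟨0, 1, one_pos⟩
  obtain ⟨A, A', e, h0, -, h1, h2⟩ := exists_interface hq (lt_add_one q) hW hpd hA Q
  obtain ⟨j, hj⟩ : ∃ j, e j ≠ 0 := by
    by_contra! hcon
    have h3 := h2 0
    have hq0 : ¬ q < 0 := by linarith
    have : Nonempty (Fin n) := ⟨⟨0, hn⟩⟩
    simp only [hcon, wt] at h3
    have h4 : matPow (W 0) (1 / (q + 1)) * A = 0 := by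
      simpa [mvec, zero_rpow_of_pos (show 0 < q by linarith), show 0 < q + 1 by linarith,
        show ¬ (q + 1 < 0) by linarith] using h3
    have h5 : (1 : Mat n) = 0 := by
      rw [← h0, ← one_mul A, ← matPow_neg_mul (hpd 0) (1 / (q + 1)), mul_assoc _ _ A, h4]; simp
    exact one_ne_zero h5
  have h3 : ∀ x, wt W q (e j) x ≠ 0 := by
    intro x hx
    rw [wt, rpow_eq_zero_iff_of_pos (by linarith), enorm_eq_zero] at hx
    apply hj
    rw [← mvec_one (e j), ← matPow_neg_mul (hpd x) (1 / q), ← mvec_mvec, hx]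
    simp [mvec]
  refine (one_le_AInftyConst (Q := Q) ?_ ?_).trans
    ((le_iSup (fun e => AInftyConst (wt W q e)) (e j)).trans (AqScConst_eq W q).ge)
  · refine ((setLIntegral_pos_iff (measurable_wt hW hpd q (e j))).2 ?_).ne'
    rw [Function.support_eq_univ h3, univ_inter, volume_set]
    exact qvol_pos Q
  · rw [← qvol_mul_av]
    exact mul_ne_top (qvol_ne_top Q) (ne_top_of_le_ne_top (by finiteness) (h1 j))

lemma NiceV.exists_support {F : Rd d → Vec n} (hF : NiceV F) :
    ∃ R : ℝ, ∀ x, R < ‖x‖ → F x = 0 := by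
  choose R hR using fun i => (hF i).2.2
  refine ⟨∑ i, |R i|, fun x hx => ?_⟩
  ext i
  refine hR i x (lt_of_le_of_lt ?_ hx)
  exact (le_abs_self _).trans (Finset.single_le_sum (f := fun i => |R i|)
    (fun _ _ => abs_nonneg _) (Finset.mem_univ i))

theorem tmax_norm_le (hd : 1 ≤ d) (hn : 1 ≤ n) {p q C : ℝ} (hq : 1 < q) (hqp : q < p)
    (hC : 0 < C) : ∃ K : ℝ≥0∞, K ≠ ⊤ ∧
      ∀ Ω : Rd d → ℂ, IsRoughKernel Ω C → ∀ W : Rd d → Mat n, Measurable W →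
      (∀ x, (W x).PosDef) → AqConst W q ≠ ⊤ → ∀ F : Rd d → Vec n, NiceV F → ∀ b : ℤ,
      ∫⁻ x, tmax (fun x => matPow (W x) (1 / p)) Ω b F x ^ p ≤
        (K * AqConst W q ^ (1 / p) * AqScConst W q ^ (1 + (p - 1) / p) *
          (∫⁻ x, ‖mvec (matPow (W x) (1 / p)) (F x)‖ₑ ^ p) ^ (1 / p)) ^ p := by
  obtain ⟨K, hK, t, ht, htp, hform⟩ := form_bound hd hn hq hqp hC
  have hp : 1 < p := hq.trans hqp
  have hp0 : 0 < p := by linarith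
  have hp1 : 0 < p - 1 := by linarith
  set D1 := (ENNReal.ofReal (p / t / (p / t - 1)) * (5 ^ d * 2 ^ (p / t))) ^ (1 / p) with hD1
  set D2 : ℝ≥0∞ := (2 * (5 ^ d * 2 ^ (1 + p / (p - 1)))) ^ ((p - 1) / p) with hD2
  set D3 := ENNReal.ofReal (4 * p * 2 ^ (d + 1)) ^ (1 + (p - 1) / p) with hD3
  refine ⟨K * D1 * D2 * D3, ?_, ?_⟩
  · have h1 : D1 ≠ ⊤ := rpow_ne_top_of_nonneg (by positivity) (by finiteness)
    have h2 : D2 ≠ ⊤ := rpow_ne_top_of_nonneg (by positivity) (by finiteness)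
    have h3 : D3 ≠ ⊤ := rpow_ne_top_of_nonneg (by positivity) (by finiteness)
    finiteness
  intro Ω hΩ W hW hpd hA F hF b
  have hS1 := one_le_AqScConst hn hq hW hpd hA
  have hSt : AqScConst W q ≠ ⊤ := ne_top_of_le_ne_top (by finiteness) (AqScConst_le hd hW hpd hq hA)
  obtain ⟨s, hs1, hs⟩ : ∃ s : ℝ, 1 ≤ s ∧ AqScConst W q = ENNReal.ofReal s :=
    ⟨(AqScConst W q).toReal, by simpa using toReal_mono hSt hS1,
      (ofReal_toReal hSt).symm⟩
  have h2d : (1:ℝ) ≤ 2 ^ (d + 1) := one_le_pow₀ (by norm_num)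
  obtain ⟨ε, hε⟩ : ∃ ε : ℝ, ε = 1 / (2 ^ (d + 1) * s) := ⟨_, rfl⟩
  have hε0 : 0 < ε := by rw [hε]; positivity
  have hε1 : ε ≤ 1 := by
    rw [hε, div_le_one (by positivity)]
    exact one_le_mul_of_one_le_of_one_le h2d hs1
  obtain ⟨v, hv⟩ : ∃ v : ℝ, v = 2 * p * (1 + ε) / ε := ⟨_, rfl⟩
  have hv2 : 2 ≤ v := by rw [hv, le_div_iff₀ hε0]; nlinarith
  have hv0 : 0 < v := by linarith
  have hvs : v ≤ 4 * p * 2 ^ (d + 1) * s := by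
    calc v = 2 * p * (1 + ε) * (2 ^ (d + 1) * s) := by rw [hv, hε]; field_simp
      _ ≤ 2 * p * (1 + 1) * (2 ^ (d + 1) * s) := by gcongr
      _ = _ := by ring
  obtain ⟨u, hu⟩ : ∃ u : ℝ, 1 / u = 1 - 1 / p + 1 / v := ⟨_, one_div_one_div _⟩
  have hu0 : 0 < u := by
    refine one_div_pos.1 (hu ▸ ?_)
    have h1 : 1 / p < 1 := (div_lt_one hp0).2 hp
    have h2 : 0 < 1 / v := by positivity
    linarith
  have hεS : ENNReal.ofReal ε * (2 ^ (d + 1) * AqScConst W q) ≤ 1 := by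
    rw [hs, show (2:ℝ≥0∞) ^ (d + 1) = ENNReal.ofReal (2 ^ (d + 1)) by
      rw [ofReal_pow (by norm_num)]; simp, ← ofReal_mul (by positivity),
      ← ofReal_mul hε0.le, hε, one_div_mul_cancel (by positivity), ofReal_one]
  have hB := measurable_matPow hW hpd (1 / p)
  obtain ⟨R1, hR1⟩ := hF.exists_support
  refine lintegral_rpow_le_of_duality hp (measurable_tmax hΩ hC.le hB hF b) fun N g hg hgN => ?_
  obtain ⟨Q, hQ, -⟩ := exists_cube_supp (d := d) hd (max (N : ℝ) R1) (V := 0) (by simp)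
  have hFQ : (tri Q).set.indicator F = F := by
    refine indicator_eq_self.2 fun x hx => set_subset_tri Q (hset_subset_set Q (hQ x ?_))
    exact (not_lt.1 fun h => hx (hR1 x h)).trans (le_max_right _ _)
  have hgQ : ∫⁻ x, tmax (fun x => matPow (W x) (1 / p)) Ω b F x * g x =
      ∫⁻ x in hset Q, tmax (fun x => matPow (W x) (1 / p)) Ω b F x * g x := by
    rw [setLIntegral_eq_of_support_subset]
    intro x hx
    refine hQ x ((not_lt.1 fun h => hx ?_).trans (le_max_left _ _))
    simp [hgN x h]
  have h1 := hform Ω hΩ W hW hpd hA (by rintro h; simp [h] at hS1) v ε u hv2 hε0 hu0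
    (by rw [hv, one_div_div]) hu hεS F hF b g hg Q
  rw [hFQ, ← hgQ] at h1
  have hφ : Measurable fun x => ‖mvec (matPow (W x) (1 / p)) (F x)‖ₑ :=
    (continuous_mvec.measurable.comp (hB.prodMk hF.measurable)).enorm
  have h2 := lintegral_HLM_mul_HLM_le hd ht htp hp hv2 hu0 hu hφ hg
  rw [← hD1, ← hD2] at h2
  have h3 : ENNReal.ofReal v * ENNReal.ofReal v ^ ((p - 1) / p) ≤
      D3 * AqScConst W q ^ (1 + (p - 1) / p) := by
    rw [hD3, ← mul_rpow_of_nonneg _ _ (by positivity), hs,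
      ← ofReal_mul (by positivity)]
    calc _ = ENNReal.ofReal v ^ (1 + (p - 1) / p) := by
          rw [rpow_add_of_nonneg _ _ zero_le_one (by positivity), rpow_one]
      _ ≤ _ := by gcongr
  calc _ ≤ _ := h1.trans (mul_le_mul_right ((setLIntegral_le_lintegral _ _).trans h2) _)
    _ = K * D1 * D2 * (ENNReal.ofReal v * ENNReal.ofReal v ^ ((p - 1) / p)) *
        (AqConst W q ^ (1 / p) *
        (∫⁻ x, ‖mvec (matPow (W x) (1 / p)) (F x)‖ₑ ^ p) ^ (1 / p) *
        (∫⁻ x, g x ^ (p / (p - 1))) ^ ((p - 1) / p)) := by ring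
    _ ≤ K * D1 * D2 * (D3 * AqScConst W q ^ (1 + (p - 1) / p)) * _ :=
        mul_le_mul_left (mul_le_mul_right h3 _) _
    _ = _ := by ring

lemma measurable_mvec_mvec {B : Rd d → Mat n} {F : Rd d → Vec n} (hB : Measurable B)
    (hF : Measurable F) : Measurable fun x => mvec (B x) (F x) := by
  simpa only [Function.comp_def] using continuous_mvec.measurable.comp (hB.prodMk hF)

/-- Truncation of a vector field in size and support. -/
def cut (F : Rd d → Vec n) (m : ℕ) : Rd d → Vec n :=
  {x | ‖F x‖ ≤ m ∧ ‖x‖ ≤ m}.indicator F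

lemma niceV_cut {F : Rd d → Vec n} (hF : Measurable F) (m : ℕ) : NiceV (cut F m) := by
  intro i
  have hs : MeasurableSet {x | ‖F x‖ ≤ m ∧ ‖x‖ ≤ m} :=
    (measurableSet_le hF.norm measurable_const).inter
      (measurableSet_le measurable_norm measurable_const)
  have h1 : Measurable (cut F m) := hF.indicator hs
  refine ⟨?_, ⟨m, fun x => ?_⟩, ⟨m, fun x hx => ?_⟩⟩
  · fun_prop
  · refine (PiLp.norm_apply_le _ i).trans ?_
    by_cases hx : x ∈ {x | ‖F x‖ ≤ m ∧ ‖x‖ ≤ m}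
    · rw [cut, indicator_of_mem hx]; exact hx.1
    · rw [cut, indicator_of_notMem hx]; simp
  · have h : x ∉ {x | ‖F x‖ ≤ m ∧ ‖x‖ ≤ m} := fun h => absurd h.2 (not_le.2 hx)
    beta_reduce
    rw [cut, indicator_of_notMem h]; rfl

lemma cut_eq (F : Rd d → Vec n) (y : Rd d) : ∀ᶠ m : ℕ in atTop, cut F m y = F y := by
  filter_upwards [eventually_ge_atTop ⌈‖F y‖⌉₊, eventually_ge_atTop ⌈‖y‖⌉₊] with m h1 h2
  exact indicator_of_mem (show y ∈ {x | ‖F x‖ ≤ m ∧ ‖x‖ ≤ m} from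
    ⟨Nat.ceil_le.1 h1, Nat.ceil_le.1 h2⟩) F

lemma tendsto_truncRough {C : ℝ} {Ω : Rd d → ℂ} (hΩ : IsRoughKernel Ω C) {F : Rd d → Vec n}
    (hF : Measurable F) {δ : ℝ} {δm : ℕ → ℝ} (h1 : ∀ m, δ ≤ δm m) (h2 : Tendsto δm atTop (𝓝 δ))
    {x : Rd d} (hi : IntegrableOn (fun y => rk Ω (x - y) • F y) {y | δ < ‖x - y‖}) :
    Tendsto (fun m => truncRough Ω (δm m) (cut F m) x) atTop (𝓝 (truncRough Ω δ F x)) := by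
  simp_rw [truncRough_eq, ← integral_indicator (measurableSet_trunc _ x)]
  have hrk : Measurable fun y => rk Ω (x - y) :=
    (measurable_rk hΩ.1).comp (measurable_const.sub measurable_id)
  refine tendsto_integral_of_dominated_convergence
    (fun y => ‖{y | δ < ‖x - y‖}.indicator (fun y => rk Ω (x - y) • F y) y‖) (fun m => ?_)
    (hi.integrable_indicator (measurableSet_trunc δ x)).norm (fun m => ?_) ?_
  · exact ((hrk.smul (niceV_cut hF m).measurable).indicator
      (measurableSet_trunc _ x)).aestronglyMeasurable
  · refine .of_forall fun y => ?_
    by_cases hy : δm m < ‖x - y‖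
    · rw [indicator_of_mem (show y ∈ {y | δm m < ‖x - y‖} from hy),
        indicator_of_mem (show y ∈ {y | δ < ‖x - y‖} from (h1 m).trans_lt hy), norm_smul, norm_smul]
      exact mul_le_mul_of_nonneg_left (norm_indicator_le_norm_self _ _) (norm_nonneg _)
    · rw [indicator_of_notMem (show y ∉ {y | δm m < ‖x - y‖} from hy), norm_zero]
      positivity
  · refine .of_forall fun y => tendsto_nhds_of_eventually_eq ?_
    by_cases hy : δ < ‖x - y‖
    · filter_upwards [cut_eq F y, h2.eventually_lt_const hy] with m h3 h4
      rw [indicator_of_mem (show y ∈ {y | δm m < ‖x - y‖} from h4),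
        indicator_of_mem (show y ∈ {y | δ < ‖x - y‖} from hy), h3]
    · refine .of_forall fun m => ?_
      rw [indicator_of_notMem (show y ∉ {y | δ < ‖x - y‖} from hy), indicator_of_notMem
        (show y ∉ {y | δm m < ‖x - y‖} from fun h => hy ((h1 m).trans_lt h))]

lemma enorm_mvec_truncRough_le {C : ℝ} {Ω : Rd d → ℂ} (hΩ : IsRoughKernel Ω C)
    {F : Rd d → Vec n} (hF : Measurable F) (B : Rd d → Mat n) {δ : ℝ} (hδ : 0 < δ) (x : Rd d) :
    ‖mvec (B x) (truncRough Ω δ F x)‖ₑ ≤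
      liminf (fun m : ℕ => tmax B Ω (-(m:ℤ)) (cut F m) x) atTop := by
  by_cases hi : IntegrableOn (fun y => rk Ω (x - y) • F y) {y | δ < ‖x - y‖}
  swap
  · rw [truncRough_eq, integral_undef hi]; simp [mvec]
  choose δm h1 h2 using fun m : ℕ => exists_rat_btwn
    (lt_add_of_pos_right δ (Nat.one_div_pos_of_nat (α := ℝ) (n := m)))
  have h3 : Tendsto (fun m => (δm m : ℝ)) atTop (𝓝 δ) := by
    refine tendsto_of_tendsto_of_tendsto_of_le_of_le tendsto_const_nhds ?_
      (fun m => (h1 m).le) fun m => (h2 m).le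
    simpa using (tendsto_const_nhds (x := δ)).add (tendsto_one_div_add_atTop_nhds_zero_nat (𝕜 := ℝ))
  have h4 := ((continuous_mvec.comp (Continuous.prodMk_right (B x))).tendsto _).comp
    (tendsto_truncRough hΩ hF (fun m => (h1 m).le) h3 hi)
  rw [show ‖mvec (B x) (truncRough Ω δ F x)‖ₑ = _ from h4.enorm.liminf_eq.symm]
  refine liminf_le_liminf ?_
  have h5 := tendsto_pow_atTop_nhds_zero_of_lt_one (r := (2:ℝ)⁻¹) (by norm_num) (by norm_num)
  filter_upwards [h5.eventually_lt_const hδ] with m hm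
  have h6 : (2:ℝ) ^ (-(m:ℤ)) ≤ δm m := by
    rw [zpow_neg, zpow_natCast, ← inv_pow]
    exact (hm.trans (h1 m)).le
  exact le_iSup₂_of_le (f := fun (δ : ℚ) (_ : (2:ℝ) ^ (-(m:ℤ)) ≤ δ) =>
    ‖mvec (B x) (truncRough Ω δ (cut F m) x)‖ₑ) (δm m) h6 le_rfl

/-- The first bound of the theorem for a weight that is positive definite everywhere. -/
theorem lintegral_TstarRough_le (hd : 1 ≤ d) (hn : 1 ≤ n) {p q C : ℝ} (hq : 1 < q) (hqp : q < p)
    (hC : 0 < C) : ∃ K : ℝ≥0∞, K ≠ ⊤ ∧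
      ∀ Ω : Rd d → ℂ, IsRoughKernel Ω C → ∀ W : Rd d → Mat n, Measurable W →
      (∀ x, (W x).PosDef) → AqConst W q ≠ ⊤ → ∀ f : Rd d → Vec n, Measurable f →
      lpNormE p (TstarRough Ω W p f) ≤
        K * AqConst W q ^ (1 / p) * AqScConst W q ^ (1 + (p - 1) / p) * lpNormV p f := by
  obtain ⟨K, hK, H⟩ := tmax_norm_le hd hn hq hqp hC
  have hp0 : 0 < p := by linarith
  refine ⟨K, hK, fun Ω hΩ W hW hpd hA f hf => ?_⟩
  have H := H Ω hΩ W hW hpd hA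
  have hBm := measurable_matPow hW hpd (1 / p)
  have hFm : Measurable fun y => mvec (matPow (W y) (-(1 / p))) (f y) := by
    exact measurable_mvec_mvec (measurable_matPow hW hpd (-(1 / p))) hf
  have hBF : ∀ y, mvec (matPow (W y) (1 / p)) (mvec (matPow (W y) (-(1 / p))) (f y)) = f y :=
    fun y => by rw [mvec_mvec, matPow_mul_neg (hpd y), mvec_one]
  have hT : ∀ x, TstarRough Ω W p f x = ⨆ (δ : ℝ) (_ : 0 < δ), ‖mvec (matPow (W x) (1 / p))
    (truncRough Ω δ (fun y => mvec (matPow (W y) (-(1 / p))) (f y)) x)‖ₑ := fun _ => rfl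
  obtain ⟨B, hB⟩ : ∃ B : Rd d → Mat n, ∀ x, matPow (W x) (1 / p) = B x :=
    ⟨fun x => matPow (W x) (1 / p), fun _ => rfl⟩
  obtain ⟨F, hF⟩ : ∃ F : Rd d → Vec n, ∀ y, mvec (matPow (W y) (-(1 / p))) (f y) = F y :=
    ⟨fun y => mvec (matPow (W y) (-(1 / p))) (f y), fun _ => rfl⟩
  simp_rw [hF] at hT hBF hFm
  simp_rw [hB] at hT hBF hBm H
  have h1 : ∀ m y, ‖mvec (B y) (cut F m y)‖ₑ ≤ ‖f y‖ₑ := by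
    intro m y
    by_cases hy : y ∈ {x | ‖F x‖ ≤ m ∧ ‖x‖ ≤ m}
    · rw [cut, indicator_of_mem hy, hBF]
    · rw [cut, indicator_of_notMem hy]; simp [mvec]
  simp_rw [lpNormE, hT]
  rw [one_div, rpow_inv_le_iff hp0, ← one_div]
  calc _ ≤ ∫⁻ x, liminf (fun m : ℕ => tmax B Ω (-(m:ℤ)) (cut F m) x ^ p) atTop := by
        refine lintegral_mono fun x => ?_
        refine le_trans (rpow_le_rpow (iSup₂_le fun δ hδ =>
          enorm_mvec_truncRough_le hΩ hFm B hδ x) hp0.le) (le_of_eq ?_)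
        exact (orderIsoRpow p hp0).liminf_apply
    _ ≤ liminf (fun m : ℕ => ∫⁻ x, tmax B Ω (-(m:ℤ)) (cut F m) x ^ p) atTop :=
        lintegral_liminf_le fun m =>
          (measurable_tmax hΩ hC.le hBm (niceV_cut hFm m) _).pow_const p
    _ ≤ _ := by
        refine liminf_le_of_frequently_le' (Frequently.of_forall fun m => ?_)
        refine (H _ (niceV_cut hFm m) _).trans ?_
        refine rpow_le_rpow (mul_le_mul_right (rpow_le_rpow ?_ (by positivity)) _)
          hp0.le
        exact lintegral_mono fun y => rpow_le_rpow (h1 m y) hp0.le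

/-! ### Changing the weight on a null set -/

lemma AqConst_congr_ae {W V : Rd d → Mat n} (h : W =ᵐ[volume] V) (q : ℝ) : AqConst W q = AqConst V q := by
  refine iSup_congr fun Q => congrArg _ (lintegral_congr_ae ((ae_restrict_of_ae h).mono fun x hx => ?_))
  have h1 : ∀ᵐ y ∂volume.restrict Q.set,
      ENNReal.ofReal (opNorm (matPow (W x) (1/q) * matPow (W y) (-(1/q)))) ^ (q/(q-1)) =
      ENNReal.ofReal (opNorm (matPow (V x) (1/q) * matPow (V y) (-(1/q)))) ^ (q/(q-1)) :=
    (ae_restrict_of_ae h).mono fun y hy => by rw [hx, hy]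
  beta_reduce
  rw [lintegral_congr_ae h1]

lemma AqScConst_congr_ae {W V : Rd d → Mat n} (h : W =ᵐ[volume] V) (q : ℝ) : AqScConst W q = AqScConst V q := by
  rw [AqScConst_eq, AqScConst_eq]
  refine iSup_congr fun e => ?_
  have h' : wt W q e =ᵐ[volume] wt V q e := h.mono fun x hx => by rw [wt, wt, hx]
  unfold AInftyConst
  refine iSup_congr fun Q => ?_
  rw [lintegral_congr_ae (ae_restrict_of_ae h' : wt W q e =ᵐ[volume.restrict Q.set] _),
    HLM_congr_ae (g := Q.set.indicator (wt W q e)) (h := Q.set.indicator (wt V q e))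
      (h'.mono fun x hx => by simp only [indicator, hx])]

lemma lpNormE_TstarRough_congr_ae {W V : Rd d → Mat n} (h : W =ᵐ[volume] V)
    (Ω : Rd d → ℂ) (p : ℝ) (f : Rd d → Vec n) :
    lpNormE p (TstarRough Ω W p f) = lpNormE p (TstarRough Ω V p f) := by
  refine congrArg (· ^ (1 / p)) (lintegral_congr_ae (h.mono fun x hx => ?_))
  have h' : ∀ δ, truncRough Ω δ (fun y => mvec (matPow (W y) (-(1/p))) (f y)) x =
      truncRough Ω δ (fun y => mvec (matPow (V y) (-(1/p))) (f y)) x := fun δ =>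
    integral_congr_ae (ae_restrict_of_ae (h.mono fun y hy => by beta_reduce; rw [hy]))
  beta_reduce
  unfold TstarRough
  simp_rw [h', hx]

lemma IsMatrixWeight.exists_ae_eq {W : Rd d → Mat n} (h : IsMatrixWeight W) :
    ∃ V : Rd d → Mat n, W =ᵐ[volume] V ∧ Measurable V ∧ ∀ x, (V x).PosDef := by
  classical
  set N := toMeasurable volume {x | ¬ (W x).PosDef} with hN
  have hNm : MeasurableSet N := measurableSet_toMeasurable _ _
  have hN0 : volume N = 0 := by rw [hN, measure_toMeasurable]; exact h.2
  refine ⟨N.piecewise (fun _ => 1) W, ?_, measurable_const.piecewise hNm (measurable_mat h.1),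
    fun x => ?_⟩
  · filter_upwards [measure_eq_zero_iff_ae_notMem.1 hN0] with x hx
    rw [piecewise_eq_of_notMem _ _ _ hx]
  · by_cases hx : x ∈ N
    · rw [piecewise_eq_of_mem _ _ _ hx]; exact Matrix.PosDef.one
    · rw [piecewise_eq_of_notMem _ _ _ hx]
      by_contra hcon
      exact hx (subset_toMeasurable volume {x | ¬ (W x).PosDef} hcon)

end

end RoughWeight

/-- `A_q` bound for maximal rough singular integrals, `1 < q < p`. -/
theorem aq_bound_rough (d n : ℕ) (hd : 1 ≤ d) (hn : 1 ≤ n) (p q : ℝ) (hq : 1 < q)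
    (hqp : q < p) (CΩ : ℝ) :
    ∃ c : ℝ≥0∞, 0 < c ∧ c ≠ ⊤ ∧
      ∀ Ω : Rd d → ℂ, IsRoughKernel Ω CΩ →
        ∀ W : Rd d → Mat n, IsMatrixWeight W → AqConst W q ≠ ⊤ →
          ∀ f : Rd d → Vec n, MeasurableV f →
            lpNormE p (TstarRough Ω W p f) ≤
                c * AqConst W q ^ (1/p) * AqScConst W q ^ (1 + (p-1)/p) * lpNormV p f ∧
            lpNormE p (TstarRough Ω W p f) ≤ c * AqConst W q ^ (2 : ℝ) * lpNormV p f := by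
  obtain ⟨K, hK, H⟩ := RoughWeight.lintegral_TstarRough_le (C := max CΩ 1) hd hn hq hqp
    (by positivity)
  have hp0 : 0 < p := by linarith
  have hs : 0 ≤ 1 + (p - 1) / p := add_nonneg zero_le_one (div_nonneg (by linarith) hp0.le)
  have hD : (5 ^ d * 8 : ℝ≥0∞) ^ (1 + (p - 1) / p) ≠ ⊤ :=
    ENNReal.rpow_ne_top_of_nonneg hs (by finiteness)
  refine ⟨K + K * (5 ^ d * 8) ^ (1 + (p - 1) / p) + 1, by simp, by finiteness,
    fun Ω hΩ W hW hA f hf => ?_⟩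
  obtain ⟨V, hWV, hVm, hVp⟩ := RoughWeight.IsMatrixWeight.exists_ae_eq hW
  rw [RoughWeight.lpNormE_TstarRough_congr_ae hWV, RoughWeight.AqConst_congr_ae hWV,
    RoughWeight.AqScConst_congr_ae hWV]
  rw [RoughWeight.AqConst_congr_ae hWV] at hA
  have h := H Ω (RoughWeight.IsRoughKernel.mono hΩ (le_max_left _ _)) V hVm hVp hA f
    ((PiLp.continuous_toLp 2 _).measurable.comp (measurable_pi_iff.2 hf))
  refine ⟨h.trans ?_, h.trans ?_⟩
  · gcongr
    rw [add_assoc]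
    exact le_self_add
  · refine mul_le_mul_left ?_ _
    calc K * AqConst V q ^ (1 / p) * AqScConst V q ^ (1 + (p - 1) / p)
        ≤ K * AqConst V q ^ (1 / p) * (5 ^ d * 8 * AqConst V q) ^ (1 + (p - 1) / p) := by
          gcongr
          exact RoughWeight.AqScConst_le hd hVm hVp hq hA
      _ = K * (5 ^ d * 8) ^ (1 + (p - 1) / p) * AqConst V q ^ (2 : ℝ) := by
          rw [ENNReal.mul_rpow_of_nonneg _ _ hs, show (2 : ℝ) = 1 / p + (1 + (p - 1) / p) by
            field_simp; ring, ENNReal.rpow_add_of_nonneg _ _ (by positivity) hs]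
          ring
      _ ≤ _ := by
          gcongr
          exact le_add_self.trans le_self_add

end
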